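/- Fix 0 < ε < 1/6. There exists a constant u₀ = u₀(ε) such that for all real x ≥ 1, all real u with u₀ ≤ u ≤ (log x)^{1/6−ε}, and all real h with ρ(u)^{−3−ε} ≤ h ≤ √x, one has Ψ(x + h·√x, x^{1/u}) − Ψ(x, x^{1/u}) ≥ ρ(u)²·h·√x / (log x)³. -/

import Mathlib

open scoped Classical BigOperators
open MeasureTheory

/-- The Dickman function: the unique continuous function on `[0,∞)` with `ρ(u) = 1` for
`0 ≤ u ≤ 1`, satisfying `u ρ'(u) = -ρ(u-1)` for `u > 1`, extended by `0` for `u < 0`. -/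
def IsDickman (ρ : ℝ → ℝ) : Prop :=
  ContinuousOn ρ (Set.Ici 0) ∧
  (∀ u : ℝ, 0 ≤ u → u ≤ 1 → ρ u = 1) ∧
  (∀ u : ℝ, 1 < u → HasDerivAt ρ (-ρ (u - 1) / u) u) ∧
  (∀ u : ℝ, u < 0 → ρ u = 0)

/-- `Ψ(x, y)`: the number of `y`-friable integers `1 ≤ n ≤ x`. -/
noncomputable def Psi (x y : ℝ) : ℕ :=
  ((Finset.Icc 1 ⌊x⌋₊).filter (fun n => ∀ p : ℕ, p ∈ n.primeFactors → (p : ℝ) ≤ y)).card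

lemma newton_roots {R : Type*} [CommRing R] {k : ℕ} (hu : ∀ j : ℕ, 1 ≤ j → j ≤ k → IsUnit (j : R))
    (x y : Fin k → R) (h : ∀ j : ℕ, 1 ≤ j → j ≤ k → ∑ i, x i ^ j = ∑ i, y i ^ j) (i : Fin k) :
    ∏ j, (x i - y j) = 0 := by
  have he : ∀ j : ℕ, j ≤ k → MvPolynomial.aeval x (MvPolynomial.esymm (Fin k) ℤ j)
      = MvPolynomial.aeval y (MvPolynomial.esymm (Fin k) ℤ j) := by
    intro j
    induction j using Nat.strong_induction_on with
    | _ j ih =>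
      intro hj
      rcases Nat.eq_zero_or_pos j with rfl | hp
      · simp
      · have hN := MvPolynomial.mul_esymm_eq_sum (Fin k) ℤ j
        have hx := congrArg (MvPolynomial.aeval x) hN
        have hy := congrArg (MvPolynomial.aeval y) hN
        simp only [map_mul, map_sum, map_natCast, map_pow, map_neg, map_one] at hx hy
        apply (hu j hp hj).mul_left_cancel
        rw [hx, hy]
        congr 1
        apply Finset.sum_congr rfl
        intro a ha
        have ha0 := Finset.HasAntidiagonal.mem_antidiagonal.1 (Finset.mem_filter.1 ha).1
        have ha1 : a.1 < j := by simpa using (Finset.mem_filter.1 ha).2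
        rw [ih a.1 ha1 (by omega)]
        congr 1
        simp only [MvPolynomial.psum, map_sum, map_pow, MvPolynomial.aeval_X]
        exact h a.2 (by omega) (by omega)
  have hprod : (∏ j, (Polynomial.X - Polynomial.C (x j))) = ∏ j, (Polynomial.X - Polynomial.C (y j)) := by
    have key : ∀ z : Fin k → R, (∏ j, (Polynomial.X - Polynomial.C (z j))) =
        ∑ j ∈ Finset.range (k + 1), (-1) ^ j * (Polynomial.C
          (MvPolynomial.aeval z (MvPolynomial.esymm (Fin k) ℤ j)) * Polynomial.X ^ (k - j)) := by
      intro z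
      have := Multiset.prod_X_sub_X_eq_sum_esymm (Finset.univ.val.map z)
      simp only [Multiset.map_map, Multiset.card_map, Finset.card_val, Finset.card_univ,
        Fintype.card_fin] at this
      simp only [MvPolynomial.aeval_esymm_eq_multiset_esymm]
      rw [← this]; rfl
    rw [key x, key y]
    apply Finset.sum_congr rfl
    intro j hj
    rw [he j (by simpa [Nat.lt_succ_iff] using hj)]
  have := congrArg (Polynomial.eval (x i)) hprod
  simp only [Polynomial.eval_prod, Polynomial.eval_sub, Polynomial.eval_X, Polynomial.eval_C] at this
  rw [← this]
  exact Finset.prod_eq_zero (Finset.mem_univ i) (by simp)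

/-- weighted injective tuple sums -/
noncomputable def injQ {ι : Type*} [Fintype ι] (S : ι → ℂ) (j k : ℕ) : ℂ :=
  ∑ a : Fin (k+1) → ι, if Function.Injective a then S (a 0) ^ j * ∏ i : Fin k, S (a i.succ) else 0
noncomputable def injD {ι : Type*} [Fintype ι] (S : ι → ℂ) (k : ℕ) : ℂ :=
  ∑ a : Fin k → ι, if Function.Injective a then ∏ i, S (a i) else 0

lemma injD_succ {ι : Type*} [Fintype ι] (S : ι → ℂ) (k : ℕ) : injD S (k+1) = injQ S 1 k := by
  simp [injD, injQ, Fin.prod_univ_succ]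

lemma injQ_zero {ι : Type*} [Fintype ι] (S : ι → ℂ) (j : ℕ) : injQ S j 0 = ∑ a, S a ^ j := by
  unfold injQ
  rw [← (Equiv.funUnique (Fin 1) ι).symm.sum_comp]
  apply Finset.sum_congr rfl
  intro a _
  simp [Function.injective_of_subsingleton]

lemma injQ_rec {ι : Type*} [Fintype ι] (S : ι → ℂ) (j k : ℕ) :
    injQ S j (k+1) = (∑ a, S a ^ j) * injD S (k+1) - (k+1) * injQ S (j+1) k := by
  have h1 : injQ S j (k+1) = ∑ a : Fin (k+1) → ι, if Function.Injective a then
      (∏ i, S (a i)) * (∑ b, if b ∈ Set.range a then 0 else S b ^ j) else 0 := by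
    unfold injQ
    rw [← (Fin.consEquiv (fun _ : Fin (k+2) => ι)).sum_comp, Fintype.sum_prod_type, Finset.sum_comm]
    apply Finset.sum_congr rfl
    intro a _
    simp only [Fin.consEquiv, Equiv.coe_fn_mk, Fin.cons_zero, Fin.cons_succ, Fin.cons_injective_iff]
    by_cases ha : Function.Injective a
    · simp only [ha, and_true, if_true, Finset.mul_sum]
      apply Finset.sum_congr rfl
      intro b _
      by_cases hb : b ∈ Set.range a <;> simp [hb, mul_comm]
    · simp [ha]
  have h2 : ∀ a : Fin (k+1) → ι, Function.Injective a →
      (∑ b, if b ∈ Set.range a then 0 else S b ^ j) = (∑ b, S b ^ j) - ∑ i, S (a i) ^ j := by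
    intro a ha
    have : ∑ i, S (a i) ^ j = ∑ b, if b ∈ Set.range a then S b ^ j else 0 := by
      rw [← Finset.sum_filter]
      rw [show (Finset.univ.filter (fun b => b ∈ Set.range a)) = Finset.univ.image a by ext; simp]
      rw [Finset.sum_image (fun _ _ _ _ h => ha h)]
    rw [this, ← Finset.sum_sub_distrib]
    apply Finset.sum_congr rfl
    intro b _
    split_ifs <;> simp
  have h3 : ∀ i : Fin (k+1), (∑ a : Fin (k+1) → ι, if Function.Injective a then
      (∏ i, S (a i)) * S (a i) ^ j else 0) = injQ S (j+1) k := by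
    intro i
    unfold injQ
    rw [← ((Equiv.swap i 0).arrowCongr (Equiv.refl ι)).sum_comp]
    apply Finset.sum_congr rfl
    intro a _
    have e1 : ((Equiv.swap i 0).arrowCongr (Equiv.refl ι)) a = a ∘ (Equiv.swap i 0) := by
      ext; simp [Equiv.arrowCongr]
    rw [e1]
    have e2 : Function.Injective (a ∘ (Equiv.swap i 0)) ↔ Function.Injective a :=
      Function.Injective.of_comp_iff' a (Equiv.swap i 0).bijective
    simp only [e2, Function.comp, Equiv.swap_apply_left]
    rw [Equiv.prod_comp (Equiv.swap i 0) (fun m => S (a m)), Fin.prod_univ_succ]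
    congr 1
    ring
  rw [h1]
  have : ∀ a : Fin (k+1) → ι, (if Function.Injective a then
      (∏ i, S (a i)) * (∑ b, if b ∈ Set.range a then 0 else S b ^ j) else 0) =
      (∑ b, S b ^ j) * (if Function.Injective a then ∏ i, S (a i) else 0) -
      ∑ i, (if Function.Injective a then (∏ i, S (a i)) * S (a i) ^ j else 0) := by
    intro a
    by_cases ha : Function.Injective a
    · simp only [ha, if_true, h2 a ha, ← Finset.mul_sum]; ring
    · simp [ha]
  simp_rw [this]
  rw [Finset.sum_sub_distrib, ← Finset.mul_sum, Finset.sum_comm]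
  simp_rw [h3]
  simp [injD]

lemma inj_bound {ι : Type*} [Fintype ι] (S : ι → ℂ) (k : ℕ) (hk : 1 ≤ k) (q : ℝ) (hq : 0 ≤ q)
    (hp : ∑ a, ‖S a‖ ^ 2 = q ^ 2) (hA : 3 * k * q ≤ ‖∑ a, S a‖) :
    ‖∑ a, S a‖ ^ k ≤ 2 * ‖injD S k‖ := by
  set A := ‖∑ a, S a‖ with hAd
  have hA0 : 0 ≤ A := norm_nonneg _
  have hpj : ∀ j : ℕ, 2 ≤ j → ‖∑ a, S a ^ j‖ ≤ q ^ j := by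
    intro j hj
    have hle : ∀ a, ‖S a‖ ≤ q := fun a => by
      apply (sq_le_sq₀ (norm_nonneg _) hq).1
      rw [← hp]
      exact Finset.single_le_sum (f := fun a => ‖S a‖^2) (fun _ _ => by positivity) (Finset.mem_univ a)
    calc ‖∑ a, S a ^ j‖ ≤ ∑ a, ‖S a ^ j‖ := norm_sum_le _ _
      _ ≤ ∑ a, ‖S a‖ ^ 2 * q ^ (j - 2) := by
          apply Finset.sum_le_sum
          intro a _
          rw [norm_pow]
          calc ‖S a‖ ^ j = ‖S a‖ ^ 2 * ‖S a‖ ^ (j-2) := by rw [← pow_add]; congr 1; omega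
            _ ≤ _ := by gcongr; exact hle a
      _ = q ^ j := by rw [← Finset.sum_mul, hp, ← pow_add]; congr 1; omega
  have hk1 : (1:ℝ) ≤ k := by exact_mod_cast hk
  have main : ∀ m : ℕ, m + 1 ≤ k → (‖injD S (m+1) - (∑ a, S a) ^ (m+1)‖ ≤ m / (2*k) * A ^ (m+1)) ∧
      ∀ j, 2 ≤ j → ‖injQ S j m‖ ≤ 4 * q ^ j * A ^ m := by
    intro m
    induction m with
    | zero =>
      intro _
      refine ⟨by simp [injD_succ, injQ_zero], fun j hj => ?_⟩
      rw [injQ_zero]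
      have := hpj j hj
      have : 0 ≤ q ^ j := by positivity
      simp; linarith
    | succ m ih =>
      intro hm
      obtain ⟨i1, i2⟩ := ih (by omega)
      have hmk : (m:ℝ) + 1 + 1 ≤ k := by exact_mod_cast hm
      have hD : ‖injD S (m+1)‖ ≤ 2 * A ^ (m+1) := by
        have : ‖injD S (m+1)‖ ≤ ‖injD S (m+1) - (∑ a, S a) ^ (m+1)‖ + ‖(∑ a, S a) ^ (m+1)‖ := by
          simpa using norm_add_le (injD S (m+1) - (∑ a, S a) ^ (m+1)) ((∑ a, S a) ^ (m+1))
        rw [norm_pow, ← hAd] at this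
        have h5 : (m:ℝ) / (2*k) ≤ 1 := by rw [div_le_one (by positivity)]; linarith
        have := mul_le_mul_of_nonneg_right h5 (show 0 ≤ A^(m+1) by positivity)
        linarith
      have hn : ‖((m:ℂ)+1)‖ = (m:ℝ)+1 := by
        rw [show ((m:ℂ)+1) = ((m+1:ℝ):ℂ) by push_cast; ring, Complex.norm_real, Real.norm_of_nonneg (by positivity)]
      constructor
      · rw [injD_succ, injQ_rec]
        simp only [pow_one]
        have e : (∑ a, S a) * injD S (m+1) - (m+1) * injQ S (1+1) m - (∑ a, S a) ^ (m+1+1) =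
          (∑ a, S a) * (injD S (m+1) - (∑ a, S a) ^ (m+1)) - (m+1) * injQ S 2 m := by ring
        rw [e]
        refine (norm_sub_le _ _).trans ?_
        rw [norm_mul, norm_mul, ← hAd, hn]
        have h2 := i2 2 le_rfl
        have hq2 : q^2 ≤ A^2 / (9*k^2) := by
          rw [le_div_iff₀ (by positivity)]
          have := pow_le_pow_left₀ (by positivity) hA 2
          nlinarith only [this]
        calc A * ‖injD S (m+1) - (∑ a, S a) ^ (m+1)‖ + (m+1) * ‖injQ S 2 m‖
            ≤ A * (m / (2*k) * A ^ (m+1)) + k * (4 * (A^2/(9*k^2)) * A ^ m) := by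
              gcongr
              · linarith
              · exact h2.trans (by gcongr)
          _ = (m/(2*k) + 4/(9*k)) * A^(m+1+1) := by field_simp; ring
          _ ≤ _ := by
              gcongr
              push_cast
              rw [add_div]
              have : (4:ℝ)/(9*k) ≤ 1/(2*k) := by
                rw [div_le_div_iff₀ (by positivity) (by positivity)]; linarith
              linarith
      · intro j hj
        rw [injQ_rec]
        refine (norm_sub_le _ _).trans ?_
        rw [norm_mul, norm_mul, hn]
        calc ‖∑ a, S a ^ j‖ * ‖injD S (m+1)‖ + (m+1) * ‖injQ S (j+1) m‖
            ≤ q^j * (2 * A^(m+1)) + k * (4 * q^(j+1) * A^m) := by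
              gcongr
              · exact hpj j hj
              · linarith
              · exact i2 (j+1) (by omega)
          _ = q^j * A^m * (2*A + 4*k*q) := by ring
          _ ≤ q^j * A^m * (4 * A) := by gcongr; nlinarith only [hA, hA0]
          _ = _ := by ring
  obtain ⟨k, rfl⟩ : ∃ m, k = m + 1 := ⟨k-1, by omega⟩
  have := (main k le_rfl).1
  have h6 : ‖(∑ a, S a) ^ (k+1)‖ ≤ ‖injD S (k+1) - (∑ a, S a) ^ (k+1)‖ + ‖injD S (k+1)‖ := by
    have := norm_sub_le (injD S (k+1)) (injD S (k+1) - (∑ a, S a) ^ (k+1))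
    rw [sub_sub_cancel] at this; linarith
  rw [norm_pow, ← hAd] at h6
  have h5 : (k:ℝ) / (2*((k+1:ℕ):ℝ)) ≤ 1/2 := by
    push_cast
    rw [div_le_div_iff₀ (by positivity) (by positivity)]; linarith
  have := mul_le_mul_of_nonneg_right h5 (show 0 ≤ A^(k+1) by positivity)
  linarith

/-- additive energy -/
noncomputable def en {V G : Type*} [Fintype V] (φ : V → G) : ℕ :=
  (Finset.univ.filter (fun w : V × V => φ w.1 = φ w.2)).card

lemma en_shift {V G : Type*} [Fintype V] [AddCommGroup G] (φ : V → G) (c : G) :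
    (Finset.univ.filter (fun w : V × V => φ w.1 - φ w.2 = c)).card ≤ en φ := by
  set f : G → ℕ := fun g => (Finset.univ.filter (fun v => φ v = g)).card
  have h1 : ∀ d : G, (Finset.univ.filter (fun w : V × V => φ w.1 - φ w.2 = d)).card =
      ∑ v : V, f (d + φ v) := by
    intro d
    rw [Finset.card_filter, Fintype.sum_prod_type, Finset.sum_comm]
    apply Finset.sum_congr rfl
    intro v _
    rw [← Finset.card_filter]
    simp only [f, sub_eq_iff_eq_add]
  have h0 : en φ = ∑ v : V, f (φ v) := by
    have := h1 0
    simp only [sub_eq_zero, zero_add] at this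
    exact this
  have hs : ∀ d : G, ∑ v : V, f (d + φ v) = ∑ g ∈ Finset.univ.image φ, f g * f (d + g) := by
    intro d
    rw [Finset.sum_comp (fun g => f (d + g)) φ]
    simp [f]
  rw [h1, h0]
  have h00 : ∑ v : V, f (φ v) = ∑ g ∈ Finset.univ.image φ, f g * f g := by simpa using hs 0
  rw [hs c, h00]
  have hsq : ∑ g ∈ Finset.univ.image φ, f (c+g) * f (c+g) ≤ ∑ g ∈ Finset.univ.image φ, f g * f g := by
    have : ∑ g ∈ Finset.univ.image φ, f (c+g) * f (c+g) =
        ∑ g ∈ (Finset.univ.image φ).image (fun g => c + g), f g * f g := by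
      exact (Finset.sum_image (f := fun g => f g * f g) (g := fun g => c + g)
        (fun _ _ _ _ h => add_left_cancel h)).symm
    rw [this]
    apply Finset.sum_le_sum_of_ne_zero
    intro g _ hg
    have : f g ≠ 0 := fun h => hg (by simp [h])
    simp only [f] at this
    obtain ⟨v, hv⟩ := Finset.card_ne_zero.1 this
    exact Finset.mem_image.2 ⟨v, Finset.mem_univ _, (Finset.mem_filter.1 hv).2⟩
  have : 2 * ∑ g ∈ Finset.univ.image φ, f g * f (c+g) ≤
      ∑ g ∈ Finset.univ.image φ, f g * f g + ∑ g ∈ Finset.univ.image φ, f (c+g) * f (c+g) := by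
    rw [Finset.mul_sum, ← Finset.sum_add_distrib]
    apply Finset.sum_le_sum
    intro g _
    zify
    nlinarith only [sq_nonneg ((f g : ℤ) - f (c+g))]
  omega

noncomputable def cc {k : ℕ} (Q : ℕ) (ψ : AddChar (Fin k → ZMod (Q+1)) ℂ) (z : Fin k → ℤ) : ℂ :=
  ψ (fun j => (z j : ZMod (Q+1)))

lemma cc_add {k : ℕ} (Q : ℕ) (ψ : AddChar (Fin k → ZMod (Q+1)) ℂ) (z w : Fin k → ℤ) :
    cc Q ψ (z + w) = cc Q ψ z * cc Q ψ w := by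
  unfold cc
  rw [← AddChar.map_add_eq_mul]
  congr 1; ext j; simp

lemma cc_sum {k : ℕ} (Q : ℕ) (ψ : AddChar (Fin k → ZMod (Q+1)) ℂ) {ι : Type*} (s : Finset ι)
    (z : ι → Fin k → ℤ) : cc Q ψ (∑ i ∈ s, z i) = ∏ i ∈ s, cc Q ψ (z i) := by
  induction s using Finset.induction_on with
  | empty => simp [cc]; exact AddChar.map_zero_eq_one ψ
  | insert a s ha ih => rw [Finset.sum_insert ha, Finset.prod_insert ha, cc_add, ih]

lemma cc_conj {k : ℕ} (Q : ℕ) (ψ : AddChar (Fin k → ZMod (Q+1)) ℂ) (z : Fin k → ℤ) :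
    (starRingEnd ℂ) (cc Q ψ z) = cc Q ψ (-z) := by
  unfold cc
  rw [← AddChar.map_neg_eq_conj]
  congr 1; ext j; simp

lemma cc_count {k : ℕ} {V : Type*} [Fintype V] (φ : V → Fin k → ℤ) :
    ∀ᶠ Q : ℕ in Filter.atTop, ∑ ψ : AddChar (Fin k → ZMod (Q+1)) ℂ, ‖∑ v, cc Q ψ (φ v)‖ ^ 2 =
      (Fintype.card (Fin k → ZMod (Q+1)) : ℝ) * en φ := by
  have hQ : ∀ᶠ Q : ℕ in Filter.atTop, ∀ w : V × V, ∀ j, |φ w.1 j - φ w.2 j| < Q + 1 := by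
    rw [Filter.eventually_all]; intro w
    rw [Filter.eventually_all]; intro j
    filter_upwards [Filter.eventually_ge_atTop (|φ w.1 j - φ w.2 j|).toNat] with Q h
    have := Int.self_le_toNat (|φ w.1 j - φ w.2 j|)
    omega
  filter_upwards [hQ] with Q hQ
  have hc : ∀ ψ : AddChar (Fin k → ZMod (Q+1)) ℂ, ((‖∑ v, cc Q ψ (φ v)‖ ^ 2 : ℝ) : ℂ) =
      ∑ w : V × V, cc Q ψ (φ w.1 - φ w.2) := by
    intro ψ
    rw [← Complex.normSq_eq_norm_sq, ← Complex.mul_conj, map_sum, Finset.sum_mul_sum,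
      Fintype.sum_prod_type]
    simp_rw [cc_conj, ← cc_add, sub_eq_add_neg]
  have : ((∑ ψ : AddChar (Fin k → ZMod (Q+1)) ℂ, ‖∑ v, cc Q ψ (φ v)‖ ^ 2 : ℝ) : ℂ) =
      (((Fintype.card (Fin k → ZMod (Q+1)) : ℝ) * en φ : ℝ) : ℂ) := by
    rw [Complex.ofReal_sum]
    simp_rw [hc]
    rw [Finset.sum_comm]
    unfold cc
    simp_rw [AddChar.sum_apply_eq_ite]
    rw [← Finset.sum_filter, Finset.sum_const, nsmul_eq_mul, mul_comm]
    push_cast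
    congr 2
    unfold en
    congr 1
    ext w
    simp only [Finset.mem_filter, Finset.mem_univ, true_and]
    constructor
    · intro h
      ext j
      have h1 := congrFun h j
      simp only [Pi.sub_apply, Pi.zero_apply] at h1
      rw [ZMod.intCast_zmod_eq_zero_iff_dvd] at h1
      have := Int.eq_zero_of_abs_lt_dvd h1 (by have := hQ w j; push_cast; exact this)
      omega
    · intro h; ext j; simp [h]
  exact_mod_cast this

def pv (k : ℕ) (n : ℤ) : Fin k → ℤ := fun j => n ^ (j.1+1)

noncomputable def J (s k X : ℕ) : ℕ := en (fun v : Fin s → Fin X => ∑ i, pv k (v i : ℕ))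

lemma sum_pow_cc {k : ℕ} (Q : ℕ) (ψ : AddChar (Fin k → ZMod (Q+1)) ℂ) {ι : Type*} [Fintype ι]
    (z : ι → Fin k → ℤ) (s : ℕ) :
    (∑ i, cc Q ψ (z i)) ^ s = ∑ v : Fin s → ι, cc Q ψ (∑ i, z (v i)) := by
  simp_rw [cc_sum]
  rw [Finset.sum_pow', Fintype.piFinset_univ]

lemma en_inj {V W G H : Type*} [Fintype V] [Fintype W] (φ : V → G) (θ : W → H) (f : V → W)
    (hf : Function.Injective f) (h : ∀ v v', φ v = φ v' → θ (f v) = θ (f v')) : en φ ≤ en θ := by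
  unfold en
  apply Finset.card_le_card_of_injOn (fun w => (f w.1, f w.2))
  · intro w hw
    simp only [Finset.coe_filter, Finset.mem_univ, true_and, Set.mem_ofPred_eq] at hw ⊢
    exact h _ _ hw
  · intro a _ b _ hab
    simp only [Prod.mk.injEq] at hab
    exact Prod.ext (hf hab.1) (hf hab.2)

lemma J_mono (s k : ℕ) {X Y : ℕ} (h : X ≤ Y) : J s k X ≤ J s k Y := by
  refine en_inj _ _ (fun v i => Fin.castLE h (v i)) ?_ ?_
  · intro a b hab; ext i; simpa using congrArg Fin.val (congrFun hab i)
  · intro v v' hv; simpa using hv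

/-- translation-dilation -/
lemma td {k : ℕ} {ι : Type*} (s : Finset ι) (x x' : ι → ℤ)
    (h : ∀ j : ℕ, 1 ≤ j → j ≤ k → ∑ i ∈ s, x i ^ j = ∑ i ∈ s, x' i ^ j) (a : ℤ) (j : ℕ) (hj : j ≤ k) :
    ∑ i ∈ s, (x i + a) ^ j = ∑ i ∈ s, (x' i + a) ^ j := by
  have : ∀ m ≤ k, ∑ i ∈ s, x i ^ m = ∑ i ∈ s, x' i ^ m := by
    intro m hm
    rcases Nat.eq_zero_or_pos m with rfl | h0
    · simp
    · exact h m h0 hm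
  simp_rw [add_pow]
  rw [Finset.sum_comm, Finset.sum_comm (s := s)]
  apply Finset.sum_congr rfl
  intro m hm
  simp_rw [← Finset.sum_mul]
  rw [this m (by simp at hm; omega)]

abbrev LU (k p X : ℕ) := {a : Fin k → Fin p // Function.Injective a} × (Fin k → Fin X)
def LU.val {k p X : ℕ} (u : LU k p X) (i : Fin k) : ℤ := ((u.1.1 i : ℕ) : ℤ) + p * ((u.2 i : ℕ) : ℤ)

lemma linnik {k p X : ℕ} (hp : p.Prime) (hkp : k < p) (hX : X * p ≤ p ^ k) (a : ℤ) (c : ℕ → ℤ) :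
    (Finset.univ.filter (fun u : LU k p X => ∀ j : ℕ, 1 ≤ j → j ≤ k →
      ((p : ℤ) ^ j) ∣ ∑ i, (u.val i + a) ^ j - c j)).card ≤ k ^ k * p ^ (k * (k-1) / 2) := by
  have hp0 : (0:ℤ) < p := by exact_mod_cast hp.pos
  let R := ZMod (p ^ k)
  set T := Finset.univ.filter (fun u : LU k p X => ∀ j : ℕ, 1 ≤ j → j ≤ k →
      ((p : ℤ) ^ j) ∣ ∑ i, (u.val i + a) ^ j - c j)
  let w : LU k p X → (∀ j : Fin k, ZMod (p ^ (k - 1 - j.1))) := fun u j =>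
    (((∑ i, (u.val i + a) ^ (j.1+1) - c (j.1+1)) / (p:ℤ) ^ (j.1+1) : ℤ) : ZMod (p ^ (k-1-j.1)))
  have : ∀ n : ℕ, NeZero (p ^ n) := fun n => ⟨(pow_pos hp.pos n).ne'⟩
  have hcard : (Finset.univ : Finset (∀ j : Fin k, ZMod (p ^ (k - 1 - j.1)))).card = p ^ (k * (k-1) / 2) := by
    rw [Finset.card_univ, Fintype.card_pi]
    simp only [ZMod.card]
    rw [Finset.prod_pow_eq_pow_sum, Fin.sum_univ_eq_sum_range (fun j => k - 1 - j),
      Finset.sum_range_reflect (fun j => j), Finset.sum_range_id]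
  rw [← hcard]
  apply Finset.card_le_mul_card_image_of_maps_to (f := w) (fun _ _ => Finset.mem_univ _)
  intro b _
  rcases Finset.eq_empty_or_nonempty ({u ∈ T | w u = b} : Finset (LU k p X)) with h0 | ⟨y, hy⟩
  · rw [h0]; simp
  obtain ⟨hyT, hyb⟩ := Finset.mem_filter.1 hy
  have hval0 : ∀ (u : LU k p X) i, 0 ≤ u.val i ∧ u.val i < (p:ℤ)^k := by
    intro u i
    have h1 : (u.1.1 i : ℕ) < p := (u.1.1 i).2
    have h2 : (u.2 i : ℕ) < X := (u.2 i).2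
    have h3 : (u.1.1 i : ℕ) + p * (u.2 i : ℕ) < p ^ k := by nlinarith only [hX, h1, h2]
    unfold LU.val
    constructor
    · positivity
    · exact_mod_cast h3
  have key : ∀ u ∈ ({u ∈ T | w u = b} : Finset (LU k p X)), ∀ i, ∃ j, u.val i = y.val j := by
    intro u hu i
    obtain ⟨huT, hub⟩ := Finset.mem_filter.1 hu
    have hps : ∀ j : ℕ, 1 ≤ j → j ≤ k → ∑ i, (((u.val i + a : ℤ)) : R) ^ j = ∑ i, (((y.val i + a : ℤ)) : R) ^ j := by
      intro j h1 hj
      obtain ⟨q, hq⟩ := (Finset.mem_filter.1 huT).2 j h1 hj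
      obtain ⟨r, hr⟩ := (Finset.mem_filter.1 hyT).2 j h1 hj
      have hw := congrFun (hub.trans hyb.symm) ⟨j-1, by omega⟩
      simp only [w] at hw
      have hjj : j - 1 + 1 = j := by omega
      simp only [hjj] at hw
      rw [hq, hr, Int.mul_ediv_cancel_left _ (by positivity), Int.mul_ediv_cancel_left _ (by positivity),
        ZMod.intCast_eq_intCast_iff_dvd_sub] at hw
      have : ((p^k : ℕ):ℤ) ∣ ∑ i, (y.val i + a) ^ j - ∑ i, (u.val i + a) ^ j := by
        have e : ∑ i, (y.val i + a) ^ j - ∑ i, (u.val i + a) ^ j = (p:ℤ)^j * (r - q) := by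
          rw [mul_sub, ← hq, ← hr]; ring
        rw [e, show ((p^k : ℕ):ℤ) = (p:ℤ)^j * ((p ^ (k-1-(j-1)) : ℕ) : ℤ) by
          push_cast; rw [← pow_add]; congr 1; omega]
        exact mul_dvd_mul_left _ hw
      rw [← ZMod.intCast_eq_intCast_iff_dvd_sub] at this
      simpa using this
    have hu' : ∀ j : ℕ, 1 ≤ j → j ≤ k → IsUnit (j : R) := by
      intro j h1 hj
      rw [ZMod.isUnit_iff_coprime]
      exact Nat.Coprime.pow_right _ (Nat.coprime_of_lt_prime (by omega) (by omega) hp).symm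
    have h0 := newton_roots hu' _ _ hps i
    have h1 : ((∏ j, (u.val i - y.val j) : ℤ) : R) = 0 := by
      rw [Int.cast_prod]; rw [← h0]
      apply Finset.prod_congr rfl; intro j _; push_cast; ring
    rw [ZMod.intCast_zmod_eq_zero_iff_dvd] at h1
    have hk0 : k ≠ 0 := by rintro rfl; exact i.elim0
    have hpd : (p:ℤ) ∣ ∏ j, (u.val i - y.val j) := by
      refine dvd_trans ?_ h1
      push_cast; exact dvd_pow_self _ hk0
    obtain ⟨j, -, hj⟩ := (Prime.dvd_finsetProd_iff (Nat.prime_iff_prime_int.1 hp) _).1 hpd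
    refine ⟨j, ?_⟩
    have hcop : IsCoprime ((p^k:ℕ):ℤ) (∏ m ∈ Finset.univ.erase j, (u.val i - y.val m)) := by
      apply IsCoprime.prod_right
      intro m hm
      push_cast
      apply IsCoprime.pow_left
      rw [Int.isCoprime_iff_gcd_eq_one]
      rw [← Int.isCoprime_iff_gcd_eq_one]
      refine (Prime.coprime_iff_not_dvd (Nat.prime_iff_prime_int.1 hp)).2 ?_
      intro hd
      have hmj : m ≠ j := (Finset.mem_erase.1 hm).1
      apply hmj
      have h3 : (p:ℤ) ∣ y.val j - y.val m := by
        have := dvd_sub hd hj; rwa [show u.val i - y.val m - (u.val i - y.val j) = y.val j - y.val m by ring] at this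
      have h4 : (p:ℤ) ∣ ((y.1.1 j : ℕ):ℤ) - ((y.1.1 m : ℕ):ℤ) := by
        have : y.val j - y.val m = ((y.1.1 j : ℕ):ℤ) - ((y.1.1 m : ℕ):ℤ) + p * (((y.2 j : ℕ):ℤ) - ((y.2 m : ℕ):ℤ)) := by
          unfold LU.val; ring
        rw [this] at h3
        exact (dvd_add_left (dvd_mul_right _ _)).1 h3
      have h5 := Int.eq_zero_of_abs_lt_dvd h4 (by
        have := (y.1.1 j).2; have := (y.1.1 m).2; rw [abs_lt]; omega)
      exact y.1.2 (Fin.ext (by omega))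
    have h6 : ((p^k:ℕ):ℤ) ∣ u.val i - y.val j := by
      rw [← Finset.mul_prod_erase _ _ (Finset.mem_univ j)] at h1
      exact hcop.dvd_of_dvd_mul_right h1
    have h7 := Int.eq_zero_of_abs_lt_dvd h6 (by
      have := hval0 u i; have := hval0 y j; push_cast; rw [abs_lt]; omega)
    omega
  have hinj : Function.Injective (fun u : LU k p X => u.val) := by
    intro u v huv
    have : ∀ i, (u.1.1 i : ℕ) = v.1.1 i ∧ (u.2 i : ℕ) = v.2 i := by
      intro i
      have h := congrFun huv i
      simp only [LU.val] at h
      have h' : (u.1.1 i : ℕ) + p * (u.2 i : ℕ) = (v.1.1 i : ℕ) + p * (v.2 i : ℕ) := by exact_mod_cast h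
      have e1 := congrArg (· % p) h'
      simp only [Nat.add_mul_mod_self_left, Nat.mod_eq_of_lt (u.1.1 i).2, Nat.mod_eq_of_lt (v.1.1 i).2] at e1
      refine ⟨e1, ?_⟩
      rw [e1] at h'
      exact Nat.eq_of_mul_eq_mul_left hp.pos (by omega)
    refine Prod.ext (Subtype.ext (funext fun i => Fin.ext (this i).1)) (funext fun i => Fin.ext (this i).2)
  calc _ ≤ (Fintype.piFinset (fun _ : Fin k => Finset.univ.image y.val)).card := by
        apply Finset.card_le_card_of_injOn (fun u => u.val)
        · intro u hu
          simp only [Finset.mem_coe, Fintype.mem_piFinset, Finset.mem_image, Finset.mem_univ, true_and]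
          intro i
          obtain ⟨j, hj⟩ := key u hu i
          exact ⟨j, hj.symm⟩
        · exact fun _ _ _ _ h => hinj h
    _ ≤ k ^ k := by
        rw [Fintype.card_piFinset]
        simp only [Finset.prod_const, Finset.card_univ, Fintype.card_fin]
        exact Nat.pow_le_pow_left (Finset.card_image_le.trans (by simp)) _

lemma pow_sum_le' {p : ℕ} (f : Fin p → ℝ) (hf : ∀ a, 0 ≤ f a) (n : ℕ) (hn : 1 ≤ n) (hp : 0 < p) :
    (∑ a, f a) ^ n ≤ (p:ℝ) ^ (n-1) * ∑ a, f a ^ n := by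
  obtain ⟨n, rfl⟩ : ∃ m, n = m + 1 := ⟨n-1, by omega⟩
  have := pow_sum_div_card_le_sum_pow (s := Finset.univ) (f := f) (fun i _ => hf i) n
  rw [div_le_iff₀ (by simp; positivity)] at this
  simp only [Finset.card_univ, Fintype.card_fin] at this
  simpa [mul_comm] using this

lemma en_quad {U Z G : Type*} [Fintype U] [Fintype Z] (θ : U × Z → G) :
    en θ = ∑ u' : U, ∑ u : U, (Finset.univ.filter (fun w : Z × Z => θ (u, w.1) = θ (u', w.2))).card := by
  unfold en
  simp_rw [Finset.card_filter, Fintype.sum_prod_type]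
  rw [Finset.sum_comm' (t' := Finset.univ) (s' := fun _ => Finset.univ) (by simp)]
  simp_rw [Finset.sum_comm (s := (Finset.univ : Finset Z)) (t := (Finset.univ : Finset U))]
  rw [Finset.sum_comm]

lemma sum_subtype_ite {A M : Type*} [Fintype A] [AddCommMonoid M] (P : A → Prop) (F : A → M)
    (i : Fintype {a // P a}) (d : DecidablePred P) :
    (∑ a, if P a then F a else 0) = ∑ x : {a // P a}, F x.1 := by
  rw [← Finset.sum_filter]
  exact Finset.sum_subtype _ (by simp) _

lemma J_rec {k p X s : ℕ} (hp : p.Prime) (hkp : k < p) (hk : 1 ≤ k) (hs : 1 ≤ s) (hX : X * p ≤ p ^ k) :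
    (J (s+k) k (X*p) : ℝ) ≤ 4 * p^(2*s) * (((X:ℝ)*p)^k * (k^k * p^(k*(k-1)/2))) * J s k X +
      (9*k^2*p)^(s+k) * J (s+k) k X := by
  set b := s + k with hb
  have hp0 : 0 < p := hp.pos
  let sh : Fin p → Fin X → ℤ := fun a z => ((a:ℕ):ℤ) + p * ((z:ℕ):ℤ)
  let φ (a : Fin p) : (Fin b → Fin X) → Fin k → ℤ := fun v => ∑ i, pv k (sh a (v i))
  let θ (a : Fin p) : LU k p X × (Fin s → Fin X) → Fin k → ℤ :=
    fun v => (∑ i, pv k (v.1.val i)) + ∑ i, pv k (sh a (v.2 i))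
  obtain ⟨Q, ⟨h0, h1⟩, h2⟩ := (((cc_count (fun v : Fin b → Fin (X*p) => ∑ i, pv k (v i : ℕ))).and
    ((Filter.eventually_all).2 (fun a => cc_count (φ a)))).and
    ((Filter.eventually_all).2 (fun a => cc_count (θ a)))).exists
  set G : ℝ := (Fintype.card (Fin k → ZMod (Q+1)) : ℝ)
  have hG : 0 < G := by
    have : 0 < Fintype.card (Fin k → ZMod (Q+1)) := Fintype.card_pos
    exact Nat.cast_pos.2 this
  let Sa (ψ : AddChar (Fin k → ZMod (Q+1)) ℂ) (a : Fin p) : ℂ := ∑ z : Fin X, cc Q ψ (pv k (sh a z))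
  have hS : ∀ ψ, ∑ n : Fin (X*p), cc Q ψ (pv k (n:ℕ)) = ∑ a, Sa ψ a := by
    intro ψ
    rw [← finProdFinEquiv.sum_comp, Fintype.sum_prod_type, Finset.sum_comm]
    apply Finset.sum_congr rfl; intro a _
    apply Finset.sum_congr rfl; intro z _
    simp [sh, finProdFinEquiv]
  have hD : ∀ ψ, injD (Sa ψ) k = ∑ u : LU k p X, cc Q ψ (∑ i, pv k (u.val i)) := by
    intro ψ
    unfold injD
    rw [Fintype.sum_prod_type]
    have hss := fun i d => sum_subtype_ite (fun a : Fin k → Fin p => Function.Injective a)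
      (fun a => ∏ i, Sa ψ (a i)) i d
    refine (Eq.trans ?_ (hss inferInstance inferInstance)).trans ?_
    · apply Finset.sum_congr rfl; intro a _
      by_cases h : Function.Injective a <;> simp [h]
    apply Finset.sum_congr rfl; intro a _
    simp only [Sa, LU.val]
    simp_rw [cc_sum]
    rw [Finset.prod_univ_sum, Fintype.piFinset_univ]
  have hpt : ∀ ψ, ‖∑ n : Fin (X*p), cc Q ψ (pv k (n:ℕ))‖ ^ (2*b) ≤
      4 * (p:ℝ)^(2*s-1) * (∑ a, ‖injD (Sa ψ) k‖^2 * ‖Sa ψ a‖^(2*s)) +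
      (9*k^2)^b * ((p:ℝ)^(b-1) * ∑ a, ‖Sa ψ a‖^(2*b)) := by
    intro ψ
    rw [hS]
    set A := ‖∑ a, Sa ψ a‖
    set q := Real.sqrt (∑ a, ‖Sa ψ a‖^2)
    have hqq : q ^ 2 = ∑ a, ‖Sa ψ a‖^2 := Real.sq_sqrt (by positivity)
    by_cases hA : 3 * k * q ≤ A
    · have h3 := inj_bound (Sa ψ) k hk q (Real.sqrt_nonneg _) hqq.symm hA
      have h4 : A ^ (2*s) ≤ (p:ℝ)^(2*s-1) * ∑ a, ‖Sa ψ a‖^(2*s) :=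
        (pow_le_pow_left₀ (norm_nonneg _) (norm_sum_le _ _) _).trans
          (pow_sum_le' _ (fun _ => norm_nonneg _) _ (by omega) hp0)
      calc A ^ (2*b) = (A^k)^2 * A^(2*s) := by rw [← pow_mul, ← pow_add]; congr 1; omega
        _ ≤ (2 * ‖injD (Sa ψ) k‖)^2 * ((p:ℝ)^(2*s-1) * ∑ a, ‖Sa ψ a‖^(2*s)) := by
            gcongr
        _ = 4 * (p:ℝ)^(2*s-1) * (∑ a, ‖injD (Sa ψ) k‖^2 * ‖Sa ψ a‖^(2*s)) := by
            rw [← Finset.mul_sum]; ring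
        _ ≤ _ := le_add_of_nonneg_right (by positivity)
    · push Not at hA
      calc A ^ (2*b) ≤ (3*k*q)^(2*b) := pow_le_pow_left₀ (norm_nonneg _) hA.le _
        _ = (9*k^2)^b * (∑ a, ‖Sa ψ a‖^2)^b := by rw [← hqq, pow_mul, ← mul_pow]; ring
        _ ≤ (9*k^2)^b * ((p:ℝ)^(b-1) * ∑ a, (‖Sa ψ a‖^2)^b) := by
            gcongr
            exact pow_sum_le' _ (fun _ => by positivity) _ (by omega) hp0
        _ = (9*k^2)^b * ((p:ℝ)^(b-1) * ∑ a, ‖Sa ψ a‖^(2*b)) := by simp_rw [pow_mul]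
        _ ≤ _ := le_add_of_nonneg_left (by positivity)
  have e0 : ∑ ψ, ‖∑ n : Fin (X*p), cc Q ψ (pv k (n:ℕ))‖ ^ (2*b) = G * J b k (X*p) := by
    rw [J, ← h0]
    apply Finset.sum_congr rfl; intro ψ _
    rw [mul_comm 2 b, pow_mul, ← norm_pow, sum_pow_cc]
  have e1 : ∀ a, ∑ ψ, ‖Sa ψ a‖^(2*b) = G * en (φ a) := by
    intro a
    rw [← h1 a]
    apply Finset.sum_congr rfl; intro ψ _
    rw [mul_comm 2 b, pow_mul, ← norm_pow, sum_pow_cc]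
  have e2 : ∀ a, ∑ ψ, ‖injD (Sa ψ) k‖^2 * ‖Sa ψ a‖^(2*s) = G * en (θ a) := by
    intro a
    rw [← h2 a]
    apply Finset.sum_congr rfl; intro ψ _
    rw [mul_comm 2 s, pow_mul, ← norm_pow (Sa ψ a), sum_pow_cc, hD, ← mul_pow, ← norm_mul, Finset.sum_mul_sum,
      ← Fintype.sum_prod_type']
    simp only [θ, cc_add]
  have hpz : (p:ℤ) ≠ 0 := by exact_mod_cast hp0.ne'
  have f1 : ∀ a, en (φ a) ≤ J b k X := by
    intro a
    refine en_inj _ _ id Function.injective_id ?_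
    intro v v' hv
    ext j
    have h3 := td (k := k) Finset.univ (fun i => sh a (v i)) (fun i => sh a (v' i)) (by
      intro m hm1 hm
      have := congrFun hv ⟨m-1, by omega⟩
      simpa [φ, pv, show m - 1 + 1 = m by omega] using this) (-(a:ℕ)) (j.1+1) (by omega)
    simp only [sh, add_neg_cancel_comm, mul_pow, ← Finset.mul_sum] at h3
    have := mul_left_cancel₀ (pow_ne_zero _ hpz) h3
    simpa [pv] using this
  have f2 : ∀ a, (en (θ a) : ℝ) ≤ (((X:ℝ)*p)^k * (k^k * p^(k*(k-1)/2))) * J s k X := by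
    intro a
    have hU : Fintype.card (LU k p X) ≤ (X*p)^k := by
      rw [Fintype.card_prod, Fintype.card_fun, Fintype.card_fin, Fintype.card_fin, mul_pow, mul_comm]
      gcongr
      exact (Fintype.card_subtype_le _).trans (by simp)
    have hc : en (θ a) ≤ (X*p)^k * (k^k * p^(k*(k-1)/2)) * J s k X := by
      have h5 : en (θ a) ≤ ∑ u' : LU k p X, ∑ u ∈ Finset.univ.filter (fun u : LU k p X =>
          ∀ j : ℕ, 1 ≤ j → j ≤ k → ((p : ℤ) ^ j) ∣ ∑ i, (u.val i + (-(a:ℕ))) ^ j -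
            ∑ i, (u'.val i + (-(a:ℕ))) ^ j), J s k X := by
        rw [en_quad]
        simp_rw [Finset.sum_filter]
        apply Finset.sum_le_sum; intro u' _
        apply Finset.sum_le_sum; intro u _
        have himp : ∀ y y' : Fin s → Fin X, θ a (u, y) = θ a (u', y') → ∀ j : ℕ, 1 ≤ j → j ≤ k →
            ∑ i, (u.val i + (-(a:ℕ))) ^ j + (p:ℤ)^j * ∑ i, ((y i : ℕ):ℤ)^j =
            ∑ i, (u'.val i + (-(a:ℕ))) ^ j + (p:ℤ)^j * ∑ i, ((y' i : ℕ):ℤ)^j := by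
          intro y y' hy j hj1 hj
          have h3 := td (k := k) (Finset.univ : Finset (Fin k ⊕ Fin s))
            (Sum.elim u.val (fun i => sh a (y i))) (Sum.elim u'.val (fun i => sh a (y' i))) (by
            intro m hm1 hm
            have := congrFun hy ⟨m-1, by omega⟩
            simpa [θ, pv, show m - 1 + 1 = m by omega, Fintype.sum_sum_type] using this) (-(a:ℕ)) j hj
          simpa [Fintype.sum_sum_type, sh, mul_pow, ← Finset.mul_sum] using h3
        split_ifs with hu
        · let c : Fin k → ℤ := fun j => (∑ i, (u'.val i + (-(a:ℕ))) ^ (j.1+1) -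
            ∑ i, (u.val i + (-(a:ℕ))) ^ (j.1+1)) / (p:ℤ)^(j.1+1)
          refine le_trans (Finset.card_le_card ?_)
            (en_shift (fun v : Fin s → Fin X => ∑ i, pv k (v i : ℕ)) c)
          intro w hw
          simp only [Finset.mem_filter, Finset.mem_univ, true_and] at hw ⊢
          ext j
          have := himp w.1 w.2 hw (j.1+1) (by omega) (by omega)
          simp only [c, Pi.sub_apply, Finset.sum_apply, pv]
          symm
          apply Int.ediv_eq_of_eq_mul_right (pow_ne_zero _ hpz)
          linarith only [this]
        · apply le_of_eq
          refine Finset.card_eq_zero.2 (Finset.eq_empty_of_forall_notMem ?_)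
          rintro ⟨y, y'⟩ hy
          simp only [Finset.mem_filter, Finset.mem_univ, true_and] at hy
          apply hu
          intro j hj1 hj
          refine ⟨∑ i, ((y' i : ℕ):ℤ)^j - ∑ i, ((y i : ℕ):ℤ)^j, ?_⟩
          have := himp y y' hy j hj1 hj
          linarith only [this]
      refine h5.trans ?_
      calc _ ≤ ∑ u' : LU k p X, (k^k * p^(k*(k-1)/2)) * J s k X := by
            apply Finset.sum_le_sum; intro u' _
            rw [Finset.sum_const, smul_eq_mul]
            gcongr
            exact linnik hp hkp hX _ (fun j => ∑ i, (u'.val i + (-(a:ℕ))) ^ j)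
        _ ≤ _ := by
            rw [Finset.sum_const, smul_eq_mul, Finset.card_univ, mul_assoc ((X*p)^k)]
            gcongr
    exact_mod_cast hc
  have hsum := Finset.sum_le_sum (fun ψ (_ : ψ ∈ Finset.univ) => hpt ψ)
  rw [e0, Finset.sum_add_distrib, ← Finset.mul_sum, ← Finset.mul_sum, ← Finset.mul_sum, Finset.sum_comm,
    Finset.sum_comm (f := fun ψ a => ‖Sa ψ a‖^(2*b))] at hsum
  simp_rw [e1, e2, ← Finset.mul_sum] at hsum
  have g1 : ∑ a, (en (φ a) : ℝ) ≤ p * J b k X := by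
    calc _ ≤ ∑ a : Fin p, (J b k X : ℝ) := Finset.sum_le_sum (fun a _ => by exact_mod_cast f1 a)
      _ = _ := by simp
  have g2 : ∑ a, (en (θ a) : ℝ) ≤ p * ((((X:ℝ)*p)^k * (k^k * p^(k*(k-1)/2))) * J s k X) := by
    calc _ ≤ ∑ a : Fin p, ((((X:ℝ)*p)^k * (k^k * p^(k*(k-1)/2))) * J s k X) := Finset.sum_le_sum (fun a _ => f2 a)
      _ = _ := by simp
  have := calc G * J b k (X*p) ≤ _ := hsum
    _ ≤ 4 * (p:ℝ)^(2*s-1) * (G * (p * ((((X:ℝ)*p)^k * (k^k * p^(k*(k-1)/2))) * J s k X))) +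
        (9*k^2)^b * ((p:ℝ)^(b-1) * (G * (p * J b k X))) := by gcongr
    _ = G * (4 * ((p:ℝ)^(2*s-1) * p) * (((X:ℝ)*p)^k * (k^k * p^(k*(k-1)/2))) * J s k X +
        (9*k^2)^b * ((p:ℝ)^(b-1) * p) * J b k X) := by ring
    _ = G * (4 * p^(2*s) * (((X:ℝ)*p)^k * (k^k * p^(k*(k-1)/2))) * J s k X + (9*k^2*p)^b * J b k X) := by
        rw [← pow_succ, ← pow_succ, show 2*s-1+1 = 2*s by omega, show b-1+1 = b by omega, mul_pow (9*(k:ℝ)^2)]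
  exact le_of_mul_le_mul_left this hG

lemma J_triv (s k X : ℕ) : J s k X ≤ X^(2*s) := by
  unfold J en
  refine (Finset.card_le_univ _).trans ?_
  simp [two_mul, pow_add]

lemma geom_lb (k n : ℕ) (hk : 2 ≤ k) :
    (5/4 : ℝ) * (k*(n+1)) ≤ 2*(k*(n+1)) - k*(k+1)/2 + k*(k+1)/2*(1-1/(k:ℝ))^n := by
  have hk' : (2:ℝ) ≤ k := by exact_mod_cast hk
  have h1 : 1 + (n:ℝ) * (-(1/k)) ≤ (1 + -(1/(k:ℝ)))^n :=
    one_add_mul_le_pow (by have : 1/(k:ℝ) ≤ 1 := by rw [div_le_one (by linarith)]; linarith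
                           linarith) n
  have h2 : (k:ℝ)*(k+1)/2 * (1 + (n:ℝ) * (-(1/k))) = k*(k+1)/2 - n*(k+1)/2 := by
    field_simp; ring
  have h3 : (k:ℝ)*(k+1)/2 * (1 + (n:ℝ) * (-(1/k))) ≤ k*(k+1)/2*(1-1/(k:ℝ))^n := by
    rw [sub_eq_add_neg]; gcongr
  have hn : (0:ℝ) ≤ n := n.cast_nonneg
  nlinarith only [hk', h2, h3]

set_option maxHeartbeats 2000000 in
lemma J_bound (k : ℕ) (hk : 2 ≤ k) : ∀ n X : ℕ, 1 ≤ X →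
    (J (k*(n+1)) k X : ℝ) ≤ (50*k:ℝ)^(8*k^3+2*k^2*n+k*n^2) *
      (X:ℝ)^(2*((k:ℝ)*(n+1)) - k*(k+1)/2 + k*(k+1)/2*(1-1/(k:ℝ))^n) := by
  have hk' : (2:ℝ) ≤ k := by exact_mod_cast hk
  have hk50 : (1:ℝ) ≤ 50*k := by linarith
  intro n
  induction n with
  | zero =>
    intro X hX
    have h1 : (J (k*(0+1)) k X : ℝ) ≤ (X:ℝ)^(2*k) := by
      have := J_triv (k*(0+1)) k X
      simp only [zero_add, mul_one] at this ⊢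
      exact_mod_cast this
    have h2 : (X:ℝ)^(2*((k:ℝ)*((0:ℕ)+1)) - k*(k+1)/2 + k*(k+1)/2*(1-1/(k:ℝ))^0) = (X:ℝ)^(2*k) := by
      rw [← Real.rpow_natCast (X:ℝ)]
      have : 2*((k:ℝ)*((0:ℕ)+1)) - k*(k+1)/2 + k*(k+1)/2*(1-1/(k:ℝ))^0 = ((2*k:ℕ):ℝ) := by
        push_cast; ring
      rw [this]
    rw [h2]
    exact h1.trans (le_mul_of_one_le_left (by positivity) (one_le_pow₀ hk50))
  | succ n ih =>
    intro X
    set e : ℝ := 2*((k:ℝ)*((n+1:ℕ)+1)) - k*(k+1)/2 + k*(k+1)/2*(1-1/(k:ℝ))^(n+1) with he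
    set b := k*(n+1+1) with hb
    have heb : (5/4:ℝ) * b ≤ e := by
      have := geom_lb k (n+1) hk
      rw [he, hb]; push_cast at this ⊢; exact this
    have hkinv : 0 ≤ 1-1/(k:ℝ) := by
      have : 1/(k:ℝ) ≤ 1 := by rw [div_le_one (by linarith only [hk'])]; linarith only [hk']
      linarith
    induction X using Nat.strong_induction_on with
    | _ X IH =>
    intro hX
    have hXr : (1:ℝ) ≤ X := by exact_mod_cast hX
    by_cases hsm : (X:ℝ) ≤ ((44*k^2)^4)^k
    · have h1 : (J b k X : ℝ) ≤ (X:ℝ)^(2*b) := by exact_mod_cast J_triv b k X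
      have h2 : (X:ℝ)^(2*b) = (X:ℝ)^(k*(k+1)/2 - k*(k+1)/2*(1-1/(k:ℝ))^(n+1)) * (X:ℝ)^e := by
        rw [← Real.rpow_natCast, ← Real.rpow_add (by linarith only [hXr])]; congr 1
        rw [he, hb]; push_cast; ring
      rw [h2] at h1
      refine h1.trans ?_
      gcongr
      calc (X:ℝ)^(k*(k+1)/2 - k*(k+1)/2*(1-1/(k:ℝ))^(n+1)) ≤ (X:ℝ)^((k^2:ℕ):ℝ) := by
            apply Real.rpow_le_rpow_of_exponent_le hXr
            have : 0 ≤ k*(k+1)/2*(1-1/(k:ℝ))^(n+1) := by positivity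
            push_cast; nlinarith only [this, hk']
        _ = (X:ℝ)^(k^2) := Real.rpow_natCast _ _
        _ ≤ ((((44*k^2)^4)^k)^(k^2):ℝ) := by gcongr
        _ ≤ ((((50*k)^8)^k)^(k^2):ℝ) := by
            gcongr (?_^k)^(k^2)
            calc (44*(k:ℝ)^2)^4 ≤ ((50*k)^2)^4 := by gcongr; nlinarith only [hk']
              _ = _ := by ring
        _ = (50*k:ℝ)^(8*k^3) := by rw [← pow_mul, ← pow_mul]; congr 1; ring
        _ ≤ _ := by
            apply pow_le_pow_right₀ hk50
            rw [add_assoc]; exact Nat.le_add_right _ _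
    push Not at hsm
    set R : ℝ := (X:ℝ)^(1/(k:ℝ)) with hR
    have hR0 : 0 ≤ R := by positivity
    have hRk : R^k = X := by
      rw [hR, ← Real.rpow_natCast, ← Real.rpow_mul (by linarith only [hXr])]
      rw [one_div_mul_cancel (by linarith only [hk']), Real.rpow_one]
    have hRbig : (44*k^2)^4 < R := by
      rw [← hRk] at hsm
      exact lt_of_pow_lt_pow_left₀ _ hR0 hsm
    have hRb2 : 44*(k:ℝ)^2 ≤ R := le_trans (le_self_pow₀ (by nlinarith only [hk']) (by norm_num)) hRbig.le
    have hR44 : 176 ≤ R := by nlinarith only [hk', hRb2]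
    obtain ⟨p, hp, hp1, hp2⟩ := Nat.exists_prime_lt_and_le_two_mul ⌈2*R⌉₊ (by
      have : 0 < ⌈2*R⌉₊ := Nat.ceil_pos.2 (by linarith only [hR44])
      omega)
    have hpR : 2*R < p := lt_of_le_of_lt (Nat.le_ceil _) (by exact_mod_cast hp1)
    have hpR2 : (p:ℝ) ≤ 5*R := by
      have h1 : (p:ℝ) ≤ 2*⌈2*R⌉₊ := by exact_mod_cast hp2
      have := Nat.ceil_lt_add_one (a := 2*R) (by linarith only [hR44])
      linarith only [hR44, h1, this]
    have hp0 : (0:ℝ) < p := by linarith only [hR44, hpR]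
    have hRX : R^2 ≤ X := by rw [← hRk]; exact pow_le_pow_right₀ (by linarith only [hR44]) hk
    have hpX : (p:ℝ) ≤ X := by nlinarith only [hRX, hR44, hpR2]
    set X' := X/p + 1 with hX'
    have hX'1 : 1 ≤ X' := Nat.le_add_left _ _
    have hX'p : X ≤ X'*p := by
      have := Nat.lt_div_mul_add (a := X) hp.pos
      rw [hX']; nlinarith only [this]
    have hX'r : (X':ℝ) ≤ 2*X/p := by
      have : ((X/p:ℕ):ℝ) ≤ X/p := Nat.cast_div_le
      have h2 : 1 ≤ (X:ℝ)/p := by rw [le_div_iff₀ hp0]; linarith only [hpX]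
      rw [hX']; push_cast; rw [mul_div_assoc]; linarith only [this, h2]
    have hX'p2 : (X':ℝ)*p ≤ 2*X := by rwa [le_div_iff₀ hp0] at hX'r
    have hX'lt : X' < X := by
      have : (X':ℝ) < X := by nlinarith only [hX'p2, hpR, hR44, hXr]
      exact_mod_cast this
    have hpk : (2:ℝ)*X ≤ p^k := by
      calc 2*(X:ℝ) = 2^1*R^k := by rw [hRk]; ring
        _ ≤ 2^k*R^k := by gcongr <;> linarith only [hk]
        _ = (2*R)^k := by rw [mul_pow]
        _ ≤ _ := by gcongr
    have hrec := J_rec (s := k*(n+1)) (X := X') hp (by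
      have : (k:ℝ) < p := by nlinarith only [hk', hpR, hRb2]
      exact_mod_cast this) (by omega) (by nlinarith only [hk]) (by
      have : (X':ℝ)*p ≤ p^k := by linarith only [hX'p2, hpk]
      exact_mod_cast this)
    rw [show k*(n+1)+k = b by rw [hb]; ring] at hrec
    have hJm : (J b k X : ℝ) ≤ J b k (X'*p) := by exact_mod_cast J_mono _ _ hX'p
    refine (hJm.trans hrec).trans ?_
    have ih' := ih X' hX'1
    have IH' := IH X' hX'lt hX'1
    set C := (50*k:ℝ)^(8*k^3+2*k^2*n+k*n^2) with hC
    set C' := (50*k:ℝ)^(8*k^3+2*k^2*(n+1)+k*(n+1)^2) with hC'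
    have hC0 : 0 < C := by positivity
    have hC'0 : 0 < C' := by positivity
    set e0 : ℝ := 2*((k:ℝ)*(n+1)) - k*(k+1)/2 + k*(k+1)/2*(1-1/(k:ℝ))^n with he0
    set η : ℝ := k*(k+1)/2*(1-1/(k:ℝ))^n with hη
    have hη0 : 0 ≤ η := by positivity
    have he0pos : 0 ≤ e0 := le_trans (by positivity) (geom_lb k n hk)
    have hX'pos : (0:ℝ) ≤ X' := by positivity
    have hXp : (0:ℝ) ≤ 2*X/p := by positivity
    have second : (9*k^2*p:ℝ)^b * J b k X' ≤ C' * (X:ℝ)^e / 2 := by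
      have h1 : (X':ℝ)^e ≤ (2/p:ℝ)^e * (X:ℝ)^e := by
        rw [← Real.mul_rpow (by positivity) (by positivity)]
        apply Real.rpow_le_rpow hX'pos _ (le_trans (by positivity) heb)
        rw [div_mul_eq_mul_div]; exact hX'r
      have h2 : (2/p:ℝ)^e ≤ (2/p:ℝ)^((5/4:ℝ)*b) := by
        apply Real.rpow_le_rpow_of_exponent_ge (by positivity) _ heb
        rw [div_le_one hp0]; linarith only [hR44, hpR]
      have h3 : (2/p:ℝ)^((5/4:ℝ)*b) = ((2/p:ℝ)^(5/4:ℝ))^b := by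
        rw [Real.rpow_mul (by positivity), Real.rpow_natCast]
      have hp4 : 44*(k:ℝ)^2 ≤ (p:ℝ)^(1/4:ℝ) := by
        calc 44*(k:ℝ)^2 = ((44*(k:ℝ)^2)^4)^(1/4:ℝ) := by
              rw [← Real.rpow_natCast (_) 4, ← Real.rpow_mul (by positivity)]; norm_num
          _ ≤ _ := by gcongr; linarith only [hRbig, hR44, hpR]
      have h4 : (9*k^2*p:ℝ) * (2/p:ℝ)^(5/4:ℝ) ≤ 1/2 := by
        have e1 : (p:ℝ)^(5/4:ℝ) = p * (p:ℝ)^(1/4:ℝ) := by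
          nth_rewrite 2 [← Real.rpow_one (p:ℝ)]
          rw [← Real.rpow_add hp0]; norm_num
        have e2 : (2:ℝ)^(5/4:ℝ) ≤ 2.4 := by
          have : (2:ℝ)^(5/4:ℝ) = ((2:ℝ)^5)^(1/4:ℝ) := by
            rw [← Real.rpow_natCast, ← Real.rpow_mul (by norm_num)]; norm_num
          rw [this]
          calc ((2:ℝ)^5)^(1/4:ℝ) ≤ ((2.4:ℝ)^4)^(1/4:ℝ) := by gcongr; norm_num
            _ = 2.4 := by rw [← Real.rpow_natCast, ← Real.rpow_mul (by norm_num)]; norm_num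
        rw [Real.div_rpow (by norm_num) hp0.le, e1]
        have hq : (0:ℝ) < (p:ℝ)^(1/4:ℝ) := by positivity
        rw [show (9*(k:ℝ)^2*p) * ((2:ℝ)^(5/4:ℝ) / (p * (p:ℝ)^(1/4:ℝ))) = 9*k^2*(2:ℝ)^(5/4:ℝ) / (p:ℝ)^(1/4:ℝ) by
          field_simp]
        rw [div_le_iff₀ hq]
        nlinarith only [e2, hp4, sq_nonneg (k:ℝ)]
      have h5 : ((9*k^2*p:ℝ) * (2/p:ℝ)^(5/4:ℝ))^b ≤ 1/2 := by
        have : 1 ≤ b := by rw [hb]; nlinarith only [hk]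
        calc _ ≤ (1/2:ℝ)^b := by gcongr
          _ ≤ (1/2:ℝ)^1 := pow_le_pow_of_le_one (by norm_num) (by norm_num) this
          _ = _ := by norm_num
      calc (9*k^2*p:ℝ)^b * J b k X' ≤ (9*k^2*p:ℝ)^b * (C' * ((2/p:ℝ)^((5/4:ℝ)*b) * (X:ℝ)^e)) := by
            gcongr
            exact IH'.trans (by gcongr; exact h1.trans (by gcongr))
        _ = ((9*k^2*p:ℝ) * (2/p:ℝ)^(5/4:ℝ))^b * (C' * (X:ℝ)^e) := by rw [h3, mul_pow]; ring
        _ ≤ 1/2 * (C' * (X:ℝ)^e) := by gcongr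
        _ = _ := by ring
    have first : 4 * (p:ℝ)^(2*(k*(n+1))) * (((X':ℝ)*p)^k * (k^k * (p:ℝ)^(k*(k-1)/2))) * J (k*(n+1)) k X'
        ≤ C' * (X:ℝ)^e / 2 := by
      have hkk : ((k*(k-1)/2:ℕ):ℝ) = k*(k-1)/2 := by
        rw [Nat.cast_div (Nat.even_mul_pred_self k).two_dvd (by norm_num)]
        push_cast [Nat.cast_sub (show 1 ≤ k by omega)]; ring
      have hηle : η ≤ k^2 := by
        have : (1-1/(k:ℝ))^n ≤ 1 := pow_le_one₀ hkinv (by have : 0 ≤ 1/(k:ℝ) := by positivity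
                                                          linarith only [this])
        calc η ≤ k*(k+1)/2*1 := by rw [hη]; gcongr
          _ ≤ _ := by nlinarith only [hk']
      have h1 : (X':ℝ)^e0 ≤ (2*X)^e0 / (p:ℝ)^e0 := by
        rw [← Real.div_rpow (by positivity) hp0.le]
        exact Real.rpow_le_rpow hX'pos hX'r he0pos
      have h2 : (p:ℝ)^(2*(k*(n+1))) * (p:ℝ)^(k*(k-1)/2) / (p:ℝ)^e0 = (p:ℝ)^((k:ℝ)^2-η) := by
        rw [← Real.rpow_natCast, ← Real.rpow_natCast, ← Real.rpow_add hp0, ← Real.rpow_sub hp0, hkk]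
        congr 1; rw [he0]; push_cast; ring
      have h3 : (p:ℝ)^((k:ℝ)^2-η) ≤ 5^(k^2) * (X:ℝ)^(k-η/k) := by
        calc (p:ℝ)^((k:ℝ)^2-η) ≤ (5*R)^((k:ℝ)^2-η) := by gcongr
          _ = 5^((k:ℝ)^2-η) * R^((k:ℝ)^2-η) := Real.mul_rpow (by norm_num) hR0
          _ ≤ 5^(k^2) * (X:ℝ)^(k-η/k) := by
            have a1 : (5:ℝ)^((k:ℝ)^2-η) ≤ 5^(k^2) := by
              rw [← Real.rpow_natCast 5]
              apply Real.rpow_le_rpow_of_exponent_le (by norm_num)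
              push_cast; linarith only [hη0]
            have a2 : R^((k:ℝ)^2-η) = (X:ℝ)^(k-η/k) := by
              rw [hR, ← Real.rpow_mul (by linarith only [hR44, hpR, hpX])]; congr 1; field_simp
            rw [a2]; gcongr
      have h4 : (2*(X:ℝ))^e0 ≤ 4^(k*(n+1)) * (X:ℝ)^e0 := by
        rw [Real.mul_rpow (by norm_num) (by linarith only [hR44, hpR, hpX])]
        gcongr
        calc (2:ℝ)^e0 ≤ 2^((2*(k*(n+1)):ℕ):ℝ) := by
              apply Real.rpow_le_rpow_of_exponent_le (by norm_num)
              have : (1-1/(k:ℝ))^n ≤ 1 := pow_le_one₀ hkinv (by have : 0 ≤ 1/(k:ℝ) := by positivity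
                                                                linarith only [this])
              have : η ≤ k*(k+1)/2*1 := by rw [hη]; gcongr
              rw [he0]; push_cast; linarith only [this]
          _ = 4^(k*(n+1)) := by rw [Real.rpow_natCast, pow_mul]; norm_num
      have h5 : (X:ℝ)^k * ((X:ℝ)^e0 * (X:ℝ)^(k-η/k)) = (X:ℝ)^e := by
        rw [← Real.rpow_natCast, ← Real.rpow_add (by linarith only [hR44, hpR, hpX]), ← Real.rpow_add (by linarith only [hR44, hpR, hpX])]
        congr 1
        rw [he, he0, hη, pow_succ]; push_cast; field_simp; ring
      have h6 : 4 * 2^k * k^k * 4^(k*(n+1)) * 5^(k^2) * C ≤ C'/2 := by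
        have : C' = C * ((50*k)^(k^2) * (50*k)^(k^2) * (50*k)^(k*(2*n+1))) := by
          rw [hC, hC', ← pow_add, ← pow_add, ← pow_add]; congr 1; ring
        rw [this]
        have b1 : (5:ℝ)^(k^2) * 2 ≤ (50*k:ℝ)^(k^2) := by
          calc (5:ℝ)^(k^2) * 2 ≤ 5^(k^2) * 10^(k^2) := by
                gcongr
                calc (2:ℝ) ≤ 10^1 := by norm_num
                  _ ≤ 10^(k^2) := pow_le_pow_right₀ (by norm_num) (by nlinarith only [hk])
            _ = 50^(k^2) := by rw [← mul_pow]; norm_num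
            _ ≤ _ := by gcongr; linarith only [hk']
        have b2 : (4:ℝ)^(k*n) ≤ (50*k:ℝ)^(k*(2*n+1)) := by
          calc (4:ℝ)^(k*n) ≤ (50*k:ℝ)^(k*n) := by gcongr; linarith only [hk']
            _ ≤ _ := pow_le_pow_right₀ hk50 (by nlinarith only [hk])
        have b3 : 4 * 2^k * (k:ℝ)^k * 4^k ≤ (50*k:ℝ)^(k^2) := by
          calc 4 * 2^k * (k:ℝ)^k * 4^k ≤ 4^k * 2^k * (k:ℝ)^k * 4^k := by
                gcongr; exact le_self_pow₀ (by norm_num) (by omega)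
            _ = (32*k)^k := by rw [← mul_pow, ← mul_pow, ← mul_pow]; ring
            _ ≤ (50*k)^k := by gcongr; norm_num
            _ ≤ _ := pow_le_pow_right₀ hk50 (by nlinarith only [hk])
        calc 4 * 2^k * (k:ℝ)^k * 4^(k*(n+1)) * 5^(k^2) * C
            = C * ((4 * 2^k * (k:ℝ)^k * 4^k) * (5^(k^2)*2) * 4^(k*n)) / 2 := by
              rw [mul_add, mul_one, pow_add]; ring
          _ ≤ _ := by gcongr
      calc _ ≤ 4 * (p:ℝ)^(2*(k*(n+1))) * ((2*X)^k * (k^k * (p:ℝ)^(k*(k-1)/2))) *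
              (C * (4^(k*(n+1)) * (X:ℝ)^e0 / (p:ℝ)^e0)) := by
            gcongr
            exact ih'.trans (by gcongr; exact h1.trans (by gcongr))
        _ = 4 * 2^k * k^k * 4^(k*(n+1)) * C * ((p:ℝ)^(2*(k*(n+1))) * (p:ℝ)^(k*(k-1)/2) / (p:ℝ)^e0) *
              ((X:ℝ)^k * (X:ℝ)^e0) := by rw [mul_pow]; ring
        _ ≤ 4 * 2^k * k^k * 4^(k*(n+1)) * C * (5^(k^2) * (X:ℝ)^(k-η/k)) * ((X:ℝ)^k * (X:ℝ)^e0) := by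
            rw [h2]; gcongr
        _ = (4 * 2^k * k^k * 4^(k*(n+1)) * 5^(k^2) * C) * ((X:ℝ)^k * ((X:ℝ)^e0 * (X:ℝ)^(k-η/k))) := by ring
        _ ≤ C'/2 * (X:ℝ)^e := by rw [h5]; gcongr
        _ = _ := by ring
    linarith only [second, first]

noncomputable def ee (x : ℝ) : ℂ := Complex.exp (Complex.I * x)
lemma ee_add (x y : ℝ) : ee (x+y) = ee x * ee y := by
  simp [ee, mul_add, Complex.exp_add]
lemma ee_norm (x : ℝ) : ‖ee x‖ = 1 := Complex.norm_exp_I_mul_ofReal x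
lemma ee_conj (x : ℝ) : (starRingEnd ℂ) (ee x) = ee (-x) := by
  simp [ee, ← Complex.exp_conj]
lemma ee_zero : ee 0 = 1 := by simp [ee]
lemma ee_sum {ι : Type*} (s : Finset ι) (f : ι → ℝ) : ee (∑ i ∈ s, f i) = ∏ i ∈ s, ee (f i) := by
  simp [ee, Finset.mul_sum, Complex.exp_sum]
lemma ee_sub (x y : ℝ) : ‖ee x - ee y‖ ≤ |x - y| := by
  have : ee x - ee y = ee y * (ee (x-y) - 1) := by
    rw [mul_sub, ← ee_add]; simp
  rw [this, norm_mul, ee_norm, one_mul]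
  exact Real.norm_exp_I_mul_ofReal_sub_one_le
lemma ee_sub_one_lb {x : ℝ} (hx : |x| ≤ Real.pi) : 2/Real.pi*|x| ≤ ‖ee x - 1‖ := by
  rw [ee, Complex.norm_exp_I_mul_ofReal_sub_one, norm_mul]
  have := Real.mul_abs_le_abs_sin (x := x/2) (by rw [abs_div]; simp; linarith)
  rw [abs_div, abs_two] at this
  simp only [Real.norm_eq_abs, abs_two]
  linarith

noncomputable def Dl (φ : ℝ) (B : ℕ) : ℝ :=
  ∑ m ∈ Finset.Icc (-(B:ℤ)) B, ‖∑ l ∈ Finset.Icc (-(B:ℤ)) B, ee (φ * l * m)‖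

lemma norm_pow_sum_ee {ι : Type*} [Fintype ι] {k : ℕ} (θ : Fin k → ℝ) (z : ι → Fin k → ℤ) (s : ℕ) :
    ((‖∑ i, ee (∑ l, θ l * z i l)‖^(2*s) : ℝ) : ℂ) =
      ∑ w : (Fin s → ι) × (Fin s → ι),
        ee (∑ l, θ l * (((∑ i, z (w.1 i)) - ∑ i, z (w.2 i)) l : ℤ)) := by
  have h1 : (∑ i, ee (∑ l, θ l * z i l))^s = ∑ v : Fin s → ι, ee (∑ l, θ l * (∑ i, z (v i) l : ℤ)) := by
    have : ∀ v : Fin s → ι, ee (∑ l, θ l * (∑ i, z (v i) l : ℤ)) = ∏ i, ee (∑ l, θ l * z (v i) l) := by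
      intro v
      rw [← ee_sum, Finset.sum_comm]; congr 1
      apply Finset.sum_congr rfl; intro l _
      push_cast; rw [Finset.mul_sum]
    simp_rw [this]
    rw [Finset.sum_pow', Fintype.piFinset_univ]
  rw [pow_mul', ← norm_pow, h1, ← Complex.normSq_eq_norm_sq, ← Complex.mul_conj, map_sum, Finset.sum_mul_sum,
    ← Fintype.sum_prod_type']
  apply Finset.sum_congr rfl; intro w _
  rw [ee_conj, ← ee_add]; congr 1
  simp only [Pi.sub_apply, Finset.sum_apply]; push_cast
  rw [← sub_eq_add_neg, ← Finset.sum_sub_distrib]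
  apply Finset.sum_congr rfl; intro l _; ring

lemma pm {ι : Type*} [Fintype ι] (f : ι → ℝ) (hf : ∀ a, 0 ≤ f a) (n : ℕ) (hn : 1 ≤ n) :
    (∑ a, f a) ^ n ≤ (Fintype.card ι:ℝ) ^ (n-1) * ∑ a, f a ^ n := by
  obtain ⟨n, rfl⟩ : ∃ m, n = m + 1 := ⟨n-1, by omega⟩
  rcases Nat.eq_zero_or_pos (Fintype.card ι) with h | h
  · have := Fintype.card_eq_zero_iff.1 h
    simp
  have := pow_sum_div_card_le_sum_pow (s := Finset.univ) (f := f) (fun i _ => hf i) n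
  rw [div_le_iff₀ (by simp; positivity)] at this
  simp only [Finset.card_univ] at this
  simpa [mul_comm] using this

/-- sums over pairs bounded by sums over the box -/
lemma box_sum (s k X : ℕ) (F : (Fin k → ℤ) → ℝ) (hF : ∀ z, 0 ≤ F z) :
    ∑ w : (Fin s → Fin X) × (Fin s → Fin X),
      F ((∑ i, pv k (w.1 i : ℕ)) - ∑ i, pv k (w.2 i : ℕ)) ≤
    J s k X * ∑ z ∈ Fintype.piFinset (fun l : Fin k => Finset.Icc (-((s*X^(l.1+1) : ℕ):ℤ)) ((s*X^(l.1+1):ℕ):ℤ)), F z := by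
  set Δ : (Fin s → Fin X) × (Fin s → Fin X) → Fin k → ℤ :=
    fun w => (∑ i, pv k (w.1 i : ℕ)) - ∑ i, pv k (w.2 i : ℕ)
  set bx := Fintype.piFinset (fun l : Fin k => Finset.Icc (-((s*X^(l.1+1) : ℕ):ℤ)) ((s*X^(l.1+1):ℕ):ℤ))
  have hb : ∀ (v : Fin s → Fin X) (l : Fin k), 0 ≤ (∑ i, pv k (v i : ℕ)) l ∧
      (∑ i, pv k (v i : ℕ)) l ≤ ((s*X^(l.1+1):ℕ):ℤ) := by
    intro v l
    simp only [Finset.sum_apply, pv]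
    constructor
    · positivity
    · calc ∑ i, (((v i : ℕ):ℤ))^(l.1+1) ≤ ∑ i : Fin s, ((X:ℤ))^(l.1+1) := by
            gcongr with i; exact_mod_cast (v i).2.le
        _ = _ := by simp
  have hm : ∀ w ∈ (Finset.univ : Finset ((Fin s → Fin X) × (Fin s → Fin X))), Δ w ∈ bx := by
    intro w _
    simp only [bx, Fintype.mem_piFinset, Finset.mem_Icc]
    intro l
    have h1 := hb w.1 l
    have h2 := hb w.2 l
    simp only [Δ, Pi.sub_apply]
    constructor <;> linarith
  change ∑ w, F (Δ w) ≤ _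
  rw [← Finset.sum_fiberwise_of_maps_to hm, Finset.mul_sum]
  apply Finset.sum_le_sum; intro z _
  rw [Finset.sum_congr rfl (g := fun _ => F z) (by intro w hw; rw [(Finset.mem_filter.1 hw).2])]
  rw [Finset.sum_const, nsmul_eq_mul]
  gcongr
  · exact hF z
  · refine le_trans (Finset.card_le_card ?_) (en_shift (fun v : Fin s → Fin X => ∑ i, pv k (v i : ℕ)) z)
    intro w hw
    simp only [Finset.mem_filter, Finset.mem_univ, true_and] at hw ⊢
    exact hw

lemma bilin (k X s : ℕ) (hs : 1 ≤ s) (θ : Fin k → ℝ) :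
    ‖∑ a : Fin X, ∑ b : Fin X, ee (∑ l, θ l * ((a:ℕ):ℝ)^(l.1+1) * ((b:ℕ):ℝ)^(l.1+1))‖^(4*s^2) ≤
      (X:ℝ)^(8*s^2-4*s) * (J s k X)^2 * ∏ l : Fin k, Dl (θ l) (s*X^(l.1+1)) := by
  set Jr : ℝ := ((J s k X : ℕ) : ℝ)
  have hJ0 : 0 ≤ Jr := Nat.cast_nonneg _
  let Δ : (Fin s → Fin X) × (Fin s → Fin X) → Fin k → ℤ :=
    fun w => (∑ i, pv k (w.1 i : ℕ)) - ∑ i, pv k (w.2 i : ℕ)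
  let T : (Fin k → ℤ) → ℂ := fun z => ∑ a : Fin X, ee (∑ l, (θ l * z l) * (pv k (a:ℕ) l : ℤ))
  set bx := Fintype.piFinset (fun l : Fin k => Finset.Icc (-((s*X^(l.1+1) : ℕ):ℤ)) ((s*X^(l.1+1):ℕ):ℤ)) with hbx
  have hcard : Fintype.card ((Fin s → Fin X) × (Fin s → Fin X)) = X^(2*s) := by
    simp [two_mul, pow_add]
  have s1 : ‖∑ a : Fin X, ∑ b : Fin X, ee (∑ l, θ l * ((a:ℕ):ℝ)^(l.1+1) * ((b:ℕ):ℝ)^(l.1+1))‖^(2*s) ≤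
      (X:ℝ)^(2*s-1) * ∑ w, ‖T (Δ w)‖ := by
    calc _ ≤ (∑ a : Fin X, ‖∑ b : Fin X, ee (∑ l, θ l * ((a:ℕ):ℝ)^(l.1+1) * ((b:ℕ):ℝ)^(l.1+1))‖)^(2*s) := by
          gcongr; exact norm_sum_le _ _
      _ ≤ (X:ℝ)^(2*s-1) * ∑ a : Fin X, ‖∑ b : Fin X, ee (∑ l, θ l * ((a:ℕ):ℝ)^(l.1+1) * ((b:ℕ):ℝ)^(l.1+1))‖^(2*s) := by
          have := pm (fun a : Fin X => ‖∑ b : Fin X, ee (∑ l, θ l * ((a:ℕ):ℝ)^(l.1+1) * ((b:ℕ):ℝ)^(l.1+1))‖)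
            (fun _ => norm_nonneg _) (2*s) (by omega)
          simpa using this
      _ ≤ _ := by
          gcongr
          have h1 : ((∑ a : Fin X, ‖∑ b : Fin X, ee (∑ l, θ l * ((a:ℕ):ℝ)^(l.1+1) * ((b:ℕ):ℝ)^(l.1+1))‖^(2*s) : ℝ):ℂ)
              = ∑ w, T (Δ w) := by
            push_cast
            simp only [T]
            rw [Finset.sum_comm]
            apply Finset.sum_congr rfl; intro a _
            have := norm_pow_sum_ee (fun l => θ l * ((a:ℕ):ℝ)^(l.1+1)) (fun b : Fin X => pv k (b:ℕ)) s
            simp only [pv, Int.cast_pow, Int.cast_natCast] at this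
            push_cast at this
            rw [this]
            apply Finset.sum_congr rfl; intro w _
            congr 1
            apply Finset.sum_congr rfl; intro l _
            simp only [Δ, pv, Pi.sub_apply, Finset.sum_apply]; push_cast; ring
          have h2 : (0:ℝ) ≤ ∑ a : Fin X, ‖∑ b : Fin X, ee (∑ l, θ l * ((a:ℕ):ℝ)^(l.1+1) * ((b:ℕ):ℝ)^(l.1+1))‖^(2*s) := by positivity
          rw [← abs_of_nonneg h2, ← Real.norm_eq_abs, ← Complex.norm_real, h1]
          exact norm_sum_le _ _
  have s2 : (∑ w, ‖T (Δ w)‖)^(2*s) ≤ (X:ℝ)^(2*s*(2*s-1)) * (Jr * ∑ z ∈ bx, ‖T z‖^(2*s)) := by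
    calc _ ≤ _ := pm (fun w => ‖T (Δ w)‖) (fun _ => norm_nonneg _) (2*s) (by omega)
      _ = (X:ℝ)^(2*s*(2*s-1)) * ∑ w, ‖T (Δ w)‖^(2*s) := by rw [hcard]; push_cast; rw [← pow_mul]
      _ ≤ _ := by
        gcongr
        exact box_sum s k X (fun z => ‖T z‖^(2*s)) (fun _ => by positivity)
  have s3 : ∑ z ∈ bx, ‖T z‖^(2*s) ≤ Jr * ∏ l : Fin k, Dl (θ l) (s*X^(l.1+1)) := by
    have h1 : ((∑ z ∈ bx, ‖T z‖^(2*s) : ℝ):ℂ) = ∑ w, ∏ l : Fin k,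
        ∑ m ∈ Finset.Icc (-((s*X^(l.1+1) : ℕ):ℤ)) ((s*X^(l.1+1):ℕ):ℤ), ee (θ l * m * (Δ w l)) := by
      simp_rw [Finset.prod_univ_sum, ← hbx]
      rw [Finset.sum_comm]
      push_cast
      apply Finset.sum_congr rfl; intro z _
      have := norm_pow_sum_ee (fun l => θ l * z l) (fun a : Fin X => pv k (a:ℕ)) s
      push_cast at this
      rw [this]
      apply Finset.sum_congr rfl; intro w _
      rw [← ee_sum]
    have h2 : (0:ℝ) ≤ ∑ z ∈ bx, ‖T z‖^(2*s) := by positivity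
    rw [← abs_of_nonneg h2, ← Real.norm_eq_abs, ← Complex.norm_real, h1]
    refine (norm_sum_le _ _).trans ?_
    simp_rw [norm_prod]
    refine (box_sum s k X (fun z => ∏ l : Fin k,
        ‖∑ m ∈ Finset.Icc (-((s*X^(l.1+1) : ℕ):ℤ)) ((s*X^(l.1+1):ℕ):ℤ), ee (θ l * m * (z l))‖)
        (fun _ => by positivity)).trans (le_of_eq ?_)
    congr 1
    unfold Dl
    rw [Finset.prod_univ_sum]
  calc _ = (‖∑ a : Fin X, ∑ b : Fin X, ee (∑ l, θ l * ((a:ℕ):ℝ)^(l.1+1) * ((b:ℕ):ℝ)^(l.1+1))‖^(2*s))^(2*s) := by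
        rw [← pow_mul]; congr 1; ring
    _ ≤ ((X:ℝ)^(2*s-1) * ∑ w, ‖T (Δ w)‖)^(2*s) := by gcongr
    _ = (X:ℝ)^((2*s-1)*(2*s)) * (∑ w, ‖T (Δ w)‖)^(2*s) := by rw [mul_pow, ← pow_mul]
    _ ≤ (X:ℝ)^((2*s-1)*(2*s)) * ((X:ℝ)^(2*s*(2*s-1)) * (Jr * (Jr * ∏ l : Fin k, Dl (θ l) (s*X^(l.1+1))))) := by
        gcongr
        exact s2.trans (by gcongr)
    _ = _ := by
        have : 8*s^2-4*s = (2*s-1)*(2*s) + 2*s*(2*s-1) := by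
          obtain ⟨n, rfl⟩ : ∃ n, s = n+1 := ⟨s-1, by omega⟩
          rw [show 2*(n+1)-1 = 2*n+1 by omega]
          ring_nf; omega
        rw [this, pow_add]; ring

lemma card_sym (B : ℕ) : (Finset.Icc (-(B:ℤ)) B).card = 2*B+1 := by
  rw [Int.card_Icc]; omega

lemma inner_ee (x : ℝ) (B : ℕ) : ‖∑ l ∈ Finset.Icc (-(B:ℤ)) B, ee (x * l)‖ * ‖ee x - 1‖ ≤ 2 := by
  have h : ∑ l ∈ Finset.Icc (-(B:ℤ)) B, ee (x * l) = ∑ i ∈ Finset.range (2*B+1), ee (x * ((i:ℝ) - B)) := by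
    refine Finset.sum_nbij' (fun l => (l + B).toNat) (fun i => (i:ℤ) - B) ?_ ?_ ?_ ?_ ?_
    · intro l hl; simp only [Finset.mem_Icc, Finset.mem_range] at *; omega
    · intro l hl; simp only [Finset.mem_Icc, Finset.mem_range] at *; omega
    · intro l hl; simp only [Finset.mem_Icc] at *; omega
    · intro l hl; simp only [Finset.mem_range] at *; omega
    · intro l hl
      have : 0 ≤ l + B := by simp only [Finset.mem_Icc] at hl; omega
      have h2 : (((l+B).toNat : ℤ):ℝ) = ((l+B : ℤ):ℝ) := by rw [Int.toNat_of_nonneg this]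
      push_cast at h2; rw [h2]; congr 1; ring
  rw [h, ← norm_mul, Finset.sum_mul]
  have h3 : ∀ i ∈ Finset.range (2*B+1), ee (x * ((i:ℝ) - B)) * (ee x - 1) =
      ee (x * (((i+1:ℕ):ℝ) - B)) - ee (x * ((i:ℝ) - B)) := by
    intro i _
    rw [mul_sub, ← ee_add, mul_one]; congr 2; push_cast; ring
  rw [Finset.sum_congr rfl h3, Finset.sum_range_sub (fun i : ℕ => ee (x * ((i:ℝ) - B)))]
  refine (norm_sub_le _ _).trans ?_
  rw [ee_norm, ee_norm]; norm_num

lemma inner_triv (f : ℤ → ℝ) (B : ℕ) (hB : 1 ≤ B) : ‖∑ l ∈ Finset.Icc (-(B:ℤ)) B, ee (f l)‖ ≤ 3 * B := by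
  refine (norm_sum_le _ _).trans ?_
  simp_rw [ee_norm]
  rw [Finset.sum_const, card_sym]; simp
  have : (1:ℝ) ≤ B := by exact_mod_cast hB
  linarith

lemma Dl_nonneg (φ : ℝ) (B : ℕ) : 0 ≤ Dl φ B := Finset.sum_nonneg (fun _ _ => norm_nonneg _)

lemma Dl_triv (φ : ℝ) (B : ℕ) (hB : 1 ≤ B) : Dl φ B ≤ 9 * (B:ℝ)^2 := by
  unfold Dl
  have hB' : (1:ℝ) ≤ B := by exact_mod_cast hB
  calc _ ≤ ∑ m ∈ Finset.Icc (-(B:ℤ)) B, (3*B:ℝ) :=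
        Finset.sum_le_sum (fun m _ => inner_triv (fun l => φ*l*m) B hB)
    _ = (2*B+1)*(3*B) := by rw [Finset.sum_const, card_sym]; simp
    _ ≤ _ := by nlinarith

lemma Dl_bound (φ δ : ℝ) (B : ℕ) (hB : 1 ≤ B) (h0 : φ ≠ 0) (h1 : |φ| * B ≤ Real.pi) (hδ : 0 < δ)
    (h2 : 1 ≤ δ * B) (h3 : Real.pi ≤ 9 * (|φ| * δ^2 * B^2)) : Dl φ B ≤ 36 * (δ * B^2) := by
  have hB' : (1:ℝ) ≤ B := by exact_mod_cast hB
  have hφ : 0 < |φ| := abs_pos.2 h0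
  unfold Dl
  have key : ∀ m ∈ Finset.Icc (-(B:ℤ)) B, ‖∑ l ∈ Finset.Icc (-(B:ℤ)) B, ee (φ * l * m)‖ ≤
      (if |(m:ℝ)| ≤ δ*B then (3*B:ℝ) else 0) + 9*(δ*B) := by
    intro m hm
    split_ifs with hc
    · have := inner_triv (fun l => φ*l*m) B hB
      have : 0 ≤ δ*B := by positivity
      linarith
    · rw [zero_add]
      push Not at hc
      have hmB : |(m:ℝ)| ≤ B := by
        rw [Finset.mem_Icc] at hm
        rw [abs_le]; exact ⟨by exact_mod_cast hm.1, by exact_mod_cast hm.2⟩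
      have e1 := inner_ee (φ*m) B
      have e2 := ee_sub_one_lb (x := φ*m) (by rw [abs_mul]; exact le_trans (by gcongr) h1)
      rw [show (∑ l ∈ Finset.Icc (-(B:ℤ)) B, ee (φ * l * m)) = ∑ l ∈ Finset.Icc (-(B:ℤ)) B, ee (φ * m * l) from
        Finset.sum_congr rfl (fun l _ => by congr 1; ring)]
      set I := ‖∑ l ∈ Finset.Icc (-(B:ℤ)) B, ee (φ * m * l)‖
      have e3 : I * (2/Real.pi*(|φ| * (δ*B))) ≤ 2 := by
        refine le_trans ?_ e1
        gcongr
        refine le_trans ?_ e2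
        rw [abs_mul]; gcongr
      have hpi := Real.pi_pos
      have e4 : I * (|φ| * (δ*B)) ≤ Real.pi := by
        have : I * (2/Real.pi*(|φ| * (δ*B))) = (I * (|φ| * (δ*B))) * 2 / Real.pi := by ring
        rw [this, div_le_iff₀ hpi] at e3
        linarith
      have e5 : I * (|φ| * (δ*B)) ≤ (9*(δ*B)) * (|φ| * (δ*B)) := e4.trans (h3.trans (le_of_eq (by ring)))
      exact le_of_mul_le_mul_right e5 (by positivity)
  calc _ ≤ _ := Finset.sum_le_sum key
    _ = ((Finset.Icc (-(B:ℤ)) B).filter (fun m : ℤ => |(m:ℝ)| ≤ δ*B)).card * (3*B) + (2*B+1)*(9*(δ*B)) := by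
        rw [Finset.sum_add_distrib, ← Finset.sum_filter, Finset.sum_const, Finset.sum_const, card_sym]
        simp
    _ ≤ (3*(δ*B)) * (3*B) + (3*B)*(9*(δ*B)) := by
        gcongr
        · have : (Finset.Icc (-(B:ℤ)) B).filter (fun m : ℤ => |(m:ℝ)| ≤ δ*B) ⊆
              Finset.Icc (-((⌊δ*B⌋₊:ℕ):ℤ)) (⌊δ*B⌋₊:ℕ) := by
            intro m hm
            have hm := (Finset.mem_filter.1 hm).2
            rw [Finset.mem_Icc]
            have : (m.natAbs : ℝ) ≤ δ*B := by rw [Nat.cast_natAbs]; push_cast; exact hm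
            have := Nat.le_floor this
            omega
          have h4 := Finset.card_le_card this
          rw [card_sym] at h4
          have h5 : (((Finset.Icc (-(B:ℤ)) B).filter (fun m : ℤ => |(m:ℝ)| ≤ δ*B)).card : ℝ) ≤ 2*⌊δ*B⌋₊+1 := by
            exact_mod_cast h4
          have := Nat.floor_le (a := δ*B) (by positivity)
          linarith
        · linarith
    _ = _ := by ring

structure ZS (q k s X M : ℕ) (t : ℝ) : Prop where
  hq : 1 ≤ q
  hk : k = 12*q
  hA : (10:ℝ)^(12*k) ≤ t
  h9 : t^9 ≤ (M:ℝ)^k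
  hM : 1 ≤ M
  hs : (s:ℝ)^8 ≤ (10:ℝ)^(12*k)
  hks : k ≤ s
  hX : 1 ≤ X
  hX1 : (X:ℝ)^2 ≤ M * t^(-(2/(k:ℝ)))
  hX2 : M * t^(-(2/(k:ℝ))) / 4 ≤ (X:ℝ)^2

namespace ZS
variable {q k s X M : ℕ} {t : ℝ}
lemma log10 : (2.25:ℝ) ≤ Real.log 10 := by
  have h1 : Real.log 10 = Real.log 2 + Real.log 5 := by
    rw [← Real.log_mul (by norm_num) (by norm_num)]; norm_num
  have h2 : 2 * Real.log 5 ≥ 4 * Real.log 2 + 0.44 := by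
    have : 2 * Real.log 5 = 4 * Real.log 2 + Real.log (25/16) := by
      have e1 : (2:ℝ) * Real.log 5 = Real.log (5^2) := by rw [Real.log_pow]; norm_num
      have e2 : (4:ℝ) * Real.log 2 = Real.log (2^4) := by rw [Real.log_pow]; norm_num
      rw [e1, e2, ← Real.log_mul (by norm_num) (by norm_num)]; norm_num
    have h3 : Real.log (25/16) = 2 * Real.log (5/4) := by
      have : (25/16:ℝ) = (5/4)^2 := by norm_num
      rw [this, Real.log_pow]; norm_num
    have h5 : (0.22:ℝ) ≤ Real.log (5/4) := by
      have := Real.le_log_iff_exp_le (x := (0.22:ℝ)) (y := 5/4) (by norm_num)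
      rw [this]
      have := Real.exp_bound' (x := 0.22) (by norm_num) (by norm_num) (n := 4) (by norm_num)
      refine this.trans ?_
      simp [Finset.sum_range_succ, Nat.factorial]; norm_num
    linarith
  have := Real.log_two_gt_d9
  linarith

lemma tpos (h : ZS q k s X M t) : 0 < t := lt_of_lt_of_le (by positivity) h.hA
lemma logA (h : ZS q k s X M t) : 27 * (k:ℝ) ≤ Real.log t := by
  have := Real.log_le_log (by positivity) h.hA
  rw [Real.log_pow] at this
  push_cast at this
  have h2 := log10
  have : (0:ℝ) ≤ k := by positivity
  nlinarith
lemma log9 (h : ZS q k s X M t) : 9 * Real.log t ≤ k * Real.log M := by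
  have := Real.log_le_log (pow_pos h.tpos _) h.h9
  rw [Real.log_pow, Real.log_pow] at this
  exact_mod_cast this
lemma logs (h : ZS q k s X M t) : 8 * Real.log s ≤ Real.log t := by
  have hk := h.hk; have hq := h.hq; have h4 := h.hks
  have : 0 < (s:ℝ) := by have : 0 < s := by omega
                         exact_mod_cast this
  have := Real.log_le_log (pow_pos this _) (h.hs.trans h.hA)
  rw [Real.log_pow] at this
  exact_mod_cast this
lemma kpos (h : ZS q k s X M t) : (12:ℝ) ≤ k := by
  have hk := h.hk; have hq := h.hq
  have : 12 ≤ k := by omega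
  exact_mod_cast this
lemma logV (h : ZS q k s X M t) : Real.log (M * t^(-(2/(k:ℝ)))) = Real.log M - 2/k*Real.log t := by
  have hM : (0:ℝ) < M := by exact_mod_cast h.hM
  rw [Real.log_mul hM.ne' (Real.rpow_pos_of_pos h.tpos _).ne', Real.log_rpow h.tpos]; ring
lemma logX1 (h : ZS q k s X M t) : 2 * Real.log X ≤ Real.log M - 2/k*Real.log t := by
  have hX : (0:ℝ) < X := by exact_mod_cast h.hX
  have := Real.log_le_log (by positivity) h.hX1
  rw [h.logV, Real.log_pow] at this; exact_mod_cast this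
lemma logX2 (h : ZS q k s X M t) : Real.log M - 2/k*Real.log t - 2*Real.log 2 ≤ 2 * Real.log X := by
  have hM : (0:ℝ) < M := by exact_mod_cast h.hM
  have hp := Real.rpow_pos_of_pos h.tpos (-(2/(k:ℝ)))
  have := Real.log_le_log (by positivity) h.hX2
  rw [Real.log_div (by positivity) (by norm_num), h.logV, Real.log_pow, show (4:ℝ) = 2^2 by norm_num,
    Real.log_pow] at this
  push_cast at this; linarith

lemma D_save (h : ZS q k s X M t) (c : ℕ) (hc1 : M ≤ c) (hc2 : c ≤ 32*M) (l : ℕ) (hl1 : 3*q ≤ l) (hl2 : l ≤ 4*q)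
    (φ : ℝ) (hφ : |φ| = t/(l*(c:ℝ)^l)) :
    Dl φ (s*X^l) ≤ 9 * ((s:ℝ)*X^l)^2 * t^(-(1/8:ℝ)) := by
  have ht := h.tpos
  have hM : (1:ℝ) ≤ M := by exact_mod_cast h.hM
  have hX : (1:ℝ) ≤ X := by exact_mod_cast h.hX
  have hkp := h.kpos
  have hc0 : (0:ℝ) < c := lt_of_lt_of_le (by linarith) (by exact_mod_cast hc1 : (M:ℝ) ≤ c)
  have hq1 := h.hq
  have hl0 : (3:ℝ) ≤ l := by have : 3 ≤ l := by omega
                             exact_mod_cast this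
  have hlk1 : (k:ℝ)/4 ≤ l := by
    have h1 : (k:ℝ) = 12*q := by exact_mod_cast h.hk
    have : (3:ℝ)*q ≤ l := by exact_mod_cast hl1
    rw [h1]; linarith
  have hlk2 : (l:ℝ) ≤ k/3 := by
    have h1 : (k:ℝ) = 12*q := by exact_mod_cast h.hk
    have : (l:ℝ) ≤ 4*q := by exact_mod_cast hl2
    rw [h1]; linarith only [this]
  have hs1 : (1:ℝ) ≤ s := by
    have h1 := h.hks; have h2 := h.hk
    have : 1 ≤ s := by omega
    exact_mod_cast this
  have hls : (l:ℝ) ≤ s := by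
    have : (k:ℝ) ≤ s := by exact_mod_cast h.hks
    linarith
  set Lt := Real.log t with hLt
  set LM := Real.log M with hLM
  set LX := Real.log X with hLX
  have e1 := h.logA
  have e2 := h.log9
  have e3 := h.logs
  have e4 := h.logX1
  have e5 := h.logX2
  simp only [← hLt, ← hLM, ← hLX] at e1 e2 e3 e4 e5
  have hl2a := Real.log_two_lt_d9
  have hl2b := Real.log_two_gt_d9
  have hLtk : 2/(k:ℝ)*Lt ≤ 2/9*LM := by
    rw [div_mul_eq_mul_div, div_le_iff₀ (by linarith only [hkp, hl2a, hl2b])]; linarith only [e2]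
  have hLt0 : 0 ≤ Lt := by nlinarith only [e1, hkp]
  have hLtk0 : 0 ≤ 2/(k:ℝ)*Lt := by positivity
  have hLX0 : 0 ≤ LX := Real.log_nonneg hX
  have hlogc : Real.log c ≤ LM + 5*Real.log 2 := by
    calc Real.log c ≤ Real.log (32*M) := Real.log_le_log hc0 (by exact_mod_cast hc2)
      _ = _ := by rw [Real.log_mul (by norm_num) (by linarith only [hM, hl2a, hl2b]), show (32:ℝ) = 2^5 by norm_num, Real.log_pow]
                  push_cast; ring
  have hlogc1 : LM ≤ Real.log c := Real.log_le_log (by linarith only [hM, hl2a, hl2b]) (by exact_mod_cast hc1)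
  have hXl : (0:ℝ) < (X:ℝ)^l := by positivity
  have hlogB : Real.log (s*X^l) = Real.log s + l*LX := by
    rw [Real.log_mul (by linarith only [hl0, hls, hl2a, hl2b]) hXl.ne', Real.log_pow]
  have hφ0 : 0 < |φ| := by rw [hφ]; positivity
  have hlogφ : Real.log |φ| = Lt - Real.log l - l * Real.log c := by
    rw [hφ, Real.log_div ht.ne' (by positivity), Real.log_mul (by linarith only [hl0, hl2a, hl2b]) (by positivity), Real.log_pow]; ring
  have hlogl : 0 ≤ Real.log l := Real.log_nonneg (by linarith only [hl0, hl2a, hl2b])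
  have hlogls : Real.log l ≤ Real.log s := Real.log_le_log (by linarith only [hl0, hl2a, hl2b]) hls
  have hlogs0 : 0 ≤ Real.log s := Real.log_nonneg hs1
  have hLM0 : 0 ≤ LM := Real.log_nonneg hM
  have hB1 : 1 ≤ s*X^l := by
    have : (1:ℝ) ≤ s*X^l := one_le_mul_of_one_le_of_one_le hs1 (one_le_pow₀ hX)
    exact_mod_cast this
  have hlogδ : Real.log (t^(-(1/8:ℝ))/4) = -(1/8)*Lt - 2*Real.log 2 := by
    rw [Real.log_div (by positivity) (by norm_num), Real.log_rpow ht, show (4:ℝ) = 2^2 by norm_num, Real.log_pow]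
    push_cast; ring
  have hδ : 0 < t^(-(1/8:ℝ))/4 := by positivity
  have := Dl_bound φ (t^(-(1/8:ℝ))/4) (s*X^l) hB1 (by intro h; simp [h] at hφ0) ?_ hδ ?_ ?_
  · refine this.trans (le_of_eq ?_)
    push_cast; ring
  · refine le_trans ?_ (by linarith only [hl2a, hl2b, Real.pi_gt_three] : (1:ℝ) ≤ Real.pi)
    push_cast
    rw [← Real.log_nonpos_iff (by positivity), Real.log_mul (by positivity) (by positivity), hlogB, hlogφ]
    have a1 : l * LM ≤ l * Real.log c := by gcongr
    have a2 : l * (2*LX) ≤ l * LM := by gcongr; linarith only [e4, hLtk0]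
    have a3 : k/4 * LM ≤ l*LM := by gcongr
    linarith only [e2, e3, hlogl, a1, a2, a3]
  · push_cast
    rw [← Real.log_nonneg_iff (by positivity), Real.log_mul (by positivity) (by positivity), hlogB, hlogδ]
    have a1 : k/4*LX ≤ l*LX := by gcongr
    have a2 : (k:ℝ)*(7/9*LM - 2*Real.log 2) ≤ k*(2*LX) := by gcongr; linarith only [e5, hLtk]
    have a3 : (k:ℝ) * Real.log 2 ≤ k*0.7 := by gcongr; linarith only [hl2a, hl2b]
    nlinarith only [a1, a2, a3, e1, e2, hkp, hlogs0, hl2a]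
  · push_cast
    refine le_trans (by linarith only [hl2a, hl2b, Real.pi_lt_d2] : Real.pi ≤ 9) ?_
    have : 1 ≤ |φ| * (t^(-(1/8:ℝ))/4)^2 * (s*X^l)^2 := by
      rw [← Real.log_nonneg_iff (by positivity), Real.log_mul (by positivity) (by positivity),
        Real.log_mul (by positivity) (by positivity), Real.log_pow, Real.log_pow, hlogB, hlogφ, hlogδ]
      have a1 : l * Real.log c ≤ l * (LM + 5*Real.log 2) := by gcongr
      have a2 : l * (LM - 2/k*Lt - 2*Real.log 2) ≤ l*(2*LX) := by gcongr
      have a3 : l * (2/k*Lt + 7*Real.log 2) ≤ k/3 * (2/k*Lt + 7*Real.log 2) := by gcongr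
      have a4 : (k:ℝ)/3 * (2/k*Lt + 7*Real.log 2) = 2/3*Lt + 7/3*(k*Real.log 2) := by field_simp
      have a5 : (k:ℝ) * Real.log 2 ≤ k*0.7 := by gcongr; linarith only [hl2a, hl2b]
      push_cast
      nlinarith only [a1, a2, a3, a4, a5, e1, hlogs0, hlogls, hkp, hl2a]
    linarith only [this]
end ZS

namespace ZS
variable {q k s X M : ℕ} {t : ℝ}

noncomputable def th (t : ℝ) (c l : ℕ) : ℝ := t * (-1)^(l+1) / ((l+1:ℕ) * (c:ℝ)^(l+1))

lemma prod_D (h : ZS q k s X M t) (c : ℕ) (hc1 : M ≤ c) (hc2 : c ≤ 32*M) :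
    ∏ l : Fin k, Dl (th t c l) (s*X^(l.1+1)) ≤ (9*(s:ℝ)^2)^k * (X:ℝ)^(k*(k+1)) * (t^(-(1/8:ℝ)))^q := by
  have ht := h.tpos
  have hX := h.hX
  have hs : 1 ≤ s := by have := h.hks; have := h.hk; have := h.hq; omega
  calc _ ≤ ∏ l : Fin k, ((9*(s:ℝ)^2) * (X^2:ℝ)^(l.1+1) * (if l.1 ∈ Finset.Ico (3*q) (4*q) then t^(-(1/8:ℝ)) else 1)) := by
        apply Finset.prod_le_prod
        · intro l _; exact Dl_nonneg _ _
        · intro l _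
          split_ifs with hl
          · rw [Finset.mem_Ico] at hl
            refine (h.D_save c hc1 hc2 (l.1+1) (by omega) (by omega) _ ?_).trans (le_of_eq ?_)
            · unfold th
              rw [abs_div, abs_mul, abs_pow, abs_neg, abs_one, one_pow, mul_one, abs_of_pos ht, abs_of_nonneg (by positivity)]
            · ring
          · have : 1 ≤ s*X^(l.1+1) := Nat.mul_pos hs (pow_pos hX _)
            refine (Dl_triv _ _ this).trans (le_of_eq ?_)
            push_cast; ring
    _ = _ := by
        rw [Finset.prod_mul_distrib, Finset.prod_mul_distrib, Finset.prod_const, Finset.card_univ, Fintype.card_fin]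
        congr 1
        · congr 1
          rw [Finset.prod_pow_eq_pow_sum, Fin.sum_univ_eq_sum_range (fun i => i+1), ← pow_mul]
          congr 1
          have := Finset.sum_range_id_mul_two (k+1)
          rw [Finset.sum_range_succ'] at this
          simp only [add_zero, Nat.add_sub_cancel] at this
          linarith only [this]
        · rw [Fin.prod_univ_eq_prod_range (fun i => if i ∈ Finset.Ico (3*q) (4*q) then t^(-(1/8:ℝ)) else 1) k,
            ← Finset.prod_filter, Finset.prod_const]
          congr 1
          have : (Finset.range k).filter (fun i => i ∈ Finset.Ico (3*q) (4*q)) = Finset.Ico (3*q) (4*q) := by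
            ext i; simp only [Finset.mem_filter, Finset.mem_range, Finset.mem_Ico]
            have := h.hk; omega
          rw [this, Nat.card_Ico]; omega

lemma U_bound (h : ZS q k s X M t) (n : ℕ) (hn : k ≤ n) (hsn : s = k*(n+1)) (hMt : M ≤ t)
    (hη : (k:ℝ)*(k+1)/2*(1-1/(k:ℝ))^n ≤ k/200) (c : ℕ) (hc1 : M ≤ c) (hc2 : c ≤ 32*M) :
    ‖∑ a : Fin X, ∑ b : Fin X, ee (∑ l : Fin k, th t c l * ((a:ℕ):ℝ)^(l.1+1) * ((b:ℕ):ℝ)^(l.1+1))‖ ≤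
      (X:ℝ)^2 * (Real.exp 4 * t^(-(k/(800*(s:ℝ)^2)))) := by
  have ht := h.tpos
  have hX : (1:ℝ) ≤ X := by exact_mod_cast h.hX
  have hkp := h.kpos
  have hks : (k:ℝ) ≤ s := by exact_mod_cast h.hks
  have hs0 : (12:ℝ) ≤ s := by linarith
  have hs1 : 1 ≤ s := by have := h.hks; have := h.hk; have := h.hq; omega
  set W := ‖∑ a : Fin X, ∑ b : Fin X, ee (∑ l : Fin k, th t c l * ((a:ℕ):ℝ)^(l.1+1) * ((b:ℕ):ℝ)^(l.1+1))‖ with hW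
  rcases (show 0 ≤ W from norm_nonneg _).eq_or_lt with h0 | h0
  · rw [← h0]; positivity
  have hb := bilin k X s hs1 (fun l => th t c l)
  rw [← hW] at hb
  have hD := h.prod_D c hc1 hc2
  have hJ := J_bound k (by have := h.hk; have := h.hq; omega) n X h.hX
  rw [← hsn] at hJ
  set η : ℝ := (k:ℝ)*(k+1)/2*(1-1/(k:ℝ))^n with hηd
  set E : ℕ := 8*k^3+2*k^2*n+k*n^2 with hE
  have hX0 : (0:ℝ) < X := by linarith only [hX]
  have h1 : W^(4*s^2) ≤ (X:ℝ)^(8*s^2-4*s) * ((50*k:ℝ)^E * (X:ℝ)^(2*((k:ℝ)*(n+1)) - k*(k+1)/2 + η))^2 *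
      ((9*(s:ℝ)^2)^k * (X:ℝ)^(k*(k+1)) * (t^(-(1/8:ℝ)))^q) := by
    refine hb.trans ?_
    gcongr
    exact Finset.prod_nonneg (fun l _ => Dl_nonneg _ _)
  have h2 := Real.log_le_log (by positivity) h1
  have hkq : (k:ℝ) = 12*q := by exact_mod_cast h.hk
  have hsub : ((8*s^2-4*s:ℕ):ℝ) = 8*(s:ℝ)^2-4*s := by
    rw [Nat.cast_sub (by nlinarith only [hs1])]; push_cast; ring
  have hsn' : (s:ℝ) = k*(n+1) := by exact_mod_cast hsn
  rw [Real.log_pow, Real.log_mul (by positivity) (by positivity), Real.log_mul (by positivity) (by positivity),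
    Real.log_mul (by positivity) (by positivity), Real.log_mul (by positivity) (by positivity),
    Real.log_pow, Real.log_pow, Real.log_mul (by positivity) (by positivity), Real.log_rpow hX0, Real.log_pow, Real.log_pow, Real.log_pow,
    Real.log_pow, Real.log_rpow ht, hsub] at h2
  have hLX : 2*Real.log X ≤ Real.log t := by
    have a1 := h.logX1
    have a2 : Real.log M ≤ Real.log t := Real.log_le_log (by exact_mod_cast h.hM) hMt
    have a3 : 0 ≤ 2/(k:ℝ)*Real.log t := by
      have := h.logA
      have : 0 ≤ Real.log t := by linarith only [hkp, this]
      positivity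
    linarith only [a1, a2, a3]
  have hη0 : 0 ≤ η := by
    have : 0 ≤ 1-1/(k:ℝ) := by
      have : 1/(k:ℝ) ≤ 1 := by rw [div_le_one (by linarith only [hkp])]; linarith only [hkp]
      linarith only [this]
    positivity
  have hLt0 : 0 ≤ Real.log t := by have := h.logA; linarith only [hkp, this]
  have hηX : 2*(η * Real.log X) ≤ k/200*Real.log t := by
    calc 2*(η * Real.log X) = η*(2*Real.log X) := by ring
      _ ≤ k/200*Real.log t := by gcongr
  have hn' : (k:ℝ) ≤ n := by exact_mod_cast hn
  have hEb : (E:ℝ) * Real.log (50*k) ≤ 6.5*(s:ℝ)^2 := by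
    have b1 : Real.log (50*k) ≤ 0.58*k := by
      have c1 : Real.log (50*k) = Real.log 600 + Real.log (k/12) := by
        rw [← Real.log_mul (by norm_num) (by positivity)]; congr 1; ring
      have c2 := Real.log_le_sub_one_of_pos (x := (k:ℝ)/12) (by positivity)
      have c3 : Real.log 600 ≤ 10*Real.log 2 := by
        calc Real.log 600 ≤ Real.log (2^10) := Real.log_le_log (by norm_num) (by norm_num)
          _ = _ := by rw [Real.log_pow]; norm_num
      have := Real.log_two_lt_d9
      rw [c1]; linarith only [c2, c3, this, hkp]
    have b2 : (E:ℝ) ≤ 11*(k*(n:ℝ)^2) := by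
      rw [hE]; push_cast
      have : (k:ℝ)^2 ≤ n^2 := by gcongr
      have hk0 : (0:ℝ) ≤ k := by positivity
      have a1 := mul_le_mul_of_nonneg_left this hk0
      have a2 := mul_le_mul_of_nonneg_left hn' (mul_nonneg hk0 (hk0.trans hn'))
      linarith only [a1, a2]
    have b3 : (k:ℝ)*n ≤ s := by rw [hsn']; nlinarith only [hkp]
    have b4 : ((k:ℝ)*n)^2 ≤ (s:ℝ)^2 := by gcongr
    calc (E:ℝ) * Real.log (50*k) ≤ 11*(k*(n:ℝ)^2) * (0.58*k) := by
          have := Real.log_nonneg (x := 50*(k:ℝ)) (by linarith only [hkp])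
          gcongr
      _ = 6.38*((k:ℝ)*n)^2 := by ring
      _ ≤ _ := by linarith only [hkp, hks, hsub, b4, sq_nonneg (s:ℝ)]
  have h9s : (k:ℝ) * Real.log (9*(s:ℝ)^2) ≤ 0.5*(s:ℝ)^2 := by
    have b1 : Real.log (9*(s:ℝ)^2) ≤ 6*s := by
      rw [show 9*(s:ℝ)^2 = (3*s)^2 by ring, Real.log_pow]
      have := Real.log_le_sub_one_of_pos (x := 3*(s:ℝ)) (by positivity)
      push_cast; linarith only [this]
    have b2 : (13:ℝ)*k ≤ s := by rw [hsn']; nlinarith only [hn', hkp]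
    calc (k:ℝ) * Real.log (9*(s:ℝ)^2) ≤ (s/13) * (6*s) := by
          have := Real.log_nonneg (x := 9*(s:ℝ)^2) (by nlinarith only [hs0])
          gcongr; linarith only [b2]
      _ ≤ _ := by nlinarith only [hs0]
  have h3 : 4*(s:ℝ)^2 * (Real.log W - 2*Real.log X) ≤ 16*(s:ℝ)^2 - k/200*Real.log t := by
    rw [← hsn'] at h2
    push_cast at h2
    have hq' : (q:ℝ) = k/12 := by linarith only [hkq]
    rw [hq'] at h2
    have : (k:ℝ)/96*Real.log t - k/200*Real.log t ≥ k/200*Real.log t := by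
      have : 0 ≤ (k:ℝ)*Real.log t := by positivity
      linarith only [this]
    nlinarith only [h2, hEb, h9s, hηX, this, sq_nonneg (s:ℝ)]
  have h4 : Real.log W ≤ 2*Real.log X + 4 + -(k/(800*(s:ℝ)^2))*Real.log t := by
    have hs2 : 0 < 4*(s:ℝ)^2 := by positivity
    rw [← le_div_iff₀' hs2] at h3
    have : (16*(s:ℝ)^2 - k/200*Real.log t)/(4*(s:ℝ)^2) = 4 + -(k/(800*(s:ℝ)^2))*Real.log t := by
      field_simp; ring
    rw [this] at h3
    linarith only [h3]
  rw [← Real.log_le_log_iff h0 (by positivity), Real.log_mul (by positivity) (by positivity),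
    Real.log_mul (by positivity) (by positivity), Real.log_exp, Real.log_rpow ht, Real.log_pow]
  push_cast
  linarith only [h4]
end ZS

lemma shift_sum (f : ℕ → ℂ) (hf : ∀ n, ‖f n‖ ≤ 1) (A B d : ℕ) :
    ‖∑ c ∈ Finset.Ico A B, f c - ∑ c ∈ Finset.Ico A B, f (c+d)‖ ≤ 2*d := by
  induction d with
  | zero => simp
  | succ d ih =>
    rcases le_or_gt B A with h | h
    · rw [Finset.Ico_eq_empty (by omega)]; simp; positivity
    have h1 : ∑ c ∈ Finset.Ico A B, f (c+d) - ∑ c ∈ Finset.Ico A B, f (c+(d+1)) = f (A+d) - f (B+d) := by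
      rw [← Finset.sum_sub_distrib]
      have := Finset.sum_Ico_sub (fun c => f (c+d)) h.le
      rw [← neg_inj, ← Finset.sum_neg_distrib, neg_sub, ← this]
      apply Finset.sum_congr rfl; intro c _
      rw [neg_sub, show c+(d+1) = c+1+d by ring]
    calc _ = ‖(∑ c ∈ Finset.Ico A B, f c - ∑ c ∈ Finset.Ico A B, f (c+d)) +
          (∑ c ∈ Finset.Ico A B, f (c+d) - ∑ c ∈ Finset.Ico A B, f (c+(d+1)))‖ := by congr 1; ring
      _ ≤ 2*d + (1 + 1) := by
          refine (norm_add_le _ _).trans (add_le_add ih ?_)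
          rw [h1]; exact (norm_sub_le _ _).trans (add_le_add (hf _) (hf _))
      _ = _ := by push_cast; ring

lemma taylor_ee (t : ℝ) (ht : 0 < t) (c d k : ℕ) (hc : 0 < c) (z : ℝ) (hz : (d:ℝ)/c ≤ z) (hz2 : z ≤ 1/2) :
    |(-(t * Real.log ((c+d:ℕ):ℝ))) - (-(t * Real.log c) + ∑ l : Fin k, ZS.th t c l * (d:ℝ)^(l.1+1))| ≤ 2*t*z^(k+1) := by
  have hc' : (0:ℝ) < c := by exact_mod_cast hc
  have h0 : 0 ≤ (d:ℝ)/c := by positivity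
  have habs : |(-((d:ℝ)/c))| = (d:ℝ)/c := by rw [abs_neg, abs_of_nonneg h0]
  have h1 := Real.abs_log_sub_add_sum_range_le (x := -((d:ℝ)/c)) (by rw [habs]; linarith) k
  rw [habs, sub_neg_eq_add] at h1
  have h2 : Real.log ((c+d:ℕ):ℝ) = Real.log c + Real.log (1+d/c) := by
    rw [← Real.log_mul hc'.ne' (by positivity)]; congr 1; push_cast; field_simp
  have h3 : ∑ l : Fin k, ZS.th t c l * (d:ℝ)^(l.1+1) = t * ∑ i ∈ Finset.range k, (-((d:ℝ)/c))^(i+1)/(i+1) := by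
    rw [Finset.mul_sum, ← Fin.sum_univ_eq_sum_range (fun i => t * ((-((d:ℝ)/c))^(i+1)/(i+1)))]
    apply Finset.sum_congr rfl; intro l _
    rw [neg_pow, div_pow]; unfold ZS.th; push_cast; field_simp
  rw [h2, h3]
  rw [show -(t * (Real.log c + Real.log (1+d/c))) - (-(t * Real.log c) + t * ∑ i ∈ Finset.range k, (-((d:ℝ)/c))^(i+1)/(i+1))
    = -(t * (∑ i ∈ Finset.range k, (-((d:ℝ)/c))^(i+1)/(i+1) + Real.log (1+d/c))) by ring, abs_neg, abs_mul, abs_of_pos ht]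
  calc _ ≤ t * ((d/c)^(k+1)/(1-d/c)) := by gcongr
    _ ≤ t * (z^(k+1)/(1/2)) := by
        have : (1:ℝ)/2 ≤ 1-d/c := by linarith
        have : 0 ≤ z := h0.trans hz
        gcongr
    _ = _ := by ring

lemma zeta_sum (q m k : ℕ) (hq : 1 ≤ q) (hk : k = 12*q) (t : ℝ) (hA : (10:ℝ)^(12*k) ≤ t) (M M' : ℕ)
    (h9 : t^9 ≤ (M:ℝ)^k) (hMt : (M:ℝ) ≤ t) (hM' : M' ≤ 32*M) (hm1 : 1 ≤ m) (hmk : m ≤ k) (hm : 100*(k+1) ≤ 2^m) :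
    ‖∑ c ∈ Finset.Ico M M', ee (-(t * Real.log c))‖ ≤ 2000 * M * t^(-(1/(3200*(k:ℝ)^3*(m:ℝ)^2))) := by
  have hk12 : (12:ℝ) ≤ k := by have : 12 ≤ k := by omega
                               exact_mod_cast this
  have ht1 : 1 ≤ t := le_trans (one_le_pow₀ (by norm_num)) hA
  have ht : 0 < t := by linarith
  have hM1 : 1 ≤ M := by
    rcases Nat.eq_zero_or_pos M with h | h
    · rw [h, Nat.cast_zero, zero_pow (by omega)] at h9
      have : 0 < t^9 := by positivity
      linarith
    · exact h
  have hM0 : (0:ℝ) < M := by exact_mod_cast hM1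
  set n := k*m with hn
  set s := k*(n+1) with hs
  have hm0 : (1:ℝ) ≤ m := by exact_mod_cast hm1
  have hs2 : (s:ℝ) ≤ 2*k^2*m := by
    rw [hs, hn]; push_cast; nlinarith only [hk12, hm0, mul_le_mul hk12 hm0 (by norm_num) (by linarith)]
  have hmk' : (m:ℝ) ≤ k := by exact_mod_cast hmk
  set z : ℝ := t^(-(2/(k:ℝ))) with hz
  have hz0 : 0 < z := by positivity
  have hzk : z^k = t^(-(2:ℝ)) := by
    rw [hz, ← Real.rpow_natCast, ← Real.rpow_mul ht.le]; congr 1; field_simp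
  set V : ℝ := M*z with hV
  have hV1 : 1 ≤ V := by
    have : 1 ≤ V^k := by
      rw [hV, mul_pow, hzk]
      calc (1:ℝ) ≤ t^(7:ℝ) := Real.one_le_rpow ht1 (by norm_num)
        _ = t^9 * t^(-(2:ℝ)) := by rw [← Real.rpow_natCast t 9, ← Real.rpow_add ht]; norm_num
        _ ≤ _ := by gcongr
    by_contra h
    have := pow_lt_one₀ (by positivity) (not_le.1 h) (show k ≠ 0 by omega)
    linarith
  set X := ⌊Real.sqrt V⌋₊ with hX
  have hsq1 : 1 ≤ Real.sqrt V := Real.one_le_sqrt.2 hV1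
  have hXle : (X:ℝ) ≤ Real.sqrt V := Nat.floor_le (by positivity)
  have hX1 : 1 ≤ X := Nat.le_floor (by simpa using hsq1)
  have hX1' : (1:ℝ) ≤ X := by exact_mod_cast hX1
  have hXlt : Real.sqrt V < X+1 := Nat.lt_floor_add_one _
  have hsqV : Real.sqrt V^2 = V := Real.sq_sqrt (by linarith)
  have hXV : (X:ℝ)^2 ≤ V := by rw [← hsqV]; gcongr
  have hXV2 : V/4 ≤ (X:ℝ)^2 := by nlinarith only [hsqV, hXlt, hX1', hsq1]
  have hsk : k ≤ s := by rw [hs]; exact Nat.le_mul_of_pos_right _ (by omega)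
  have Z : ZS q k s X M t := by
    refine ⟨hq, hk, hA, h9, hM1, ?_, hsk, hX1, hXV, hXV2⟩
    have h1 : (s:ℝ) ≤ 2*(k:ℝ)^3 := hs2.trans (by nlinarith only [hmk', hk12, sq_nonneg (k:ℝ), mul_le_mul_of_nonneg_left hmk' (sq_nonneg (k:ℝ))])
    have h2 : (k:ℝ) ≤ 2^k := by exact_mod_cast Nat.lt_two_pow_self.le
    have h2' : (2:ℝ) ≤ 2^k := by linarith only [hk12, h2]
    calc (s:ℝ)^8 ≤ (2^k*(2^k)^3)^8 := by gcongr; exact h1.trans (by gcongr)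
      _ = (2^32)^k := by rw [← pow_mul 2 32 k]; ring
      _ ≤ (10^12)^k := by gcongr; norm_num
      _ = _ := by rw [pow_mul]
  set η := t^(-(k/(800*(s:ℝ)^2))) with hη
  have hη0 : 0 < η := by positivity
  have hs0 : (12:ℝ) ≤ s := hk12.trans (by exact_mod_cast hsk)
  have hsk' : (k:ℝ) ≤ s := by exact_mod_cast hsk
  have hzη : z ≤ η := by
    apply Real.rpow_le_rpow_of_exponent_le ht1
    rw [neg_le_neg_iff, div_le_div_iff₀ (by positivity) (by positivity)]
    nlinarith only [hsk', hk12]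
  have htη : t⁻¹ ≤ η := by
    rw [← Real.rpow_neg_one]
    apply Real.rpow_le_rpow_of_exponent_le ht1
    rw [neg_le_neg_iff, div_le_one (by positivity)]
    nlinarith only [hsk', hk12]
  have hηf : η ≤ t^(-(1/(3200*(k:ℝ)^3*(m:ℝ)^2))) := by
    apply Real.rpow_le_rpow_of_exponent_le ht1
    rw [neg_le_neg_iff, div_le_div_iff₀ (by positivity) (by positivity)]
    have : (s:ℝ)^2 ≤ (2*k^2*m)^2 := by gcongr
    nlinarith only [this]
  have hz2 : z ≤ 1/2 := by
    have : t^(-(2/(k:ℝ))) ≤ ((2:ℝ)^k)^(-(1/(k:ℝ))) := by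
      calc t^(-(2/(k:ℝ))) ≤ t^(-(1/(k:ℝ))) := by
            apply Real.rpow_le_rpow_of_exponent_le ht1
            rw [neg_le_neg_iff]; gcongr; norm_num
        _ ≤ _ := by
            apply Real.rpow_le_rpow_of_nonpos (by positivity)
            · refine le_trans ?_ hA
              rw [pow_mul]; gcongr; norm_num
            · rw [neg_nonpos]; positivity
    rw [← Real.rpow_natCast, ← Real.rpow_mul (by norm_num), show (k:ℝ)*(-(1/(k:ℝ))) = -1 by field_simp, Real.rpow_neg_one] at this
    rw [hz]; linarith only [this]
  have hUb : ∀ c ∈ Finset.Ico M M', ‖∑ a : Fin X, ∑ b : Fin X, ee (-(t * Real.log ((c + a*b:ℕ):ℝ)))‖ ≤ X^2*(55*η) + X^2*(2*η) := by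
    intro c hc
    rw [Finset.mem_Ico] at hc
    have hc1 := hc.1
    have hU := Z.U_bound n (Nat.le_mul_of_pos_right _ hm1) rfl hMt ?_ c hc.1 (by omega)
    · have he : Real.exp 4 ≤ 55 := by
        have := Real.exp_one_lt_d9
        calc Real.exp 4 = Real.exp 1^4 := by rw [← Real.exp_nat_mul]; norm_num
          _ ≤ 2.7182818286^4 := by gcongr
          _ ≤ 55 := by norm_num
      have e1 : ∑ a : Fin X, ∑ b : Fin X, ee (-(t * Real.log c)) * ee (∑ l : Fin k, ZS.th t c l * ((a:ℕ):ℝ)^(l.1+1) * ((b:ℕ):ℝ)^(l.1+1))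
          = ee (-(t * Real.log c)) * ∑ a : Fin X, ∑ b : Fin X, ee (∑ l : Fin k, ZS.th t c l * ((a:ℕ):ℝ)^(l.1+1) * ((b:ℕ):ℝ)^(l.1+1)) := by
        simp only [Finset.mul_sum]
      have e2 : ‖∑ a : Fin X, ∑ b : Fin X, ee (-(t * Real.log ((c + a*b:ℕ):ℝ))) - ∑ a : Fin X, ∑ b : Fin X, ee (-(t * Real.log c)) * ee (∑ l : Fin k, ZS.th t c l * ((a:ℕ):ℝ)^(l.1+1) * ((b:ℕ):ℝ)^(l.1+1))‖
          ≤ X^2*(2*η) := by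
        simp only [← Finset.sum_sub_distrib]
        have : ∀ a b : Fin X, ‖ee (-(t * Real.log ((c + a*b:ℕ):ℝ))) - ee (-(t * Real.log c)) * ee (∑ l : Fin k, ZS.th t c l * ((a:ℕ):ℝ)^(l.1+1) * ((b:ℕ):ℝ)^(l.1+1))‖ ≤ 2*η := by
          intro a b
          rw [← ee_add]
          refine (ee_sub _ _).trans ?_
          have := taylor_ee t ht c (a*b) k (by omega) z ?_ hz2
          · simp only [Nat.cast_mul, mul_pow, ← mul_assoc] at this ⊢
            refine this.trans ?_
            rw [pow_succ, hzk]
            calc 2*t*(t^(-(2:ℝ))*z) ≤ 2*t*(t^(-(2:ℝ))*1) := by gcongr; linarith only [hz0, hz2]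
              _ = 2*t⁻¹ := by rw [mul_one, Real.rpow_neg ht.le, Real.rpow_two]; field_simp
              _ ≤ _ := by gcongr
          · have hc0 : (M:ℝ) ≤ c := by exact_mod_cast hc.1
            rw [div_le_iff₀ (by linarith only [hM0, hc0])]
            have ha : ((a:ℕ):ℝ) ≤ X := by exact_mod_cast a.2.le
            have hb : ((b:ℕ):ℝ) ≤ X := by exact_mod_cast b.2.le
            calc ((a*b:ℕ):ℝ) ≤ X^2 := by push_cast; rw [sq]; gcongr
              _ ≤ M*z := hXV
              _ ≤ z*c := by rw [mul_comm]; gcongr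
        calc _ ≤ ∑ a : Fin X, ∑ b : Fin X, 2*η := (norm_sum_le _ _).trans (Finset.sum_le_sum fun a _ => (norm_sum_le _ _).trans (Finset.sum_le_sum fun b _ => this a b))
          _ = _ := by simp; ring
      rw [e1] at e2
      have e3 := norm_sub_norm_le (∑ a : Fin X, ∑ b : Fin X, ee (-(t * Real.log ((c + a*b:ℕ):ℝ)))) (ee (-(t * Real.log c)) * ∑ a : Fin X, ∑ b : Fin X, ee (∑ l : Fin k, ZS.th t c l * ((a:ℕ):ℝ)^(l.1+1) * ((b:ℕ):ℝ)^(l.1+1)))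
      rw [norm_mul, ee_norm, one_mul] at e3
      have : (X:ℝ)^2*(Real.exp 4*η) ≤ X^2*(55*η) := by gcongr
      linarith only [hU, e2, e3, this]
    · have h1 : (1-1/(k:ℝ))^k ≤ 1/2 := by
        have a1 := Real.one_sub_le_exp_neg (1/(k:ℝ))
        have a0 : 0 ≤ 1-1/(k:ℝ) := by rw [sub_nonneg, div_le_one (by linarith only [hk12, hz0, hz2])]; linarith only [hk12, hz0, hz2]
        calc _ ≤ (Real.exp (-(1/(k:ℝ))))^k := by gcongr
          _ = Real.exp (-1) := by rw [← Real.exp_nat_mul]; congr 1; field_simp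
          _ ≤ 1/2 := by
            rw [Real.exp_neg, inv_le_comm₀ (Real.exp_pos _) (by norm_num)]
            have := Real.add_one_le_exp (1:ℝ); norm_num; linarith only [this]
      have a0 : 0 ≤ 1-1/(k:ℝ) := by rw [sub_nonneg, div_le_one (by linarith only [hk12, hz0, hz2])]; linarith only [hk12, hz0, hz2]
      have h2 : (1-1/(k:ℝ))^n ≤ 1/(100*(k+1)) := by
        rw [hn, pow_mul]
        calc _ ≤ (1/2:ℝ)^m := by gcongr
          _ = 1/2^m := by rw [div_pow, one_pow]
          _ ≤ _ := by gcongr; exact_mod_cast hm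
      calc _ ≤ (k:ℝ)*(k+1)/2*(1/(100*(k+1))) := by gcongr
        _ = k/200 := by field_simp; norm_num
  set S := ∑ c ∈ Finset.Ico M M', ee (-(t * Real.log c)) with hS
  have hav : ‖(X:ℂ)^2 * S - ∑ c ∈ Finset.Ico M M', ∑ a : Fin X, ∑ b : Fin X, ee (-(t * Real.log ((c + a*b:ℕ):ℝ)))‖ ≤ X^2*(2*X^2) := by
    have e : (X:ℂ)^2 * S - ∑ c ∈ Finset.Ico M M', ∑ a : Fin X, ∑ b : Fin X, ee (-(t * Real.log ((c + a*b:ℕ):ℝ)))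
      = ∑ a : Fin X, ∑ b : Fin X, (S - ∑ c ∈ Finset.Ico M M', ee (-(t * Real.log ((c + a*b:ℕ):ℝ)))) := by
      simp only [Finset.sum_sub_distrib]
      congr 1
      · simp; ring
      · rw [Finset.sum_comm]; apply Finset.sum_congr rfl; intro a _; rw [Finset.sum_comm]
    rw [e]
    calc _ ≤ ∑ a : Fin X, ∑ b : Fin X, 2*(X:ℝ)^2 := by
          refine (norm_sum_le _ _).trans (Finset.sum_le_sum fun a _ => (norm_sum_le _ _).trans (Finset.sum_le_sum fun b _ => ?_))
          refine (shift_sum (fun c => ee (-(t * Real.log c))) (fun n => (ee_norm _).le) M M' (a*b)).trans ?_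
          have ha : ((a:ℕ):ℝ) ≤ X := by exact_mod_cast a.2.le
          have hb : ((b:ℕ):ℝ) ≤ X := by exact_mod_cast b.2.le
          push_cast; rw [sq]; gcongr
      _ = _ := by simp; ring
  have hsum : ‖∑ c ∈ Finset.Ico M M', ∑ a : Fin X, ∑ b : Fin X, ee (-(t * Real.log ((c + a*b:ℕ):ℝ)))‖ ≤ 32*M*(X^2*(57*η)) := by
    calc _ ≤ ∑ c ∈ Finset.Ico M M', (X:ℝ)^2*(57*η) := (norm_sum_le _ _).trans (Finset.sum_le_sum fun c hc => (hUb c hc).trans (by linarith only []))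
      _ = ((M'-M:ℕ):ℝ)*(X^2*(57*η)) := by simp
      _ ≤ _ := by gcongr; exact_mod_cast (show M'-M ≤ 32*M by omega)
  have hfin : (X:ℝ)^2*‖S‖ ≤ X^2*(2*X^2 + 32*M*(57*η)) := by
    have : (X:ℝ)^2*‖S‖ = ‖(X:ℂ)^2*S‖ := by simp
    rw [this]
    have := norm_sub_norm_le ((X:ℂ)^2*S) (∑ c ∈ Finset.Ico M M', ∑ a : Fin X, ∑ b : Fin X, ee (-(t * Real.log ((c + a*b:ℕ):ℝ))))
    linarith only [hav, hsum, this]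
  have hfin2 := le_of_mul_le_mul_left hfin (by positivity)
  calc ‖S‖ ≤ 2*X^2 + 32*M*(57*η) := hfin2
    _ ≤ 2*(M*η) + 32*M*(57*η) := by gcongr; exact hXV.trans (mul_le_mul_of_nonneg_left hzη hM0.le)
    _ ≤ 2000*M*η := by nlinarith only [mul_pos hM0 hη0]
    _ ≤ _ := by gcongr

lemma KL (f g : ℕ → ℝ) (A : ℕ) (hg : ∀ n, g n = f (n+1) - f n) (k : ℕ)
    (h0 : ∀ n, A ≤ n → n ≤ A+k → 0 < g n ∧ g n ≤ 1) (ha : ∀ n, A ≤ n → n < A+k → g (n+1) ≤ g n) :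
    ‖∑ n ∈ Finset.Ico A (A+k+1), ee (f n)‖ ≤ 6 / g (A+k) := by
  set c : ℕ → ℂ := fun n => (ee (g n) - 1)⁻¹ with hc
  have hlb : ∀ n, A ≤ n → n ≤ A+k → g n / 2 ≤ ‖ee (g n) - 1‖ := by
    intro n h1 h2
    obtain ⟨h3, h4⟩ := h0 n h1 h2
    have := ee_sub_one_lb (x := g n) (by rw [abs_of_pos h3]; linarith [Real.pi_gt_three])
    rw [abs_of_pos h3] at this
    refine le_trans ?_ this
    have : 1/2 ≤ 2/Real.pi := by rw [div_le_div_iff₀ (by norm_num) Real.pi_pos]; linarith [Real.pi_lt_four]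
    nlinarith only [h3, this]
  have hne : ∀ n, A ≤ n → n ≤ A+k → ee (g n) - 1 ≠ 0 := by
    intro n h1 h2 h; have := hlb n h1 h2; rw [h, norm_zero] at this; linarith [(h0 n h1 h2).1]
  have hcb : ∀ n, A ≤ n → n ≤ A+k → ‖c n‖ ≤ 2 / g n := by
    intro n h1 h2
    have h3 := (h0 n h1 h2).1
    rw [hc]; simp only [norm_inv]
    rw [inv_le_comm₀ (lt_of_lt_of_le (by linarith) (hlb n h1 h2)) (by positivity), inv_div]; exact hlb n h1 h2
  have hE : ∀ n, A ≤ n → n ≤ A+k → ee (f n) = c n * ee (f (n+1)) - c n * ee (f n) := by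
    intro n h1 h2
    have : ee (f (n+1)) = ee (f n) * ee (g n) := by rw [← ee_add, hg]; congr 1; ring
    rw [this, hc]; field_simp [hne n h1 h2]
  have key : ∀ j, j ≤ k → ‖∑ n ∈ Finset.Ico A (A+j+1), ee (f n) - c (A+j) * ee (f (A+j+1))‖ ≤ 2/g A + 4*(1/g (A+j) - 1/g A) := by
    intro j
    induction j with
    | zero =>
      intro _
      have h1 := hE A le_rfl (by omega)
      rw [add_zero, Nat.Ico_succ_singleton, Finset.sum_singleton, sub_self, mul_zero, add_zero]
      have : ee (f A) - c A * ee (f (A+1)) = -(c A * ee (f A)) := by linear_combination h1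
      rw [this, norm_neg, norm_mul, ee_norm, mul_one]; exact hcb A le_rfl (by omega)
    | succ j ih =>
      intro hj
      have ih := ih (by omega)
      set n := A+j+1 with hn
      have h1 := hE n (by omega) (by omega)
      have e1 : A + (j+1) = n := by omega
      rw [e1, Finset.sum_Ico_succ_top (by omega)]
      have g1 := (h0 (A+j) (by omega) (by omega)).1
      have g2 := (h0 n (by omega) (by omega)).1
      have g3 := ha (A+j) (by omega) (by omega)
      have hd : ‖c (A+j) - c n‖ ≤ 4*(1/g n - 1/g (A+j)) := by
        have e2 : c (A+j) - c n = (ee (g n) - ee (g (A+j))) * (c (A+j) * c n) := by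
          have a := hne (A+j) (by omega) (by omega)
          have b := hne n (by omega) (by omega)
          rw [hc]; field_simp; ring
        rw [e2, norm_mul, norm_mul]
        calc _ ≤ (g (A+j) - g n) * (2/g (A+j) * (2/g n)) := by
              refine mul_le_mul ((ee_sub _ _).trans (le_of_eq ?_)) (mul_le_mul (hcb _ (by omega) (by omega)) (hcb _ (by omega) (by omega)) (norm_nonneg _) (by positivity)) (by positivity) ?_
              · rw [abs_sub_comm, abs_of_nonneg (by rw [hn]; linarith)]
              · rw [hn]; linarith
          _ = _ := by field_simp; ring
      have e3 : ∑ m ∈ Finset.Ico A n, ee (f m) + ee (f n) - c n * ee (f (n+1)) =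
        (∑ m ∈ Finset.Ico A n, ee (f m) - c (A+j) * ee (f n)) + (c (A+j) - c n) * ee (f n) := by linear_combination h1
      rw [e3]
      refine (norm_add_le _ _).trans ?_
      rw [norm_mul, ee_norm, mul_one]
      linarith only [ih, hd]
  have h1 := key k le_rfl
  have h2 := hcb (A+k) (by omega) le_rfl
  have g1 := (h0 A le_rfl (by omega)).1
  have g2 := (h0 (A+k) (by omega) le_rfl).1
  have h3 := norm_sub_norm_le (∑ n ∈ Finset.Ico A (A+k+1), ee (f n)) (c (A+k) * ee (f (A+k+1)))
  rw [norm_mul, ee_norm, mul_one] at h3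
  have : 0 < 1/g A := by positivity
  have e : 6/g (A+k) = 2/g (A+k) + 4*(1/g (A+k)) := by ring
  have e' : 2/g A = 2*(1/g A) := by ring
  rw [e]; linarith

noncomputable def ph (v : ℕ) : ℝ := Real.log ((v+1:ℕ):ℝ) - Real.log (v:ℝ)
lemma ph_eq (v : ℕ) (hv : 1 ≤ v) : ph v = Real.log (1+1/(v:ℝ)) := by
  have : (0:ℝ) < v := by exact_mod_cast hv
  rw [ph, ← Real.log_div (by positivity) (by positivity)]; congr 1; push_cast; field_simp
lemma ph_le (v : ℕ) (hv : 1 ≤ v) : ph v ≤ 1/v := by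
  rw [ph_eq v hv]; have : (0:ℝ) < v := by exact_mod_cast hv
  have := Real.log_le_sub_one_of_pos (x := 1+1/(v:ℝ)) (by positivity)
  linarith
lemma ph_ge (v : ℕ) (hv : 1 ≤ v) : 1/((v:ℝ)+1) ≤ ph v := by
  rw [ph_eq v hv]; have : (0:ℝ) < v := by exact_mod_cast hv
  have := Real.one_sub_inv_le_log_of_pos (x := 1+1/(v:ℝ)) (by positivity)
  refine le_trans (le_of_eq ?_) this
  field_simp; ring
lemma ph_anti (v : ℕ) (hv : 1 ≤ v) : ph (v+1) ≤ ph v := by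
  rw [ph_eq v hv, ph_eq _ (by omega)]; have : (0:ℝ) < v := by exact_mod_cast hv
  apply Real.log_le_log (by positivity); push_cast; gcongr; linarith

/-- bound for short `t` -/
lemma KL_zeta (t : ℝ) (A B : ℕ) (hA : 1 ≤ A) (ht : 0 < t) (htA : t ≤ A) :
    ‖∑ n ∈ Finset.Ico A B, ee (-(t * Real.log n))‖ ≤ 6 * B / t := by
  rcases le_or_gt B A with h | h
  · rw [Finset.Ico_eq_empty (by omega)]; simp; positivity
  obtain ⟨k, rfl⟩ : ∃ k, B = A+k+1 := ⟨B-A-1, by omega⟩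
  have hA' : (1:ℝ) ≤ A := by exact_mod_cast hA
  have e : ‖∑ n ∈ Finset.Ico A (A+k+1), ee (-(t * Real.log n))‖ = ‖∑ n ∈ Finset.Ico A (A+k+1), ee (t * Real.log n)‖ := by
    rw [← Complex.norm_conj, map_sum]; simp only [ee_conj, neg_neg]
  rw [e]
  have := KL (fun n => t * Real.log n) (fun n => t * ph n) A (fun n => by simp only [ph]; ring) k ?_ ?_
  · refine this.trans ?_
    have h1 := ph_ge (A+k) (by omega)
    have h2 : t * (1/((A+k+1:ℕ):ℝ)) ≤ t * ph (A+k) := by gcongr; push_cast at h1 ⊢; exact h1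
    calc 6/(t * ph (A+k)) ≤ 6/(t * (1/((A+k+1:ℕ):ℝ))) := by gcongr
      _ = _ := by field_simp
  · intro n h1 h2
    have h3 : 1 ≤ n := by omega
    have h4 : (A:ℝ) ≤ n := by exact_mod_cast h1
    have : 0 < ph n := lt_of_lt_of_le (by positivity) (ph_ge n h3)
    refine ⟨by positivity, ?_⟩
    calc t*ph n ≤ n*(1/n) := by gcongr; linarith; exact ph_le n h3
      _ = 1 := by field_simp
  · intro n h1 h2
    have := ph_anti n (by omega); gcongr

lemma ph2_eq (v : ℕ) (hv : 1 ≤ v) : ph v - ph (v+1) = Real.log (1 + 1/((v:ℝ)*(v+2))) := by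
  have h0 : (0:ℝ) < v := by exact_mod_cast hv
  rw [ph, ph, sub_sub_sub_eq, show (v+1+1:ℕ) = v+2 by ring]
  have : (1 + 1/((v:ℝ)*(v+2))) = ((v+1)*(v+1))/(v*(v+2)) := by field_simp; ring
  rw [this, Real.log_div (by positivity) (by positivity), Real.log_mul (by positivity) (by positivity), Real.log_mul (by positivity) (by positivity)]
  push_cast; ring
lemma ph2_le (v : ℕ) (hv : 1 ≤ v) : ph v - ph (v+1) ≤ 1/(v:ℝ)^2 := by
  have h0 : (0:ℝ) < v := by exact_mod_cast hv
  rw [ph2_eq v hv]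
  have := Real.log_le_sub_one_of_pos (x := 1 + 1/((v:ℝ)*(v+2))) (by positivity)
  have h3 : 1/((v:ℝ)*(v+2)) ≤ 1/(v:ℝ)^2 := by
    apply one_div_le_one_div_of_le (by positivity); nlinarith only [h0]
  linarith
lemma ph2_ge (v : ℕ) (hv : 1 ≤ v) : 1/((v:ℝ)+1)^2 ≤ ph v - ph (v+1) := by
  have h0 : (0:ℝ) < v := by exact_mod_cast hv
  rw [ph2_eq v hv]
  have := Real.one_sub_inv_le_log_of_pos (x := 1 + 1/((v:ℝ)*(v+2))) (by positivity)
  refine le_trans (le_of_eq ?_) this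
  field_simp; ring
lemma ph2_anti (v : ℕ) (hv : 1 ≤ v) : ph (v+1) - ph (v+1+1) ≤ ph v - ph (v+1) := by
  have h0 : (0:ℝ) < v := by exact_mod_cast hv
  rw [ph2_eq v hv, ph2_eq (v+1) (by omega)]
  apply Real.log_le_log (by positivity); push_cast; gcongr <;> linarith

/-- differenced sums -/
lemma KL_diff (t : ℝ) (A B d : ℕ) (hA : 1 ≤ A) (ht : 0 < t) (hd : 1 ≤ d) (htA : t*d ≤ (A:ℝ)^2) :
    ‖∑ n ∈ Finset.Ico A (B-d), ee (-(t * Real.log ((n+d:ℕ):ℝ))) * ee (t * Real.log n)‖ ≤ 6 * (B:ℝ)^2 / (t*d) := by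
  have hd0 : (0:ℝ) < d := by exact_mod_cast hd
  rcases le_or_gt (B-d) A with h | h
  · rw [Finset.Ico_eq_empty (by omega)]; simp; positivity
  obtain ⟨k, hk⟩ : ∃ k, B-d = A+k+1 := ⟨B-d-A-1, by omega⟩
  have hA' : (1:ℝ) ≤ A := by exact_mod_cast hA
  rw [hk]; simp only [← ee_add]
  have hs : ∀ n, ph n - ph (n+d) = ∑ j ∈ Finset.range d, (ph (n+j) - ph (n+j+1)) := by
    intro n; have := Finset.sum_range_sub' (fun j => ph (n+j)) d
    simpa [add_assoc] using this.symm
  have hlb : ∀ n, 1 ≤ n → n + d ≤ B → d/(B:ℝ)^2 ≤ ph n - ph (n+d) := by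
    intro n hn hB
    rw [hs]
    calc d/(B:ℝ)^2 = ∑ j ∈ Finset.range d, 1/(B:ℝ)^2 := by simp; ring
      _ ≤ _ := Finset.sum_le_sum fun j hj => by
          rw [Finset.mem_range] at hj
          refine le_trans ?_ (ph2_ge (n+j) (by omega))
          have : ((n+j:ℕ):ℝ)+1 ≤ B := by exact_mod_cast (show n+j+1 ≤ B by omega)
          gcongr
  have hB0 : (0:ℝ) < B := by exact_mod_cast (show 0 < B by omega)
  have := KL (fun n => -(t * Real.log ((n+d:ℕ):ℝ)) + t * Real.log n) (fun n => t * (ph n - ph (n+d))) A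
    (fun n => by simp only [ph]; rw [show n+1+d = n+d+1 by ring]; ring) k ?_ ?_
  · refine this.trans ?_
    have h1 := hlb (A+k) (by omega) (by omega)
    calc 6/(t * (ph (A+k) - ph (A+k+d))) ≤ 6/(t * (d/(B:ℝ)^2)) := by gcongr
      _ = _ := by field_simp
  · intro n h1 h2
    have h3 := hlb n (by omega) (by omega)
    have h4 : (A:ℝ) ≤ n := by exact_mod_cast h1
    have : 0 < d/(B:ℝ)^2 := by positivity
    have : 0 < ph n - ph (n+d) := by linarith only [h3, this]
    refine ⟨by positivity, ?_⟩
    have h5 : ph n - ph (n+d) ≤ d * (1/(A:ℝ)^2) := by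
      rw [hs]
      calc _ ≤ ∑ j ∈ Finset.range d, 1/(A:ℝ)^2 := Finset.sum_le_sum fun j hj => by
            refine (ph2_le (n+j) (by omega)).trans ?_
            have : (A:ℝ) ≤ (n+j:ℕ) := by exact_mod_cast (show A ≤ n+j by omega)
            gcongr
        _ = _ := by simp
    calc t*(ph n - ph (n+d)) ≤ t*(d*(1/(A:ℝ)^2)) := by gcongr
      _ = t*d/(A:ℝ)^2 := by ring
      _ ≤ 1 := by rw [div_le_one (by positivity)]; exact htA
  · intro n h1 h2
    have : ph (n+1) - ph (n+1+d) ≤ ph n - ph (n+d) := by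
      rw [hs, hs]
      refine Finset.sum_le_sum fun j hj => ?_
      have := ph2_anti (n+j) (by omega)
      rw [show n+1+j = n+j+1 by ring]; exact this
    gcongr

lemma vdc (f : ℕ → ℂ) (A B H : ℕ) (hH : 1 ≤ H) (hHA : H ≤ A) (hAB : A ≤ B) (hf : ∀ n, ‖f n‖ ≤ 1) (D : ℕ → ℝ) (hD0 : ∀ d, 0 ≤ D d)
    (hD : ∀ d, 1 ≤ d → d < H → ‖∑ n ∈ Finset.Ico A (B-d), f (n+d) * (starRingEnd ℂ) (f n)‖ ≤ D d) :
    (H:ℝ)^2 * ‖∑ n ∈ Finset.Ico A B, f n‖^2 ≤ ((B-A+H:ℕ):ℝ) * (H * ((B-A:ℕ):ℝ) + 2*H*∑ d ∈ Finset.Ico 1 H, D d) := by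
  set z : ℕ → ℂ := fun n => if n ∈ Finset.Ico A B then f n else 0 with hz
  set S := ∑ n ∈ Finset.Ico A B, f n with hS
  have hsh : ∀ h < H, ∑ n ∈ Finset.Ico (A-H) B, z (n+h) = S := by
    intro h hh
    rw [Finset.sum_Ico_add' z] 
    rw [hS, hz, ← Finset.sum_filter]
    apply Finset.sum_congr _ (fun _ _ => rfl)
    ext n; simp only [Finset.mem_filter, Finset.mem_Ico]; omega
  have e1 : (H:ℂ) * S = ∑ n ∈ Finset.Ico (A-H) B, ∑ h ∈ Finset.range H, z (n+h) := by
    rw [Finset.sum_comm, Finset.sum_congr rfl (fun h hh => hsh h (Finset.mem_range.1 hh))]; simp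
  have e2 : (H:ℝ)^2 * ‖S‖^2 ≤ ((B-A+H:ℕ):ℝ) * ∑ n ∈ Finset.Ico (A-H) B, ‖∑ h ∈ Finset.range H, z (n+h)‖^2 := by
    have : (H:ℝ)^2 * ‖S‖^2 = ‖(H:ℂ)*S‖^2 := by rw [norm_mul, mul_pow]; simp
    rw [this, e1]
    calc _ ≤ (∑ n ∈ Finset.Ico (A-H) B, ‖∑ h ∈ Finset.range H, z (n+h)‖)^2 := by gcongr; exact norm_sum_le _ _
      _ ≤ _ := sq_sum_le_card_mul_sum_sq
      _ = _ := by rw [Nat.card_Ico, show B-(A-H) = B-A+H by omega]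
  refine e2.trans ?_
  gcongr
  have hcor : ∀ h < H, ∀ h' < h, ‖∑ n ∈ Finset.Ico (A-H) B, z (n+h) * (starRingEnd ℂ) (z (n+h'))‖ ≤ D (h-h') := by
    intro h hh h' hh'
    refine le_trans (le_of_eq ?_) (hD (h-h') (by omega) (by omega))
    congr 1
    have : ∀ n, z (n+h) * (starRingEnd ℂ) (z (n+h')) = (fun k => z (k+(h-h')) * (starRingEnd ℂ) (z k)) (n+h') := by
      intro n; dsimp only; rw [show n+h'+(h-h') = n+h by omega]
    rw [Finset.sum_congr rfl (fun n _ => this n), Finset.sum_Ico_add' (fun k => z (k+(h-h')) * (starRingEnd ℂ) (z k))]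
    rw [← Finset.sum_subset (s₁ := Finset.Ico A (B-(h-h')))]
    · apply Finset.sum_congr rfl; intro n hn
      rw [Finset.mem_Ico] at hn
      simp only [hz]; rw [if_pos (by rw [Finset.mem_Ico]; omega), if_pos (by rw [Finset.mem_Ico]; omega)]
    · intro n hn; rw [Finset.mem_Ico] at *; omega
    · intro n hn hn'
      rw [Finset.mem_Ico] at *
      simp only [hz, Finset.mem_Ico]
      split_ifs <;> first | omega | simp
  have hre : ∑ n ∈ Finset.Ico (A-H) B, ‖∑ h ∈ Finset.range H, z (n+h)‖^2 =
      (∑ h ∈ Finset.range H, ∑ h' ∈ Finset.range H, ∑ n ∈ Finset.Ico (A-H) B, z (n+h) * (starRingEnd ℂ) (z (n+h'))).re := by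
    have : ((∑ n ∈ Finset.Ico (A-H) B, ‖∑ h ∈ Finset.range H, z (n+h)‖^2:ℝ):ℂ) =
       ∑ h ∈ Finset.range H, ∑ h' ∈ Finset.range H, ∑ n ∈ Finset.Ico (A-H) B, z (n+h) * (starRingEnd ℂ) (z (n+h')) := by
      push_cast
      simp only [← Complex.mul_conj', map_sum, Finset.sum_mul_sum]
      rw [Finset.sum_comm]; apply Finset.sum_congr rfl; intro h _; rw [Finset.sum_comm]
    rw [← this, Complex.ofReal_re]
  rw [hre]
  refine (Complex.re_le_norm _).trans ((norm_sum_le _ _).trans ?_)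
  have hrow : ∀ h ∈ Finset.range H, ‖∑ h' ∈ Finset.range H, ∑ n ∈ Finset.Ico (A-H) B, z (n+h) * (starRingEnd ℂ) (z (n+h'))‖ ≤ ((B-A:ℕ):ℝ) + 2*∑ d ∈ Finset.Ico 1 H, D d := by
    intro h hh
    rw [Finset.mem_range] at hh
    refine (norm_sum_le _ _).trans ?_
    have hb : ∀ h' ∈ Finset.range H, ‖∑ n ∈ Finset.Ico (A-H) B, z (n+h) * (starRingEnd ℂ) (z (n+h'))‖ ≤
       (if h' = h then ((B-A:ℕ):ℝ) else 0) + (if h' < h then D (h-h') else 0) + (if h < h' then D (h'-h) else 0) := by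
      intro h' hh'
      rw [Finset.mem_range] at hh'
      rcases lt_trichotomy h' h with g | g | g
      · rw [if_neg g.ne, if_pos g, if_neg (by omega)]; have := hcor h hh h' g; linarith
      · subst g
        rw [if_pos rfl, if_neg (lt_irrefl _), add_zero, add_zero]
        refine (norm_sum_le _ _).trans ?_
        have : ∀ n, ‖z (n+h') * (starRingEnd ℂ) (z (n+h'))‖ ≤ (if n + h' ∈ Finset.Ico A B then (1:ℝ) else 0) := by
          intro n; simp only [hz]; split_ifs
          · rw [norm_mul, Complex.norm_conj]; nlinarith only [hf, hf (n+h'), norm_nonneg (f (n+h'))]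
          · simp
        refine (Finset.sum_le_sum fun n _ => this n).trans ?_
        rw [Finset.sum_Ico_add' (fun k => if k ∈ Finset.Ico A B then (1:ℝ) else 0), Finset.sum_boole]
        norm_cast
        refine (Finset.card_le_card (t := Finset.Ico A B) ?_).trans (by simp)
        intro n hn; simp only [Finset.mem_filter] at hn; exact hn.2
      · rw [if_neg g.ne', if_neg (by omega), if_pos g, zero_add, zero_add]
        have := hcor h' hh' h g
        rw [← Complex.norm_conj, map_sum] at this
        simp only [map_mul, Complex.conj_conj] at this
        simpa only [mul_comm] using this
    refine (Finset.sum_le_sum hb).trans ?_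
    rw [Finset.sum_add_distrib, Finset.sum_add_distrib, Finset.sum_ite_eq', if_pos (Finset.mem_range.2 hh), ← Finset.sum_filter, ← Finset.sum_filter]
    have i1 : ∑ a ∈ (Finset.range H).filter (fun a => a < h), D (h-a) ≤ ∑ d ∈ Finset.Ico 1 H, D d := by
      rw [← Finset.sum_image (f := D) (g := fun a => h-a)]
      · refine Finset.sum_le_sum_of_subset_of_nonneg ?_ (fun _ _ _ => hD0 _)
        intro d; simp only [Finset.mem_image, Finset.mem_filter, Finset.mem_range, Finset.mem_Ico]; rintro ⟨a, ha, rfl⟩; omega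
      · intro a ha b hb hab; simp only [Finset.coe_filter, Finset.mem_range, Set.mem_ofPred_eq] at ha hb; dsimp only at hab; omega
    have i2 : ∑ a ∈ (Finset.range H).filter (fun a => h < a), D (a-h) ≤ ∑ d ∈ Finset.Ico 1 H, D d := by
      rw [← Finset.sum_image (f := D) (g := fun a => a-h)]
      · refine Finset.sum_le_sum_of_subset_of_nonneg ?_ (fun _ _ _ => hD0 _)
        intro d; simp only [Finset.mem_image, Finset.mem_filter, Finset.mem_range, Finset.mem_Ico]; rintro ⟨a, ha, rfl⟩; omega
      · intro a ha b hb hab; simp only [Finset.coe_filter, Finset.mem_range, Set.mem_ofPred_eq] at ha hb; dsimp only at hab; omega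
    linarith
  refine (Finset.sum_le_sum hrow).trans (le_of_eq ?_)
  simp; ring

lemma Z_bound (t : ℝ) (A : ℕ) (hA : 1 ≤ A) (ht1 : (A:ℝ) ≤ t) (ht2 : t ≤ (A:ℝ)^2) :
    ‖∑ n ∈ Finset.Ico A (2*A), ee (-(t * Real.log n))‖^2 ≤ 400 * t * (1 + Real.log A) := by
  have hA' : (1:ℝ) ≤ A := by exact_mod_cast hA
  have ht : 0 < t := by linarith
  set H := ⌊(A:ℝ)^2/t⌋₊ with hH
  have h1 : 1 ≤ (A:ℝ)^2/t := by rw [le_div_iff₀ ht]; linarith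
  have hH1 : 1 ≤ H := Nat.le_floor (by simpa using h1)
  have hHle : (H:ℝ) ≤ (A:ℝ)^2/t := Nat.floor_le (by positivity)
  have hHlt : (A:ℝ)^2/t < H+1 := Nat.lt_floor_add_one _
  have hH1' : (1:ℝ) ≤ H := by exact_mod_cast hH1
  have hHA' : (H:ℝ) ≤ A := hHle.trans (by rw [div_le_iff₀ ht]; nlinarith only [ht1])
  have hHA : H ≤ A := by exact_mod_cast hHA'
  have := vdc (fun n => ee (-(t * Real.log n))) A (2*A) H hH1 hHA (by omega) (fun n => (ee_norm _).le)
    (fun d => 24*(A:ℝ)^2/t*(d:ℝ)⁻¹) (fun d => by positivity) ?_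
  · have hharm : ∑ d ∈ Finset.Ico 1 H, (d:ℝ)⁻¹ ≤ 1 + Real.log A := by
      have h2 := harmonic_le_one_add_log H
      have h3 : ∑ d ∈ Finset.Ico 1 H, (d:ℝ)⁻¹ ≤ ((harmonic H:ℚ):ℝ) := by
        rw [harmonic_eq_sum_Icc]; push_cast
        exact Finset.sum_le_sum_of_subset_of_nonneg (fun d => by simp only [Finset.mem_Ico, Finset.mem_Icc]; omega) (fun _ _ _ => by positivity)
      have h4 := Real.log_le_log (by linarith only [h1, hHlt]) hHA'
      linarith only [h2, h3, h4]
    rw [← Finset.mul_sum] at this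
    set S := ‖∑ n ∈ Finset.Ico A (2*A), ee (-(t * Real.log n))‖
    have e1 : ((2*A-A:ℕ):ℝ) = A := by congr 1; omega
    have e2 : ((2*A-A+H:ℕ):ℝ) ≤ 2*A := by exact_mod_cast (show 2*A-A+H ≤ 2*A by omega)
    rw [e1] at this
    set Lg := 1 + Real.log A with hLg
    have hL1 : 1 ≤ Lg := by have := Real.log_nonneg hA'; linarith only [this]
    have h5 : (H:ℝ)^2*S^2 ≤ 2*A*(H*A + 2*H*(24*(A:ℝ)^2/t*Lg)) := this.trans (by gcongr)
    have h6 : 24*(A:ℝ)^2/t ≤ 24*A := by rw [div_le_iff₀ ht]; nlinarith only [ht1]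
    have h7 : (H:ℝ)^2*S^2 ≤ H*(98*(A:ℝ)^2*Lg) := h5.trans (by
      calc 2*(A:ℝ)*(H*A + 2*H*(24*(A:ℝ)^2/t*Lg)) ≤ 2*A*(H*(A*Lg) + 2*H*(24*A*Lg)) := by gcongr; nlinarith only [hL1]
        _ = _ := by ring)
    have h8 : (H:ℝ)*S^2 ≤ 98*(A:ℝ)^2*Lg := by
      have : (H:ℝ)*(H*S^2) ≤ H*(98*(A:ℝ)^2*Lg) := by linarith only [h7]
      exact le_of_mul_le_mul_left this (by linarith only [h1, hHlt])
    have h9 : (A:ℝ)^2 ≤ 2*H*t := by rw [div_lt_iff₀ ht] at hHlt; nlinarith only [hHlt, hH1']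
    have h10 : (H:ℝ)*S^2 ≤ H*(400*t*Lg) := by
      refine h8.trans ?_
      calc 98*(A:ℝ)^2*Lg ≤ 98*(2*H*t)*Lg := by gcongr
        _ ≤ _ := by nlinarith only [ht, h1, hHlt, hL1, mul_pos (mul_pos (show (0:ℝ) < H by linarith only [h1, hHlt]) ht) (show (0:ℝ) < Lg by linarith only [hL1])]
    exact le_of_mul_le_mul_left h10 (by linarith only [h1, hHlt])
  · intro d hd hdH
    have hd' : (d:ℝ) ≤ H := by exact_mod_cast hdH.le
    have := KL_diff t A (2*A) d hA ht hd (by rw [le_div_iff₀ ht] at hHle; nlinarith only [ht1, hHle, hd'])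
    simp only [ee_conj, neg_neg]
    refine this.trans (le_of_eq ?_)
    have : (0:ℝ) < d := by exact_mod_cast hd
    push_cast; field_simp; ring

noncomputable def dz (t : ℝ) (n : ℕ) : ℂ := ee (-(t * Real.log n))
lemma dz_norm (t : ℝ) (n : ℕ) : ‖dz t n‖ = 1 := ee_norm _
lemma dz_mul (t : ℝ) (m n : ℕ) (hm : m ≠ 0) (hn : n ≠ 0) : dz t (m*n) = dz t m * dz t n := by
  rw [dz, dz, dz, ← ee_add, Nat.cast_mul, Real.log_mul (by exact_mod_cast hm) (by exact_mod_cast hn)]; congr 1; ring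
lemma ee_cont : Continuous ee := by unfold ee; fun_prop
lemma dz_cont (n : ℕ) : Continuous (fun t => dz t n) := by
  unfold dz; exact ee_cont.comp (by fun_prop)
noncomputable def dp (N : ℕ) (a : ℕ → ℝ) (t : ℝ) : ℂ := ∑ n ∈ Finset.Icc 1 N, (a n : ℂ) * dz t n
lemma dp_cont (N : ℕ) (a : ℕ → ℝ) : Continuous (dp N a) := by
  unfold dp; exact continuous_finsetSum _ (fun n _ => continuous_const.mul (dz_cont n))
lemma dp_bound (N : ℕ) (a : ℕ → ℝ) (t : ℝ) : ‖dp N a t‖ ≤ ∑ n ∈ Finset.Icc 1 N, |a n| := by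
  refine (norm_sum_le _ _).trans (Finset.sum_le_sum fun n _ => ?_)
  rw [norm_mul, dz_norm, mul_one, Complex.norm_real, Real.norm_eq_abs]
def sup (a : ℕ → ℝ) (N : ℕ) : Prop := ∀ n, a n ≠ 0 → 1 ≤ n ∧ n ≤ N
lemma dp_mono {a : ℕ → ℝ} {N N' : ℕ} (ha : sup a N) (h : N ≤ N') (t : ℝ) : dp N' a t = dp N a t := by
  symm; apply Finset.sum_subset (Finset.Icc_subset_Icc_right h)
  intro n _ hn
  have : a n = 0 := by by_contra h0; exact hn (Finset.mem_Icc.2 (ha n h0))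
  simp [this]
noncomputable def cv (P : Finset ℕ) (a : ℕ → ℕ → ℝ) (k : ℕ) : ℝ := ∑ p ∈ P.filter (fun p => p ∣ k), a p (k/p)
lemma sum_dvd {M : Type*} [AddCommMonoid M] (p N : ℕ) (hp : 1 ≤ p) (f : ℕ → M) :
    ∑ k ∈ (Finset.Icc 1 N).filter (fun k => p ∣ k), f k = ∑ n ∈ Finset.Icc 1 (N/p), f (p*n) := by
  rw [← Finset.sum_image (f := f) (g := fun n => p*n)]
  · apply Finset.sum_congr _ (fun _ _ => rfl)
    ext k; simp only [Finset.mem_filter, Finset.mem_image, Finset.mem_Icc]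
    constructor
    · rintro ⟨⟨h1, h2⟩, n, rfl⟩
      exact ⟨n, ⟨Nat.pos_of_mul_pos_left h1, (Nat.le_div_iff_mul_le hp).2 (by linarith)⟩, rfl⟩
    · rintro ⟨n, ⟨h1, h2⟩, rfl⟩
      rw [Nat.le_div_iff_mul_le hp] at h2
      exact ⟨⟨Nat.mul_pos hp h1, by linarith⟩, dvd_mul_right _ _⟩
  · intro a _ b _ h; exact Nat.eq_of_mul_eq_mul_left hp h
lemma dp_conv (P : Finset ℕ) (a : ℕ → ℕ → ℝ) (N Q : ℕ) (hP : ∀ p ∈ P, 1 ≤ p ∧ p ≤ Q) (ha : ∀ p ∈ P, sup (a p) N) (t : ℝ) :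
    ∑ p ∈ P, dz t p * dp N (a p) t = dp (Q*N) (cv P a) t := by
  unfold dp cv
  simp only [Complex.ofReal_sum, Finset.sum_mul, Finset.sum_filter, apply_ite Complex.ofReal, Complex.ofReal_zero, ite_mul, zero_mul]
  rw [Finset.sum_comm]
  apply Finset.sum_congr rfl; intro p hp
  obtain ⟨h1, h2⟩ := hP p hp
  rw [← Finset.sum_filter, sum_dvd p _ h1]
  have h3 : dz t p * dp N (a p) t = dz t p * dp (Q*N/p) (a p) t := by
    rw [dp_mono (N' := Q*N/p) (ha p hp) (by rw [Nat.le_div_iff_mul_le h1]; nlinarith)]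
  have h4 : dz t p * dp N (a p) t = dz t p * ∑ n ∈ Finset.Icc 1 N, (a p n : ℂ) * dz t n := rfl
  rw [← h4, h3, dp, Finset.mul_sum]
  apply Finset.sum_congr rfl; intro n hn
  rw [Finset.mem_Icc] at hn
  rw [Nat.mul_div_cancel_left _ h1, dz_mul t p n (by omega) (by omega)]; ring
lemma cv_sup (P : Finset ℕ) (a : ℕ → ℕ → ℝ) (N Q : ℕ) (hP : ∀ p ∈ P, 1 ≤ p ∧ p ≤ Q) (ha : ∀ p ∈ P, sup (a p) N) : sup (cv P a) (Q*N) := by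
  intro k hk
  obtain ⟨p, hp, h⟩ := Finset.exists_ne_zero_of_sum_ne_zero hk
  rw [Finset.mem_filter] at hp
  obtain ⟨hp, n, rfl⟩ := hp
  obtain ⟨h1, h2⟩ := hP p hp
  rw [Nat.mul_div_cancel_left _ h1] at h
  obtain ⟨h3, h4⟩ := ha p hp n h
  exact ⟨Nat.mul_pos h1 h3, Nat.mul_le_mul h2 h4⟩

lemma geo_sum (s : Finset ℕ) (j : ℕ → ℕ) (hj : Set.InjOn j s) (δ : ℝ) (hδ : 0 < δ) (f : ℕ → ℝ)
    (hf : ∀ m ∈ s, f m ≤ Real.exp (-δ)^(j m)) : ∑ m ∈ s, f m ≤ 1 + 1/δ := by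
  have hr0 := (Real.exp_pos (-δ)).le
  have hr1 : Real.exp (-δ) < 1 := by rw [Real.exp_lt_one_iff]; linarith
  calc ∑ m ∈ s, f m ≤ ∑ m ∈ s, Real.exp (-δ)^(j m) := Finset.sum_le_sum hf
    _ = ∑ i ∈ s.image j, Real.exp (-δ)^i := by rw [Finset.sum_image hj]
    _ ≤ ∑' i, Real.exp (-δ)^i := (summable_geometric_of_lt_one hr0 hr1).sum_le_tsum _ (fun _ _ => by positivity)
    _ = (1 - Real.exp (-δ))⁻¹ := tsum_geometric_of_lt_one hr0 hr1
    _ ≤ _ := by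
      have h := Real.add_one_le_exp δ
      have : Real.exp (-δ) ≤ 1/(1+δ) := by rw [Real.exp_neg, one_div]; gcongr; linarith
      calc (1 - Real.exp (-δ))⁻¹ ≤ (1 - 1/(1+δ))⁻¹ := by
            apply inv_anti₀ _ (by linarith)
            rw [sub_pos, div_lt_one (by linarith)]; linarith
        _ = _ := by
          have : 1 - 1/(1+δ) = δ/(1+δ) := by field_simp; ring
          rw [this, inv_div, add_div, div_self hδ.ne']; ring
lemma gsum (s : Finset ℕ) (c δ : ℝ) (hδ : 0 < δ) :
    ∑ m ∈ s, Real.exp (-(((m:ℝ)-c)*δ)^2/2) ≤ 4*(1+1/δ) := by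
  have h1 : ∀ v : ℝ, Real.exp (-v^2/2) ≤ 2*Real.exp (-|v|) := by
    intro v
    have : Real.exp (-v^2/2) ≤ Real.exp (1/2 + -|v|) := by
      apply Real.exp_le_exp.2; nlinarith only [sq_nonneg (|v|-1), sq_abs v]
    rw [Real.exp_add] at this
    have h2 : Real.exp (1/2) ≤ 2 := by
      have := Real.exp_one_lt_d9
      have h3 : Real.exp (1/2)^2 = Real.exp 1 := by rw [← Real.exp_nat_mul]; norm_num
      nlinarith only [this, h3, Real.exp_pos (1/2)]
    nlinarith [Real.exp_pos (-|v|)]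
  have h2 : ∑ m ∈ s, Real.exp (-|((m:ℝ)-c)*δ|) ≤ 2*(1+1/δ) := by
    rw [← Finset.sum_filter_add_sum_filter_not s (fun m : ℕ => c ≤ m)]
    have a1 := geo_sum (s.filter (fun m : ℕ => c ≤ m)) (fun m => ((m:ℤ)-⌈c⌉).toNat) ?_ δ hδ (fun m : ℕ => Real.exp (-|((m:ℝ)-c)*δ|)) ?_
    have a2 := geo_sum (s.filter (fun m : ℕ => ¬ c ≤ m)) (fun m => (⌊c⌋-(m:ℤ)).toNat) ?_ δ hδ (fun m : ℕ => Real.exp (-|((m:ℝ)-c)*δ|)) ?_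
    · linarith
    · intro a ha b hb hab
      simp only [Finset.coe_filter, Set.mem_ofPred_eq, not_le] at ha hb
      have e1 : (a:ℤ) ≤ ⌊c⌋ := Int.le_floor.2 (by exact_mod_cast ha.2.le)
      have e2 : (b:ℤ) ≤ ⌊c⌋ := Int.le_floor.2 (by exact_mod_cast hb.2.le)
      dsimp only at hab; omega
    · intro m hm
      simp only [Finset.mem_filter, not_le] at hm
      have e1 : (m:ℤ) ≤ ⌊c⌋ := Int.le_floor.2 (by exact_mod_cast hm.2.le)
      rw [← Real.exp_nat_mul, abs_mul, abs_of_pos hδ, abs_of_neg (by linarith [hm.2])]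
      apply Real.exp_le_exp.2
      have e3 : (((⌊c⌋-(m:ℤ)).toNat:ℕ):ℝ) = ⌊c⌋-m := by
        have : (((⌊c⌋-(m:ℤ)).toNat:ℕ):ℤ) = ⌊c⌋-m := Int.toNat_of_nonneg (by omega)
        exact_mod_cast this
      rw [e3]; nlinarith only [hδ, Int.floor_le c]
    · intro a ha b hb hab
      simp only [Finset.coe_filter, Set.mem_ofPred_eq] at ha hb
      have e1 : ⌈c⌉ ≤ (a:ℤ) := Int.ceil_le.2 (by exact_mod_cast ha.2)
      have e2 : ⌈c⌉ ≤ (b:ℤ) := Int.ceil_le.2 (by exact_mod_cast hb.2)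
      dsimp only at hab; omega
    · intro m hm
      simp only [Finset.mem_filter] at hm
      have e1 : ⌈c⌉ ≤ (m:ℤ) := Int.ceil_le.2 (by exact_mod_cast hm.2)
      rw [← Real.exp_nat_mul, abs_mul, abs_of_pos hδ, abs_of_nonneg (by linarith [hm.2])]
      apply Real.exp_le_exp.2
      have e3 : ((((m:ℤ)-⌈c⌉).toNat:ℕ):ℝ) = m-⌈c⌉ := by
        have : ((((m:ℤ)-⌈c⌉).toNat:ℕ):ℤ) = m-⌈c⌉ := Int.toNat_of_nonneg (by omega)
        exact_mod_cast this
      rw [e3]; nlinarith [Int.le_ceil c]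
  calc _ ≤ ∑ m ∈ s, 2*Real.exp (-|((m:ℝ)-c)*δ|) := Finset.sum_le_sum fun m _ => h1 _
    _ ≤ _ := by rw [← Finset.mul_sum]; linarith

noncomputable def gm (η : ℝ) : Measure ℝ := ProbabilityTheory.gaussianReal 0 (Real.toNNReal ((η^2)⁻¹))
instance (η : ℝ) : IsProbabilityMeasure (gm η) := by unfold gm; infer_instance
lemma gm_char (η : ℝ) (hη : 0 < η) (τ : ℝ) : ∫ t, ee (τ*t) ∂(gm η) = (Real.exp (-τ^2/(2*η^2)) : ℂ) := by
  have := ProbabilityTheory.charFun_gaussianReal (μ := 0) (v := Real.toNNReal ((η^2)⁻¹)) τ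
  rw [charFun_apply_real] at this
  unfold gm ee
  rw [show (fun t : ℝ => Complex.exp (Complex.I * ((τ*t:ℝ):ℂ))) = fun t : ℝ => Complex.exp (τ*t*Complex.I) by
    ext t; congr 1; push_cast; ring, this, Complex.ofReal_exp]
  congr 1
  rw [Real.coe_toNNReal _ (by positivity)]; push_cast; field_simp; ring
lemma int_cont {E : Type*} [NormedAddCommGroup E] [SecondCountableTopology E] [MeasurableSpace E] [BorelSpace E] (μ : Measure ℝ) [IsFiniteMeasure μ] (f : ℝ → E) (hf : Continuous f) (C : ℝ) (hC : ∀ t, ‖f t‖ ≤ C) : Integrable f μ :=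
  Integrable.of_bound hf.aestronglyMeasurable C (Filter.Eventually.of_forall hC)

lemma log_dist (n m N : ℝ) (hn : 0 < n) (hm : 0 < m) (hnN : n ≤ N) (hmN : m ≤ N) : ((m-n)/N)^2 ≤ (Real.log m - Real.log n)^2 := by
  have hN : 0 < N := by linarith
  wlog h : n ≤ m generalizing n m
  · have := this m n hm hn hmN hnN (by linarith)
    rw [← neg_sq, ← neg_sq (Real.log m - _)]; rw [neg_sub, ← neg_div, neg_sub]; exact this
  have h1 : (m-n)/N ≤ Real.log m - Real.log n := by
    rw [← Real.log_div hm.ne' hn.ne']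
    have := Real.one_sub_inv_le_log_of_pos (x := m/n) (by positivity)
    refine le_trans ?_ this
    rw [inv_div]
    calc (m-n)/N ≤ (m-n)/m := by apply div_le_div_of_nonneg_left (by linarith) hm hmN
      _ = _ := by field_simp
  have h2 : 0 ≤ (m-n)/N := div_nonneg (by linarith) hN.le
  gcongr

lemma MV (η : ℝ) (hη : 0 < η) (N : ℕ) (hN : 1 ≤ N) (a : ℕ → ℝ) :
    ∫ t, ‖dp N a t‖^2 ∂(gm η) ≤ 4*(1+η*N) * ∑ n ∈ Finset.Icc 1 N, a n^2 := by
  have hN' : (0:ℝ) < N := by exact_mod_cast hN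
  have e1 : ((∫ t, ‖dp N a t‖^2 ∂(gm η) : ℝ):ℂ) = ∑ n ∈ Finset.Icc 1 N, ∑ m ∈ Finset.Icc 1 N,
      ((a n * a m * Real.exp (-(Real.log m - Real.log n)^2/(2*η^2)) : ℝ):ℂ) := by
    rw [← integral_complex_ofReal]
    have : ∀ t, ((‖dp N a t‖^2:ℝ):ℂ) = ∑ n ∈ Finset.Icc 1 N, ∑ m ∈ Finset.Icc 1 N, (a n * a m:ℂ) * ee ((Real.log m - Real.log n)*t) := by
      intro t
      push_cast
      rw [← Complex.mul_conj', dp, map_sum, Finset.sum_mul_sum]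
      apply Finset.sum_congr rfl; intro n _; apply Finset.sum_congr rfl; intro m _
      rw [map_mul, Complex.conj_ofReal, dz, dz, ee_conj, show (Real.log m - Real.log n)*t = -(t*Real.log n) + -(-(t*Real.log m)) by ring, ee_add]; ring
    simp only [this]
    have hi : ∀ n m : ℕ, Integrable (fun t => (a n * a m:ℂ) * ee ((Real.log m - Real.log n)*t)) (gm η) := fun n m =>
      (int_cont _ _ (ee_cont.comp (by fun_prop : Continuous fun t : ℝ => (Real.log m - Real.log n)*t)) 1 (fun t => (ee_norm _).le)).const_mul _
    rw [integral_finsetSum _ (fun n _ => integrable_finsetSum _ (fun m _ => hi n m))]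
    apply Finset.sum_congr rfl; intro n _
    rw [integral_finsetSum _ (fun m _ => hi n m)]
    apply Finset.sum_congr rfl; intro m _
    rw [integral_const_mul, gm_char η hη]; push_cast; ring
  have e2 : ∫ t, ‖dp N a t‖^2 ∂(gm η) = ∑ n ∈ Finset.Icc 1 N, ∑ m ∈ Finset.Icc 1 N,
      a n * a m * Real.exp (-(Real.log m - Real.log n)^2/(2*η^2)) := by exact_mod_cast e1
  rw [e2]
  set w : ℕ → ℕ → ℝ := fun n m => Real.exp (-(Real.log m - Real.log n)^2/(2*η^2)) with hw
  have hsym : ∀ n m, w n m = w m n := fun n m => by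
    simp only [hw]; congr 1; rw [← neg_sub (Real.log (n:ℝ)), neg_sq]
  have hrow : ∀ n ∈ Finset.Icc 1 N, ∑ m ∈ Finset.Icc 1 N, w n m ≤ 4*(1+η*N) := by
    intro n hn
    have := gsum (Finset.Icc 1 N) n (1/(η*N)) (by positivity)
    rw [one_div_one_div] at this
    refine le_trans (Finset.sum_le_sum fun m hm => ?_) this
    rw [Finset.mem_Icc] at hn hm
    apply Real.exp_le_exp.2
    have h := log_dist n m N (by exact_mod_cast hn.1) (by exact_mod_cast hm.1) (by exact_mod_cast hn.2) (by exact_mod_cast hm.2)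
    have e : (((m:ℝ)-n)*(1/(η*N)))^2/2 = (((m-n)/N:ℝ)^2)/(2*η^2) := by field_simp
    rw [neg_div, neg_div, neg_le_neg_iff, e]; gcongr
  calc _ ≤ ∑ n ∈ Finset.Icc 1 N, ∑ m ∈ Finset.Icc 1 N, (a n^2/2 * w n m + a m^2/2 * w n m) := by
        refine Finset.sum_le_sum fun n _ => Finset.sum_le_sum fun m _ => ?_
        have : 0 < w n m := Real.exp_pos _
        nlinarith only [this, mul_nonneg (sq_nonneg (a n - a m)) this.le]
    _ = ∑ n ∈ Finset.Icc 1 N, ∑ m ∈ Finset.Icc 1 N, a n^2 * w n m := by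
        simp only [Finset.sum_add_distrib]
        rw [add_comm, Finset.sum_comm, ← Finset.sum_add_distrib]
        apply Finset.sum_congr rfl; intro n _
        rw [← Finset.sum_add_distrib]
        apply Finset.sum_congr rfl; intro m _
        rw [hsym m n]; ring
    _ ≤ ∑ n ∈ Finset.Icc 1 N, a n^2 * (4*(1+η*N)) := by
        refine Finset.sum_le_sum fun n hn => ?_
        rw [← Finset.mul_sum]; gcongr; exact hrow n hn
    _ = _ := by rw [← Finset.sum_mul]; ring

lemma dz_conj (s t : ℝ) (n : ℕ) : dz t n * (starRingEnd ℂ) (dz s n) = dz (t-s) n := by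
  unfold dz; rw [ee_conj, ← ee_add]; congr 1; ring
noncomputable def ds (S : Finset ℕ) (t : ℝ) : ℂ := ∑ n ∈ S, dz t n
lemma ds_cont (S : Finset ℕ) : Continuous (ds S) := by
  unfold ds; exact continuous_finsetSum _ (fun n _ => dz_cont n)
lemma ds_bound (S : Finset ℕ) (t : ℝ) : ‖ds S t‖ ≤ S.card := by
  refine (norm_sum_le _ _).trans ?_
  simp [dz_norm]
lemma ds_neg (S : Finset ℕ) (t : ℝ) : ‖ds S (-t)‖ = ‖ds S t‖ := by
  have : ds S (-t) = (starRingEnd ℂ) (ds S t) := by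
    unfold ds; rw [map_sum]; apply Finset.sum_congr rfl; intro n _
    unfold dz; rw [ee_conj]; congr 1; ring
  rw [this, RCLike.norm_conj]

lemma HM (ν : Measure ℝ) [IsFiniteMeasure ν] (T S : Finset ℕ) (hST : S ⊆ T) (M : ℝ) (hM0 : 0 ≤ M)
    (hM : ∀ᵐ s ∂ν, ∫ t, ‖ds T (t-s)‖ ∂ν ≤ M) : ∫ t, ‖ds S t‖^2 ∂ν ≤ S.card * M := by
  set I := ∫ t, ‖ds S t‖^2 ∂ν with hI
  have hI0 : 0 ≤ I := integral_nonneg fun _ => by positivity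
  set c : ℕ → ℂ := fun n => ∫ t, (starRingEnd ℂ) (ds S t) * dz t n ∂ν with hc
  have cB : Continuous (fun t => (starRingEnd ℂ) (ds S t)) := Complex.continuous_conj.comp (ds_cont S)
  have hi : ∀ n, Integrable (fun t => (starRingEnd ℂ) (ds S t) * dz t n) ν := fun n =>
    int_cont ν _ (cB.mul (dz_cont n)) S.card (fun t => by
      rw [norm_mul, dz_norm, mul_one, RCLike.norm_conj]; exact ds_bound S t)
  have e1 : (I:ℂ) = ∑ n ∈ S, c n := by
    rw [hI, ← integral_complex_ofReal, hc, ← integral_finsetSum _ (fun n _ => hi n)]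
    congr 1; ext t
    rw [← Finset.mul_sum]; push_cast; rw [← Complex.conj_mul']; rfl
  have e2 : I ≤ ∑ n ∈ S, ‖c n‖ := by
    have : I = ‖(I:ℂ)‖ := by rw [Complex.norm_real, Real.norm_of_nonneg hI0]
    rw [this, e1]; exact norm_sum_le _ _
  have e3 : I^2 ≤ S.card * ∑ n ∈ T, ‖c n‖^2 :=
    calc I^2 ≤ (∑ n ∈ S, ‖c n‖)^2 := by gcongr
      _ ≤ S.card * ∑ n ∈ S, ‖c n‖^2 := sq_sum_le_card_mul_sum_sq
      _ ≤ _ := by gcongr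
  have cc : ∀ n, (starRingEnd ℂ) (c n) = ∫ s, ds S s * (starRingEnd ℂ) (dz s n) ∂ν := by
    intro n; rw [hc]; simp only; rw [← integral_conj]; simp
  have hi2 : ∀ n, Integrable (fun s => ds S s * (starRingEnd ℂ) (dz s n)) ν := fun n =>
    int_cont ν _ ((ds_cont S).mul (Complex.continuous_conj.comp (dz_cont n))) S.card (fun t => by
      rw [norm_mul, RCLike.norm_conj, dz_norm, mul_one]; exact ds_bound S t)
  have e4 : ((∑ n ∈ T, ‖c n‖^2 : ℝ):ℂ) = ∫ s, ∫ t, ds S s * (starRingEnd ℂ) (ds S t) * ds T (t-s) ∂ν ∂ν := by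
    push_cast
    have : ∀ s, ∫ t, ds S s * (starRingEnd ℂ) (ds S t) * ds T (t-s) ∂ν = ∑ n ∈ T, c n * (ds S s * (starRingEnd ℂ) (dz s n)) := by
      intro s
      have : ∀ t, ds S s * (starRingEnd ℂ) (ds S t) * ds T (t-s) = ∑ n ∈ T, (starRingEnd ℂ) (ds S t) * dz t n * (ds S s * (starRingEnd ℂ) (dz s n)) := by
        intro t; conv_lhs => rw [ds.eq_1 T]
        rw [Finset.mul_sum]; apply Finset.sum_congr rfl; intro n _; rw [← dz_conj]; ring
      simp only [this]
      rw [integral_finsetSum _ (fun n _ => (hi n).mul_const _)]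
      apply Finset.sum_congr rfl; intro n _; rw [integral_mul_const]
    simp only [this]
    rw [integral_finsetSum _ (fun n _ => (hi2 n).const_mul _)]
    apply Finset.sum_congr rfl; intro n _
    rw [integral_const_mul, ← cc, Complex.mul_conj']
  have hZc : Continuous fun p : ℝ × ℝ => ‖ds T (p.1-p.2)‖ := ((ds_cont T).comp (by fun_prop)).norm
  have hZs : ∀ s, Continuous fun t : ℝ => ‖ds T (t-s)‖ := fun s => ((ds_cont T).comp (by fun_prop)).norm
  have hZi : ∀ s, Integrable (fun t => ‖ds T (t-s)‖) ν := fun s => int_cont ν _ (hZs s) T.card (fun t => by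
    rw [Real.norm_of_nonneg (norm_nonneg _)]; exact ds_bound _ _)
  have b2 : ∀ s, ‖ds S s‖^2 ≤ (S.card:ℝ)^2 := fun s => by gcongr; exact ds_bound _ _
  have hB2 : Continuous fun s => ‖ds S s‖^2 := (ds_cont S).norm.pow 2
  have hBZ : ∀ s, Integrable (fun t => ‖ds S t‖^2 * ‖ds T (t-s)‖) ν := fun s =>
    int_cont ν _ (hB2.mul (hZs s)) ((S.card:ℝ)^2*T.card) (fun t => by
      rw [Real.norm_of_nonneg (by positivity)]; gcongr; exacts [ds_bound _ _, ds_bound _ _])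
  have hp : Integrable (fun p : ℝ × ℝ => ‖ds S p.1‖^2 * ‖ds T (p.1-p.2)‖) (ν.prod ν) :=
    Integrable.of_bound ((hB2.comp continuous_fst).mul hZc).aestronglyMeasurable ((S.card:ℝ)^2*T.card)
      (Filter.Eventually.of_forall fun p => by
        rw [Real.norm_of_nonneg (by positivity)]; gcongr; exacts [ds_bound _ _, ds_bound _ _])
  have hp' : Integrable (fun p : ℝ × ℝ => ‖ds S p.2‖^2 * ‖ds T (p.1-p.2)‖) (ν.prod ν) :=
    Integrable.of_bound ((hB2.comp continuous_snd).mul hZc).aestronglyMeasurable ((S.card:ℝ)^2*T.card)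
      (Filter.Eventually.of_forall fun p => by
        rw [Real.norm_of_nonneg (by positivity)]; gcongr; exacts [ds_bound _ _, ds_bound _ _])
  have k1 : ∫ s, ∫ t, ‖ds S s‖^2 * ‖ds T (t-s)‖ ∂ν ∂ν ≤ M*I := by
    rw [hI, ← integral_const_mul]
    apply integral_mono_ae
    · exact hp'.swap.integral_prod_left
    · exact (int_cont ν _ hB2 ((S.card:ℝ)^2) (fun t => by rw [Real.norm_of_nonneg (by positivity)]; exact b2 t)).const_mul _
    · filter_upwards [hM] with s hs
      rw [integral_const_mul, mul_comm]; gcongr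
  have k2 : ∫ s, ∫ t, ‖ds S t‖^2 * ‖ds T (t-s)‖ ∂ν ∂ν = ∫ s, ∫ t, ‖ds S s‖^2 * ‖ds T (t-s)‖ ∂ν ∂ν := by
    rw [integral_integral_swap (f := fun s t => ‖ds S t‖^2 * ‖ds T (t-s)‖) hp.swap]
    congr 1; ext t; congr 1; ext s; rw [← ds_neg T]; congr 3; ring
  have e5 : ∑ n ∈ T, ‖c n‖^2 ≤ M*I := by
    have : ∑ n ∈ T, ‖c n‖^2 = ‖((∑ n ∈ T, ‖c n‖^2 : ℝ):ℂ)‖ := by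
      rw [Complex.norm_real, Real.norm_of_nonneg (Finset.sum_nonneg fun _ _ => by positivity)]
    rw [this, e4]
    calc _ ≤ ∫ s, ∫ t, ((1/2)*(‖ds S s‖^2 * ‖ds T (t-s)‖) + (1/2)*(‖ds S t‖^2 * ‖ds T (t-s)‖)) ∂ν ∂ν := by
          refine (norm_integral_le_integral_norm _).trans (integral_mono_of_nonneg (Filter.Eventually.of_forall fun _ => norm_nonneg _) ?_ (Filter.Eventually.of_forall fun s => ?_))
          · exact ((hp'.swap.const_mul (1/2)).add (hp.swap.const_mul (1/2))).integral_prod_left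
          · refine (norm_integral_le_integral_norm _).trans (integral_mono_of_nonneg (Filter.Eventually.of_forall fun _ => norm_nonneg _) ?_ (Filter.Eventually.of_forall fun t => ?_))
            · exact (((hZi s).const_mul _).const_mul _).add ((hBZ s).const_mul _)
            · simp only [norm_mul, RCLike.norm_conj]
              nlinarith [mul_nonneg (sq_nonneg (‖ds S s‖-‖ds S t‖)) (norm_nonneg (ds T (t-s)))]
      _ = (1/2)*(∫ s, ∫ t, ‖ds S s‖^2 * ‖ds T (t-s)‖ ∂ν ∂ν) + (1/2)*(∫ s, ∫ t, ‖ds S t‖^2 * ‖ds T (t-s)‖ ∂ν ∂ν) := by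
          rw [← integral_const_mul, ← integral_const_mul, ← integral_add]
          · congr 1; ext s
            rw [← integral_const_mul, ← integral_const_mul, ← integral_add]
            · exact ((hZi s).const_mul _).const_mul _
            · exact (hBZ s).const_mul _
          · exact hp'.swap.integral_prod_left.const_mul _
          · exact hp.swap.integral_prod_left.const_mul _
      _ ≤ _ := by rw [k2]; linarith
  by_cases h0 : I = 0
  · rw [h0]; positivity
  · have : I*I ≤ (S.card*M)*I := by nlinarith [mul_le_mul_of_nonneg_left e5 (Nat.cast_nonneg S.card : (0:ℝ) ≤ S.card)]
    exact le_of_mul_le_mul_right this (lt_of_le_of_ne hI0 (Ne.symm h0))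

lemma gm_Icc (η : ℝ) (hη : 0 < η) (c r : ℝ) (hr : 0 ≤ r) : (gm η).real (Metric.closedBall c r) ≤ 2*r*η := by
  have hv : Real.toNNReal ((η^2)⁻¹) ≠ 0 := by simp [hη.ne']
  unfold gm Measure.real
  rw [ProbabilityTheory.gaussianReal_apply 0 hv]
  apply ENNReal.toReal_le_of_le_ofReal (by positivity)
  calc _ ≤ ∫⁻ x in Metric.closedBall c r, ENNReal.ofReal η := by
        apply lintegral_mono; intro x
        rw [ProbabilityTheory.gaussianPDF]
        apply ENNReal.ofReal_le_ofReal
        rw [ProbabilityTheory.gaussianPDFReal, Real.coe_toNNReal _ (by positivity)]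
        have h1 : Real.exp (-(x-0)^2/(2*(η^2)⁻¹)) ≤ 1 := by
          apply Real.exp_le_one_iff.2; rw [neg_div]; exact neg_nonpos.2 (by positivity)
        have h2 : (Real.sqrt (2*Real.pi*(η^2)⁻¹))⁻¹ ≤ η := by
          rw [inv_le_comm₀ (by positivity) hη]
          apply Real.le_sqrt_of_sq_le
          rw [inv_pow]; nlinarith only [hη, Real.pi_gt_three, inv_pos.2 (pow_pos hη 2)]
        calc _ ≤ η*1 := by gcongr
          _ = η := mul_one _
    _ = _ := by
        rw [setLIntegral_const, Real.volume_closedBall, ← ENNReal.ofReal_mul hη.le]; congr 1; ring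

lemma Zb (A : ℕ) (hA : 1 ≤ A) (τ : ℝ) (hτ : |τ| ≤ (A:ℝ)^2) (I : ℕ) (hI : (A:ℝ) ≤ 2^I) :
    ‖ds (Finset.Ico A (2*A)) τ‖ ≤ ∑ i ∈ Finset.range (I+1), 24*(A:ℝ)/2^i * (Metric.closedBall 0 (2^i)).indicator 1 τ
      + Real.sqrt (400 * |τ| * (1+Real.log A)) := by
  have hA' : (1:ℝ) ≤ A := by exact_mod_cast hA
  wlog h : 0 ≤ τ generalizing τ
  · have := this (-τ) (by rwa [abs_neg]) (by linarith)
    rw [ds_neg, abs_neg] at this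
    simpa [Set.indicator_apply] using this
  have hnn : ∀ i : ℕ, 0 ≤ 24*(A:ℝ)/2^i * (Metric.closedBall (0:ℝ) (2^i)).indicator 1 τ := fun i =>
    mul_nonneg (by positivity) (Set.indicator_nonneg (fun _ _ => by simp) _)
  rw [abs_of_nonneg h] at hτ ⊢
  rcases le_or_gt (A:ℝ) τ with h1 | h1
  · have := Z_bound τ A hA h1 hτ
    have h2 : ‖ds (Finset.Ico A (2*A)) τ‖ ≤ Real.sqrt (400*τ*(1+Real.log A)) := Real.le_sqrt_of_sq_le this
    linarith [Finset.sum_nonneg fun i (_ : i ∈ Finset.range (I+1)) => hnn i]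
  · have hs := Real.sqrt_nonneg (400*τ*(1+Real.log A))
    have key : ∃ i ∈ Finset.range (I+1), τ ≤ 2^i ∧ ‖ds (Finset.Ico A (2*A)) τ‖ ≤ 24*(A:ℝ)/2^i := by
      rcases le_or_gt τ 1 with h2 | h2
      · refine ⟨0, by simp, by simpa using h2, (ds_bound _ _).trans ?_⟩
        simp only [Nat.card_Ico, pow_zero, div_one]
        rw [show 2*A-A = A by omega]; linarith
      · have hex : ∃ i : ℕ, τ ≤ 2^i := ⟨I, by linarith⟩
        have hm := Nat.find_spec hex
        have hmin : Nat.find hex ≤ I := Nat.find_min' hex (by linarith)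
        set i := Nat.find hex
        have hi0 : i ≠ 0 := by intro h0; rw [h0] at hm; norm_num at hm; linarith
        have hl : (2:ℝ)^(i-1) < τ := by
          have := Nat.find_min hex (m := i-1) (by omega); linarith
        refine ⟨i, by simp; omega, hm, (KL_zeta τ A (2*A) hA (by linarith) h1.le).trans ?_⟩
        have e : (2:ℝ)^i = 2*2^(i-1) := by rw [← pow_succ']; congr 1; omega
        rw [div_le_div_iff₀ (by linarith) (by positivity), e]
        push_cast; nlinarith only [hl]
    obtain ⟨i, hi, h3, h4⟩ := key
    have := Finset.single_le_sum (fun i _ => hnn i) hi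
    rw [Set.indicator_of_mem (by simp [abs_of_nonneg h, h3]), Pi.one_apply, mul_one] at this
    linarith

lemma HM_B (η : ℝ) (hη : 0 < η) (A : ℕ) (hA : 1 ≤ A) (I : ℕ) (hI : (A:ℝ) ≤ 2^I) (T : ℝ) (hT : 2*T ≤ (A:ℝ)^2)
    (U : Set ℝ) (hU : MeasurableSet U) (hUT : ∀ t ∈ U, |t| ≤ T) (S : Finset ℕ) (hS : S ⊆ Finset.Ico A (2*A)) :
    ∫ t in U, ‖ds S t‖^2 ∂(gm η) ≤ S.card * (48*A*η*(I+1) + Real.sqrt (800*T*(1+Real.log A))*(gm η).real U) := by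
  have hlog : 0 ≤ Real.log A := Real.log_natCast_nonneg A
  apply HM ((gm η).restrict U) _ S hS _ (by positivity)
  filter_upwards [ae_restrict_mem hU] with s hs
  have hZs : Continuous fun t : ℝ => ‖ds (Finset.Ico A (2*A)) (t-s)‖ := ((ds_cont _).comp (by fun_prop)).norm
  have hind : ∀ i : ℕ, Integrable (fun t => 24*(A:ℝ)/2^i * (Metric.closedBall s (2^i)).indicator 1 t) (gm η) := fun i =>
    ((integrable_const 1).indicator Metric.isClosed_closedBall.measurableSet).const_mul _
  calc _ ≤ ∫ t in U, (∑ i ∈ Finset.range (I+1), 24*(A:ℝ)/2^i * (Metric.closedBall s (2^i)).indicator 1 t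
      + Real.sqrt (800*T*(1+Real.log A))) ∂(gm η) := by
        apply setIntegral_mono_on
        · exact int_cont _ _ hZs (Finset.Ico A (2*A)).card (fun t => by rw [Real.norm_of_nonneg (norm_nonneg _)]; exact ds_bound _ _)
        · exact ((integrable_finsetSum _ fun i _ => hind i).add (integrable_const _)).integrableOn
        · exact hU
        · intro t ht
          have h1 : |t-s| ≤ 2*T := by have := abs_sub t s; linarith [hUT t ht, hUT s hs]
          refine (Zb A hA (t-s) (h1.trans hT) I hI).trans ?_
          apply add_le_add
          · apply le_of_eq; apply Finset.sum_congr rfl; intro i _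
            congr 1; simp [Set.indicator_apply, Real.dist_eq]
          · apply Real.sqrt_le_sqrt; nlinarith only [hlog, h1]
    _ ≤ _ := by
        rw [integral_add ((integrable_finsetSum _ fun i _ => hind i).integrableOn) (integrable_const _)]
        apply add_le_add
        · calc _ ≤ ∫ t, (∑ i ∈ Finset.range (I+1), 24*(A:ℝ)/2^i * (Metric.closedBall s (2^i)).indicator 1 t) ∂(gm η) := by
                apply setIntegral_le_integral (integrable_finsetSum _ fun i _ => hind i)
                exact Filter.Eventually.of_forall fun t => Finset.sum_nonneg fun i _ => mul_nonneg (by positivity) (Set.indicator_nonneg (fun _ _ => by simp) _)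
            _ = ∑ i ∈ Finset.range (I+1), 24*(A:ℝ)/2^i * (gm η).real (Metric.closedBall s (2^i)) := by
                rw [integral_finsetSum _ fun i _ => hind i]
                apply Finset.sum_congr rfl; intro i _
                rw [integral_const_mul, integral_indicator_one Metric.isClosed_closedBall.measurableSet]
            _ ≤ ∑ i ∈ Finset.range (I+1), 48*A*η := by
                apply Finset.sum_le_sum; intro i _
                calc _ ≤ 24*(A:ℝ)/2^i*(2*2^i*η) := by gcongr; exact gm_Icc η hη s _ (by positivity)
                  _ = _ := by field_simp; ring
            _ = _ := by simp; ring
        · simp [Measure.real, mul_comm]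

noncomputable def om (P : Finset ℕ) (k : ℕ) : ℕ := ∑ p ∈ P, k.factorization p
lemma om_mul (P : Finset ℕ) (p m : ℕ) (hp : p ∈ P) (hp' : p.Prime) (hm : m ≠ 0) : om P (p*m) = om P m + 1 := by
  unfold om
  rw [Nat.factorization_mul hp'.ne_zero hm]
  simp only [Finsupp.add_apply, Finset.sum_add_distrib, hp'.factorization]
  rw [add_comm]; congr 1
  simp [Finsupp.single_apply, hp]
lemma om_card (P : Finset ℕ) (hP : ∀ p ∈ P, p.Prime) (k : ℕ) (hk : k ≠ 0) : (P.filter (fun p => p ∣ k)).card ≤ om P k := by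
  rw [Finset.card_filter]; unfold om
  apply Finset.sum_le_sum; intro p hp
  split_ifs with h
  · exact (hP p hp).factorization_pos_of_dvd hk h
  · simp
lemma mom_step (P : Finset ℕ) (hP : ∀ p ∈ P, p.Prime) (Q N : ℕ) (hQ : ∀ p ∈ P, p ≤ Q) (g : ℕ → ℝ) (hg : sup g N)
    (φ : ℕ → ℕ) : ∑ k ∈ Finset.Icc 1 (Q*N), (cv P (fun _ => g) k)^2 * φ (om P k) ≤
      P.card * ∑ m ∈ Finset.Icc 1 N, g m^2 * ((om P m + 1 : ℕ) * φ (om P m + 1)) := by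
  calc _ ≤ ∑ k ∈ Finset.Icc 1 (Q*N), ∑ p ∈ P.filter (fun p => p ∣ k), g (k/p)^2 * ((om P k:ℝ) * φ (om P k)) := by
        apply Finset.sum_le_sum; intro k hk
        rw [Finset.mem_Icc] at hk
        rw [← Finset.sum_mul]
        have h1 : (cv P (fun _ => g) k)^2 ≤ (P.filter (fun p => p ∣ k)).card * ∑ p ∈ P.filter (fun p => p ∣ k), g (k/p)^2 := sq_sum_le_card_mul_sum_sq
        have h2 : ((P.filter (fun p => p ∣ k)).card:ℝ) ≤ om P k := by exact_mod_cast om_card P hP k (by omega)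
        have h3 : 0 ≤ ∑ p ∈ P.filter (fun p => p ∣ k), g (k/p)^2 := Finset.sum_nonneg fun _ _ => sq_nonneg _
        calc _ ≤ ((om P k:ℝ) * ∑ p ∈ P.filter (fun p => p ∣ k), g (k/p)^2) * φ (om P k) := by gcongr; exact h1.trans (by gcongr)
          _ = _ := by ring
    _ = ∑ p ∈ P, ∑ k ∈ (Finset.Icc 1 (Q*N)).filter (fun k => p ∣ k), g (k/p)^2 * ((om P k:ℝ) * φ (om P k)) := by
        simp only [Finset.sum_filter]; rw [Finset.sum_comm]
    _ = ∑ p ∈ P, ∑ m ∈ Finset.Icc 1 N, g m^2 * ((om P m + 1 : ℕ) * φ (om P m + 1)) := by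
        apply Finset.sum_congr rfl; intro p hp
        have h1 := (hP p hp).one_lt.le
        rw [sum_dvd p _ h1]
        symm
        rw [Finset.sum_subset (Finset.Icc_subset_Icc_right (show N ≤ Q*N/p by rw [Nat.le_div_iff_mul_le h1]; nlinarith only [hQ, hp, hQ p hp]))]
        · apply Finset.sum_congr rfl; intro m hm
          rw [Finset.mem_Icc] at hm
          rw [Nat.mul_div_cancel_left _ h1, om_mul P p m hp (hP p hp) (by omega)]
        · intro m _ hm
          have : g m = 0 := by by_contra h0; exact hm (Finset.mem_Icc.2 (hg m h0))
          simp [this]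
    _ = _ := by rw [Finset.sum_const, nsmul_eq_mul]

lemma mom_iter (P : Finset ℕ) (hP : ∀ p ∈ P, p.Prime) (Q : ℕ) (hQ : ∀ p ∈ P, p ≤ Q) (ℓ : ℕ) : ∀ (N : ℕ) (g : ℕ → ℝ) (_ : sup g N),
    ∃ g', sup g' (Q^ℓ*N) ∧ (∀ t, ds P t^ℓ * dp N g t = dp (Q^ℓ*N) g' t) ∧ ∀ j,
      ∑ k ∈ Finset.Icc 1 (Q^ℓ*N), g' k^2 * ((om P k+1).ascFactorial j:ℕ) ≤ (P.card:ℝ)^ℓ * ∑ m ∈ Finset.Icc 1 N, g m^2 * ((om P m+1).ascFactorial (j+ℓ) : ℕ) := by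
  induction ℓ with
  | zero => intro N g hg; exact ⟨g, by simpa using hg, by simp, by simp⟩
  | succ ℓ ih =>
    intro N g hg
    obtain ⟨g', h1, h2, h3⟩ := ih N g hg
    have hP1 : ∀ p ∈ P, 1 ≤ p ∧ p ≤ Q := fun p hp => ⟨(hP p hp).one_lt.le, hQ p hp⟩
    have e : Q^(ℓ+1)*N = Q*(Q^ℓ*N) := by rw [pow_succ']; ring
    rw [e]
    refine ⟨cv P (fun _ => g'), cv_sup P _ _ _ hP1 (fun _ _ => h1), fun t => ?_, fun j => ?_⟩
    · rw [← dp_conv P _ _ _ hP1 (fun _ _ => h1), ← Finset.sum_mul, ← h2, pow_succ']; unfold ds; ring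
    · refine (mom_step P hP Q _ hQ g' h1 (fun n => (n+1).ascFactorial j)).trans ?_
      rw [pow_succ', mul_assoc]
      apply mul_le_mul_of_nonneg_left _ (Nat.cast_nonneg _)
      refine le_trans (le_of_eq ?_) ((h3 (j+1)).trans (le_of_eq ?_))
      · apply Finset.sum_congr rfl; intro k _
        congr 1; rw [← Nat.cast_mul]; congr 1
        rw [Nat.succ_ascFactorial, Nat.ascFactorial_succ]
      · rw [show j+1+ℓ = j+(ℓ+1) by ring]

lemma two_om (A : ℝ) (hA : 4 ≤ A) (P : Finset ℕ) : (∀ p ∈ P, p.Prime ∧ A ≤ p) → ∀ N : ℕ,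
    ∑ m ∈ Finset.Icc 1 N, (2:ℝ)^(om P m) ≤ Real.exp (4/A)^P.card * N := by
  induction P using Finset.induction_on with
  | empty => intro _ N; simp [om]
  | insert p P hpP ih =>
    intro hP N
    have ih := ih (fun q hq => hP q (Finset.mem_insert_of_mem hq))
    obtain ⟨hp, hpA⟩ := hP p (Finset.mem_insert_self _ _)
    rw [Finset.card_insert_of_notMem hpP, pow_succ]
    set c := Real.exp (4/A)^P.card
    have hc : 0 < c := by positivity
    have he : 1 + 4/A ≤ Real.exp (4/A) := by linarith [Real.add_one_le_exp (4/A)]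
    induction N using Nat.strong_induction_on with
    | _ N ihN =>
      rcases Nat.eq_zero_or_pos N with h0 | h0
      · simp [h0]
      rw [← Finset.sum_filter_add_sum_filter_not (Finset.Icc 1 N) (fun k => p ∣ k), sum_dvd p _ hp.one_lt.le]
      have a1 : ∑ m ∈ Finset.Icc 1 (N/p), (2:ℝ)^(om (insert p P) (p*m)) ≤ 2*(c*Real.exp (4/A)*(N/p)) := by
        calc _ = ∑ m ∈ Finset.Icc 1 (N/p), 2*(2:ℝ)^(om (insert p P) m) := by
              apply Finset.sum_congr rfl; intro m hm
              rw [Finset.mem_Icc] at hm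
              rw [om_mul _ p m (Finset.mem_insert_self _ _) hp (by omega), pow_succ']
          _ ≤ 2*(c*Real.exp (4/A)*((N/p:ℕ):ℝ)) := by
              rw [← Finset.mul_sum]; gcongr; exact ihN (N/p) (Nat.div_lt_self h0 hp.one_lt)
          _ ≤ _ := by gcongr; exact Nat.cast_div_le
      have a2 : ∑ m ∈ (Finset.Icc 1 N).filter (fun k => ¬ p ∣ k), (2:ℝ)^(om (insert p P) m) ≤ c*N := by
        refine le_trans ?_ (ih N)
        calc _ = ∑ m ∈ (Finset.Icc 1 N).filter (fun k => ¬ p ∣ k), (2:ℝ)^(om P m) := by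
              apply Finset.sum_congr rfl; intro m hm
              simp only [Finset.mem_filter] at hm
              unfold om; rw [Finset.sum_insert hpP, Nat.factorization_eq_zero_of_not_dvd hm.2, zero_add]
          _ ≤ _ := Finset.sum_le_sum_of_subset_of_nonneg (Finset.filter_subset _ _) (fun _ _ _ => by positivity)
      refine (add_le_add a1 a2).trans ?_
      have hp0 : (0:ℝ) < p := by linarith
      have hN : (0:ℝ) ≤ N := by positivity
      have h1 : 1 ≤ Real.exp (4/A) * (1-2/p) := by
        have b1 : 1 - 2/A ≤ 1 - 2/(p:ℝ) := by gcongr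
        have b2 : 0 ≤ 1 - 2/A := by rw [sub_nonneg, div_le_one (by linarith)]; linarith
        calc (1:ℝ) ≤ (1+4/A)*(1-2/A) := by
              have : (1+4/A)*(1-2/A) = 1 + 2*(A-4)/A^2 := by field_simp; ring
              rw [this]; have : 0 ≤ 2*(A-4)/A^2 := div_nonneg (by linarith) (by positivity)
              linarith only [this]
          _ ≤ _ := by gcongr
      calc _ = c*N*(1 + Real.exp (4/A)*(2/p)) := by ring
        _ ≤ c*N*(Real.exp (4/A)) := by gcongr; nlinarith only [h1]
        _ = _ := by ring

lemma mom (η : ℝ) (hη : 0 < η) (A : ℕ) (hA : 4 ≤ A) (P : Finset ℕ) (hP : ∀ p ∈ P, p.Prime ∧ A ≤ p ∧ p ≤ 4*A)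
    (N : ℕ) (hN : 1 ≤ N) (g : ℕ → ℝ) (hg : sup g N) (hg1 : ∀ n, |g n| ≤ 1) (ℓ : ℕ) (V : ℝ) (hV : 0 < V) (U : Set ℝ) (hU : MeasurableSet U)
    (hUV : ∀ t ∈ U, V ≤ ‖ds P t‖) : ∫ t in U, ‖dp N g t‖^2 ∂(gm η) ≤
      2^26*(1+η*((4*A)^ℓ*N)) * N * (2*ℓ*P.card/V^2)^ℓ := by
  obtain ⟨g', h1, h2, h3⟩ := mom_iter P (fun p hp => (hP p hp).1) (4*A) (fun p hp => (hP p hp).2.2) ℓ N g hg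
  have hcard : P.card ≤ 4*A := by
    have : P ⊆ Finset.Icc A (4*A) := fun p hp => by simp [hP p hp]
    have := Finset.card_le_card this
    rw [Nat.card_Icc] at this; omega
  have hA' : (4:ℝ) ≤ A := by exact_mod_cast hA
  have e1 : ∑ m ∈ Finset.Icc 1 N, g m^2 * ((om P m+1).ascFactorial (0+ℓ) : ℕ) ≤ ℓ^ℓ*2^ℓ*(2^24*N) := by
    calc _ ≤ ∑ m ∈ Finset.Icc 1 N, (ℓ^ℓ*2^ℓ*2^(om P m):ℝ) := by
          apply Finset.sum_le_sum; intro m _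
          have b1 : g m^2 ≤ 1 := by rw [sq_le_one_iff_abs_le_one]; exact hg1 m
          have b2 : (om P m+1).ascFactorial (0+ℓ) ≤ ℓ^ℓ*2^ℓ*2^(om P m) := by
            rw [zero_add, Nat.ascFactorial_eq_factorial_mul_choose, mul_assoc, ← pow_add, add_comm ℓ]
            exact Nat.mul_le_mul (Nat.factorial_le_pow ℓ) (Nat.choose_le_two_pow _ _)
          have b3 : (((om P m+1).ascFactorial (0+ℓ):ℕ):ℝ) ≤ ℓ^ℓ*2^ℓ*2^(om P m) := by exact_mod_cast b2
          nlinarith only [b1, b3, sq_nonneg (g m), Nat.cast_nonneg (α := ℝ) ((om P m+1).ascFactorial (0+ℓ))]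
      _ ≤ _ := by
          rw [← Finset.mul_sum]; gcongr
          refine (two_om A hA' P (fun p hp => ⟨(hP p hp).1, by exact_mod_cast (hP p hp).2.1⟩) N).trans ?_
          gcongr
          calc Real.exp (4/A)^P.card ≤ Real.exp (4/A)^(4*A) := pow_le_pow_right₀ (Real.one_le_exp (by positivity)) hcard
            _ = Real.exp 1^16 := by rw [← Real.exp_nat_mul, ← Real.exp_nat_mul]; congr 1; push_cast; field_simp; ring
            _ ≤ 2.7182818286^16 := by gcongr; exact Real.exp_one_lt_d9.le
            _ ≤ _ := by norm_num
  have e2 := h3 0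
  simp only [Nat.ascFactorial_zero, Nat.cast_one, mul_one] at e2
  have hM := MV η hη ((4*A)^ℓ*N) (Nat.mul_pos (by positivity) hN) g'
  have hint : Integrable (fun t => ‖dp ((4*A)^ℓ*N) g' t‖^2) (gm η) := int_cont _ _ ((dp_cont _ _).norm.pow 2) ((∑ n ∈ Finset.Icc 1 ((4*A)^ℓ*N), |g' n|)^2) (fun t => by
    rw [Real.norm_of_nonneg (by positivity)]; gcongr; exact dp_bound _ _ _)
  have hint' : Integrable (fun t => ‖dp N g t‖^2) (gm η) := int_cont _ _ ((dp_cont _ _).norm.pow 2) ((∑ n ∈ Finset.Icc 1 N, |g n|)^2) (fun t => by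
    rw [Real.norm_of_nonneg (by positivity)]; gcongr; exact dp_bound _ _ _)
  have e3 : (V^2)^ℓ * ∫ t in U, ‖dp N g t‖^2 ∂(gm η) ≤ ∫ t, ‖dp ((4*A)^ℓ*N) g' t‖^2 ∂(gm η) := by
    rw [← integral_const_mul]
    refine le_trans (setIntegral_mono_on (hint'.const_mul _).integrableOn hint.integrableOn hU fun t ht => ?_)
      (setIntegral_le_integral hint (Filter.Eventually.of_forall fun t => sq_nonneg _))
    rw [← h2, norm_mul, mul_pow, norm_pow, ← pow_mul, ← pow_mul, mul_comm ℓ 2]; gcongr; exact hUV t ht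
  have hVp : 0 < (V^2)^ℓ := by positivity
  rw [← mul_le_mul_iff_right₀ hVp]
  refine e3.trans (hM.trans ?_)
  calc _ ≤ 4*(1+η*(((4*A)^ℓ*N:ℕ):ℝ)) * ((P.card:ℝ)^ℓ*(ℓ^ℓ*2^ℓ*(2^24*N))) := by
        gcongr; exact e2.trans (by gcongr)
    _ = _ := by push_cast; rw [div_pow, mul_pow (2*(ℓ:ℝ)), mul_pow (2:ℝ)]; generalize (V^2)^ℓ = W at *; field_simp; ring

noncomputable def wD (D : Finset ℕ) (m : ℕ) : ℕ := (D.filter (fun p => p ∣ m)).card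
noncomputable def rb (D : Finset ℕ) (G : ℕ → Prop) (m : ℕ) : ℝ := if ∃ p ∈ D, ¬ p ∣ m ∧ G (p*m) then 1/((wD D m:ℝ)+1) else 0
lemma rb_nonneg (D G m) : 0 ≤ rb D G m := by unfold rb; split_ifs <;> positivity
lemma rb_le (D G m) : rb D G m ≤ 1/((wD D m:ℝ)+1) := by unfold rb; split_ifs; exacts [le_rfl, by positivity]
lemma rb_le_one (D G m) : rb D G m ≤ 1 := (rb_le D G m).trans (by rw [div_le_one (by positivity)]; linarith [Nat.cast_nonneg (α := ℝ) (wD D m)])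
lemma rb_sum_le (D : Finset ℕ) (hD : ∀ p ∈ D, p.Prime) (G : ℕ → Prop) (k : ℕ) :
    ∑ p ∈ D.filter (fun p => p ∣ k), rb D G (k/p) ≤ 1 := by
  rcases Nat.eq_zero_or_pos (wD D k) with h | h
  · rw [wD, Finset.card_eq_zero] at h; simp [h]
  calc _ ≤ ∑ p ∈ D.filter (fun p => p ∣ k), 1/(wD D k:ℝ) := by
        apply Finset.sum_le_sum; intro p hp
        simp only [Finset.mem_filter] at hp
        refine (rb_le _ _ _).trans ?_
        have : wD D k ≤ wD D (k/p) + 1 := by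
          unfold wD
          refine (Finset.card_le_card (t := insert p (D.filter (fun q => q ∣ k/p))) ?_).trans (Finset.card_insert_le _ _)
          intro q hq
          simp only [Finset.mem_filter, Finset.mem_insert] at hq ⊢
          by_cases hqp : q = p
          · exact Or.inl hqp
          · right; refine ⟨hq.1, ?_⟩
            obtain ⟨m, rfl⟩ := hp.2
            rw [Nat.mul_div_cancel_left _ (hD p hp.1).pos]
            exact (Nat.Coprime.dvd_mul_left ((Nat.coprime_primes (hD q hq.1) (hD p hp.1)).2 hqp)).1 hq.2
        have h1 : (wD D k:ℝ) ≤ wD D (k/p) + 1 := by exact_mod_cast this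
        have h2 : (0:ℝ) < wD D k := by exact_mod_cast h
        gcongr
    _ = 1 := by rw [Finset.sum_const, nsmul_eq_mul]; unfold wD at h ⊢; field_simp
lemma rb_sum_eq (D : Finset ℕ) (hD : ∀ p ∈ D, p.Prime) (G : ℕ → Prop) (H1 : ∀ n, G n → ∃ p ∈ D, p ∣ n)
    (H2 : ∀ p ∈ D, ∀ p' ∈ D, ∀ m, ¬ p ∣ m → ¬ p' ∣ m → G (p*m) → G (p'*m)) (k : ℕ) (hk : ∀ p ∈ D, ¬ p^2 ∣ k) :
    ∑ p ∈ D.filter (fun p => p ∣ k), rb D G (k/p) = if G k then 1 else 0 := by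
  have key : ∀ p ∈ D.filter (fun p => p ∣ k), rb D G (k/p) = if G k then 1/(wD D k:ℝ) else 0 := by
    intro p hp
    simp only [Finset.mem_filter] at hp
    obtain ⟨hpD, m, rfl⟩ := hp
    have hpm : ¬ p ∣ m := fun h => hk p hpD (by rw [pow_two]; exact mul_dvd_mul_left p h)
    rw [Nat.mul_div_cancel_left _ (hD p hpD).pos]
    have hw : wD D (p*m) = wD D m + 1 := by
      unfold wD
      rw [← Finset.card_insert_of_notMem (a := p) (s := D.filter (fun q => q ∣ m)) (by simp [hpm])]
      congr 1; ext q
      simp only [Finset.mem_filter, Finset.mem_insert]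
      constructor
      · rintro ⟨hq, h⟩
        by_cases hqp : q = p
        · exact Or.inl hqp
        · exact Or.inr ⟨hq, (Nat.Coprime.dvd_mul_left ((Nat.coprime_primes (hD q hq) (hD p hpD)).2 hqp)).1 h⟩
      · rintro (rfl | ⟨hq, h⟩)
        · exact ⟨hpD, dvd_mul_right _ _⟩
        · exact ⟨hq, h.mul_left p⟩
    rw [rb, hw]
    have : (∃ q ∈ D, ¬ q ∣ m ∧ G (q*m)) ↔ G (p*m) :=
      ⟨fun ⟨q, hq, h1, h2⟩ => H2 q hq p hpD m h1 hpm h2, fun h => ⟨p, hpD, hpm, h⟩⟩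
    simp only [this]; push_cast; rfl
  rw [Finset.sum_congr rfl key, Finset.sum_const, nsmul_eq_mul]
  split_ifs with h
  · obtain ⟨p, hp, hpk⟩ := H1 k h
    have : (D.filter (fun p => p ∣ k)).card ≠ 0 := Finset.card_ne_zero_of_mem (a := p) (by simp [hp, hpk])
    have : ((D.filter (fun p => p ∣ k)).card:ℝ) ≠ 0 := by exact_mod_cast this
    unfold wD; field_simp
  · simp

noncomputable def vv (K : ℝ) (p : ℕ) : ℕ := ⌊K*Real.log p⌋₊
noncomputable def pc (D : Finset ℕ) (K : ℝ) (v : ℕ) : Finset ℕ := D.filter (fun p => vv K p = v)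
lemma vv_bd (K : ℝ) (hK : 0 < K) (p : ℕ) (hp : 1 ≤ p) : Real.exp (vv K p/K) ≤ p ∧ (p:ℝ) < Real.exp ((vv K p+1)/K) := by
  have hp' : (0:ℝ) < p := by exact_mod_cast hp
  have h0 : 0 ≤ K*Real.log p := mul_nonneg hK.le (Real.log_natCast_nonneg p)
  have h1 := Nat.floor_le h0
  have h2 := Nat.lt_floor_add_one (K*Real.log p)
  unfold vv
  constructor
  · rw [← Real.le_log_iff_exp_le hp', div_le_iff₀ hK]; linarith
  · rw [← Real.log_lt_iff_lt_exp hp', lt_div_iff₀ hK]; linarith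

lemma card_real_Ico (s : Finset ℕ) (a b : ℝ) (ha : 0 ≤ a) (hab : a ≤ b) (h : ∀ n ∈ s, a ≤ (n:ℝ) ∧ (n:ℝ) < b) : (s.card:ℝ) ≤ b - a + 1 := by
  have : s ⊆ Finset.Ico ⌈a⌉₊ ⌈b⌉₊ := fun n hn => by
    rw [Finset.mem_Ico, Nat.ceil_le, Nat.lt_ceil]; exact h n hn
  have h1 := Finset.card_le_card this
  rw [Nat.card_Ico] at h1
  have h2 : (s.card:ℝ) ≤ (⌈b⌉₊:ℝ) - ⌈a⌉₊ := by
    have : s.card + ⌈a⌉₊ ≤ ⌈b⌉₊ := by have := Nat.ceil_mono hab; omega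
    have : (s.card:ℝ) + ⌈a⌉₊ ≤ ⌈b⌉₊ := by exact_mod_cast this
    linarith
  linarith [Nat.le_ceil a, Nat.ceil_lt_add_one (ha.trans hab)]

lemma sum_inv_sq (D : Finset ℕ) (H : ℕ) (hH : 2 ≤ H) (hD : ∀ p ∈ D, H ≤ p) : ∑ p ∈ D, 1/(p:ℝ)^2 ≤ (2:ℝ)/(H:ℝ) := by
  have : ∀ M, H ≤ M → ∑ p ∈ Finset.Ico H M, 1/(p:ℝ)^2 ≤ 1/((H:ℝ)-1) - 1/((M:ℝ)-1) := by
    intro M hM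
    induction M, hM using Nat.le_induction with
    | base => simp
    | succ M hM ih =>
      rw [Finset.sum_Ico_succ_top hM]
      have hM' : (2:ℝ) ≤ M := by exact_mod_cast hH.trans hM
      have : 1/(M:ℝ)^2 ≤ 1/((M:ℝ)-1) - 1/M := by
        rw [div_sub_div _ _ (by linarith) (by linarith), div_le_div_iff₀ (by positivity) (by nlinarith)]; nlinarith
      push_cast; rw [add_sub_cancel_right]; linarith
  have hH' : (2:ℝ) ≤ H := by exact_mod_cast hH
  have h1 : D ⊆ Finset.Ico H (H + (D.sup id + 1)) := fun p hp => by
    have := Finset.le_sup (f := id) hp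
    rw [Finset.mem_Ico]; exact ⟨hD p hp, by simp only [id] at this; omega⟩
  calc _ ≤ _ := Finset.sum_le_sum_of_subset_of_nonneg h1 (fun _ _ _ => by positivity)
    _ ≤ _ := this _ (by omega)
    _ ≤ 1/((H:ℝ)-1) := by
        have : 0 ≤ 1/(((H+(D.sup id+1):ℕ):ℝ)-1) := by
          apply div_nonneg zero_le_one; push_cast
          have : (0:ℝ) ≤ ((D.sup id : ℕ):ℝ) := Nat.cast_nonneg _
          linarith
        linarith
    _ ≤ _ := by rw [div_le_div_iff₀ (by linarith) (by linarith)]; linarith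

lemma step (η : ℝ) (hη : 0 < η) (N : ℕ) (hN : 1 ≤ N) (D : Finset ℕ) (H : ℕ) (hH : 2 ≤ H) (hD : ∀ p ∈ D, p.Prime ∧ H ≤ p)
    (G : ℕ → Prop) (H1 : ∀ n, G n → ∃ p ∈ D, p ∣ n)
    (H2 : ∀ p ∈ D, ∀ p' ∈ D, ∀ m, ¬ p ∣ m → ¬ p' ∣ m → G (p*m) → G (p'*m)) (K : ℝ) (hK : 2 ≤ K)
    (U : Set ℝ) (hU : MeasurableSet U) (V W : ℕ → ℝ) (hV : ∀ t ∈ U, ∀ v ∈ D.image (vv K), ‖ds (pc D K v) t‖ ≤ V v)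
    (hW : ∀ v ∈ D.image (vv K), ∀ g, sup g ⌊2*N/Real.exp (v/K)⌋₊ → (∀ n, |g n| ≤ 1) → ∫ t in U, ‖dp ⌊2*N/Real.exp (v/K)⌋₊ g t‖^2 ∂(gm η) ≤ W v) :
    ∫ t in U, ‖dp (2*N) (fun n => if N ≤ n ∧ n < 2*N ∧ G n then 1 else 0) t‖^2 ∂(gm η) ≤
      2*((D.image (vv K)).card*∑ v ∈ D.image (vv K), V v^2*W v) + 8*(1+4*η*N)*(6*N/K+8*N/H+2) := by
  set f : ℕ → ℝ := fun n => if N ≤ n ∧ n < 2*N ∧ G n then 1 else 0 with hf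
  set I := D.image (vv K)
  have hK0 : 0 < K := by linarith
  have hN' : (1:ℝ) ≤ N := by exact_mod_cast hN
  set g : ℕ → ℕ → ℝ := fun v m => if N/Real.exp (v/K) ≤ m ∧ (m:ℝ) < 2*N/Real.exp (v/K) then rb D G m else 0 with hg
  have hg1 : ∀ v n, |g v n| ≤ 1 := by
    intro v n; simp only [hg]; split_ifs
    · rw [abs_of_nonneg (rb_nonneg _ _ _)]; exact rb_le_one _ _ _
    · simp
  have hgs : ∀ v, sup (g v) ⌊2*N/Real.exp (v/K)⌋₊ := by
    intro v n hn
    have : N/Real.exp (v/K) ≤ n ∧ (n:ℝ) < 2*N/Real.exp (v/K) := by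
      by_contra h; simp only [hg, if_neg h] at hn; exact hn rfl
    have h0 : (0:ℝ) < N/Real.exp (v/K) := by positivity
    exact ⟨by have : (0:ℝ) < n := by linarith [this.1]
              exact_mod_cast this, Nat.le_floor this.2.le⟩
  have hfl : ∀ v : ℕ, ⌊2*N/Real.exp (v/K)⌋₊ ≤ 2*N := by
    intro v; apply Nat.floor_le_of_le; push_cast
    apply div_le_self (by positivity); exact Real.one_le_exp (by positivity)
  have hgs2 : ∀ v, sup (g v) (2*N) := fun v n hn => ⟨(hgs v n hn).1, (hgs v n hn).2.trans (hfl v)⟩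
  set Q := D.sup id + 2
  have hQ : ∀ p ∈ D, 1 ≤ p ∧ p ≤ Q := fun p hp => ⟨(hD p hp).1.one_lt.le, by
    have := Finset.le_sup (f := id) hp; simp only [id] at this; omega⟩
  set c := cv D (fun p => g (vv K p)) with hc
  have hmain : ∀ t, ∑ v ∈ I, ds (pc D K v) t * dp ⌊2*N/Real.exp (v/K)⌋₊ (g v) t = dp (Q*(2*N)) c t := by
    intro t
    rw [← dp_conv D _ _ _ hQ (fun p _ => hgs2 _) t]
    rw [← Finset.sum_fiberwise_of_maps_to (g := vv K) (t := I) (fun p hp => Finset.mem_image_of_mem _ hp)]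
    apply Finset.sum_congr rfl; intro v _
    unfold ds pc; rw [Finset.sum_mul]
    apply Finset.sum_congr rfl; intro p hp
    simp only [Finset.mem_filter] at hp
    rw [hp.2, dp_mono (hgs v) (hfl v)]
  have hc0 : ∀ k, 0 ≤ c k := fun k => Finset.sum_nonneg fun p _ => by
    simp only [hg]; split_ifs; exacts [rb_nonneg _ _ _, le_rfl]
  have hc1 : ∀ k, c k ≤ 1 := fun k => by
    refine le_trans (Finset.sum_le_sum fun p _ => ?_) (rb_sum_le D (fun p hp => (hD p hp).1) G k)
    simp only [hg]; split_ifs; exacts [le_rfl, rb_nonneg _ _ _]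
  set e : ℕ → ℝ := fun k => f k - c k with he
  have hf01 : ∀ k, 0 ≤ f k ∧ f k ≤ 1 := fun k => by simp only [hf]; split_ifs <;> norm_num
  have he1 : ∀ k, |e k| ≤ 1 := fun k => by
    rw [abs_le]; simp only [he]; constructor <;> linarith [hc0 k, hc1 k, (hf01 k).1, (hf01 k).2]
  set E1 := Real.exp (1/K) with hE1
  have hE : 1 ≤ E1 ∧ E1 ≤ 1 + 2/K := by
    refine ⟨Real.one_le_exp (by positivity), ?_⟩
    have h1 : |1/K| ≤ 1 := by rw [abs_of_pos (by positivity), div_le_one hK0]; linarith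
    have := Real.abs_exp_sub_one_le h1
    rw [abs_of_pos (by positivity : 0 < 1/K)] at this
    have := (abs_le.1 this).2
    rw [show 2/K = 2*(1/K) by ring]; linarith
  have h2K : 2/K ≤ 1 := by rw [div_le_one hK0]; exact hK
  have hloc : ∀ p ∈ D, ∀ m : ℕ, g (vv K p) m ≠ 0 → (N:ℝ) ≤ (p*m:ℕ) ∧ ((p*m:ℕ):ℝ) < 2*N*E1 := by
    intro p hp m hm
    have h : N/Real.exp (vv K p/K) ≤ m ∧ (m:ℝ) < 2*N/Real.exp (vv K p/K) := by
      by_contra h; simp only [hg, if_neg h] at hm; exact hm rfl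
    obtain ⟨b1, b2⟩ := vv_bd K hK0 p (hQ p hp).1
    rw [div_le_iff₀ (Real.exp_pos _), lt_div_iff₀ (Real.exp_pos _)] at h
    rw [add_div, Real.exp_add] at b2
    push_cast
    have hm0 : (0:ℝ) ≤ m := Nat.cast_nonneg m
    constructor
    · nlinarith only [h.1, b1, hm0]
    · nlinarith only [h.2, b2, hm0, hE.1, Real.exp_pos ((vv K p:ℝ)/K), mul_le_mul_of_nonneg_left b2.le hm0, mul_lt_mul_of_pos_right h.2 (by linarith : 0 < E1)]
  set B1 := (Finset.Icc 1 (4*N)).filter (fun k : ℕ => (N:ℝ) ≤ k ∧ (k:ℝ) < N*E1)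
  set B2 := (Finset.Icc 1 (4*N)).filter (fun k : ℕ => (2*N:ℝ) ≤ k ∧ (k:ℝ) < 2*N*E1)
  set B3 := D.biUnion (fun p => (Finset.Icc 1 (4*N)).filter (fun k => p^2 ∣ k))
  have hes : ∀ k, e k ≠ 0 → k ∈ B1 ∪ B2 ∪ B3 := by
    intro k hk
    have hr : (N:ℝ) ≤ k ∧ (k:ℝ) < 2*N*E1 := by
      by_cases hf0 : f k = 0
      · have hck : c k ≠ 0 := by intro h; simp [he, hf0, h] at hk
        obtain ⟨p, hp, h⟩ := Finset.exists_ne_zero_of_sum_ne_zero hck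
        simp only [Finset.mem_filter] at hp
        obtain ⟨hp, m, rfl⟩ := hp
        rw [Nat.mul_div_cancel_left _ (hQ p hp).1] at h
        exact hloc p hp m h
      · have : N ≤ k ∧ k < 2*N ∧ G k := by by_contra h; simp only [hf, if_neg h] at hf0; exact hf0 trivial
        refine ⟨by exact_mod_cast this.1, ?_⟩
        have : (k:ℝ) < 2*N := by exact_mod_cast this.2.1
        nlinarith only [this, hE.1, hN']
    have hk4 : k ∈ Finset.Icc 1 (4*N) := by
      rw [Finset.mem_Icc]; constructor
      · have : (1:ℝ) ≤ k := by linarith [hr.1]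
        exact_mod_cast this
      · have : (k:ℝ) ≤ 4*N := by nlinarith only [hr.2, hE.2, hN', h2K]
        exact_mod_cast this
    by_contra hcon
    simp only [Finset.mem_union, not_or, B1, B2, B3, Finset.mem_filter, hk4, true_and, Finset.mem_biUnion, not_and, not_lt, not_exists] at hcon
    obtain ⟨⟨q1, q2⟩, q3⟩ := hcon
    have r1 := q1 hr.1
    have r2 : (k:ℝ) < 2*N := by by_contra h; have := q2 (by linarith); linarith [hr.2]
    apply hk
    have hfk : f k = if G k then 1 else 0 := by
      have a1 : N ≤ k := by exact_mod_cast hr.1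
      have a2 : k < 2*N := by exact_mod_cast r2
      simp [hf, a1, a2]
    have hck : c k = if G k then 1 else 0 := by
      rw [← rb_sum_eq D (fun p hp => (hD p hp).1) G H1 H2 k (fun p hp => q3 p hp)]
      apply Finset.sum_congr rfl; intro p hp
      simp only [Finset.mem_filter] at hp
      obtain ⟨hp, m, rfl⟩ := hp
      rw [Nat.mul_div_cancel_left _ (hQ p hp).1]
      obtain ⟨b1, b2⟩ := vv_bd K hK0 p (hQ p hp).1
      rw [add_div, Real.exp_add] at b2
      push_cast at r1 r2
      have hm0 : (0:ℝ) ≤ m := Nat.cast_nonneg m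
      have : N/Real.exp (vv K p/K) ≤ m ∧ (m:ℝ) < 2*N/Real.exp (vv K p/K) := by
        rw [div_le_iff₀ (Real.exp_pos _), lt_div_iff₀ (Real.exp_pos _)]
        constructor
        · have : (N:ℝ)*E1 ≤ (m*Real.exp (vv K p/K))*E1 := by nlinarith only [r1, mul_le_mul_of_nonneg_left b2.le hm0]
          exact le_of_mul_le_mul_right this (by linarith)
        · nlinarith only [r2, b1, hm0]
      simp only [hg, if_pos this]
    simp only [he, hfk, hck, sub_self]
  have hcard : ((B1 ∪ B2 ∪ B3).card:ℝ) ≤ 6*N/K+8*N/H+2 := by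
    have c1 : (B1.card:ℝ) ≤ N*E1 - N + 1 := card_real_Ico _ _ _ (by positivity) (by nlinarith only [hE.1, hN']) (fun n hn => by simp only [B1, Finset.mem_filter] at hn; exact hn.2)
    have c2 : (B2.card:ℝ) ≤ 2*N*E1 - 2*N + 1 := card_real_Ico _ _ _ (by positivity) (by nlinarith only [hE.1, hN']) (fun n hn => by simp only [B2, Finset.mem_filter] at hn; exact hn.2)
    have c3 : (B3.card:ℝ) ≤ 8*N/H := by
      calc (B3.card:ℝ) ≤ ∑ p ∈ D, (((Finset.Icc 1 (4*N)).filter (fun k => p^2 ∣ k)).card:ℝ) := by exact_mod_cast Finset.card_biUnion_le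
        _ ≤ ∑ p ∈ D, 4*N*(1/(p:ℝ)^2) := by
            apply Finset.sum_le_sum; intro p hp
            have : ((Finset.Icc 1 (4*N)).filter (fun k => p^2 ∣ k)).card = 4*N/p^2 := by
              rw [Finset.card_eq_sum_ones, sum_dvd (p^2) _ (Nat.pow_pos (hQ p hp).1)]; simp
            rw [this]; refine Nat.cast_div_le.trans (le_of_eq ?_); push_cast; ring
        _ ≤ 4*N*(2/H) := by rw [← Finset.mul_sum]; gcongr; exact sum_inv_sq D H hH (fun p hp => (hD p hp).2)
        _ = _ := by ring
    have c4 : ((B1 ∪ B2 ∪ B3).card:ℝ) ≤ B1.card + B2.card + B3.card := by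
      exact_mod_cast (Finset.card_union_le _ _).trans (Nat.add_le_add_right (Finset.card_union_le _ _) _)
    have c5 : (N:ℝ)*E1 ≤ N*(1+2/K) := by gcongr; exact hE.2
    have c6 : 6*(N:ℝ)/K = 3*(N*(2/K)) := by ring
    rw [c6]; linarith only [c1, c2, c3, c4, c5]
  have hsub : B1 ∪ B2 ∪ B3 ⊆ Finset.Icc 1 (4*N) := by
    intro k hk; simp only [B1, B2, B3, Finset.mem_union, Finset.mem_biUnion, Finset.mem_filter] at hk
    rcases hk with (hk | hk) | ⟨p, _, hk⟩ <;> exact hk.1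
  have hesup : sup e (4*N) := fun k hk => Finset.mem_Icc.1 (hsub (hes k hk))
  have hEint : ∫ t, ‖dp (4*N) e t‖^2 ∂(gm η) ≤ 4*(1+4*η*N)*(6*N/K+8*N/H+2) := by
    refine (MV η hη (4*N) (by omega) e).trans ?_
    have : ∑ n ∈ Finset.Icc 1 (4*N), e n^2 ≤ (B1 ∪ B2 ∪ B3).card := by
      rw [← Finset.sum_subset hsub (fun k _ hk => by
        have : e k = 0 := by by_contra h; exact hk (hes k h)
        simp [this])]
      calc _ ≤ ∑ n ∈ B1 ∪ B2 ∪ B3, (1:ℝ) := Finset.sum_le_sum fun n _ => by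
            rw [sq_le_one_iff_abs_le_one]; exact he1 n
        _ = _ := by simp
    push_cast
    rw [show η*(4*(N:ℝ)) = 4*η*N by ring]
    gcongr; exact this.trans hcard
  have hdec : ∀ t, dp (2*N) f t = ∑ v ∈ I, ds (pc D K v) t * dp ⌊2*N/Real.exp (v/K)⌋₊ (g v) t + dp (4*N) e t := by
    intro t
    have fs : sup f (2*N) := by
      intro k hk
      have : N ≤ k ∧ k < 2*N ∧ G k := by by_contra h; simp only [hf, if_neg h] at hk; exact hk rfl
      omega
    have cs : sup c (Q*(2*N)) := cv_sup D _ _ _ hQ (fun p _ => hgs2 _)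
    rw [hmain, ← dp_mono fs (show 2*N ≤ Q*(2*N)+4*N by omega), ← dp_mono cs (show Q*(2*N) ≤ Q*(2*N)+4*N by omega),
      ← dp_mono hesup (show 4*N ≤ Q*(2*N)+4*N by omega)]
    unfold dp; rw [← Finset.sum_add_distrib]; apply Finset.sum_congr rfl; intro k _
    simp only [he]; push_cast; ring
  have hIg : ∀ (M : ℕ) (a : ℕ → ℝ), Integrable (fun t => ‖dp M a t‖^2) (gm η) := fun M a =>
    int_cont _ _ ((dp_cont _ _).norm.pow 2) ((∑ n ∈ Finset.Icc 1 M, |a n|)^2) (fun t => by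
      rw [Real.norm_of_nonneg (by positivity)]; gcongr; exact dp_bound _ _ _)
  calc _ ≤ ∫ t in U, (2*(I.card*∑ v ∈ I, V v^2*‖dp ⌊2*N/Real.exp (v/K)⌋₊ (g v) t‖^2) + 2*‖dp (4*N) e t‖^2) ∂(gm η) := by
        apply setIntegral_mono_on (hIg _ _).integrableOn _ hU
        · intro t ht
          rw [hdec]
          have a1 : ‖∑ v ∈ I, ds (pc D K v) t * dp ⌊2*N/Real.exp (v/K)⌋₊ (g v) t‖^2 ≤ I.card*∑ v ∈ I, V v^2*‖dp ⌊2*N/Real.exp (v/K)⌋₊ (g v) t‖^2 := by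
            calc _ ≤ (∑ v ∈ I, V v*‖dp ⌊2*N/Real.exp (v/K)⌋₊ (g v) t‖)^2 := by
                  gcongr; refine (norm_sum_le _ _).trans (Finset.sum_le_sum fun v hv => ?_)
                  rw [norm_mul]; gcongr; exact hV t ht v hv
              _ ≤ _ := by
                  refine sq_sum_le_card_mul_sum_sq.trans (le_of_eq ?_); simp only [mul_pow]
          have a2 := norm_add_le (∑ v ∈ I, ds (pc D K v) t * dp ⌊2*N/Real.exp (v/K)⌋₊ (g v) t) (dp (4*N) e t)
          have a3 := pow_le_pow_left₀ (norm_nonneg _) a2 2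
          nlinarith only [a1, a3, sq_nonneg (‖∑ v ∈ I, ds (pc D K v) t * dp ⌊2*N/Real.exp (v/K)⌋₊ (g v) t‖ - ‖dp (4*N) e t‖)]
        · exact ((((integrable_finsetSum _ fun v _ => (hIg _ _).const_mul _).const_mul _).const_mul _).add ((hIg _ _).const_mul _)).integrableOn
    _ = 2*(I.card*∑ v ∈ I, V v^2*∫ t in U, ‖dp ⌊2*N/Real.exp (v/K)⌋₊ (g v) t‖^2 ∂(gm η)) + 2*∫ t in U, ‖dp (4*N) e t‖^2 ∂(gm η) := by
        rw [integral_add (((integrable_finsetSum _ fun v _ => (hIg _ _).const_mul _).const_mul _).const_mul _).integrableOn ((hIg _ _).const_mul _).integrableOn,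
          integral_const_mul, integral_const_mul, integral_const_mul, integral_finsetSum _ fun v _ => ((hIg _ _).const_mul _).integrableOn]
        simp only [integral_const_mul]
    _ ≤ _ := by
        have b1 : ∫ t in U, ‖dp (4*N) e t‖^2 ∂(gm η) ≤ ∫ t, ‖dp (4*N) e t‖^2 ∂(gm η) :=
          setIntegral_le_integral (hIg _ _) (Filter.Eventually.of_forall fun t => sq_nonneg _)
        have b2 : ∑ v ∈ I, V v^2*∫ t in U, ‖dp ⌊2*N/Real.exp (v/K)⌋₊ (g v) t‖^2 ∂(gm η) ≤ ∑ v ∈ I, V v^2*W v :=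
          Finset.sum_le_sum fun v hv => mul_le_mul_of_nonneg_left (hW v hv (g v) (hgs v) (hg1 v)) (sq_nonneg _)
        have b3 : (I.card:ℝ)*∑ v ∈ I, V v^2*∫ t in U, ‖dp ⌊2*N/Real.exp (v/K)⌋₊ (g v) t‖^2 ∂(gm η) ≤ I.card*∑ v ∈ I, V v^2*W v := by gcongr
        linarith only [hEint, b1, b3]

lemma cover (μ : Measure ℝ) (f : ℝ → ℝ) (hf : Integrable f μ) (h0 : ∀ t, 0 ≤ f t) (I : Finset ℕ) (U : Set ℝ) (hU : MeasurableSet U) (Ui : ℕ → Set ℝ)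
    (hUi : ∀ i, MeasurableSet (Ui i)) (h : ∀ t ∈ U, ∃ i ∈ I, t ∈ Ui i) : ∫ t in U, f t ∂μ ≤ ∑ i ∈ I, ∫ t in U ∩ Ui i, f t ∂μ := by
  have hm : ∀ i, MeasurableSet (U ∩ Ui i) := fun i => hU.inter (hUi i)
  rw [← integral_indicator hU]
  simp_rw [← integral_indicator (hm _)]
  rw [← integral_finsetSum _ (fun i _ => hf.indicator (hm i))]
  apply integral_mono (hf.indicator hU) (integrable_finsetSum _ (fun i _ => hf.indicator (hm i)))
  intro t
  have hnn : ∀ i ∈ I, 0 ≤ (U ∩ Ui i).indicator f t := fun i _ => Set.indicator_nonneg (fun t _ => h0 t) _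
  by_cases ht : t ∈ U
  · obtain ⟨i, hi, hti⟩ := h t ht
    rw [Set.indicator_of_mem ht]
    have := Finset.single_le_sum hnn hi
    rwa [Set.indicator_of_mem (show t ∈ U ∩ Ui i from ⟨ht, hti⟩)] at this
  · rw [Set.indicator_of_notMem ht]; exact Finset.sum_nonneg hnn

structure Lev (s α : ℝ) (I : Finset ℕ) (P : ℕ → Finset ℕ) (θ V : ℕ → ℝ) : Prop where
  card : (I.card:ℝ) ≤ Real.exp (2*s)
  pr : ∀ i ∈ I, ∀ p ∈ P i, p.Prime ∧ Real.exp (θ i) ≤ p ∧ (p:ℝ) ≤ 2*Real.exp (θ i)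
  th : ∀ i ∈ I, s^2-1 ≤ θ i ∧ θ i ≤ s^4
  V0 : ∀ i ∈ I, 0 < V i
  Vb : ∀ i ∈ I, 2*((P i).card:ℝ) ≤ V i^2*Real.exp (2*s-θ i*(1-2*α))

lemma lev_piece (s α : ℝ) (hs : 10^5 ≤ s) (I P θ V) (h : Lev s α I P θ V) (hα : α ≤ 1/4) (η : ℝ) (hη : 0 < η)
    (M : ℕ) (hM : 1 ≤ M) (φ : ℝ) (hφ : 0 ≤ φ) (ℓ : ℕ) (i : ℕ) (hi : i ∈ I) (hl : φ ≤ θ i*ℓ) (g : ℕ → ℝ) (hg : sup g M) (hg1 : ∀ n, |g n| ≤ 1)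
    (U : Set ℝ) (hU : MeasurableSet U) (hUV : ∀ t ∈ U, V i ≤ ‖ds (P i) t‖) :
    ∫ t in U, ‖dp M g t‖^2 ∂(gm η) ≤ 2^26*(1+η*Real.exp (θ i*ℓ)*M)*M*(4*ℓ*Real.exp (2*s))^ℓ*Real.exp (-φ*(1-2*α)) := by
  have hV := h.V0 i hi
  have hθ : 2 ≤ θ i := by have := (h.th i hi).1; nlinarith only [this, hs]
  have he : 5 ≤ Real.exp (θ i) := by
    calc (5:ℝ) ≤ (2+1)^2/2+1/2 := by norm_num
      _ ≤ 1 + θ i + θ i^2/2 := by nlinarith only [hθ]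
      _ ≤ _ := Real.quadratic_le_exp_of_nonneg (by linarith)
  set A := ⌊Real.exp (θ i)⌋₊ with hA
  have hA1 : (A:ℝ) ≤ Real.exp (θ i) := Nat.floor_le (Real.exp_pos _).le
  have hA2 : Real.exp (θ i) < A + 1 := Nat.lt_floor_add_one _
  have hA4 : 4 ≤ A := Nat.le_floor (by push_cast; linarith)
  have hA4' : (4:ℝ) ≤ A := by exact_mod_cast hA4
  refine (mom η hη A hA4 (P i) (fun p hp => ?_) M hM g hg hg1 ℓ (V i) hV U hU hUV).trans ?_
  · obtain ⟨h1, h2, h3⟩ := h.pr i hi p hp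
    refine ⟨h1, ?_, ?_⟩
    · have : (A:ℝ) ≤ p := hA1.trans h2
      exact_mod_cast this
    · have : (p:ℝ) ≤ 4*A := by linarith
      exact_mod_cast this
  have e1 : (4*(A:ℝ))^ℓ ≤ 4^ℓ*Real.exp (θ i*ℓ) := by
    rw [mul_comm (θ i), Real.exp_nat_mul, ← mul_pow]; gcongr
  have e2 : (2*ℓ*((P i).card:ℝ)/V i^2)^ℓ ≤ (ℓ*Real.exp (2*s))^ℓ*Real.exp (-φ*(1-2*α)) := by
    have : 2*ℓ*((P i).card:ℝ)/V i^2 ≤ ℓ*Real.exp (2*s)*Real.exp (-(θ i*(1-2*α))) := by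
      rw [div_le_iff₀ (by positivity), mul_assoc (ℓ:ℝ), ← Real.exp_add, ← sub_eq_add_neg]
      have := h.Vb i hi
      nlinarith only [mul_le_mul_of_nonneg_left this (Nat.cast_nonneg (α := ℝ) ℓ)]
    calc _ ≤ (ℓ*Real.exp (2*s)*Real.exp (-(θ i*(1-2*α))))^ℓ := by gcongr
      _ = (ℓ*Real.exp (2*s))^ℓ*Real.exp (-(θ i*ℓ)*(1-2*α)) := by
          rw [mul_pow _ (Real.exp _), ← Real.exp_nat_mul]; congr 2; ring
      _ ≤ _ := by gcongr; linarith
  have h4 : (1:ℝ) ≤ 4^ℓ := one_le_pow₀ (by norm_num)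
  calc _ ≤ 2^26*(4^ℓ*(1+η*Real.exp (θ i*ℓ)*M))*M*((ℓ*Real.exp (2*s))^ℓ*Real.exp (-φ*(1-2*α))) := by
        gcongr
        calc 1+η*((4*(A:ℝ))^ℓ*M) ≤ 4^ℓ*1+η*(4^ℓ*Real.exp (θ i*ℓ)*M) := by gcongr; linarith
          _ = _ := by ring
    _ = _ := by rw [mul_assoc 4 (ℓ:ℝ), mul_pow 4 (ℓ*Real.exp (2*s))]; ring

lemma exp_big (s : ℝ) (hs : 10^5 ≤ s) : 16*s^10 ≤ Real.exp s := by
  have := Real.pow_div_factorial_le_exp s (by linarith) 12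
  refine le_trans ?_ this
  rw [le_div_iff₀ (by positivity)]
  have : ((Nat.factorial 12:ℕ):ℝ) = 479001600 := by norm_num [Nat.factorial]
  rw [this]
  have h2 : (10:ℝ)^10 ≤ s^2 := by nlinarith
  calc 16*s^10*479001600 ≤ s^10*10^10 := by nlinarith only [hs, pow_nonneg (by linarith : 0 ≤ s) 10]
    _ ≤ s^10*s^2 := by gcongr
    _ = s^12 := by ring

lemma lev_step (s α' α : ℝ) (hs : 10^5 ≤ s) (I P θ V) (h : Lev s α' I P θ V) (hα0 : 0 ≤ α') (hα : α ≤ 1/4) (hαα : α = α' + 12/s)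
    (η : ℝ) (hη : 0 < η) (N : ℕ) (hNη : η*N ≤ 2) (hN : Real.exp (2*(s^3)^4) ≤ N) (D : Finset ℕ)
    (hD : ∀ p ∈ D, p.Prime ∧ Real.exp ((s^3)^2) ≤ p ∧ (p:ℝ) ≤ Real.exp ((s^3)^4))
    (G : ℕ → Prop) (H1 : ∀ n, G n → ∃ p ∈ D, p ∣ n)
    (H2 : ∀ p ∈ D, ∀ p' ∈ D, ∀ m, ¬ p ∣ m → ¬ p' ∣ m → G (p*m) → G (p'*m))
    (U : Set ℝ) (hU : MeasurableSet U)
    (hUg : ∀ t ∈ U, ∀ v ∈ D.image (vv (Real.exp (s^3))), ‖ds (pc D (Real.exp (s^3)) v) t‖ ≤ Real.exp ((v/Real.exp (s^3))*(1-α)-s^3))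
    (hUb : ∀ t ∈ U, ∃ i ∈ I, V i ≤ ‖ds (P i) t‖) :
    ∫ t in U, ‖dp (2*N) (fun n => if N ≤ n ∧ n < 2*N ∧ G n then 1 else 0) t‖^2 ∂(gm η) ≤ N*Real.exp (-s^3/2) := by
  have hs0 : 0 < s := by linarith
  set K := Real.exp (s^3) with hKdef
  have hK0 : 0 < K := Real.exp_pos _
  have hs3 : 10^15 ≤ s^3 := by calc (10:ℝ)^15 = (10^5)^3 := by norm_num
                                  _ ≤ s^3 := by gcongr
  have hKs : s^3 + 1 ≤ K := Real.add_one_le_exp _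
  have hN0 : (0:ℝ) < N := lt_of_lt_of_le (Real.exp_pos _) hN
  have hN1 : 1 ≤ N := by exact_mod_cast hN0
  set H := ⌈Real.exp ((s^3)^2)⌉₊ with hH
  have hHK : K ≤ H := by
    refine le_trans ?_ (Nat.le_ceil _)
    apply Real.exp_le_exp.2; nlinarith only [hs3]
  have hH2 : 2 ≤ H := by
    have : (2:ℝ) ≤ H := by linarith
    exact_mod_cast this
  set W : ℕ → ℝ := fun v => Real.exp (30+3*s+s^4+12*(v/K)/s-(v/K)*(2-2*α'))*N with hW
  have hφ : ∀ v ∈ D.image (vv K), s^6/2 ≤ (v:ℝ)/K ∧ s^6-1 ≤ (v:ℝ)/K ∧ (v:ℝ)/K ≤ s^12 := by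
    intro v hv
    rw [Finset.mem_image] at hv
    obtain ⟨p, hp, rfl⟩ := hv
    obtain ⟨h1, h2, h3⟩ := hD p hp
    obtain ⟨b1, b2⟩ := vv_bd K hK0 p h1.one_lt.le
    have c1 : (s^3)^2 < (vv K p+1)/K := Real.exp_lt_exp.1 (h2.trans_lt b2)
    have c2 : vv K p/K ≤ (s^3)^4 := Real.exp_le_exp.1 (b1.trans h3)
    have c3 : 1/K ≤ 1 := by rw [div_le_one hK0]; linarith
    rw [add_div] at c1
    have c4 : s^6 = (s^3)^2 := by ring
    have c5 : s^12 = (s^3)^4 := by ring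
    have c6 : 2 ≤ (s^3)^2 := by nlinarith only [hs3]
    rw [c4, c5]; refine ⟨by linarith, by linarith, c2⟩
  have key := step η hη N hN1 D H hH2 (fun p hp => ⟨(hD p hp).1, Nat.ceil_le.2 (hD p hp).2.1⟩) G H1 H2 K (by linarith) U hU
    (fun v => Real.exp ((v/K)*(1-α)-s^3)) W hUg ?_
  · refine key.trans ?_
    have hIc : ((D.image (vv K)).card:ℝ) ≤ 2*K*s^12 := by
      have := card_real_Ico (D.image (vv K)) 0 (K*s^12+1) le_rfl (by positivity) (fun v hv => ⟨by positivity, by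
        have := (hφ v hv).2.2; rw [div_le_iff₀ hK0] at this; linarith⟩)
      have h1 : 1 ≤ s^12 := one_le_pow₀ (by linarith)
      nlinarith only [this, h1, hKs, hs3]
    have hsum : ∑ v ∈ D.image (vv K), Real.exp ((v/K)*(1-α)-s^3)^2*W v ≤ (2*K*s^12)*(Real.exp (30+3*s+s^4-6*s^5-2*s^3)*N) := by
      calc _ ≤ ∑ v ∈ D.image (vv K), Real.exp (30+3*s+s^4-6*s^5-2*s^3)*N := by
            apply Finset.sum_le_sum; intro v hv
            simp only [hW]
            rw [← mul_assoc, ← Real.exp_nat_mul, ← Real.exp_add]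
            gcongr
            have e : ((2:ℕ):ℝ)*((v/K)*(1-α)-s^3) + (30+3*s+s^4+12*(v/K)/s-(v/K)*(2-2*α')) = 30+3*s+s^4-2*s^3 - 12*((v:ℝ)/K)/s := by
              rw [hαα]; push_cast; field_simp; ring
            rw [e]
            have : 6*s^5 ≤ 12*((v:ℝ)/K)/s := by
              rw [le_div_iff₀ hs0]; nlinarith only [(hφ v hv).1]
            linarith only [this]
        _ ≤ _ := by rw [Finset.sum_const, nsmul_eq_mul]; gcongr
    have hs12 : s^12 ≤ Real.exp (2*s) := by
      have h1 := exp_big s hs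
      have h2 : s^2 ≤ Real.exp s := by nlinarith only [h1, pow_le_pow_right₀ (by linarith only [hs] : 1 ≤ s) (by norm_num : 2 ≤ 10), pow_nonneg hs0.le 10]
      calc s^12 = s^10*s^2 := by ring
        _ ≤ Real.exp s*Real.exp s := by gcongr; nlinarith only [h1, pow_nonneg hs0.le 10]
        _ = _ := by rw [← Real.exp_add]; congr 1; ring
    have e8 : (8:ℝ) ≤ Real.exp 7 := by linarith [Real.add_one_le_exp (7:ℝ)]
    have hA : 2*((D.image (vv K)).card*∑ v ∈ D.image (vv K), Real.exp ((v/K)*(1-α)-s^3)^2*W v) ≤ Real.exp (-s^3)*N := by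
      calc _ ≤ 2*((2*K*s^12)*((2*K*s^12)*(Real.exp (30+3*s+s^4-6*s^5-2*s^3)*N))) := by gcongr
        _ = 8*(s^12)^2*K^2*Real.exp (30+3*s+s^4-6*s^5-2*s^3)*N := by ring
        _ ≤ Real.exp 7*(Real.exp (2*s))^2*K^2*Real.exp (30+3*s+s^4-6*s^5-2*s^3)*N := by gcongr
        _ = Real.exp (37+7*s+s^4-6*s^5)*N := by
            rw [hKdef, ← Real.exp_nat_mul, ← Real.exp_nat_mul, ← Real.exp_add, ← Real.exp_add, ← Real.exp_add]; congr 2; push_cast; ring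
        _ ≤ _ := by
            gcongr
            have a1 : s^4 ≤ s^5 := pow_le_pow_right₀ (by linarith only [hs]) (by norm_num)
            have a2 : s^3 ≤ s^5 := pow_le_pow_right₀ (by linarith) (by norm_num)
            have a3 : s*100 ≤ s^5 := by nlinarith only [a2, hs, hs3, mul_le_mul_of_nonneg_left hs3 (sq_nonneg s), sq_nonneg s]
            linarith only [hs3, a1, a2, a3]
    have hNK : K^2 ≤ N := by
      refine le_trans ?_ hN
      rw [hKdef, ← Real.exp_nat_mul]; apply Real.exp_le_exp.2
      push_cast
      have : s^3*1 ≤ s^3*(s^3)^3 := mul_le_mul_of_nonneg_left (one_le_pow₀ (by linarith)) (by positivity)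
      nlinarith only [this]
    have hB : 8*(1+4*η*N)*(6*N/K+8*N/H+2) ≤ 72*16*(N/K) := by
      have b1 : 8*(N:ℝ)/H ≤ 8*(N/K) := by rw [mul_div_assoc]; gcongr
      have b2 : (1:ℝ) ≤ N/K := by rw [le_div_iff₀ hK0]; nlinarith only [hNK, hKs, hs3]
      have b3 : 6*(N:ℝ)/K = 6*(N/K) := by ring
      calc _ ≤ 8*(1+4*2)*(6*(N/K)+8*(N/K)+2*(N/K)) := by
            have b4 : 4*η*N ≤ 4*2 := by linarith only [hNη]
            rw [b3]; gcongr; linarith only [b2]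
        _ = _ := by ring
    have hKi : (N:ℝ)/K = N*Real.exp (-s^3) := by rw [hKdef, Real.exp_neg, div_eq_mul_inv]
    have hfin : 1153*Real.exp (-s^3) ≤ Real.exp (-s^3/2) := by
      have : Real.exp (-s^3/2) = Real.exp (-s^3)*Real.exp (s^3/2) := by rw [← Real.exp_add]; congr 1; ring
      rw [this, mul_comm]; gcongr
      linarith only [hs3, Real.add_one_le_exp (s^3/2)]
    rw [hKi] at hB
    nlinarith only [hA, hB, mul_le_mul_of_nonneg_left hfin hN0.le]
  · intro v hv g hg hg1
    obtain ⟨f1, f2, f3⟩ := hφ v hv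
    set φ := (v:ℝ)/K
    have hfN : Real.exp φ ≤ N := by
      refine le_trans (Real.exp_le_exp.2 ?_) hN
      have : s^12 = (s^3)^4 := by ring
      have : 0 ≤ s^12 := by positivity
      linarith
    set M := ⌊2*N/Real.exp φ⌋₊ with hM
    have hM1 : 1 ≤ M := Nat.le_floor (by rw [Nat.cast_one, le_div_iff₀ (Real.exp_pos _)]; linarith)
    have hM2 : (M:ℝ) ≤ 2*N*Real.exp (-φ) := by rw [Real.exp_neg, ← div_eq_mul_inv]; exact Nat.floor_le (by positivity)
    have hint : Integrable (fun t => ‖dp M g t‖^2) (gm η) := int_cont _ _ ((dp_cont _ _).norm.pow 2) ((∑ n ∈ Finset.Icc 1 M, |g n|)^2) (fun t => by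
      rw [Real.norm_of_nonneg (by positivity)]; gcongr; exact dp_bound _ _ _)
    have hUm : ∀ i, MeasurableSet {t | V i ≤ ‖ds (P i) t‖} := fun i => (isClosed_le continuous_const (ds_cont _).norm).measurableSet
    refine (cover _ _ hint (fun t => sq_nonneg _) I U hU (fun i => {t | V i ≤ ‖ds (P i) t‖}) hUm hUb).trans ?_
    have each : ∀ i ∈ I, ∫ t in U ∩ {t | V i ≤ ‖ds (P i) t‖}, ‖dp M g t‖^2 ∂(gm η) ≤ Real.exp (30+s+s^4+12*φ/s-φ*(2-2*α'))*N := by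
      intro i hi
      obtain ⟨t1, t2⟩ := h.th i hi
      have hθ2 : s^2/2 ≤ θ i := by nlinarith only [t1, hs]
      have hθ0 : 0 < θ i := by nlinarith only [hθ2, hs]
      have hφ0 : 0 < φ := by have := pow_pos hs0 6; linarith only [f1, this]
      set ℓ := ⌈φ/θ i⌉₊ with hl
      have l1 : φ ≤ θ i*ℓ := by have := Nat.le_ceil (φ/θ i); rw [div_le_iff₀ hθ0] at this; linarith only [this]
      have l2 : θ i*ℓ ≤ φ + θ i := by
        have := (Nat.ceil_lt_add_one (div_nonneg hφ0.le hθ0.le)).le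
        have := mul_le_mul_of_nonneg_left this hθ0.le
        rw [mul_add, mul_one, mul_div_cancel₀ _ hθ0.ne'] at this; exact this
      have hθφ : θ i ≤ φ := by
        have w1 : 2 ≤ s^2 := by nlinarith only [hs]
        nlinarith only [t2, f1, mul_le_mul_of_nonneg_left w1 (pow_pos hs0 4).le]
      have l3 : (ℓ:ℝ)*s ≤ 4*φ/s := by
        rw [le_div_iff₀ hs0]
        nlinarith only [l2, hθφ, mul_le_mul_of_nonneg_right hθ2 (Nat.cast_nonneg (α := ℝ) ℓ)]
      have l4 : 4*(ℓ:ℝ) ≤ Real.exp s := by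
        refine le_trans ?_ (exp_big s hs)
        rw [le_div_iff₀ hs0] at l3
        have : (ℓ:ℝ)*s^2 ≤ 4*s^10*s^2 := by nlinarith only [l3, f3]
        have := le_of_mul_le_mul_right this (by positivity)
        linarith only [this]
      refine (lev_piece s α' hs I P θ V h (by rw [hαα] at hα; have : 0 < 12/s := by positivity
                                              linarith only [hα, this]) η hη M hM1 φ hφ0.le ℓ i hi l1 g hg hg1 _ (hU.inter (hUm i)) (fun t ht => ht.2)).trans ?_
      have p1 : (4*(ℓ:ℝ)*Real.exp (2*s))^ℓ ≤ Real.exp (12*φ/s) := by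
        calc _ ≤ (Real.exp s*Real.exp (2*s))^ℓ := by gcongr
          _ = Real.exp (3*(ℓ*s)) := by rw [← Real.exp_add, ← Real.exp_nat_mul]; congr 1; ring
          _ ≤ _ := by apply Real.exp_le_exp.2; rw [mul_div_assoc] at l3 ⊢; linarith only [l3]
      have p2 : 1+η*Real.exp (θ i*ℓ)*M ≤ 5*Real.exp (s^4) := by
        have q1 : Real.exp (θ i*ℓ) ≤ Real.exp φ*Real.exp (s^4) := by rw [← Real.exp_add]; apply Real.exp_le_exp.2; linarith only [t2, l2]
        have q2 : η*Real.exp (θ i*ℓ)*M ≤ η*(Real.exp φ*Real.exp (s^4))*(2*N*Real.exp (-φ)) := by gcongr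
        have q3 : η*(Real.exp φ*Real.exp (s^4))*(2*N*Real.exp (-φ)) = 2*(η*N)*Real.exp (s^4) := by
          rw [Real.exp_neg]; field_simp
        have q4 : 1 ≤ Real.exp (s^4) := Real.one_le_exp (by positivity)
        nlinarith only [q2, q3, q4, hNη]
      calc _ ≤ 2^26*(5*Real.exp (s^4))*(2*N*Real.exp (-φ))*Real.exp (12*φ/s)*Real.exp (-φ*(1-2*α')) := by gcongr
        _ = (2^26*10)*(Real.exp (s^4)*Real.exp (-φ)*Real.exp (12*φ/s)*Real.exp (-φ*(1-2*α')))*N := by ring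
        _ ≤ Real.exp (30+s)*(Real.exp (s^4)*Real.exp (-φ)*Real.exp (12*φ/s)*Real.exp (-φ*(1-2*α')))*N := by
            gcongr
            have : (2:ℝ)^30 ≤ Real.exp 1^30 := by gcongr; linarith only [Real.exp_one_gt_d9]
            rw [← Real.exp_nat_mul, mul_one] at this
            calc _ ≤ (2:ℝ)^30 := by norm_num
              _ ≤ _ := this.trans (Real.exp_le_exp.2 (by push_cast; linarith only [hs]))
        _ = _ := by rw [← Real.exp_add, ← Real.exp_add, ← Real.exp_add, ← Real.exp_add]; congr 2; ring
    calc _ ≤ ∑ i ∈ I, Real.exp (30+s+s^4+12*φ/s-φ*(2-2*α'))*N := Finset.sum_le_sum each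
      _ ≤ Real.exp (2*s)*(Real.exp (30+s+s^4+12*φ/s-φ*(2-2*α'))*N) := by
          rw [Finset.sum_const, nsmul_eq_mul]; gcongr; exact h.card
      _ = _ := by rw [← mul_assoc, ← Real.exp_add]; simp only [hW]; congr 2; ring

lemma lev_next (S α : ℝ) (hS : 10^5 ≤ S) (D : Finset ℕ) (hD : ∀ p ∈ D, p.Prime ∧ Real.exp (S^2) ≤ p ∧ (p:ℝ) ≤ Real.exp (S^4)) :
    Lev S α (D.image (vv (Real.exp S))) (pc D (Real.exp S)) (fun v => v/Real.exp S) (fun v => Real.exp ((v/Real.exp S)*(1-α)-S)) := by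
  have hS0 : 0 < S := by linarith
  set K := Real.exp S with hKdef
  have hK0 : 0 < K := Real.exp_pos _
  have hKs : S + 1 ≤ K := Real.add_one_le_exp _
  have c3 : 1/K ≤ 1/2 := by gcongr; linarith
  have hφ : ∀ v ∈ D.image (vv K), S^2-1 ≤ (v:ℝ)/K ∧ (v:ℝ)/K ≤ S^4 := by
    intro v hv
    rw [Finset.mem_image] at hv
    obtain ⟨p, hp, rfl⟩ := hv
    obtain ⟨h1, h2, h3⟩ := hD p hp
    obtain ⟨b1, b2⟩ := vv_bd K hK0 p h1.one_lt.le
    have c1 : S^2 < (vv K p+1)/K := Real.exp_lt_exp.1 (h2.trans_lt b2)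
    have c2 : vv K p/K ≤ S^4 := Real.exp_le_exp.1 (b1.trans h3)
    rw [add_div] at c1
    exact ⟨by linarith, c2⟩
  have hEK : Real.exp (1/K) ≤ 1 + 2*(1/K) := by
    have h1 : |1/K| ≤ 1 := by rw [abs_of_pos (by positivity)]; linarith
    have := (abs_le.1 (Real.abs_exp_sub_one_le h1)).2
    rw [abs_of_pos (by positivity : 0 < 1/K)] at this; linarith
  have hpr : ∀ v, ∀ p ∈ pc D K v, p.Prime ∧ Real.exp (v/K) ≤ p ∧ (p:ℝ) < Real.exp (v/K)*Real.exp (1/K) := by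
    intro v p hp
    simp only [pc, Finset.mem_filter] at hp
    obtain ⟨hp, rfl⟩ := hp
    obtain ⟨b1, b2⟩ := vv_bd K hK0 p (hD p hp).1.one_lt.le
    rw [add_div, Real.exp_add] at b2
    exact ⟨(hD p hp).1, b1, b2⟩
  refine ⟨?_, ?_, hφ, fun _ _ => Real.exp_pos _, ?_⟩
  · have := card_real_Ico (D.image (vv K)) 0 (K*S^4+1) le_rfl (by positivity) (fun v hv => ⟨by positivity, by
        have := (hφ v hv).2; rw [div_le_iff₀ hK0] at this; linarith⟩)
    have h1 : S^4 + 2 ≤ K := by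
      have h1 := exp_big S hS
      have h2 : S^4 ≤ S^10 := pow_le_pow_right₀ (by linarith) (by norm_num)
      have h3 : 1 ≤ S^4 := one_le_pow₀ (by linarith)
      linarith
    have h2 : Real.exp (2*S) = K*K := by rw [hKdef, ← Real.exp_add]; congr 1; ring
    rw [h2]; nlinarith only [this, h1, hKs, hS]
  · intro v _ p hp
    obtain ⟨a1, a2, a3⟩ := hpr v p hp
    refine ⟨a1, a2, ?_⟩
    have := Real.exp_pos ((v:ℝ)/K)
    nlinarith only [a3, hEK, c3, this]
  · intro v hv
    have := card_real_Ico (pc D K v) (Real.exp (v/K)) (Real.exp (v/K)*Real.exp (1/K)) (Real.exp_pos _).le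
      (by have := Real.one_le_exp (show 0 ≤ 1/K by positivity); nlinarith only [this, Real.exp_pos ((v:ℝ)/K)]) (fun p hp => ⟨(hpr v p hp).2.1, (hpr v p hp).2.2⟩)
    have e : Real.exp ((v/K)*(1-α)-S)^2*Real.exp (2*S-(v/K)*(1-2*α)) = Real.exp (v/K) := by
      rw [← Real.exp_nat_mul, ← Real.exp_add]; congr 1; push_cast; ring
    rw [e]
    have h5 : 8 ≤ Real.exp (v/K) := by
      have := Real.add_one_le_exp ((v:ℝ)/K); have := (hφ v hv).1; nlinarith
    have h6 : 1/K ≤ 1/8 := by gcongr; linarith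
    nlinarith only [this, hEK, h5, h6]

lemma lev_meas (s α : ℝ) (hs : 10^5 ≤ s) (I P θ V) (h : Lev s α I P θ V) (hα : α ≤ 0.22) (η : ℝ) (hη : 0 < η) (N : ℕ) (hNη : η*N ≤ 2)
    (h1 : 4*Real.log N ≤ Real.exp (s^2/500)) (h2 : 1000*s^4 ≤ Real.log N) (U : Set ℝ) (hU : MeasurableSet U)
    (hUb : ∀ t ∈ U, ∃ i ∈ I, V i ≤ ‖ds (P i) t‖) : (gm η).real U ≤ Real.exp (-0.54*Real.log N) := by
  set L := Real.log N with hL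
  have hs0 : 0 < s := by linarith
  have hs4 : s^2*100 ≤ s^4 := by nlinarith only [hs, sq_nonneg s, mul_le_mul_of_nonneg_left (show (100:ℝ) ≤ s^2 by nlinarith only [hs]) (sq_nonneg s)]
  have hL0 : 0 < L := by have := pow_pos hs0 4; linarith
  have hNp : (0:ℝ) < N := by
    rcases Nat.eq_zero_or_pos N with h0 | h0
    · rw [hL, h0] at hL0; simp at hL0
    · exact_mod_cast h0
  have hNe : (N:ℝ) = Real.exp L := by rw [hL, Real.exp_log hNp]
  have hUm : ∀ i, MeasurableSet {t | V i ≤ ‖ds (P i) t‖} := fun i => (isClosed_le continuous_const (ds_cont _).norm).measurableSet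
  set g : ℕ → ℝ := fun n => if n = 1 then 1 else 0 with hg
  have hgd : ∀ t, ‖dp 1 g t‖^2 = 1 := by intro t; simp [dp, hg, dz_norm]
  have e0 : (gm η).real U = ∫ t in U, ‖dp 1 g t‖^2 ∂(gm η) := by simp [hgd, Measure.real]
  rw [e0]
  refine (cover _ _ (by simp only [hgd]; exact integrable_const _) (fun t => sq_nonneg _) I U hU (fun i => {t | V i ≤ ‖ds (P i) t‖}) hUm hUb).trans ?_
  have each : ∀ i ∈ I, ∫ t in U ∩ {t | V i ≤ ‖ds (P i) t‖}, ‖dp 1 g t‖^2 ∂(gm η) ≤ Real.exp (30 + L/200 - 0.56*(L-s^4)) := by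
    intro i hi
    obtain ⟨t1, t2⟩ := h.th i hi
    have hθ2 : s^2/2 ≤ θ i := by nlinarith only [t1, hs]
    have hθ0 : 0 < θ i := by nlinarith only [hθ2, hs]
    have hθ1 : 1 ≤ θ i := by nlinarith only [hθ2, hs]
    set ℓ := ⌊L/θ i⌋₊ with hl
    have l1 : θ i*ℓ ≤ L := by have := Nat.floor_le (div_nonneg hL0.le hθ0.le); rw [le_div_iff₀ hθ0] at this; linarith
    have l2 : L - θ i ≤ θ i*ℓ := by have := (Nat.lt_floor_add_one (L/θ i)).le; rw [div_le_iff₀ hθ0] at this; linarith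
    have lL : (ℓ:ℝ) ≤ L := by nlinarith only [l1, hθ1, Nat.cast_nonneg (α := ℝ) ℓ]
    refine (lev_piece s α hs I P θ V h (by linarith) η hη 1 le_rfl (L-s^4) (by linarith [pow_pos hs0 4]) ℓ i hi (by linarith) g (fun n hn => by
      have : n = 1 := by by_contra h0; simp [hg, h0] at hn
      omega) (fun n => by simp only [hg]; split_ifs <;> norm_num) _ (hU.inter (hUm i)) (fun t ht => ht.2)).trans ?_
    have p1 : (4*(ℓ:ℝ)*Real.exp (2*s))^ℓ ≤ Real.exp (L/200) := by
      calc _ ≤ (Real.exp (s^2/500)*Real.exp (2*s))^ℓ := by gcongr; linarith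
        _ = Real.exp (ℓ*(s^2/500+2*s)) := by rw [← Real.exp_add, ← Real.exp_nat_mul]
        _ ≤ _ := by
            apply Real.exp_le_exp.2
            have : s^2/500+2*s ≤ s^2/400 := by nlinarith only [hs]
            nlinarith only [mul_le_mul_of_nonneg_left this (Nat.cast_nonneg (α := ℝ) ℓ), l1, mul_le_mul_of_nonneg_left hθ2 (Nat.cast_nonneg (α := ℝ) ℓ)]
    have p2 : 1+η*Real.exp (θ i*ℓ)*(1:ℕ) ≤ 3 := by
      have : Real.exp (θ i*ℓ) ≤ N := by rw [hNe]; exact Real.exp_le_exp.2 l1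
      push_cast; nlinarith only [mul_le_mul_of_nonneg_left this hη.le, hNη]
    have p3 : Real.exp (-(L-s^4)*(1-2*α)) ≤ Real.exp (-0.56*(L-s^4)) := by
      apply Real.exp_le_exp.2; nlinarith only [hα, h2, pow_pos hs0 4]
    calc _ ≤ 2^26*3*((1:ℕ):ℝ)*Real.exp (L/200)*Real.exp (-0.56*(L-s^4)) := by gcongr
      _ ≤ Real.exp 30*Real.exp (L/200)*Real.exp (-0.56*(L-s^4)) := by
          gcongr
          have : (2:ℝ)^30 ≤ Real.exp 1^30 := by gcongr; linarith only [Real.exp_one_gt_d9]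
          rw [← Real.exp_nat_mul, mul_one] at this
          calc _ ≤ (2:ℝ)^30 := by norm_num
            _ ≤ _ := by exact_mod_cast this
      _ = _ := by rw [← Real.exp_add, ← Real.exp_add]; congr 1; ring
  calc _ ≤ ∑ i ∈ I, Real.exp (30 + L/200 - 0.56*(L-s^4)) := Finset.sum_le_sum each
    _ ≤ Real.exp (2*s)*Real.exp (30 + L/200 - 0.56*(L-s^4)) := by
        rw [Finset.sum_const, nsmul_eq_mul]; gcongr; exact h.card
    _ ≤ _ := by
        rw [← Real.exp_add]; apply Real.exp_le_exp.2
        nlinarith only [h2, hs4, hs]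

def bc (f : ℝ → ℝ) : Prop := Continuous f ∧ (∀ t, 0 ≤ f t) ∧ ∃ C, ∀ t, f t ≤ C
lemma bc.mul {f g : ℝ → ℝ} (hf : bc f) (hg : bc g) : bc (fun t => f t * g t) := by
  obtain ⟨f1, f2, C, f3⟩ := hf
  obtain ⟨g1, g2, C', g3⟩ := hg
  exact ⟨f1.mul g1, fun t => mul_nonneg (f2 t) (g2 t), C*C', fun t => mul_le_mul (f3 t) (g3 t) (g2 t) ((f2 t).trans (f3 t))⟩
lemma bc.int {f : ℝ → ℝ} (hf : bc f) (μ : Measure ℝ) [IsFiniteMeasure μ] : Integrable f μ := by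
  obtain ⟨f1, f2, C, f3⟩ := hf
  exact int_cont μ f f1 C (fun t => by rw [Real.norm_of_nonneg (f2 t)]; exact f3 t)
lemma bc_dp (N a) : bc (fun t => ‖dp N a t‖) := ⟨(dp_cont N a).norm, fun _ => norm_nonneg _, _, dp_bound N a⟩
lemma bc_ds (S) : bc (fun t => ‖ds S t‖) := ⟨(ds_cont S).norm, fun _ => norm_nonneg _, _, ds_bound S⟩

lemma CS (μ : Measure ℝ) [IsFiniteMeasure μ] (f g : ℝ → ℝ) (hf : bc f) (hg : bc g) (A B : ℝ)
    (hA : ∫ t, f t^2 ∂μ ≤ A) (hB : ∫ t, g t^2 ∂μ ≤ B) : ∫ t, f t * g t ∂μ ≤ √(A*B) := by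
  have hA0 : 0 ≤ A := le_trans (integral_nonneg (fun t => sq_nonneg _)) hA
  have m : ∀ {f : ℝ → ℝ}, bc f → MemLp f (ENNReal.ofReal 2) μ := fun {f} hf => by
    obtain ⟨f1, f2, C, f3⟩ := hf
    exact MemLp.of_bound f1.aestronglyMeasurable C (Filter.Eventually.of_forall fun t => by rw [Real.norm_of_nonneg (f2 t)]; exact f3 t)
  have := integral_mul_le_Lp_mul_Lq_of_nonneg (μ := μ) Real.HolderConjugate.two_two (Filter.Eventually.of_forall hf.2.1) (Filter.Eventually.of_forall hg.2.1) (m hf) (m hg)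
  simp only [Real.rpow_two] at this
  rw [← Real.sqrt_eq_rpow, ← Real.sqrt_eq_rpow] at this
  rw [Real.sqrt_mul hA0]
  exact this.trans (by gcongr)

lemma R_eq (η : ℝ) (hη : 0 < η) (A B : ℕ) (a f : ℕ → ℝ) (ℓ : ℝ) :
    ∫ t, dp A a t * dp B f t * ee (t*ℓ) ∂(gm η) =
      ((∑ k ∈ Finset.Icc 1 A, ∑ n ∈ Finset.Icc 1 B, a k * f n * Real.exp (-(ℓ-Real.log (k*n))^2/(2*η^2)) : ℝ) : ℂ) := by
  have e : ∀ t, dp A a t * dp B f t * ee (t*ℓ) = ∑ k ∈ Finset.Icc 1 A, ∑ n ∈ Finset.Icc 1 B, ((a k * f n : ℝ):ℂ) * ee ((ℓ-Real.log (k*n))*t) := by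
    intro t
    simp only [dp]
    rw [Finset.sum_mul_sum, Finset.sum_mul]
    refine Finset.sum_congr rfl fun k hk => ?_
    rw [Finset.sum_mul]
    refine Finset.sum_congr rfl fun n hn => ?_
    rw [Finset.mem_Icc] at hk hn
    have : (ℓ-Real.log (k*n))*t = -(t*Real.log k) + -(t*Real.log n) + t*ℓ := by
      rw [Real.log_mul (by have := hk.1; positivity) (by have := hn.1; positivity)]; ring
    rw [this, ee_add, ee_add]; simp only [dz]; push_cast; ring
  have hi : ∀ c : ℝ, Integrable (fun t => ee (c*t)) (gm η) := fun c => int_cont _ _ (ee_cont.comp (by fun_prop)) 1 (fun t => (ee_norm _).le)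
  simp_rw [e]
  rw [integral_finsetSum _ (fun k _ => integrable_finsetSum _ (fun n _ => (hi _).const_mul _))]
  push_cast
  refine Finset.sum_congr rfl fun k _ => ?_
  rw [integral_finsetSum _ (fun n _ => (hi _).const_mul _)]
  refine Finset.sum_congr rfl fun n _ => ?_
  rw [integral_const_mul, gm_char η hη]
  push_cast; ring

lemma gm_int (η : ℝ) (hη : 0 < η) (g : ℝ → ℝ) : ∫ t, g t ∂(gm η) = η * ∫ t, (√(2*Real.pi))⁻¹ * Real.exp (-(η^2*t^2)/2) * g t := by
  unfold gm
  rw [ProbabilityTheory.integral_gaussianReal_eq_integral_smul (by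
    rw [ne_eq, Real.toNNReal_eq_zero, not_le]; positivity), ← integral_const_mul]
  congr 1; ext t
  rw [ProbabilityTheory.gaussianPDFReal, Real.coe_toNNReal _ (by positivity), smul_eq_mul, Real.sqrt_mul (by positivity), Real.sqrt_inv, Real.sqrt_sq hη.le, sub_zero]
  have : -t^2/(2*(η^2)⁻¹) = -(η^2*t^2)/2 := by field_simp
  rw [this, mul_inv, inv_inv]; ring

lemma transfer (η η₀ T : ℝ) (hη : 0 < η) (hηη : η ≤ η₀) (hT : 0 ≤ T) (g : ℝ → ℝ) (hg : Continuous g) (B : ℝ) (hB : ∀ t, |g t| ≤ B) :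
    (∫ t, g t ∂(gm η₀))/η₀ - (∫ t, g t ∂(gm η))/η ≤ (∫ t in {t | T ≤ |t|}, |g t| ∂(gm η))/η + T^3*η₀^2*B := by
  have h0 : 0 < η₀ := hη.trans_le hηη
  have hB0 : 0 ≤ B := (abs_nonneg _).trans (hB 0)
  have hS : MeasurableSet {t : ℝ | T ≤ |t|} := (isClosed_le continuous_const continuous_abs).measurableSet
  rw [← integral_indicator hS, gm_int η hη, gm_int η₀ h0, gm_int η hη, mul_div_cancel_left₀ _ hη.ne', mul_div_cancel_left₀ _ hη.ne', mul_div_cancel_left₀ _ h0.ne']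
  have key : ∀ c, 0 < c → Integrable (fun t : ℝ => (√(2*Real.pi))⁻¹*Real.exp (-(c^2*t^2)/2)) := by
    intro c hc
    have := (integrable_exp_neg_mul_sq (b := c^2/2) (by positivity)).const_mul (√(2*Real.pi))⁻¹
    refine this.congr (Filter.Eventually.of_forall fun t => ?_)
    simp only; congr 2; ring
  have ki : ∀ c, 0 < c → ∀ f : ℝ → ℝ, AEStronglyMeasurable f → (∀ t, |f t| ≤ B) → Integrable (fun t : ℝ => (√(2*Real.pi))⁻¹*Real.exp (-(c^2*t^2)/2)*f t) :=
    fun c hc f hf hb => (key c hc).mul_bdd (c := B) hf (Filter.Eventually.of_forall hb)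
  have i1 := ki η₀ h0 g hg.aestronglyMeasurable hB
  have i2 := ki η hη g hg.aestronglyMeasurable hB
  have i3 := ki η hη ({t : ℝ | T ≤ |t|}.indicator fun t => |g t|) (hg.abs.aestronglyMeasurable.indicator hS) (fun t => by
    unfold Set.indicator; split_ifs
    · rw [abs_abs]; exact hB t
    · simpa using hB0)
  have i4 : Integrable ((Set.Icc (-T) T).indicator fun _ : ℝ => T^2*η₀^2/2*B) := (integrable_indicator_iff measurableSet_Icc).2 (integrableOn_const (by simp))
  have e4 : ∫ t, (Set.Icc (-T) T).indicator (fun _ : ℝ => T^2*η₀^2/2*B) t = T^3*η₀^2*B := by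
    rw [integral_indicator measurableSet_Icc, setIntegral_const]; rw [Real.volume_real_Icc_of_le (by linarith), smul_eq_mul]; ring
  rw [← integral_sub i1 i2, ← e4, ← integral_add i3 i4]
  apply integral_mono (i1.sub i2) (i3.add i4)
  intro t
  show _ ≤ (√(2*Real.pi))⁻¹*Real.exp (-(η^2*t^2)/2)*({t : ℝ | T ≤ |t|}.indicator (fun t => |g t|) t) + (Set.Icc (-T) T).indicator (fun _ : ℝ => T^2*η₀^2/2*B) t
  have hpi : (√(2*Real.pi))⁻¹ ≤ 1 := inv_le_one_of_one_le₀ (Real.one_le_sqrt.2 (by linarith [Real.pi_gt_three]))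
  have hpi0 : 0 ≤ (√(2*Real.pi))⁻¹ := by positivity
  set a := Real.exp (-(η₀^2*t^2)/2)
  set b := Real.exp (-(η^2*t^2)/2)
  have ha : 0 < a := Real.exp_pos _
  have hab : a ≤ b := Real.exp_le_exp.2 (by have : η^2*t^2 ≤ η₀^2*t^2 := by gcongr
                                            linarith)
  have hd : ((√(2*Real.pi))⁻¹*a*g t - (√(2*Real.pi))⁻¹*b*g t) ≤ (√(2*Real.pi))⁻¹*((b-a)*|g t|) := by
    have : (√(2*Real.pi))⁻¹*a*g t - (√(2*Real.pi))⁻¹*b*g t = (√(2*Real.pi))⁻¹*((b-a)*-g t) := by ring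
    rw [this]
    have := sub_nonneg.2 hab
    gcongr; exact neg_le_abs _
  refine hd.trans ?_
  have n1 : 0 ≤ (Set.Icc (-T) T).indicator (fun _ : ℝ => T^2*η₀^2/2*B) t := Set.indicator_nonneg (fun _ _ => by positivity) _
  have n2 : 0 ≤ (√(2*Real.pi))⁻¹*b*({t : ℝ | T ≤ |t|}.indicator (fun t => |g t|) t) := mul_nonneg (mul_nonneg hpi0 (ha.le.trans hab)) (Set.indicator_nonneg (fun _ _ => abs_nonneg _) _)
  by_cases ht : T ≤ |t|
  · have : t ∈ {t : ℝ | T ≤ |t|} := ht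
    rw [Set.indicator_of_mem this]
    have : (√(2*Real.pi))⁻¹*((b-a)*|g t|) ≤ (√(2*Real.pi))⁻¹*b*|g t| := by
      rw [mul_assoc]; gcongr; linarith
    linarith only [n1, this]
  · push Not at ht
    have hm : t ∈ Set.Icc (-T) T := by rw [Set.mem_Icc, ← abs_le]; exact ht.le
    rw [Set.indicator_of_mem hm]
    have ha1 : 1 - η₀^2*t^2/2 ≤ a := by have := Real.add_one_le_exp (-(η₀^2*t^2)/2); linarith
    have hb1 : b ≤ 1 := Real.exp_le_one_iff.2 (by have : 0 ≤ η^2*t^2 := by positivity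
                                                  linarith)
    have ht2 : t^2 ≤ T^2 := by rw [← sq_abs]; gcongr
    have : (√(2*Real.pi))⁻¹*((b-a)*|g t|) ≤ 1*((T^2*η₀^2/2)*B) := by
      have : b - a ≤ T^2*η₀^2/2 := by nlinarith only [ha1, hb1, mul_le_mul_of_nonneg_left ht2 (sq_nonneg η₀)]
      have : 0 ≤ b - a := sub_nonneg.2 hab
      gcongr; exact hB t
    linarith only [n2, this]

lemma gm_tail (η T : ℝ) (hη : 0 < η) (hT : 0 < T) : (gm η).real {t | T ≤ |t|} ≤ 2*Real.exp (-(η*T)^2/2) := by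
  have h1 : ∀ c : ℝ, c^2 = 1 → (gm η).real {t | T ≤ c*t} ≤ Real.exp (-(η*T)^2/2) := by
    intro c hc
    have hm : ProbabilityTheory.mgf (fun t => c*t) (gm η) (η^2*T) = Real.exp ((η*T)^2/2) := by
      rw [ProbabilityTheory.mgf_const_mul]
      have := ProbabilityTheory.mgf_gaussianReal (p := gm η) (X := id) (μ := 0) (v := Real.toNNReal ((η^2)⁻¹)) (by rw [Measure.map_id]; rfl) (c*(η^2*T))
      rw [show (fun t : ℝ => t) = id from rfl, this, Real.coe_toNNReal _ (by positivity)]; congr 1; rw [mul_pow, hc]; field_simp; ring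
    have := ProbabilityTheory.measure_ge_le_exp_mul_mgf (μ := gm η) (X := fun t => c*t) (t := η^2*T) T (by positivity) (by
      by_contra hcon
      rw [ProbabilityTheory.mgf, integral_undef hcon] at hm
      exact (Real.exp_pos _).ne hm)
    rw [hm, ← Real.exp_add] at this
    refine this.trans (Real.exp_le_exp.2 ?_)
    nlinarith only []
  have hsub : {t : ℝ | T ≤ |t|} ⊆ {t | T ≤ 1*t} ∪ {t | T ≤ (-1)*t} := fun t ht => by
    rcases le_abs.1 (show T ≤ |t| from ht) with h | h
    · left; show T ≤ 1*t; linarith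
    · right; show T ≤ -1*t; linarith
  have := (measureReal_mono (μ := gm η) hsub).trans (measureReal_union_le _ _)
  linarith [h1 1 (by norm_num), h1 (-1) (by norm_num)]

noncomputable def Dv (S : ℝ) : Finset ℕ := (Finset.range (⌊Real.exp (S^4)⌋₊+1)).filter (fun p => p.Prime ∧ Real.exp (S^2) ≤ p)
lemma Dv_mem {S : ℝ} {p : ℕ} : p ∈ Dv S ↔ p.Prime ∧ Real.exp (S^2) ≤ p ∧ (p:ℝ) ≤ Real.exp (S^4) := by
  simp only [Dv, Finset.mem_filter, Finset.mem_range, Nat.lt_succ_iff, Nat.le_floor_iff (Real.exp_pos _).le]; tauto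

def Hyp (G : ℕ → Prop) (D : Finset ℕ) : Prop := (∀ n, G n → ∃ p ∈ D, p ∣ n) ∧ ∀ p ∈ D, ∀ p' ∈ D, ∀ m, ¬ p ∣ m → ¬ p' ∣ m → G (p*m) → G (p'*m)
noncomputable def fG (N : ℕ) (G : ℕ → Prop) : ℕ → ℝ := fun n => if N ≤ n ∧ n < 2*N ∧ G n then 1 else 0

lemma chain (η : ℝ) (hη : 0 < η) (N : ℕ) (hNη : η*N ≤ 2) (G : ℕ → Prop) (a d : ℝ → ℝ) (ha : bc a) (hd : bc d) (KA Q EL : ℝ)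
    (hA : ∫ t, a t^2 ∂(gm η) ≤ KA) (hQ : ∀ t, d t ≤ Q) (hQ0 : 0 ≤ Q) (W : Set ℝ)
    (hEL : ∀ U ⊆ W, MeasurableSet U → (gm η).real U ≤ Real.exp (-0.54*Real.log N) → ∫ t in U, a t*(d t*‖dp (2*N) (fG N G) t‖) ∂(gm η) ≤ EL)
    (k : ℕ) : ∀ (s α : ℝ) (I P θ V), 10^5 ≤ s → Lev s α I P θ V → 0 ≤ α → α + 24/s ≤ 0.22 → (∀ i < k, Hyp G (Dv (s^(3^(i+1))))) →
    4*Real.log N ≤ Real.exp ((s^(3^k))^2/500) → 1000*(s^(3^k))^4 ≤ Real.log N → ∀ U ⊆ W, MeasurableSet U → (∀ t ∈ U, ∃ i ∈ I, V i ≤ ‖ds (P i) t‖) →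
    ∫ t in U, a t*(d t*‖dp (2*N) (fG N G) t‖) ∂(gm η) ≤ 2*(Q*√(KA*(N*Real.exp (-s^3/2)))) + EL := by
  induction k with
  | zero =>
    intro s α I P θ V hs h _ hα' _ h1 h2 U hUW hU hUb
    have : 0 ≤ 24/s := by positivity
    have := hEL U hUW hU (lev_meas s α hs I P θ V h (by linarith) η hη N hNη (by simpa using h1) (by simpa using h2) U hU hUb)
    have : 0 ≤ Q*√(KA*(N*Real.exp (-s^3/2))) := by positivity
    linarith
  | succ k ih =>
    intro s α I P θ V hs h hα hα' hG h1 h2 U hUW hU hUb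
    have hs0 : 0 < s := by linarith
    have e : ∀ i, (s^3)^(3^i) = s^(3^(i+1)) := fun i => by rw [← pow_mul, pow_succ' 3 i]
    have hs3 : 10^5 ≤ s^3 := hs.trans (le_self_pow₀ (by linarith) (by norm_num))
    have hs3s : 100*s ≤ s^3 := by nlinarith only [hs, hs0, mul_pos hs0 hs0]
    have h24 : 24/s^3 ≤ 12/s := by rw [div_le_div_iff₀ (by positivity) hs0]; linarith
    have h12 : 12/s+12/s = 24/s := by ring
    have hp : s^3 ≤ s^(3^(k+1)) := pow_le_pow_right₀ (by linarith) (by have : 3^1 ≤ 3^(k+1) := Nat.pow_le_pow_right (by norm_num) (by omega)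
                                                                       simpa using this)
    have hlog : 2*(s^3)^4 ≤ Real.log N := by
      have : (s^3)^4 ≤ (s^(3^(k+1)))^4 := by gcongr
      have : 0 ≤ (s^3)^4 := by positivity
      linarith
    have hN0 : (0:ℝ) < N := by
      rcases Nat.eq_zero_or_pos N with h | h
      · subst h; have : 0 < (s^3)^4 := by positivity
        simp at hlog; linarith
      · exact_mod_cast h
    have hN : Real.exp (2*(s^3)^4) ≤ N := (Real.le_log_iff_exp_le hN0).1 hlog
    set D := Dv (s^3) with hD
    have hDm : ∀ p ∈ D, p.Prime ∧ Real.exp ((s^3)^2) ≤ p ∧ (p:ℝ) ≤ Real.exp ((s^3)^4) := fun p hp => Dv_mem.1 hp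
    obtain ⟨H1, H2⟩ : Hyp G D := by have := hG 0 (by omega); simpa using this
    set B : Set ℝ := ⋃ v ∈ D.image (vv (Real.exp (s^3))), {t | Real.exp ((v/Real.exp (s^3))*(1-(α+12/s))-s^3) ≤ ‖ds (pc D (Real.exp (s^3)) v) t‖} with hB
    have hBm : MeasurableSet B := Finset.measurableSet_biUnion _ (fun v _ => (isClosed_le continuous_const (ds_cont _).norm).measurableSet)
    have hbF := bc_dp (2*N) (fG N G)
    have hI := (ha.mul (hd.mul hbF)).int (gm η)
    rw [← integral_inter_add_sdiff hBm hI.integrableOn]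
    have hbad := ih (s^3) (α+12/s) _ _ _ _ hs3 (lev_next (s^3) (α+12/s) hs3 D hDm) (by positivity) (by linarith) (fun i hi => by
      rw [e]; exact hG (i+1) (by omega)) (by rw [e]; exact h1) (by rw [e]; exact h2) (U ∩ B) (Set.inter_subset_left.trans hUW) (hU.inter hBm) (fun t ht => by
        have := ht.2; simp only [hB, Set.mem_iUnion] at this; obtain ⟨v, hv, h⟩ := this; exact ⟨v, hv, h⟩)
    have hgood := lev_step s α (α+12/s) hs I P θ V h hα (by linarith only [hα', h12, show 0 ≤ 12/s by positivity]) rfl η hη N hNη hN D hDm G H1 H2 (U \ B) (hU.diff hBm) (fun t ht v hv => by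
      have := ht.2; simp only [hB, Set.mem_iUnion, not_exists] at this; exact (not_le.1 (this v hv)).le) (fun t ht => hUb t ht.1)
    have hA' : ∫ t in U \ B, a t^2 ∂(gm η) ≤ KA := (setIntegral_le_integral (by simpa only [sq] using (ha.mul ha).int (gm η)) (Filter.Eventually.of_forall fun t => sq_nonneg _)).trans hA
    have hcs := CS ((gm η).restrict (U \ B)) a _ ha hbF KA _ hA' hgood
    have hg2 : ∫ t in U \ B, a t*(d t*‖dp (2*N) (fG N G) t‖) ∂(gm η) ≤ Q*√(KA*(N*Real.exp (-s^3/2))) := by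
      refine le_trans ?_ (mul_le_mul_of_nonneg_left hcs hQ0)
      rw [← integral_const_mul]
      apply integral_mono ((ha.mul (hd.mul hbF)).int _) (((ha.mul hbF).int _).const_mul _)
      intro t
      have : 0 ≤ a t*‖dp (2*N) (fG N G) t‖ := (ha.mul hbF).2.1 t
      have := mul_le_mul_of_nonneg_right (hQ t) this
      simp only; linarith
    have hsq : 2*(Q*√(KA*(N*Real.exp (-(s^3)^3/2)))) ≤ Q*√(KA*(N*Real.exp (-s^3/2))) := by
      have hKA : 0 ≤ KA := (integral_nonneg (fun t => sq_nonneg _)).trans hA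
      have : 2*√(KA*(N*Real.exp (-(s^3)^3/2))) ≤ √(KA*(N*Real.exp (-s^3/2))) := by
        apply Real.le_sqrt_of_sq_le
        rw [mul_pow, Real.sq_sqrt (by positivity)]
        have : 4*Real.exp (-(s^3)^3/2) ≤ Real.exp (-s^3/2) := by
          have h4 : (4:ℝ) ≤ Real.exp 4 := by linarith [Real.add_one_le_exp (4:ℝ)]
          calc _ ≤ Real.exp 4*Real.exp (-(s^3)^3/2) := by gcongr
            _ = Real.exp (4+-(s^3)^3/2) := by rw [Real.exp_add]
            _ ≤ _ := by
                apply Real.exp_le_exp.2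
                have : s^3*100 ≤ (s^3)^3 := by nlinarith only [hs3, mul_pos (pow_pos hs0 3) (pow_pos hs0 3)]
                linarith
        nlinarith only [mul_le_mul_of_nonneg_left this (mul_nonneg hKA hN0.le)]
      nlinarith only [mul_le_mul_of_nonneg_left this hQ0]
    linarith

noncomputable def pr (a b : ℝ) : Finset ℕ := (Finset.Ioc ⌊a⌋₊ ⌊b⌋₊).filter Nat.Prime
lemma pr_mem {a b : ℝ} (ha : 0 ≤ a) (hb : 0 ≤ b) {p : ℕ} : p ∈ pr a b ↔ p.Prime ∧ a < p ∧ (p:ℝ) ≤ b := by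
  simp only [pr, Finset.mem_filter, Finset.mem_Ioc, Nat.floor_lt ha, Nat.le_floor_iff hb]; tauto
lemma pr_add {a b c : ℝ} (f : ℕ → ℝ) (hab : a ≤ b) (hbc : b ≤ c) : ∑ p ∈ pr a c, f p = ∑ p ∈ pr a b, f p + ∑ p ∈ pr b c, f p := by
  unfold pr
  rw [← Finset.sum_union, ← Finset.filter_union, Finset.Ioc_union_Ioc_eq_Ioc (Nat.floor_mono hab) (Nat.floor_mono hbc)]
  refine Finset.disjoint_filter_filter (Finset.disjoint_left.2 fun x hx hy => ?_)
  rw [Finset.mem_Ioc] at hx hy; omega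

lemma th4 (V : ℝ) (hV : 1000 ≤ V) : Real.exp V ≤ ∑ p ∈ pr (Real.exp V) (4*Real.exp V), Real.log p := by
  set z := Real.exp V with hz
  have hz1 : 1 ≤ z := Real.one_le_exp (by linarith)
  have h1 := Chebyshev.theta_ge' (x := 4*z) (by linarith)
  have h2 := Chebyshev.theta_le_log4_mul_x (x := z) (by linarith)
  have h3 : Chebyshev.theta (4*z) = Chebyshev.theta z + ∑ p ∈ pr z (4*z), Real.log p := by
    have := pr_add (a := 0) (b := z) (c := 4*z) (fun p => Real.log p) (by linarith) (by linarith)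
    simpa [pr, Chebyshev.theta] using this
  set w := Real.exp (V/2) with hw
  have hzw : z = w^2 := by rw [hz, hw, ← Real.exp_nat_mul]; congr 1; push_cast; ring
  have hwV : V^2/8 ≤ w := by have := Real.quadratic_le_exp_of_nonneg (x := V/2) (by linarith); nlinarith only [this, hV]
  have hw0 : 0 < w := Real.exp_pos _
  have l4 : Real.log 4 = 2*Real.log 2 := by rw [show (4:ℝ) = 2^2 by norm_num, Real.log_pow]; norm_num
  have lz : Real.log (4*z) ≤ V + 2 := by
    rw [Real.log_mul (by norm_num) (by positivity), hz, Real.log_exp, l4]; linarith [Real.log_two_lt_d9]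
  have lz2 : Real.log (4*z+2) ≤ V + 2 := by
    calc _ ≤ Real.log (z*Real.exp 2) := by
          apply Real.log_le_log (by linarith)
          have : (6:ℝ) ≤ Real.exp 2 := by
            have e1 : Real.exp 2 = Real.exp 1*Real.exp 1 := by rw [← Real.exp_add]; norm_num
            rw [e1]; nlinarith only [Real.exp_one_gt_d9]
          nlinarith only [this, hz1]
      _ = V + 2 := by rw [hz, ← Real.exp_add, Real.log_exp]
  have sq4 : √(4*z) = 2*w := by rw [hzw, show 4*w^2 = (2*w)^2 by ring, Real.sqrt_sq (by positivity)]
  rw [sq4] at h1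
  have m1 : 2*(2*w)*Real.log (4*z) ≤ 2*(2*w)*(V+2) := by gcongr
  rw [l4] at h2
  have ht := Real.log_two_gt_d9
  have ht' := Real.log_two_lt_d9
  have m2 : (4*z-1)*Real.log 2 - 2*Real.log 2*z ≥ 1.38*z - 1 := by nlinarith only [ht, ht', hz1]
  have m3 : 4*w*(V+2) + V + 3 ≤ 0.38*w^2 := by nlinarith only [hwV, hV, hw0, mul_le_mul_of_nonneg_left hwV hw0.le, mul_pos hw0 (by linarith only [hV, ht, ht'] : 0 < V)]
  linarith only [h2, h3, h1, hzw, lz2, m1, m2, m3]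

lemma pr4 (V : ℝ) (hV : 1000 ≤ V) : 1/(4*(V+2)) ≤ ∑ p ∈ pr (Real.exp V) (4*Real.exp V), (1:ℝ)/p ∧ Real.exp V/(V+2) ≤ (pr (Real.exp V) (4*Real.exp V)).card := by
  have h := th4 V hV
  have hz : 0 < Real.exp V := Real.exp_pos _
  have hl : ∀ p ∈ pr (Real.exp V) (4*Real.exp V), Real.log p ≤ V + 2 := by
    intro p hp
    obtain ⟨h1, h2, h3⟩ := (pr_mem hz.le (by positivity)).1 hp
    calc Real.log p ≤ Real.log (4*Real.exp V) := Real.log_le_log (by linarith) h3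
      _ = 2*Real.log 2 + V := by rw [Real.log_mul (by norm_num) hz.ne', Real.log_exp, show (4:ℝ) = 2^2 by norm_num, Real.log_pow]; norm_num
      _ ≤ _ := by linarith [Real.log_two_lt_d9]
  constructor
  · calc 1/(4*(V+2)) = Real.exp V/((V+2)*(4*Real.exp V)) := by field_simp
      _ ≤ (∑ p ∈ pr (Real.exp V) (4*Real.exp V), Real.log p)/((V+2)*(4*Real.exp V)) := by gcongr
      _ ≤ _ := by
          rw [Finset.sum_div]; apply Finset.sum_le_sum; intro p hp
          obtain ⟨h1, h2, h3⟩ := (pr_mem hz.le (by positivity)).1 hp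
          have hp0 : (0:ℝ) < p := by linarith
          rw [div_le_div_iff₀ (mul_pos (by linarith) (by positivity)) hp0, one_mul]
          exact mul_le_mul (hl p hp) h3 hp0.le (by linarith)
  · rw [div_le_iff₀ (by linarith)]
    calc _ ≤ _ := h
      _ ≤ ∑ p ∈ pr (Real.exp V) (4*Real.exp V), (V+2) := Finset.sum_le_sum hl
      _ = _ := by rw [Finset.sum_const, nsmul_eq_mul]

lemma pr_mono_sum {a b c d : ℝ} (h1 : c ≤ a) (h2 : b ≤ d) : ∑ p ∈ pr a b, (1:ℝ)/p ≤ ∑ p ∈ pr c d, (1:ℝ)/p := by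
  apply Finset.sum_le_sum_of_subset_of_nonneg
  · exact Finset.filter_subset_filter _ (Finset.Ioc_subset_Ioc (Nat.floor_mono h1) (Nat.floor_mono h2))
  · intros; positivity

lemma pr_sum (V V' : ℝ) (hV : 1000 ≤ V) (hVV : V ≤ V') : (V'-V-2)/(6*V') ≤ ∑ p ∈ pr (Real.exp V) (Real.exp V'), (1:ℝ)/p := by
  have hz : 0 < Real.exp V := Real.exp_pos _
  have l4 : Real.log 4 = 2*Real.log 2 := by rw [show (4:ℝ) = 2^2 by norm_num, Real.log_pow]; norm_num
  have hl4 : 1 ≤ Real.log 4 := by rw [l4]; linarith [Real.log_two_gt_d9]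
  have hl4' : Real.log 4 ≤ 1.4 := by rw [l4]; linarith [Real.log_two_lt_d9]
  have ind : ∀ q : ℕ, V + q*Real.log 4 ≤ V' → (q:ℝ)*(1/(4*(V'+2))) ≤ ∑ p ∈ pr (Real.exp V) (Real.exp (V+q*Real.log 4)), (1:ℝ)/p := by
    intro q
    induction q with
    | zero => intro _; simp [pr]
    | succ q ih =>
      intro hq
      push_cast at hq ⊢
      have e : Real.exp (V+(q+1)*Real.log 4) = 4*Real.exp (V+q*Real.log 4) := by
        rw [show V+((q:ℝ)+1)*Real.log 4 = Real.log 4 + (V+q*Real.log 4) by ring, Real.exp_add, Real.exp_log (by norm_num)]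
      have h0 : 0 ≤ (q:ℝ)*Real.log 4 := by positivity
      rw [e, pr_add (b := Real.exp (V+q*Real.log 4)) _ (Real.exp_le_exp.2 (by linarith)) (by linarith [Real.exp_pos (V+q*Real.log 4)])]
      have h1 := ih (by linarith)
      have h2 := (pr4 (V+q*Real.log 4) (by linarith)).1
      have h3 : 1/(4*(V'+2)) ≤ 1/(4*(V+q*Real.log 4+2)) := by gcongr <;> linarith
      linarith
  set q := ⌊(V'-V)/Real.log 4⌋₊
  have q1 : (q:ℝ)*Real.log 4 ≤ V'-V := by have := Nat.floor_le (a := (V'-V)/Real.log 4) (div_nonneg (by linarith) (by linarith)); rwa [le_div_iff₀ (by linarith)] at this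
  have q2 : V'-V < (q+1)*Real.log 4 := by have := Nat.lt_floor_add_one ((V'-V)/Real.log 4); rwa [div_lt_iff₀ (by linarith)] at this
  have q3 : V'-V-1.4 ≤ q*1.4 := by nlinarith only [q2, hl4', Nat.cast_nonneg (α := ℝ) q]
  refine le_trans ?_ ((ind q (by linarith)).trans (pr_mono_sum le_rfl (Real.exp_le_exp.2 (by linarith))))
  rw [mul_one_div, div_le_div_iff₀ (by linarith) (by linarith)]
  nlinarith only [q3, hV, hVV, Nat.cast_nonneg (α := ℝ) q, mul_nonneg (Nat.cast_nonneg (α := ℝ) q) (by linarith : 0 ≤ V')]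

lemma Dv_sum (S : ℝ) (hS : 10^5 ≤ S) : Real.log S/8 ≤ ∑ p ∈ Dv S, (1:ℝ)/p := by
  have hS2 : 1000 ≤ S^2 := by nlinarith only [hS]
  have ind : ∀ q : ℕ, (q:ℝ)/13 ≤ ∑ p ∈ pr (Real.exp (S^2)) (Real.exp (S^2*2^q)), (1:ℝ)/p := by
    intro q
    induction q with
    | zero => simp [pr]
    | succ q ih =>
      have h1 : (1:ℝ) ≤ 2^q := one_le_pow₀ (by norm_num)
      have hm : S^2*1 ≤ S^2*2^q := by gcongr
      have e2 : S^2*2^(q+1) = 2*(S^2*2^q) := by ring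
      rw [e2]
      rw [pr_add (b := Real.exp (S^2*2^q)) _ (Real.exp_le_exp.2 (by linarith)) (Real.exp_le_exp.2 (by linarith))]
      have h2 := pr_sum (S^2*2^q) (2*(S^2*2^q)) (by linarith) (by linarith)
      have h3 : (1:ℝ)/13 ≤ (2*(S^2*2^q)-S^2*2^q-2)/(6*(2*(S^2*2^q))) := by
        rw [div_le_div_iff₀ (by norm_num) (by positivity)]; linarith
      push_cast; linarith only [ih, h2, h3]
  have hSp : 0 < S := by linarith
  set q := Nat.log 2 ⌊S^2⌋₊
  have q1 : 2^q ≤ ⌊S^2⌋₊ := Nat.pow_log_le_self 2 (by have : 0 < ⌊S^2⌋₊ := Nat.floor_pos.2 (by linarith)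
                                                      omega)
  have q1' : (2:ℝ)^q ≤ S^2 := le_trans (by exact_mod_cast q1) (Nat.floor_le (by positivity))
  have q2 : ⌊S^2⌋₊ < 2^(q+1) := Nat.lt_pow_succ_log_self (by norm_num) _
  have q2' : S^2 ≤ 2^(q+1) := (Nat.lt_floor_add_one _).le.trans (by exact_mod_cast q2)
  have q3 : 2*Real.log S ≤ (q+1)*Real.log 2 := by
    have := Real.log_le_log (by positivity) q2'
    rw [Real.log_pow, Real.log_pow] at this; push_cast at this; exact this
  have hlS : 11 ≤ Real.log S := by
    rw [Real.le_log_iff_exp_le hSp]; refine le_trans ?_ hS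
    have : Real.exp 11 = (Real.exp 1)^11 := by rw [← Real.exp_nat_mul]; norm_num
    rw [this]; calc _ ≤ (2.7182818286:ℝ)^11 := by gcongr; exact Real.exp_one_lt_d9.le
      _ ≤ _ := by norm_num
  have h1 := ind q
  have h2 : ∑ p ∈ pr (Real.exp (S^2)) (Real.exp (S^2*2^q)), (1:ℝ)/p ≤ ∑ p ∈ Dv S, (1:ℝ)/p := by
    apply Finset.sum_le_sum_of_subset_of_nonneg
    · intro p hp
      obtain ⟨a1, a2, a3⟩ := (pr_mem (Real.exp_pos _).le (Real.exp_pos _).le).1 hp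
      refine Dv_mem.2 ⟨a1, a2.le, a3.trans (Real.exp_le_exp.2 ?_)⟩
      calc S^2*2^q ≤ S^2*S^2 := by gcongr
        _ = _ := by ring
    · intros; positivity
  nlinarith only [h1, h2, q3, hlS, Real.log_two_lt_d9, Nat.cast_nonneg (α := ℝ) q]

noncomputable def tau (n : ℕ) : ℕ := n.divisors.card
lemma tau_mul (m n : ℕ) : tau (m*n) ≤ tau m*tau n := by unfold tau; rw [Nat.divisors_mul]; exact Finset.card_mul_le
lemma harm (M : ℕ) : ∑ d ∈ Finset.Icc 1 M, (1:ℝ)/d ≤ 1 + Real.log M := by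
  have := harmonic_le_one_add_log M
  rw [harmonic_eq_sum_Icc] at this; push_cast at this; simpa only [one_div] using this
lemma dsum (M : ℕ) (f : ℕ → ℕ → ℝ) : ∑ c ∈ Finset.Icc 1 M, ∑ d ∈ c.divisors, f c d = ∑ d ∈ Finset.Icc 1 M, ∑ k ∈ Finset.Icc 1 (M/d), f (d*k) d := by
  have : ∀ c ∈ Finset.Icc 1 M, ∑ d ∈ c.divisors, f c d = ∑ d ∈ Finset.Icc 1 M, if d ∣ c then f c d else 0 := by
    intro c hc
    rw [Finset.mem_Icc] at hc
    rw [← Finset.sum_filter]; apply Finset.sum_congr _ (fun _ _ => rfl)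
    ext d; simp only [Nat.mem_divisors, Finset.mem_filter, Finset.mem_Icc]
    exact ⟨fun h => ⟨⟨Nat.pos_of_dvd_of_pos h.1 (by omega), (Nat.le_of_dvd (by omega) h.1).trans hc.2⟩, h.1⟩, fun h => ⟨h.2, by omega⟩⟩
  rw [Finset.sum_congr rfl this, Finset.sum_comm]
  refine Finset.sum_congr rfl fun d hd => ?_
  rw [← Finset.sum_filter, sum_dvd d M (Finset.mem_Icc.1 hd).1 (fun c => f c d)]
lemma log_nn (M : ℕ) : 0 ≤ Real.log M := Real.log_natCast_nonneg M
lemma tau1 (M : ℕ) : ∑ c ∈ Finset.Icc 1 M, (tau c:ℝ) ≤ M*(1+Real.log M) := by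
  have e : ∀ c, (tau c:ℝ) = ∑ d ∈ c.divisors, 1 := fun c => by simp [tau]
  simp_rw [e]; rw [dsum]
  calc _ ≤ ∑ d ∈ Finset.Icc 1 M, (M:ℝ)*(1/d) := by
        apply Finset.sum_le_sum; intro d hd
        simp only [Finset.sum_const, Nat.card_Icc, nsmul_eq_mul, mul_one, Nat.add_sub_cancel]; rw [mul_one_div]; exact Nat.cast_div_le
    _ ≤ _ := by rw [← Finset.mul_sum]; gcongr; exact harm M
lemma log_div (M d : ℕ) : Real.log ((M/d:ℕ):ℝ) ≤ Real.log M := by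
  rcases Nat.eq_zero_or_pos (M/d) with h | h
  · rw [h]; simpa using log_nn M
  · exact Real.log_le_log (by exact_mod_cast h) (by exact_mod_cast Nat.div_le_self M d)
lemma tau2 (M : ℕ) : ∑ c ∈ Finset.Icc 1 M, (tau c:ℝ)^2 ≤ M*(1+Real.log M)^3 := by
  have hl := log_nn M
  have e : ∀ c, (tau c:ℝ)^2 = ∑ d ∈ c.divisors, (tau c:ℝ) := fun c => by simp [tau, sq]
  have h1 : ∑ d ∈ Finset.Icc 1 M, (tau d:ℝ)/d ≤ (1+Real.log M)^2 := by
    have e : ∀ c, (tau c:ℝ)/c = ∑ d ∈ c.divisors, (1:ℝ)/c := fun c => by simp [tau, div_eq_mul_inv]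
    simp_rw [e]; rw [dsum, sq]
    calc _ ≤ ∑ d ∈ Finset.Icc 1 M, (1:ℝ)/d*(1+Real.log M) := by
          apply Finset.sum_le_sum; intro d hd
          have : ∑ k ∈ Finset.Icc 1 (M/d), (1:ℝ)/((d*k:ℕ):ℝ) = 1/d*∑ k ∈ Finset.Icc 1 (M/d), (1:ℝ)/k := by
            rw [Finset.mul_sum]; refine Finset.sum_congr rfl fun k _ => ?_
            push_cast; rw [one_div_mul_one_div]
          rw [this]; gcongr; exact (harm _).trans (by linarith [log_div M d])
      _ ≤ _ := by rw [← Finset.sum_mul]; gcongr; exact harm M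
  simp_rw [e]; rw [dsum]
  calc _ ≤ ∑ d ∈ Finset.Icc 1 M, (tau d:ℝ)/d*(M*(1+Real.log M)) := by
        apply Finset.sum_le_sum; intro d hd
        calc _ ≤ ∑ k ∈ Finset.Icc 1 (M/d), (tau d:ℝ)*tau k := by gcongr with k; exact_mod_cast tau_mul d k
          _ ≤ tau d*(((M:ℝ)/d)*(1+Real.log M)) := by
              rw [← Finset.mul_sum]; gcongr
              refine (tau1 _).trans ?_
              exact mul_le_mul Nat.cast_div_le (by linarith [log_div M d]) (add_nonneg zero_le_one (log_nn _)) (by positivity)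
          _ = _ := by ring
    _ ≤ _ := by
        rw [← Finset.sum_mul]
        calc _ ≤ (1+Real.log M)^2*(M*(1+Real.log M)) := by gcongr
          _ = _ := by ring

lemma mults (d : ℕ) (hd : 1 ≤ d) (A B : ℕ) {M : Type*} [AddCommMonoid M] (f : ℕ → M) :
    ∑ c ∈ (Finset.Ico A B).filter (fun c => d ∣ c), f c = ∑ k ∈ Finset.Ico (A ⌈/⌉ d) (B ⌈/⌉ d), f (d*k) := by
  rw [← Finset.sum_image (f := f) (g := fun n => d*n)]
  · apply Finset.sum_congr _ (fun _ _ => rfl)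
    ext k; simp only [Finset.mem_filter, Finset.mem_image, Finset.mem_Ico]
    have hh : ∀ n, B ≤ d*n ↔ B ⌈/⌉ d ≤ n := fun n => by rw [ceilDiv_le_iff_le_smul (by omega)]; rfl
    have hA : ∀ n, A ⌈/⌉ d ≤ n ↔ A ≤ d*n := fun n => by rw [ceilDiv_le_iff_le_smul (by omega)]; rfl
    constructor
    · rintro ⟨⟨h1, h2⟩, n, rfl⟩
      exact ⟨n, ⟨(hA n).2 h1, by rw [← not_le] at h2 ⊢; exact fun h => h2 ((hh n).2 h)⟩, rfl⟩
    · rintro ⟨n, ⟨h1, h2⟩, rfl⟩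
      exact ⟨⟨(hA n).1 h1, by rw [← not_le] at h2 ⊢; exact fun h => h2 ((hh n).1 h)⟩, dvd_mul_right _ _⟩
  · intro a _ b _ h; exact Nat.eq_of_mul_eq_mul_left hd h
lemma cdiv (d : ℕ) (hd : 1 ≤ d) (A : ℕ) : (A:ℝ)/d ≤ (A ⌈/⌉ d : ℕ) ∧ ((A ⌈/⌉ d : ℕ):ℝ) < (A:ℝ)/d + 1 := by
  have hd0 : (0:ℝ) < d := by exact_mod_cast hd
  constructor
  · rw [div_le_iff₀ hd0]
    have : A ≤ d • (A ⌈/⌉ d) := le_smul_ceilDiv (by omega)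
    rw [smul_eq_mul, mul_comm] at this; exact_mod_cast this
  · have : A ⌈/⌉ d * d < A + d := by
      rw [Nat.ceilDiv_eq_add_pred_div]; have := Nat.div_mul_le_self (A+d-1) d; omega
    have h : ((A ⌈/⌉ d:ℕ):ℝ) * d < A + d := by exact_mod_cast this
    rw [div_add_one hd0.ne', lt_div_iff₀ hd0]; exact h
lemma cnt (d : ℕ) (hd : 1 ≤ d) (A B : ℕ) (hAB : A ≤ B) : |∑ c ∈ Finset.Ico A B, (if d ∣ c then (1:ℝ) else 0) - ((B:ℝ)-A)/d| ≤ 1 := by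
  rw [← Finset.sum_filter, mults d hd A B (fun _ => (1:ℝ))]
  have hm : A ⌈/⌉ d ≤ B ⌈/⌉ d := by
    have h : B ≤ d • (B ⌈/⌉ d) := le_smul_ceilDiv (by omega)
    exact (ceilDiv_le_iff_le_smul (by omega)).2 (hAB.trans h)
  rw [Finset.sum_const, Nat.card_Ico, nsmul_eq_mul, mul_one, Nat.cast_sub hm, abs_le, sub_div]
  have h1 := cdiv d hd A
  have h2 := cdiv d hd B
  constructor <;> linarith only [h1, h2]

lemma turan (D : Finset ℕ) (hD : ∀ p ∈ D, p.Prime) (A B : ℕ) (hAB : A ≤ B) (Q : ℝ) (hQ : (D.card:ℝ) ≤ Q) (E : ℝ) (hE : E = ∑ p ∈ D, (1:ℝ)/p) :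
    (((Finset.Ico A B).filter (fun m => ∀ p ∈ D, ¬ p ∣ m)).card:ℝ)*E^2 ≤ ((B:ℝ)-A)*E + 3*Q^2 := by
  set W : ℕ → ℝ := fun m => ∑ p ∈ D, if p ∣ m then (1:ℝ) else 0 with hW
  set len : ℝ := (B:ℝ)-A with hlen
  have hl0 : 0 ≤ len := sub_nonneg.2 (by exact_mod_cast hAB)
  have hE0 : 0 ≤ E := by rw [hE]; positivity
  have hED : E ≤ D.card := by
    rw [hE, Finset.card_eq_sum_ones]; push_cast
    exact Finset.sum_le_sum fun p hp => by
      have : (1:ℝ) ≤ p := by exact_mod_cast (hD p hp).one_lt.le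
      rw [div_le_one (by linarith)]; exact this
  have h1 : (((Finset.Ico A B).filter (fun m => ∀ p ∈ D, ¬ p ∣ m)).card:ℝ)*E^2 ≤ ∑ m ∈ Finset.Ico A B, (W m - E)^2 := by
    rw [← nsmul_eq_mul, ← Finset.sum_const]
    refine le_trans (Finset.sum_le_sum fun m hm => ?_) (Finset.sum_le_sum_of_subset_of_nonneg (Finset.filter_subset _ _) (fun _ _ _ => sq_nonneg _))
    have : W m = 0 := Finset.sum_eq_zero fun p hp => if_neg ((Finset.mem_filter.1 hm).2 p hp)
    rw [this]; apply le_of_eq; ring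
  have h2 : ∑ m ∈ Finset.Ico A B, (W m-E)^2 = ∑ m ∈ Finset.Ico A B, W m^2 - 2*E*∑ m ∈ Finset.Ico A B, W m + E^2*len := by
    have : ∑ m ∈ Finset.Ico A B, E^2 = E^2*len := by rw [Finset.sum_const, Nat.card_Ico, nsmul_eq_mul, Nat.cast_sub hAB]; ring
    rw [← this, Finset.mul_sum, ← Finset.sum_sub_distrib, ← Finset.sum_add_distrib]
    exact Finset.sum_congr rfl fun m _ => by ring
  have h3 : len*E - D.card ≤ ∑ m ∈ Finset.Ico A B, W m := by
    simp only [hW]; rw [Finset.sum_comm, hE, Finset.mul_sum, Finset.card_eq_sum_ones]; push_cast; rw [← Finset.sum_sub_distrib]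
    refine Finset.sum_le_sum fun p hp => ?_
    have := (abs_le.1 (cnt p (hD p hp).one_lt.le A B hAB)).1
    rw [mul_one_div]; linarith
  have h4 : ∑ m ∈ Finset.Ico A B, W m^2 ≤ len*E^2 + len*E + (D.card:ℝ)^2 := by
    have e1 : ∀ m, W m^2 = ∑ p ∈ D, ∑ q ∈ D, if p ∣ m ∧ q ∣ m then (1:ℝ) else 0 := fun m => by
      simp only [hW]; rw [sq, Finset.sum_mul_sum]
      exact Finset.sum_congr rfl fun p _ => Finset.sum_congr rfl fun q _ => by
        by_cases a : p ∣ m <;> by_cases b : q ∣ m <;> simp [a, b]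
    simp_rw [e1]; rw [Finset.sum_comm]
    have e2 : len*E^2 + len*E + (D.card:ℝ)^2 = ∑ p ∈ D, ∑ q ∈ D, (len*(1/p*(1/q)) + (if p = q then len*(1/(p:ℝ)) else 0) + 1) := by
      simp only [Finset.sum_add_distrib, ← Finset.mul_sum, ← Finset.sum_mul, ← hE, Finset.sum_ite_eq, Finset.sum_const, nsmul_eq_mul, mul_one]
      rw [Finset.sum_congr rfl (fun p hp => if_pos hp), ← Finset.mul_sum, ← hE]; ring
    rw [e2]
    refine Finset.sum_le_sum fun p hp => ?_
    rw [Finset.sum_comm]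
    refine Finset.sum_le_sum fun q hq => ?_
    have hp1 := (hD p hp).one_lt.le
    have hq1 := (hD q hq).one_lt.le
    split_ifs with hpq
    · subst hpq; simp only [and_self]
      have := (abs_le.1 (cnt p hp1 A B hAB)).2
      have h0 : 0 ≤ len*(1/(p:ℝ)*(1/p)) := by positivity
      rw [mul_one_div len]; linarith only [this, h0]
    · have hd : ∀ m, (p ∣ m ∧ q ∣ m) ↔ p*q ∣ m := fun m =>
        ⟨fun h => ((Nat.coprime_primes (hD p hp) (hD q hq)).2 hpq).mul_dvd_of_dvd_of_dvd h.1 h.2, fun h => ⟨(dvd_mul_right _ _).trans h, (dvd_mul_left _ _).trans h⟩⟩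
      simp_rw [hd]
      have := (abs_le.1 (cnt (p*q) (Nat.mul_pos hp1 hq1) A B hAB)).2
      rw [one_div_mul_one_div, mul_one_div]; push_cast at this; linarith
  have hD0 : (0:ℝ) ≤ D.card := Nat.cast_nonneg _
  nlinarith only [h1, h2, h3, h4, hE0, hED, hQ, hD0]

noncomputable def Vi (V : ℝ) (r : ℕ) (i : ℕ) : ℝ := V*(1-1/(2*r)) + i*(V/(2*r^2))
noncomputable def Bl (V : ℝ) (r : ℕ) (i : Fin r) : Finset ℕ := pr (Real.exp (Vi V r i)) (Real.exp (Vi V r (i+1)))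
noncomputable def BB (V : ℝ) (r : ℕ) : Finset ℕ := (Fintype.piFinset (Bl V r)).image (fun f => ∏ i, f i)

lemma Vi_mono {V : ℝ} (hV : 0 ≤ V) (r : ℕ) {i j : ℕ} (h : i ≤ j) : Vi V r i ≤ Vi V r j := by
  unfold Vi; gcongr
lemma Vi_top {V : ℝ} {r : ℕ} (hr : 1 ≤ r) : Vi V r r = V := by
  have : (r:ℝ) ≠ 0 := by positivity
  unfold Vi; field_simp; ring
lemma Bl_mem {V : ℝ} {r : ℕ} {i : Fin r} {p : ℕ} : p ∈ Bl V r i ↔ p.Prime ∧ Real.exp (Vi V r i) < p ∧ (p:ℝ) ≤ Real.exp (Vi V r (i+1)) := by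
  rw [Bl, pr_mem (Real.exp_pos _).le (Real.exp_pos _).le]
lemma Bl_disj {V : ℝ} (hV : 0 ≤ V) {r : ℕ} {i j : Fin r} {p : ℕ} (hi : p ∈ Bl V r i) (hj : p ∈ Bl V r j) : i = j := by
  have key : ∀ i j : Fin r, p ∈ Bl V r i → p ∈ Bl V r j → ¬ i < j := fun i j hi hj h => by
    have h1 := (Bl_mem.1 hi).2.2; have h2 := (Bl_mem.1 hj).2.1
    have : Real.exp (Vi V r (i+1)) ≤ Real.exp (Vi V r j) := Real.exp_le_exp.2 (Vi_mono hV r (by have : (i:ℕ) < j := h; omega))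
    linarith
  exact le_antisymm (not_lt.1 (key _ _ hj hi)) (not_lt.1 (key _ _ hi hj))
lemma Bl_inj {V : ℝ} (hV : 0 ≤ V) {r : ℕ} {f : Fin r → ℕ} (hf : ∀ i, f i ∈ Bl V r i) : Function.Injective f := fun i j h =>
  Bl_disj hV (hf i) (h ▸ hf j)

lemma BB_mem {V : ℝ} (hV : 0 ≤ V) {r : ℕ} (hr : 1 ≤ r) {b : ℕ} (hb : b ∈ BB V r) : Squarefree b ∧ b.primeFactors.card ≤ r ∧
    (∀ p ∈ b.primeFactors, Real.exp (V*(1-1/(2*r))) < p ∧ (p:ℝ) ≤ Real.exp V) ∧ Real.exp (V*(r-1/2)) ≤ b ∧ (b:ℝ) ≤ Real.exp (V*r) := by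
  obtain ⟨f, hf, rfl⟩ := Finset.mem_image.1 hb
  rw [Fintype.mem_piFinset] at hf
  have hp : ∀ i, (f i).Prime := fun i => (Bl_mem.1 (hf i)).1
  have hi := Bl_inj hV hf
  have hpf : ∀ p ∈ (∏ i, f i).primeFactors, ∃ i, p = f i := fun p h => by
    rw [Nat.mem_primeFactors] at h
    obtain ⟨i, -, h'⟩ := (Prime.dvd_finsetProd_iff h.1.prime _).1 h.2.1
    exact ⟨i, (Nat.prime_dvd_prime_iff_eq h.1 (hp i)).1 h'⟩
  have hl : ∀ i, Real.exp (V*(1-1/(2*r))) < f i := fun i => by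
    refine lt_of_le_of_lt (Real.exp_le_exp.2 ?_) (Bl_mem.1 (hf i)).2.1
    have := Vi_mono hV r (Nat.zero_le i); simpa [Vi] using this
  have hu : ∀ i, (f i:ℝ) ≤ Real.exp V := fun i => (Bl_mem.1 (hf i)).2.2.trans (Real.exp_le_exp.2 (by
    have := Vi_mono hV r (show (i:ℕ)+1 ≤ r by omega); rwa [Vi_top hr] at this))
  refine ⟨?_, ?_, fun p h => ?_, ?_, ?_⟩
  · refine Finset.squarefree_prod_of_pairwise_isCoprime (fun i _ j _ hij => ?_) (fun i _ => (hp i).squarefree)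
    exact Nat.coprime_iff_isRelPrime.1 ((Nat.coprime_primes (hp i) (hp j)).2 (fun h => hij (hi h)))
  · calc _ ≤ (Finset.univ.image f).card := Finset.card_le_card (fun p h => by
          obtain ⟨i, rfl⟩ := hpf p h; exact Finset.mem_image_of_mem _ (Finset.mem_univ _))
      _ ≤ r := Finset.card_image_le.trans (by simp)
  · obtain ⟨i, rfl⟩ := hpf p h; exact ⟨hl i, hu i⟩
  · push_cast
    have e : V*(r-1/2) = r*(V*(1-1/(2*r))) := by have : (r:ℝ) ≠ 0 := by positivity
                                                 field_simp
    rw [e, Real.exp_nat_mul]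
    calc _ = ∏ _i : Fin r, Real.exp (V*(1-1/(2*r))) := by simp
      _ ≤ _ := Finset.prod_le_prod (fun _ _ => (Real.exp_pos _).le) (fun i _ => (hl i).le)
  · push_cast; rw [mul_comm, Real.exp_nat_mul]
    calc _ ≤ ∏ _i : Fin r, Real.exp V := Finset.prod_le_prod (fun _ _ => Nat.cast_nonneg _) (fun i _ => hu i)
      _ = _ := by simp

lemma BB_sum (V : ℝ) (r : ℕ) (hr : 1 ≤ r) (hV : 2000 ≤ V) (hVr : 52*(r:ℝ)^2 ≤ V) : (1/(13*(r:ℝ)^2))^r ≤ ∑ b ∈ BB V r, (1:ℝ)/b := by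
  have hr0 : (1:ℝ) ≤ r := by exact_mod_cast hr
  have h1 : ∀ i : Fin r, 1/(13*(r:ℝ)^2) ≤ ∑ p ∈ Bl V r i, (1:ℝ)/p := fun i => by
    have a1 : V/2 ≤ Vi V r i := by
      have := Vi_mono (by linarith : 0 ≤ V) r (Nat.zero_le i)
      have h2 : 1/(2*(r:ℝ)) ≤ 1/2 := by gcongr; linarith
      have : V/2 ≤ Vi V r 0 := by simp only [Vi, Nat.cast_zero, zero_mul, add_zero]; nlinarith only [h2, hV]
      linarith
    have a2 : Vi V r (i+1) ≤ V := by
      have := Vi_mono (by linarith : 0 ≤ V) r (show (i:ℕ)+1 ≤ r by omega); rwa [Vi_top hr] at this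
    have a3 : Vi V r (i+1) - Vi V r i = V/(2*r^2) := by simp only [Vi]; push_cast; ring
    have a4 : Vi V r i ≤ Vi V r (i+1) := Vi_mono (by linarith) r (by omega)
    refine le_trans ?_ (pr_sum (Vi V r i) (Vi V r (i+1)) (by linarith) a4)
    rw [a3]
    calc 1/(13*(r:ℝ)^2) ≤ (V/(2*r^2)-2)/(6*V) := by
          rw [div_le_div_iff₀ (by positivity) (by linarith)]
          have : V/(2*(r:ℝ)^2)*(13*r^2) = 13/2*V := by field_simp
          nlinarith only [this, hVr]
      _ ≤ _ := by
          gcongr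
          · rw [sub_nonneg, le_div_iff₀ (by positivity)]; linarith [sq_nonneg (r:ℝ)]
          · linarith
  rw [BB, Finset.sum_image]
  · calc _ = ∏ _i : Fin r, (1/(13*(r:ℝ)^2)) := by simp
      _ ≤ ∏ i : Fin r, ∑ p ∈ Bl V r i, (1:ℝ)/p := Finset.prod_le_prod (fun _ _ => by positivity) (fun i _ => h1 i)
      _ = _ := by
        rw [Finset.prod_univ_sum]; refine Finset.sum_congr rfl fun f _ => ?_
        push_cast; simp
  · intro f hf g hg (h : ∏ i, f i = ∏ i, g i)
    rw [Finset.mem_coe, Fintype.mem_piFinset] at hf hg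
    funext i
    obtain ⟨j, -, h'⟩ := (Prime.dvd_finsetProd_iff (Bl_mem.1 (hf i)).1.prime _).1 (h ▸ Finset.dvd_prod_of_mem f (Finset.mem_univ i))
    have := (Nat.prime_dvd_prime_iff_eq (Bl_mem.1 (hf i)).1 (Bl_mem.1 (hg j)).1).1 h'
    have e : i = j := Bl_disj (by linarith) (hf i) (this ▸ hg j)
    rw [this, e]

/-- rough/smooth uniqueness -/
lemma rough_cop {z : ℝ} {b k : ℕ} (hb : ∀ p ∈ b.primeFactors, z < (p:ℝ)) (hk : ∀ p ∈ k.primeFactors, (p:ℝ) ≤ z) : b.Coprime k ∨ b = 0 ∨ k = 0 := by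
  by_cases h0 : b = 0; · tauto
  by_cases h1 : k = 0; · tauto
  exact Or.inl ((Nat.disjoint_primeFactors h0 h1).1 (Finset.disjoint_left.2 fun p h h' => by linarith [hb p h, hk p h']))
lemma rough_uniq {z : ℝ} {b k b' k' : ℕ} (hb : ∀ p ∈ b.primeFactors, z < (p:ℝ)) (hk : ∀ p ∈ k.primeFactors, (p:ℝ) ≤ z)
    (hb' : ∀ p ∈ b'.primeFactors, z < (p:ℝ)) (hk' : ∀ p ∈ k'.primeFactors, (p:ℝ) ≤ z) (h0 : b*k ≠ 0) (h : b*k = b'*k') : b = b' ∧ k = k' := by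
  have h0' : b'*k' ≠ 0 := h ▸ h0
  rw [mul_ne_zero_iff] at h0 h0'
  have h1 := (rough_cop hb hk').resolve_right (by tauto)
  have h2 := (rough_cop hb' hk).resolve_right (by tauto)
  have e : b = b' := Nat.dvd_antisymm (h1.dvd_of_dvd_mul_right (h ▸ dvd_mul_right b k)) (h2.dvd_of_dvd_mul_right (h ▸ dvd_mul_right b' k'))
  subst e; exact ⟨rfl, Nat.eq_of_mul_eq_mul_left (by omega) h⟩

lemma omega_tau {k : ℕ} (hk : k ≠ 0) : 2^(k.primeFactors.card) ≤ tau k := by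
  rw [tau, Nat.card_divisors hk]
  refine Finset.pow_card_le_prod _ _ _ fun p hp => ?_
  have := (Nat.prime_of_mem_primeFactors hp).factorization_pos_of_dvd hk (Nat.dvd_of_mem_primeFactors hp); omega

lemma mult (ℬ : Finset ℕ) (z : ℝ) (r M : ℕ) (hB : ∀ b ∈ ℬ, Squarefree b ∧ b.primeFactors.card ≤ r ∧ ∀ p ∈ b.primeFactors, z < (p:ℝ))
    (s : ℕ) (T : Finset (ℕ × ℕ × ℕ × ℕ)) (hT : ∀ x ∈ T, x.1*x.2.1*x.2.2.1*x.2.2.2 = s ∧ x.1 ∈ ℬ ∧ 0 < x.2.1 ∧ (∀ p ∈ x.2.1.primeFactors, (p:ℝ) ≤ z) ∧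
      x.2.2.1.Prime ∧ (x.2.2.1:ℝ) ≤ z ∧ ∃ b' ∈ ℬ, ∃ m, x.2.2.2 = b'*m ∧ 0 < m ∧ (∀ p ∈ m.primeFactors, (p:ℝ) ≤ z) ∧ 2*tau x.2.1*tau m ≤ M) :
    T.card ≤ 4^r*(Nat.log 2 M*M) := by
  have hz : ∀ a b : ℕ, 0 < a → 0 < b → (∀ p ∈ a.primeFactors, (p:ℝ) ≤ z) → (∀ p ∈ b.primeFactors, (p:ℝ) ≤ z) → ∀ p ∈ (a*b).primeFactors, (p:ℝ) ≤ z := fun a b h1 h2 h3 h4 p hp => by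
    rw [Nat.primeFactors_mul (by omega) (by omega), Finset.mem_union] at hp; exact hp.elim (h3 p) (h4 p)
  have hB0 : ∀ b ∈ ℬ, b ≠ 0 := fun b h => (hB b h).1.ne_zero
  have hg : ∀ b ∈ ℬ, ∀ b' ∈ ℬ, ∀ p ∈ (b*b').primeFactors, z < (p:ℝ) := fun b h1 b' h2 p hp => by
    rw [Nat.primeFactors_mul (hB0 b h1) (hB0 b' h2), Finset.mem_union] at hp; exact hp.elim ((hB b h1).2.2 p) ((hB b' h2).2.2 p)
  have dec : ∀ x ∈ T, ∃ b' ∈ ℬ, ∃ k : ℕ, 0 < k ∧ (∀ p ∈ k.primeFactors, (p:ℝ) ≤ z) ∧ s = (x.1*b')*k ∧ x.2.2.1 ∈ k.primeFactors ∧ x.2.1 ∈ k.divisors ∧ tau k ≤ M := fun x hx => by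
    obtain ⟨h1, h2, h3, h4, h5, h6, b', hb', m, h7, h8, h9, h10⟩ := hT x hx
    have h5' : ∀ p ∈ x.2.2.1.primeFactors, (p:ℝ) ≤ z := fun p hp => by
      rw [h5.primeFactors, Finset.mem_singleton] at hp; rw [hp]; exact h6
    have q0 := h5.pos
    have hk : 0 < x.2.1*x.2.2.1*m := by positivity
    refine ⟨b', hb', x.2.1*x.2.2.1*m, hk, hz _ _ (by positivity) h8 (hz _ _ h3 q0 h4 h5') h9, by rw [← h1, h7]; ring, ?_, ?_, ?_⟩
    · exact Nat.mem_primeFactors.2 ⟨h5, ⟨x.2.1*m, by ring⟩, hk.ne'⟩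
    · exact Nat.mem_divisors.2 ⟨⟨x.2.2.1*m, by ring⟩, hk.ne'⟩
    · have : tau x.2.2.1 = 2 := by rw [tau, h5.divisors, Finset.card_pair h5.one_lt.ne]
      calc _ ≤ tau x.2.1*tau x.2.2.1*tau m := (tau_mul _ _).trans (Nat.mul_le_mul_right _ (tau_mul _ _))
        _ ≤ M := by rw [this]; linarith only [h10]
  rcases T.eq_empty_or_nonempty with rfl | ⟨x0, hx0⟩
  · simp
  obtain ⟨b0, hb0, k, hk, hkz, hs, -, -, hkM⟩ := dec x0 hx0
  have hx0B := (hT x0 hx0).2.1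
  set g := x0.1*b0
  have hs0 : s ≠ 0 := by rw [hs]; exact mul_ne_zero (mul_ne_zero (hB0 _ hx0B) (hB0 _ hb0)) hk.ne'
  have hgc : g.primeFactors.card ≤ 2*r := by
    rw [Nat.primeFactors_mul (hB0 _ hx0B) (hB0 _ hb0)]
    have := Finset.card_union_le x0.1.primeFactors b0.primeFactors
    have := (hB _ hx0B).2.1; have := (hB _ hb0).2.1; omega
  have key : ∀ x ∈ T, x.1 ∣ g ∧ x.2.2.1 ∈ k.primeFactors ∧ x.2.1 ∈ k.divisors := fun x hx => by
    obtain ⟨b', hb', k', hk', hkz', hs', h1, h2, -⟩ := dec x hx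
    obtain ⟨e1, e2⟩ := rough_uniq (hg _ (hT x hx).2.1 _ hb') hkz' (hg _ hx0B _ hb0) hkz (hs' ▸ hs0) (hs'.symm.trans hs)
    exact ⟨⟨b', e1.symm⟩, e2 ▸ h1, e2 ▸ h2⟩
  have g0 : g ≠ 0 := mul_ne_zero (hB0 _ hx0B) (hB0 _ hb0)
  calc T.card ≤ (g.primeFactors.powerset ×ˢ (k.primeFactors ×ˢ k.divisors)).card := by
        refine Finset.card_le_card_of_injOn (fun x => (x.1.primeFactors, x.2.2.1, x.2.1)) (fun x hx => ?_) (fun x hx y hy h => ?_)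
        · obtain ⟨h1, h2, h3⟩ := key x hx
          simp only [Finset.coe_product, Set.mem_prod, Finset.mem_coe, Finset.mem_powerset]
          exact ⟨Nat.primeFactors_mono h1 g0, h2, h3⟩
        · have hX := hT x hx; have hY := hT y hy
          simp only [Prod.mk.injEq] at h
          have e1 : x.1 = y.1 := by
            rw [← Nat.prod_primeFactors_of_squarefree (hB _ hX.2.1).1, h.1, Nat.prod_primeFactors_of_squarefree (hB _ hY.2.1).1]
          have e2 := hX.1.trans hY.1.symm
          rw [e1, h.2.1, h.2.2] at e2
          have := Nat.eq_of_mul_eq_mul_left (Nat.mul_pos (Nat.mul_pos (Nat.pos_of_ne_zero (hB0 _ hY.2.1)) hY.2.2.1) hY.2.2.2.2.1.pos) e2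
          exact Prod.ext e1 (Prod.ext h.2.2 (Prod.ext h.2.1 this))
    _ ≤ _ := by
        rw [Finset.card_product, Finset.card_product, Finset.card_powerset, show (4:ℕ)^r = 2^(2*r) by rw [pow_mul]; norm_num]
        have : k.primeFactors.card ≤ Nat.log 2 M := Nat.le_log_of_pow_le (by norm_num) ((omega_tau hk.ne').trans hkM)
        gcongr
        · norm_num
        · exact hkM

def good (D : ℕ → Finset ℕ) (J : ℕ) (D' : ℝ) (m : ℕ) : Prop := (∀ j < J, ∃ q ∈ D j, q ∣ m) ∧ (tau m:ℝ) ≤ D'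
def GG (ℬ : Finset ℕ) (D : ℕ → Finset ℕ) (J : ℕ) (D' : ℝ) (n : ℕ) : Prop := ∃ b ∈ ℬ, ∃ m, n = b*m ∧ good D J D' m

lemma GG_hyp (ℬ : Finset ℕ) (D : ℕ → Finset ℕ) (J : ℕ) (D' z : ℝ) (hB : ∀ b ∈ ℬ, b ≠ 0 ∧ ∀ p ∈ b.primeFactors, z < (p:ℝ))
    (hD : ∀ j < J, ∀ p ∈ D j, p.Prime ∧ (p:ℝ) ≤ z) (hdis : ∀ i < J, ∀ j < J, ∀ p, p ∈ D i → p ∈ D j → i = j) (j : ℕ) (hj : j < J) :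
    Hyp (GG ℬ D J D') (D j) := by
  refine ⟨fun n ⟨b, hb, m, e, h, _⟩ => ?_, fun p hp p' hp' m0 h1 h2 ⟨b, hb, m, e, h, ht⟩ => ?_⟩
  · obtain ⟨q, hq, hd⟩ := h j hj
    exact ⟨q, hq, e ▸ hd.mul_left b⟩
  · obtain ⟨pp, pz⟩ := hD j hj p hp
    obtain ⟨pp', -⟩ := hD j hj p' hp'
    have hpb : ¬ p ∣ b := fun h => by have := (hB b hb).2 p (Nat.mem_primeFactors.2 ⟨pp, h, (hB b hb).1⟩); linarith
    obtain ⟨m1, rfl⟩ := (pp.dvd_mul.1 (e ▸ dvd_mul_right p m0)).resolve_left hpb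
    have e' : m0 = b*m1 := Nat.eq_of_mul_eq_mul_left pp.pos (e.trans (by ring))
    have c1 : ∀ q : ℕ, q.Prime → ¬ q ∣ m0 → tau (q*m1) = 2*tau m1 := fun q hq hqm => by
      have : Nat.Coprime q m1 := (Nat.Prime.coprime_iff_not_dvd hq).2 (fun h => hqm (e' ▸ h.mul_left b))
      rw [tau, this.card_divisors_mul, hq.divisors, Finset.card_pair hq.one_lt.ne]; rfl
    refine ⟨b, hb, p'*m1, by rw [e']; ring, fun i hi => ?_, by rw [c1 p' pp' h2]; rwa [c1 p pp h1] at ht⟩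
    by_cases hij : i = j
    · subst hij; exact ⟨p', hp', dvd_mul_right _ _⟩
    · obtain ⟨q, hq, hd⟩ := h i hi
      refine ⟨q, hq, ((hD i hi q hq).1.dvd_mul.1 hd).resolve_left (fun h => ?_) |>.mul_left p'⟩
      rw [(Nat.prime_dvd_prime_iff_eq (hD i hi q hq).1 pp).1 h] at hq
      exact hij (hdis i hi j hj p hq hp)

lemma good_cnt (D : ℕ → Finset ℕ) (J : ℕ) (D' Q : ℝ) (A B : ℕ) (hAB : A ≤ B) (hD : ∀ j < J, (∀ p ∈ D j, p.Prime) ∧ ((D j).card:ℝ) ≤ Q ∧ 12*3^j ≤ ∑ p ∈ D j, (1:ℝ)/p)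
    (hQ : 3*Q^2 ≤ B-A) (hB : (B:ℝ) ≤ 3*(B-A)) (hD' : 12*(1+Real.log B) ≤ D') :
    ((B:ℝ)-A)/2 ≤ ∑ m ∈ Finset.Ico A B, (if good D J D' m then (1:ℝ) else 0) := by
  have hAB' : (A:ℝ) ≤ B := by exact_mod_cast hAB
  have hl : 0 ≤ Real.log B := log_nn B
  have h1 : ∀ m ∈ Finset.Ico A B, 1 - ∑ j ∈ Finset.range J, (if ∀ p ∈ D j, ¬ p ∣ m then (1:ℝ) else 0) - (tau m:ℝ)/D' ≤ if good D J D' m then (1:ℝ) else 0 := fun m _ => by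
    have h0 : 0 ≤ ∑ j ∈ Finset.range J, (if ∀ p ∈ D j, ¬ p ∣ m then (1:ℝ) else 0) := Finset.sum_nonneg fun j _ => by split_ifs <;> norm_num
    have h0' : 0 ≤ (tau m:ℝ)/D' := by apply div_nonneg (Nat.cast_nonneg _); linarith
    split_ifs with h
    · linarith
    · rw [good, not_and_or] at h
      rcases h with h | h
      · push Not at h
        obtain ⟨j, hj, h⟩ := h
        have := Finset.single_le_sum (f := fun j => (if ∀ p ∈ D j, ¬ p ∣ m then (1:ℝ) else 0)) (fun j _ => by split_ifs <;> norm_num) (Finset.mem_range.2 hj)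
        rw [if_pos h] at this; linarith
      · have : 1 ≤ (tau m:ℝ)/D' := by rw [le_div_iff₀ (by linarith)]; linarith
        linarith
  have h2 : ∀ j ∈ Finset.range J, ∑ m ∈ Finset.Ico A B, (if ∀ p ∈ D j, ¬ p ∣ m then (1:ℝ) else 0) ≤ ((B:ℝ)-A)/6*(1/3)^j := fun j hj => by
    obtain ⟨a1, a2, a3⟩ := hD j (Finset.mem_range.1 hj)
    have := turan (D j) a1 A B hAB Q a2 _ rfl
    rw [Finset.sum_boole]
    set E := ∑ p ∈ D j, (1:ℝ)/p
    have h3 : (1:ℝ) ≤ 3^j := one_le_pow₀ (by norm_num)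
    have hE : 1 ≤ E := by linarith
    have h4 : (((Finset.Ico A B).filter (fun m => ∀ p ∈ D j, ¬ p ∣ m)).card:ℝ)*E^2 ≤ 2*(B-A)*E := by nlinarith only [hQ, a3, this, h3]
    have h5 : (((Finset.Ico A B).filter (fun m => ∀ p ∈ D j, ¬ p ∣ m)).card:ℝ)*E ≤ 2*(B-A) := by
      refine le_of_mul_le_mul_right ?_ (by linarith : 0 < E); linarith
    rw [one_div, inv_pow, ← div_eq_mul_inv, le_div_iff₀ (by positivity)]
    have := mul_le_mul_of_nonneg_left a3 (Nat.cast_nonneg ((Finset.Ico A B).filter (fun m => ∀ p ∈ D j, ¬ p ∣ m)).card (α := ℝ))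
    linarith
  have h3 : ∑ m ∈ Finset.Ico A B, (tau m:ℝ)/D' ≤ ((B:ℝ)-A)/4 := by
    rw [← Finset.sum_div, div_le_iff₀ (by linarith)]
    calc _ ≤ ∑ c ∈ Finset.Icc 1 B, (tau c:ℝ) := by
          refine (Finset.sum_le_sum_of_subset_of_nonneg (Finset.Ico_subset_Icc_self.trans (Finset.Icc_subset_Icc_left (Nat.zero_le A))) (fun _ _ _ => Nat.cast_nonneg _)).trans ?_
          rw [← Finset.Ioc_insert_left (Nat.zero_le B), Finset.sum_insert (by simp)]; simp [tau]; rfl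
      _ ≤ B*(1+Real.log B) := tau1 B
      _ ≤ _ := by nlinarith only [hQ, hB, hD', hl]
  have h4 : ∑ j ∈ Finset.range J, ((B:ℝ)-A)/6*(1/3)^j ≤ (B-A)/4 := by
    rw [← Finset.mul_sum, geom_sum_eq (by norm_num)]
    have : (0:ℝ) ≤ (1/3)^J := by positivity
    have h : (((1:ℝ)/3)^J-1)/(1/3-1) ≤ 3/2 := by rw [div_le_iff_of_neg (by norm_num)]; linarith
    nlinarith only [hQ, h]
  have h5 := Finset.sum_le_sum h1
  rw [Finset.sum_sub_distrib, Finset.sum_sub_distrib, Finset.sum_comm] at h5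
  have h6 := Finset.sum_le_sum h2
  simp only [Finset.sum_const, Nat.card_Ico, nsmul_eq_mul, mul_one, Nat.cast_sub hAB] at h5
  linarith only [h3, h4, h6, h5]

noncomputable def sd (Y c : ℕ) : ℕ := (c.divisors.filter (fun d => d ≤ Nat.sqrt (32*Y))).card
noncomputable def ga (D : ℝ) (Y c : ℕ) : ℝ := if Y ≤ c ∧ c < 32*Y then 1 - 2/D*sd Y c else 0

lemma ga_le {D : ℝ} (hD : 0 < D) (Y c : ℕ) : ga D Y c ≤ 1 := by
  unfold ga; split_ifs
  · have : 0 ≤ 2/D*(sd Y c:ℝ) := by positivity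
    linarith
  · norm_num
lemma ga_supp {D : ℝ} {Y c : ℕ} (h : ga D Y c ≠ 0) : Y ≤ c ∧ c < 32*Y := by by_contra h'; exact h (if_neg h')
lemma ga_pos {D : ℝ} (hD : 0 < D) {Y c : ℕ} (h : 0 < ga D Y c) : (tau c:ℝ) ≤ D := by
  have hc := ga_supp h.ne'
  rw [ga, if_pos hc, sub_pos, div_mul_eq_mul_div, div_lt_one hD] at h
  have : tau c ≤ 2*sd Y c := by
    rw [tau, ← Finset.card_filter_add_card_filter_not (fun d => d ≤ Nat.sqrt (32*Y)), two_mul]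
    apply Nat.add_le_add_left
    refine Finset.card_le_card_of_injOn (fun d => c/d) (fun d hd => ?_) (fun d hd e he hde => ?_)
    · simp only [Finset.coe_filter, Set.mem_ofPred_eq, Nat.mem_divisors, not_le] at hd ⊢
      refine ⟨⟨Nat.div_dvd_of_dvd hd.1.1, hd.1.2⟩, Nat.lt_succ_iff.1 ((Nat.div_lt_iff_lt_mul (by omega)).2 ?_)⟩
      calc c < 32*Y := hc.2
        _ < (Nat.sqrt (32*Y)+1)*(Nat.sqrt (32*Y)+1) := Nat.lt_succ_sqrt _
        _ ≤ _ := Nat.mul_le_mul_left _ hd.2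
    · simp only [Finset.coe_filter, Set.mem_ofPred_eq, Nat.mem_divisors] at hd he
      rw [← Nat.div_div_self hd.1.1 hd.1.2, ← Nat.div_div_self he.1.1 he.1.2, show c/d = c/e from hde]
  have : (tau c:ℝ) ≤ 2*sd Y c := by exact_mod_cast this
  linarith
lemma ga_sq {D : ℝ} (hD : 0 < D) (Y : ℕ) (hY : 4*(1+Real.log (32*Y))^3 ≤ D^2) (M : ℕ) : ∑ c ∈ Finset.Icc 1 M, ga D Y c^2 ≤ 64*Y := by
  have h1 : ∀ c, ga D Y c^2 ≤ if c ∈ Finset.Ico Y (32*Y) then 1+4/D^2*(tau c:ℝ)^2 else 0 := fun c => by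
    by_cases h : c ∈ Finset.Ico Y (32*Y)
    · rw [if_pos h]; rw [Finset.mem_Ico] at h; rw [ga, if_pos h]
      have h2 : (sd Y c:ℝ)^2 ≤ (tau c:ℝ)^2 := by gcongr; exact Finset.card_filter_le _ _
      have h3 : 0 ≤ 2/D*(sd Y c:ℝ) := by positivity
      calc _ ≤ 1+4/D^2*(sd Y c:ℝ)^2 := by rw [show 4/D^2*(sd Y c:ℝ)^2 = (2/D*sd Y c)^2 by ring]; linarith only [h3]
        _ ≤ _ := by gcongr
    · rw [if_neg h]; rw [Finset.mem_Ico] at h; rw [ga, if_neg h]; norm_num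
  have h0 : ∀ c, (0:ℝ) ≤ if c ∈ Finset.Ico Y (32*Y) then 1+4/D^2*(tau c:ℝ)^2 else 0 := fun c => (sq_nonneg _).trans (h1 c)
  have hT := tau2 (32*Y)
  push_cast at hT
  calc _ ≤ ∑ c ∈ Finset.Icc 1 M, if c ∈ Finset.Ico Y (32*Y) then 1+4/D^2*(tau c:ℝ)^2 else 0 := Finset.sum_le_sum fun c _ => h1 c
    _ = ∑ c ∈ (Finset.Icc 1 M).filter (· ∈ Finset.Ico Y (32*Y)), (1+4/D^2*(tau c:ℝ)^2) := by rw [Finset.sum_filter]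
    _ ≤ ∑ c ∈ Finset.Icc 1 (32*Y), (1+4/D^2*(tau c:ℝ)^2) := by
        refine Finset.sum_le_sum_of_subset_of_nonneg (fun c h => ?_) (fun _ _ _ => by positivity)
        simp only [Finset.mem_filter, Finset.mem_Icc, Finset.mem_Ico] at h ⊢; omega
    _ ≤ 32*Y + 4/D^2*(32*Y*(1+Real.log (32*Y))^3) := by
        rw [Finset.sum_add_distrib, ← Finset.mul_sum]; gcongr; simp
    _ = 32*Y + (4*(1+Real.log (32*Y))^3)/D^2*(32*Y) := by ring
    _ ≤ 32*Y + 1*(32*Y) := by gcongr; rw [div_le_one (by positivity)]; exact hY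
    _ = _ := by ring

lemma dsum' {R : Type*} [CommRing R] (Y : ℕ) (hY : 1 ≤ Y) (f : ℕ → R) : ∑ c ∈ Finset.Ico Y (32*Y), (sd Y c:R)*f c =
    ∑ d ∈ Finset.Icc 1 (Nat.sqrt (32*Y)), ∑ k ∈ Finset.Ico (Y ⌈/⌉ d) ((32*Y) ⌈/⌉ d), f (d*k) := by
  calc _ = ∑ c ∈ Finset.Ico Y (32*Y), ∑ d ∈ Finset.Icc 1 (Nat.sqrt (32*Y)), if d ∣ c then f c else 0 := by
        refine Finset.sum_congr rfl fun c hc => ?_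
        rw [Finset.mem_Ico] at hc
        rw [← Finset.sum_filter, Finset.sum_const, nsmul_eq_mul, sd]
        congr 3; ext d; simp only [Finset.mem_filter, Nat.mem_divisors, Finset.mem_Icc]
        constructor
        · rintro ⟨⟨h1, h2⟩, h3⟩; exact ⟨⟨Nat.pos_of_dvd_of_pos h1 (by omega), h3⟩, h1⟩
        · rintro ⟨⟨h1, h2⟩, h3⟩; exact ⟨⟨h3, by omega⟩, h2⟩
    _ = _ := by
        rw [Finset.sum_comm]; refine Finset.sum_congr rfl fun d hd => ?_
        rw [← Finset.sum_filter, mults d (Finset.mem_Icc.1 hd).1]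

lemma Cw_bound {D : ℝ} (hD : 0 < D) (Y M : ℕ) (hY : 1 ≤ Y) (hM : 32*Y ≤ M) (t σ : ℝ) (hσ : 0 ≤ σ) (hDY : 2*(1+Real.log (32*Y)) ≤ D)
    (h : ∀ d ∈ Finset.Icc 1 (Nat.sqrt (32*Y)), ‖ds (Finset.Ico (Y ⌈/⌉ d) ((32*Y) ⌈/⌉ d)) t‖ ≤ σ*(Y/d)) : ‖dp M (ga D Y) t‖ ≤ 2*(σ*Y) := by
  have e : dp M (ga D Y) t = ds (Finset.Ico Y (32*Y)) t - (2/D:ℝ)*∑ d ∈ Finset.Icc 1 (Nat.sqrt (32*Y)), dz t d*ds (Finset.Ico (Y ⌈/⌉ d) ((32*Y) ⌈/⌉ d)) t := by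
    have e1 : dp M (ga D Y) t = ∑ c ∈ Finset.Ico Y (32*Y), (dz t c-(2/D:ℝ)*(sd Y c*dz t c)) := by
      rw [dp, ← Finset.sum_subset (s₁ := Finset.Ico Y (32*Y))]
      · refine Finset.sum_congr rfl fun c hc => ?_
        rw [ga, if_pos (Finset.mem_Ico.1 hc)]; push_cast; ring
      · intro c; simp only [Finset.mem_Ico, Finset.mem_Icc]; omega
      · intro c _ hc; rw [ga, if_neg (by rwa [Finset.mem_Ico] at hc)]; simp
    rw [e1, Finset.sum_sub_distrib, ← Finset.mul_sum, dsum' Y hY]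
    congr 2
    refine Finset.sum_congr rfl fun d hd => ?_
    rw [Finset.mem_Icc] at hd
    rw [ds, Finset.mul_sum]; refine Finset.sum_congr rfl fun k hk => dz_mul _ _ _ (by omega) ?_
    have := (cdiv d hd.1 Y).1; rintro rfl
    rw [Finset.mem_Ico] at hk
    have h0 : 0 < (Y:ℝ)/d := div_pos (by exact_mod_cast hY) (by exact_mod_cast hd.1)
    have : (0:ℝ) < (Y ⌈/⌉ d : ℕ) := by linarith only [this, h0]
    have : 0 < Y ⌈/⌉ d := by exact_mod_cast this
    omega
  have hs1 : 1 ≤ Nat.sqrt (32*Y) := Nat.le_sqrt.2 (by omega)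
  have h1 : ‖ds (Finset.Ico Y (32*Y)) t‖ ≤ σ*Y := by have := h 1 (Finset.mem_Icc.2 ⟨le_rfl, hs1⟩); simpa using this
  have hY0 : (0:ℝ) < Y := by exact_mod_cast hY
  have h2 : ‖∑ d ∈ Finset.Icc 1 (Nat.sqrt (32*Y)), dz t d*ds (Finset.Ico (Y ⌈/⌉ d) ((32*Y) ⌈/⌉ d)) t‖ ≤ σ*Y*(1+Real.log (32*Y)) := by
    calc _ ≤ ∑ d ∈ Finset.Icc 1 (Nat.sqrt (32*Y)), σ*Y*(1/d) := by
          refine (norm_sum_le _ _).trans (Finset.sum_le_sum fun d hd => ?_)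
          rw [norm_mul, dz_norm, one_mul]; refine (h d hd).trans_eq (by ring)
      _ ≤ σ*Y*(1+Real.log (Nat.sqrt (32*Y))) := by rw [← Finset.mul_sum]; gcongr; exact harm _
      _ ≤ _ := by gcongr; exact_mod_cast Nat.sqrt_le_self _
  rw [e]
  refine (norm_sub_le _ _).trans ?_
  rw [norm_mul, Complex.norm_real, Real.norm_of_nonneg (by positivity)]
  have h3 : 2/D*(σ*Y*(1+Real.log (32*Y))) ≤ σ*Y := by
    rw [div_mul_eq_mul_div, div_le_iff₀ hD]
    have : 0 ≤ σ*Y := by positivity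
    nlinarith only [hDY, this]
  have h4 := mul_le_mul_of_nonneg_left h2 (show 0 ≤ 2/D by positivity)
  linarith only [h1, h3, h4]

lemma zs (q m k : ℕ) (hq : 1 ≤ q) (hk : k = 12*q) (hm1 : 1 ≤ m) (hmk : m ≤ k) (hm : 100*(k+1) ≤ 2^m) (M M' : ℕ) (lam T0 T1 σ t : ℝ)
    (hl : Real.exp lam ≤ M) (hlk : 28*(12*k) ≤ lam) (hT : 9*Real.log T1 ≤ lam*k) (hM' : M' ≤ 32*M) (hT0 : 0 < T0) (ht0 : T0 ≤ |t|) (ht1 : |t| ≤ T1)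
    (hσ1 : 192/T0 ≤ σ) (hσ2 : 2000*Real.exp (-(lam/(3200*(k:ℝ)^3*(m:ℝ)^2))) ≤ σ) : ‖ds (Finset.Ico M M') t‖ ≤ σ*M := by
  wlog htp : 0 ≤ t generalizing t
  · have := this (-t) (by rwa [abs_neg]) (by rwa [abs_neg]) (by linarith only [htp])
    rwa [ds_neg] at this
  rw [abs_of_nonneg htp] at ht0 ht1
  have hM1 : 1 ≤ M := by have : (0:ℝ) < M := (Real.exp_pos _).trans_le hl
                         exact_mod_cast this
  rcases le_or_gt t M with h | h
  · have := KL_zeta t M M' hM1 (hT0.trans_le ht0) h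
    refine this.trans ?_
    calc 6*(M':ℝ)/t ≤ 6*(32*M)/T0 := by gcongr; exact_mod_cast hM'
      _ = 192/T0*M := by ring
      _ ≤ _ := by gcongr
  · have ht : 0 < t := by linarith
    have hMt : lam ≤ Real.log t := by rw [Real.le_log_iff_exp_le ht]; linarith
    have hA : (10:ℝ)^(12*k) ≤ t := by
      refine le_trans ?_ (hl.trans h.le)
      rw [← Real.exp_log (show (0:ℝ) < 10^(12*k) by positivity), Real.exp_le_exp, Real.log_pow]
      have : Real.log 10 ≤ 28 := (Real.log_le_sub_one_of_pos (by norm_num)).trans (by norm_num)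
      push_cast; nlinarith only [hlk, this, show (0:ℝ) ≤ k from Nat.cast_nonneg k]
    have h9 : t^9 ≤ (M:ℝ)^k := by
      calc t^9 ≤ T1^9 := by gcongr
        _ = Real.exp (9*Real.log T1) := by rw [show (9:ℝ) = (9:ℕ) by norm_num, Real.exp_nat_mul, Real.exp_log (by linarith only [hT0, ht0, ht1])]
        _ ≤ Real.exp (k*lam) := Real.exp_le_exp.2 (by linarith)
        _ ≤ _ := by rw [Real.exp_nat_mul]; gcongr
    refine (zeta_sum q m k hq hk t hA M M' h9 h.le hM' hm1 hmk hm).trans ?_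
    rw [Real.rpow_def_of_pos ht, mul_right_comm]
    gcongr
    refine le_trans ?_ hσ2
    gcongr
    rw [mul_neg, neg_le_neg_iff, mul_one_div]; gcongr

lemma cv_sum (P : Finset ℕ) (a : ℕ → ℕ → ℝ) (K M : ℕ) (g : ℕ → ℝ) (h : ∀ p ∈ P, 1 ≤ p ∧ ∀ m, a p m ≠ 0 → 1 ≤ m ∧ m ≤ M ∧ p*m ≤ K) :
    ∑ k ∈ Finset.Icc 1 K, cv P a k*g k = ∑ p ∈ P, ∑ m ∈ Finset.Icc 1 M, a p m*g (p*m) := by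
  unfold cv
  simp only [Finset.sum_mul, Finset.sum_filter, ite_mul, zero_mul]
  rw [Finset.sum_comm]
  refine Finset.sum_congr rfl fun p hp => ?_
  obtain ⟨hp1, hp2⟩ := h p hp
  rw [← Finset.sum_filter, sum_dvd p K hp1]
  simp only [Nat.mul_div_cancel_left _ (show 0 < p by omega)]
  have key : ∀ Q, (∀ m, a p m ≠ 0 → m ≤ Q) → ∑ m ∈ Finset.Icc 1 Q, a p m*g (p*m) = ∑ m ∈ Finset.Icc 1 (max (K/p) M ⊔ Q), a p m*g (p*m) := fun Q hQ => by
    refine Finset.sum_subset (Finset.Icc_subset_Icc_right (le_sup_right)) fun m hm hm' => ?_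
    rw [Finset.mem_Icc] at hm hm'
    have : a p m = 0 := by by_contra h0; exact hm' ⟨hm.1, hQ m h0⟩
    rw [this, zero_mul]
  rw [key (K/p) (fun m hm => (Nat.le_div_iff_mul_le (by omega)).2 (by linarith [(hp2 m hm).2.2])), key M (fun m hm => (hp2 m hm).2.1)]
  simp

structure Cor (N Pm : ℕ) (ℬ P0 : Finset ℕ) (a : ℕ → ℕ → ℝ) : Prop where
  hN : 1 ≤ N
  hB : ∀ b ∈ ℬ, 1 ≤ b ∧ ∀ c, a b c ≠ 0 → 1 ≤ c ∧ c ≤ 64*N ∧ b*c ≤ 64*N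
  hu : ∀ b ∈ ℬ, ∀ b' ∈ ℬ, ∀ c c', a b c ≠ 0 → a b' c' ≠ 0 → b*c = b'*c' → b = b'
  hP : ∀ p ∈ P0, 1 ≤ p ∧ p ≤ Pm

lemma Cor.abs {N Pm : ℕ} {ℬ P0 : Finset ℕ} {a : ℕ → ℕ → ℝ} (h : Cor N Pm ℬ P0 a) : Cor N Pm ℬ P0 (fun b c => |a b c|) :=
  ⟨h.hN, fun b hb => ⟨(h.hB b hb).1, fun c hc => (h.hB b hb).2 c (abs_ne_zero.1 hc)⟩,
    fun b hb b' hb' c c' h1 h2 => h.hu b hb b' hb' c c' (abs_ne_zero.1 h1) (abs_ne_zero.1 h2), h.hP⟩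

lemma Cor.A_eq {N Pm : ℕ} {ℬ P0 : Finset ℕ} {a : ℕ → ℕ → ℝ} (h : Cor N Pm ℬ P0 a) (t : ℝ) :
    dp (64*N) (cv ℬ a) t = ∑ b ∈ ℬ, dz t b*dp (64*N) (a b) t := by
  rw [dp_conv ℬ a (64*N) (1+ℬ.sup id) (fun b hb => ⟨(h.hB b hb).1, (Finset.le_sup (f := id) hb).trans (by omega)⟩)
    (fun b hb c hc => ⟨((h.hB b hb).2 c hc).1, ((h.hB b hb).2 c hc).2.1⟩)]
  refine (dp_mono (fun k hk => ?_) (Nat.le_mul_of_pos_left _ (by omega)) t).symm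
  obtain ⟨b, hb, h'⟩ := Finset.exists_ne_zero_of_sum_ne_zero hk
  rw [Finset.mem_filter] at hb
  have := (h.hB b hb.1).2 _ h'
  rw [Nat.mul_div_cancel' hb.2] at this
  exact ⟨Nat.pos_of_ne_zero (by rintro rfl; simp at this), this.2.2⟩

lemma Cor.sq {N Pm : ℕ} {ℬ P0 : Finset ℕ} {a : ℕ → ℕ → ℝ} (h : Cor N Pm ℬ P0 a) :
    ∑ k ∈ Finset.Icc 1 (64*N), cv ℬ a k^2 = ∑ b ∈ ℬ, ∑ c ∈ Finset.Icc 1 (64*N), a b c^2 := by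
  have e : ∀ k, cv ℬ a k^2 = cv ℬ (fun b c => a b c^2) k*1 := fun k => by
    unfold cv
    by_cases h0 : ∃ b ∈ ℬ.filter (· ∣ k), a b (k/b) ≠ 0
    · obtain ⟨b, hb, hb0⟩ := h0
      have hz : ∀ b' ∈ ℬ.filter (· ∣ k), b' ≠ b → a b' (k/b') = 0 := fun b' hb' hne => by
        by_contra h1
        rw [Finset.mem_filter] at hb hb'
        exact hne (h.hu b' hb'.1 b hb.1 _ _ h1 hb0 (by rw [Nat.mul_div_cancel' hb.2, Nat.mul_div_cancel' hb'.2]))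
      rw [Finset.sum_eq_single_of_mem b hb hz, Finset.sum_eq_single_of_mem b hb (fun b' h1 h2 => by simp [hz b' h1 h2]), mul_one]
    · push Not at h0
      rw [Finset.sum_eq_zero h0, Finset.sum_eq_zero (fun b hb => by simp [h0 b hb])]; norm_num
  simp_rw [e]
  rw [cv_sum ℬ _ (64*N) (64*N) (fun _ => 1) (fun b hb => ⟨(h.hB b hb).1, fun c hc => (h.hB b hb).2 c (fun h0 => hc (by simp [h0]))⟩)]
  simp

lemma fG_sq (N G) (n : ℕ) : fG N G n^2 = fG N G n := by unfold fG; split_ifs <;> norm_num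
lemma fG_nn (N G) (n : ℕ) : 0 ≤ fG N G n := by unfold fG; split_ifs <;> norm_num
lemma fG_sup (N G) (hN : 1 ≤ N) : sup (fG N G) (2*N) := fun n hn => by
  unfold fG at hn; split_ifs at hn with h
  · omega
  · simp at hn

lemma DF_eq {N Pm : ℕ} {P0 : Finset ℕ} (G) (hN : 1 ≤ N) (hP : ∀ p ∈ P0, 1 ≤ p ∧ p ≤ Pm) (t : ℝ) :
    dp (Pm*(2*N)) (cv P0 (fun _ => fG N G)) t = ds P0 t*dp (2*N) (fG N G) t := by
  rw [← dp_conv P0 _ (2*N) Pm hP (fun _ _ => fG_sup N G hN), ds, Finset.sum_mul]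

noncomputable def TS (N : ℕ) (ℬ P0 : Finset ℕ) (G : ℕ → Prop) (ℓ : ℝ) (a : ℕ → ℕ → ℝ) (η : ℝ) : ℝ :=
  ∑ b ∈ ℬ, ∑ c ∈ Finset.Icc 1 (64*N), ∑ p ∈ P0, ∑ n ∈ Finset.Icc 1 (2*N), a b c*fG N G n*Real.exp (-(ℓ-Real.log (b*c*p*n))^2/(2*η^2))

lemma Cor.R {N Pm : ℕ} {ℬ P0 : Finset ℕ} {a : ℕ → ℕ → ℝ} (h : Cor N Pm ℬ P0 a) (G) (ℓ η : ℝ) (hη : 0 < η) :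
    ∫ t, dp (64*N) (cv ℬ a) t*(ds P0 t*dp (2*N) (fG N G) t)*ee (t*ℓ) ∂(gm η) = (TS N ℬ P0 G ℓ a η : ℂ) := by
  simp_rw [← DF_eq (Pm := Pm) G h.hN h.hP]
  rw [R_eq η hη]
  congr 1
  calc _ = ∑ k ∈ Finset.Icc 1 (64*N), cv ℬ a k*∑ n ∈ Finset.Icc 1 (Pm*(2*N)), cv P0 (fun _ => fG N G) n*Real.exp (-(ℓ-Real.log (k*n))^2/(2*η^2)) := by
        simp only [Finset.mul_sum, mul_assoc]
    _ = _ := by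
        rw [cv_sum ℬ a (64*N) (64*N) (fun k => ∑ n ∈ Finset.Icc 1 (Pm*(2*N)), cv P0 (fun _ => fG N G) n*Real.exp (-(ℓ-Real.log (k*n))^2/(2*η^2))) h.hB, TS]
        refine Finset.sum_congr rfl fun b _ => Finset.sum_congr rfl fun c _ => ?_
        rw [cv_sum P0 _ (Pm*(2*N)) (2*N) (fun n => Real.exp (-(ℓ-Real.log (((b*c:ℕ):ℝ)*n))^2/(2*η^2))) (fun p hp => ⟨(h.hP p hp).1, fun m hm => by
          have := fG_sup N G h.hN m hm; exact ⟨this.1, this.2, Nat.mul_le_mul (h.hP p hp).2 this.2⟩⟩)]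
        simp only [Finset.mul_sum]; push_cast
        refine Finset.sum_congr rfl fun p _ => Finset.sum_congr rfl fun n _ => ?_
        rw [← mul_assoc (b*c:ℝ), ← mul_assoc]

lemma Cor.MVA {N Pm : ℕ} {ℬ P0 : Finset ℕ} {a : ℕ → ℕ → ℝ} (h : Cor N Pm ℬ P0 a) (η : ℝ) (hη : 0 < η) (hηN : η*N ≤ 2) (SA : ℝ)
    (hSA : ∑ b ∈ ℬ, ∑ c ∈ Finset.Icc 1 (64*N), a b c^2 ≤ SA) : ∫ t, ‖dp (64*N) (cv ℬ a) t‖^2 ∂(gm η) ≤ 516*SA := by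
  refine (MV η hη (64*N) (by have := h.hN; omega) _).trans ?_
  rw [h.sq]; gcongr
  · push_cast; linarith
lemma MVF {N : ℕ} (hN : 1 ≤ N) (G) (η : ℝ) (hη : 0 < η) (hηN : η*N ≤ 2) (SF : ℝ)
    (hSF : ∑ n ∈ Finset.Icc 1 (2*N), fG N G n ≤ SF) : ∫ t, ‖dp (2*N) (fG N G) t‖^2 ∂(gm η) ≤ 20*SF := by
  refine (MV η hη (2*N) (by omega) _).trans ?_
  simp_rw [fG_sq]
  have : 0 ≤ ∑ n ∈ Finset.Icc 1 (2*N), fG N G n := Finset.sum_nonneg fun n _ => fG_nn N G n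
  gcongr
  push_cast; linarith

noncomputable def TT (N : ℕ) (ℬ P0 : Finset ℕ) (G : ℕ → Prop) (ℓ : ℝ) (a : ℕ → ℕ → ℝ) (w : ℝ) : Finset (ℕ × ℕ × ℕ × ℕ) :=
  (ℬ ×ˢ Finset.Icc 1 (64*N) ×ˢ P0 ×ˢ Finset.Icc 1 (2*N)).filter (fun x => 0 < a x.1 x.2.1 ∧ fG N G x.2.2.2 = 1 ∧ |ℓ-Real.log (x.1*x.2.1*x.2.2.1*x.2.2.2)| < w)

lemma core {N Pm : ℕ} {ℬ P0 : Finset ℕ} {a : ℕ → ℕ → ℝ} (h : Cor N Pm ℬ P0 a) (ha1 : ∀ b c, a b c ≤ 1) (G) (ℓ η η₀ T₀ w SA SF B0 Er : ℝ) (hη : 0 < η) (hηη : η ≤ η₀)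
    (hηN : η*N ≤ 1) (hT : 0 ≤ T₀) (hw : 0 ≤ w) (hSA : ∑ b ∈ ℬ, ∑ c ∈ Finset.Icc 1 (64*N), a b c^2 ≤ SA) (hSF : ∑ n ∈ Finset.Icc 1 (2*N), fG N G n ≤ SF)
    (hB0 : ∑ b ∈ ℬ, ∑ c ∈ Finset.Icc 1 (64*N), |a b c| ≤ B0)
    (hEr : ∫ t in {t | T₀ ≤ |t|}, ‖dp (64*N) (cv ℬ a) t‖*(‖ds P0 t‖*‖dp (2*N) (fG N G) t‖) ∂(gm η) ≤ Er) :
    η*(TS N ℬ P0 G ℓ a η₀/η₀) ≤ (TT N ℬ P0 G ℓ a (w*η)).card + Real.exp (-w^2/4)*(P0.card*√(516*SA*(20*SF))) + Er + η*(T₀^3*η₀^2*(B0*(P0.card*SF))) := by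
  set f : ℝ → ℂ := fun t => dp (64*N) (cv ℬ a) t*(ds P0 t*dp (2*N) (fG N G) t)*ee (t*ℓ) with hf
  have hfc : Continuous f := ((dp_cont _ _).mul ((ds_cont _).mul (dp_cont _ _))).mul (ee_cont.comp (by fun_prop))
  have hfn : ∀ t, ‖f t‖ = ‖dp (64*N) (cv ℬ a) t‖*(‖ds P0 t‖*‖dp (2*N) (fG N G) t‖) := fun t => by
    rw [hf]; simp only [norm_mul, ee_norm, mul_one]
  have hSF0 : 0 ≤ SF := (Finset.sum_nonneg fun n _ => fG_nn N G n).trans hSF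
  have hA0 : ∀ t, ‖dp (64*N) (cv ℬ a) t‖ ≤ B0 := fun t => by
    rw [h.A_eq]; refine (norm_sum_le _ _).trans (le_trans (Finset.sum_le_sum fun b _ => ?_) hB0)
    rw [norm_mul, dz_norm, one_mul]; exact dp_bound _ _ _
  have hF0 : ∀ t, ‖dp (2*N) (fG N G) t‖ ≤ SF := fun t => (dp_bound _ _ _).trans (by simp_rw [abs_of_nonneg (fG_nn N G _)]; exact hSF)
  have hB00 : 0 ≤ B0 := (norm_nonneg _).trans (hA0 0)
  have hfB : ∀ t, ‖f t‖ ≤ B0*(P0.card*SF) := fun t => by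
    rw [hfn]; gcongr
    · exact hA0 t
    · exact ds_bound P0 t
    · exact hF0 t
  have hbA := bc_dp (64*N) (cv ℬ a)
  have hbn : bc (fun t => ‖f t‖) := ⟨hfc.norm, fun _ => norm_nonneg _, _, hfB⟩
  have hint : ∀ η', Integrable f (gm η') := fun η' => (integrable_norm_iff hfc.aestronglyMeasurable).1 (hbn.int _)
  have hre : ∀ η' > 0, ∫ t, (f t).re ∂(gm η') = TS N ℬ P0 G ℓ a η' := fun η' h' => by
    have h1 := h.R G ℓ η' h'
    have h2 := Complex.reCLM.integral_comp_comm (hint η')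
    simp only [Complex.reCLM_apply] at h2
    rw [h2]; change (∫ t, f t ∂(gm η')).re = _
    rw [h1, Complex.ofReal_re]
  have tr := transfer η η₀ T₀ hη hηη hT (fun t => (f t).re) (Complex.continuous_re.comp hfc) _ (fun t => (Complex.abs_re_le_norm _).trans (hfB t))
  rw [hre η hη, hre η₀ (by linarith)] at tr
  have hE2 : ∫ t in {t | T₀ ≤ |t|}, |(f t).re| ∂(gm η) ≤ Er := by
    refine le_trans ?_ hEr
    simp_rw [← hfn]
    exact integral_mono (hint η).re.abs.integrableOn (hint η).norm.integrableOn (fun t => Complex.abs_re_le_norm _)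
  have tail : TS N ℬ P0 G ℓ (fun b c => |a b c|) (√2*η) ≤ P0.card*√(516*SA*(20*SF)) := by
    have h2 : 0 < √2*η := by positivity
    have h3 : √2*η*N ≤ 2 := by
      have : √2 ≤ 2 := Real.sqrt_le_iff.2 ⟨by norm_num, by norm_num⟩
      nlinarith only [hη, hηN, h2, this, mul_nonneg hη.le (Nat.cast_nonneg (α := ℝ) N)]
    have h1 := h.abs.R G ℓ (√2*η) h2
    have h4 := congrArg norm h1
    rw [Complex.norm_real] at h4
    refine (le_abs_self _).trans (h4.symm.le.trans ?_)
    refine (norm_integral_le_integral_norm _).trans ?_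
    have hbA' := bc_dp (64*N) (cv ℬ (fun b c => |a b c|))
    have hbF := bc_dp (2*N) (fG N G)
    have cs := CS (gm (√2*η)) _ _ hbA' hbF _ _ (h.abs.MVA (√2*η) h2 h3 SA (by simpa only [sq_abs] using hSA)) (MVF h.hN G (√2*η) h2 h3 SF hSF)
    calc _ ≤ ∫ t, (P0.card:ℝ)*(‖dp (64*N) (cv ℬ (fun b c => |a b c|)) t‖*‖dp (2*N) (fG N G) t‖) ∂(gm (√2*η)) := by
          refine integral_mono_of_nonneg (Filter.Eventually.of_forall fun _ => norm_nonneg _) (((hbA'.mul hbF).int _).const_mul _) (Filter.Eventually.of_forall fun t => ?_)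
          simp only [norm_mul, ee_norm, mul_one]
          calc _ ≤ ‖dp (64*N) (cv ℬ (fun b c => |a b c|)) t‖*(P0.card*‖dp (2*N) (fG N G) t‖) := by gcongr; exact ds_bound P0 t
            _ = _ := by ring
      _ ≤ _ := by rw [integral_const_mul]; gcongr
  have spl : TS N ℬ P0 G ℓ a η ≤ (TT N ℬ P0 G ℓ a (w*η)).card + Real.exp (-w^2/4)*TS N ℬ P0 G ℓ (fun b c => |a b c|) (√2*η) := by
    have e : ((TT N ℬ P0 G ℓ a (w*η)).card:ℝ) = ∑ b ∈ ℬ, ∑ c ∈ Finset.Icc 1 (64*N), ∑ p ∈ P0, ∑ n ∈ Finset.Icc 1 (2*N),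
        if 0 < a b c ∧ fG N G n = 1 ∧ |ℓ-Real.log (b*c*p*n)| < w*η then (1:ℝ) else 0 := by
      rw [TT, Finset.card_filter]; push_cast; simp only [Finset.sum_product]
    rw [e, TS, TS]
    simp only [Finset.mul_sum, ← Finset.sum_add_distrib]
    refine Finset.sum_le_sum fun b _ => Finset.sum_le_sum fun c _ => Finset.sum_le_sum fun p _ => Finset.sum_le_sum fun n _ => ?_
    set q := ℓ-Real.log (b*c*p*n)
    have hn := fG_nn N G n
    have h0 : 0 ≤ Real.exp (-w^2/4)*(|a b c| *fG N G n*Real.exp (-q^2/(2*(√2*η)^2))) := by positivity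
    split_ifs with hc
    · have : a b c*fG N G n*Real.exp (-q^2/(2*η^2)) ≤ 1 := by
        rw [hc.2.1, mul_one]
        have : Real.exp (-q^2/(2*η^2)) ≤ 1 := Real.exp_le_one_iff.2 (div_nonpos_of_nonpos_of_nonneg (by nlinarith only []) (by positivity))
        nlinarith only [ha1, hc, this, ha1 b c, hc.1, Real.exp_pos (-q^2/(2*η^2))]
      linarith only [h0, this]
    · rw [zero_add]
      rcases le_or_gt (a b c) 0 with h1 | h1
      · exact (mul_nonpos_of_nonpos_of_nonneg (mul_nonpos_of_nonpos_of_nonneg h1 hn) (Real.exp_pos _).le).trans h0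
      · rcases hn.eq_or_lt with h2 | h2
        · rw [← h2]; simp
        · have h3 : fG N G n = 1 := by
            have := fG_sq N G n; rw [sq] at this; exact mul_right_cancel₀ h2.ne' (by rw [this, one_mul])
          have h4 : w*η ≤ |q| := by by_contra h5; exact hc ⟨h1, h3, not_le.1 h5⟩
          have h5 : (w*η)^2 ≤ q^2 := by rw [← sq_abs q]; gcongr
          rw [abs_of_pos h1, mul_left_comm, ← Real.exp_add]
          gcongr
          rw [mul_pow, Real.sq_sqrt (by norm_num)]
          have e1 : -q^2/(2*η^2) = -(q^2/(4*η^2)) + -q^2/(2*(2*η^2)) := by field_simp; ring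
          rw [e1]
          have : w^2/4 ≤ q^2/(4*η^2) := by rw [div_le_div_iff₀ (by norm_num) (by positivity)]; nlinarith only [h5]
          linarith only [this]
  have h6 := mul_le_mul_of_nonneg_left tail (Real.exp_pos (-w^2/4)).le
  have h7 := mul_le_mul_of_nonneg_left tr hη.le
  rw [mul_sub, mul_add, mul_div_cancel₀ _ hη.ne', mul_div_cancel₀ _ hη.ne'] at h7
  linarith only [hE2, spl, h6, h7]

lemma mainc {D : ℝ} (Y M : ℕ) (hY : 1 ≤ Y) (hM : 32*Y ≤ M) (c0 η : ℝ) (hη : 0 < η) (hη1 : η ≤ 1/16) (h1 : 15/8*Y ≤ c0) (h2 : c0 ≤ 30*Y)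
    (hYη : √(32*Y) ≤ 32*Y*η) (hYη' : 2 ≤ Y*η) (hD : 2048*(2+Real.log (32*Y)) ≤ D) :
    Y*η/4 ≤ ∑ c ∈ Finset.Icc 1 M, ga D Y c*Real.exp (-(Real.log c0-Real.log c)^2/(2*η^2)) := by
  have hY0 : (0:ℝ) < Y := by exact_mod_cast hY
  have hc0 : 0 < c0 := by nlinarith only [h1, hY0]
  have hl : 0 ≤ Real.log (32*Y) := by have := log_nn (32*Y); push_cast at this; exact this
  have hD0 : 0 < D := by linarith
  set e : ℕ → ℝ := fun c => Real.exp (-(Real.log c0-Real.log c)^2/(2*η^2)) with he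
  have e1 : ∑ c ∈ Finset.Icc 1 M, ga D Y c*e c = ∑ c ∈ Finset.Ico Y (32*Y), e c - 2/D*∑ c ∈ Finset.Ico Y (32*Y), (sd Y c:ℝ)*e c := by
    rw [← Finset.sum_subset (s₁ := Finset.Ico Y (32*Y)), Finset.mul_sum, ← Finset.sum_sub_distrib]
    · refine Finset.sum_congr rfl fun c hc => ?_
      rw [ga, if_pos (Finset.mem_Ico.1 hc)]; ring
    · intro c; simp only [Finset.mem_Ico, Finset.mem_Icc]; omega
    · intro c _ hc; rw [ga, if_neg (by rwa [Finset.mem_Ico] at hc)]; simp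
  have pos : 15/32*(Y*η) ≤ ∑ c ∈ Finset.Ico Y (32*Y), e c := by
    set I := Finset.Icc ⌈c0⌉₊ ⌊c0*(1+η)⌋₊
    have hI : ∀ c ∈ I, c0 ≤ c ∧ (c:ℝ) ≤ c0*(1+η) := fun c hc => by
      rw [Finset.mem_Icc, Nat.ceil_le, Nat.le_floor_iff (by positivity)] at hc; exact hc
    have hcard : c0*η/2 ≤ I.card := by
      rw [Nat.card_Icc]
      have a1 := Nat.lt_floor_add_one (c0*(1+η))
      have a2 := Nat.ceil_lt_add_one hc0.le
      have : (⌊c0*(1+η)⌋₊:ℝ)+1 - ⌈c0⌉₊ ≤ ((⌊c0*(1+η)⌋₊+1-⌈c0⌉₊:ℕ):ℝ) := by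
        have : ⌊c0*(1+η)⌋₊+1 ≤ (⌊c0*(1+η)⌋₊+1-⌈c0⌉₊)+⌈c0⌉₊ := by omega
        have := (Nat.cast_le (α := ℝ)).2 this; push_cast at this ⊢; linarith only [this]
      nlinarith only [hη, hη1, h1, hYη', a1, a2, this]
    calc 15/32*(Y*η) ≤ c0*η/2*(1/2) := by nlinarith only [hη, h1]
      _ ≤ I.card*(1/2) := by gcongr
      _ = ∑ c ∈ I, (1:ℝ)/2 := by rw [Finset.sum_const, nsmul_eq_mul]
      _ ≤ ∑ c ∈ I, e c := by
          refine Finset.sum_le_sum fun c hc => ?_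
          obtain ⟨a1, a2⟩ := hI c hc
          have a3 : Real.log c0 ≤ Real.log c := Real.log_le_log hc0 a1
          have a4 : Real.log c ≤ Real.log c0 + η := by
            have := Real.log_le_log (by linarith only [h1, hY0, a1]) a2
            rw [Real.log_mul hc0.ne' (by positivity)] at this
            have := Real.log_le_sub_one_of_pos (show 0 < 1+η by positivity); linarith
          have a5 : -(1/2) ≤ -(Real.log c0-Real.log c)^2/(2*η^2) := by rw [le_div_iff₀ (by positivity)]; nlinarith only [hη, hη1, a3, a4]
          have a6 := Real.add_one_le_exp (-(Real.log c0-Real.log c)^2/(2*η^2))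
          simp only [he]; linarith only [a5, a6]
      _ ≤ _ := Finset.sum_le_sum_of_subset_of_nonneg (fun c hc => by
          obtain ⟨a1, a2⟩ := hI c hc
          rw [Finset.mem_Ico]; constructor
          · have : (Y:ℝ) ≤ c := by linarith only [h1, hY0, a1]
            exact_mod_cast this
          · have : (c:ℝ) < 32*Y := by nlinarith only [hη, hη1, h2, hYη', a2]
            exact_mod_cast this) (fun _ _ _ => (Real.exp_pos _).le)
  have neg : ∑ c ∈ Finset.Ico Y (32*Y), (sd Y c:ℝ)*e c ≤ 128*(Y*η)*(2+Real.log (32*Y)) := by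
    have b1 : ∀ c ∈ Finset.Ico Y (32*Y), e c ≤ Real.exp (-(((c:ℝ)-c0)/(32*Y*η))^2/2) := fun c hc => by
      rw [Finset.mem_Ico] at hc
      have c1 : (Y:ℝ) ≤ c := by exact_mod_cast hc.1
      have c2 : (c:ℝ) < 32*Y := by exact_mod_cast hc.2
      have key : ∀ a b : ℝ, 0 < a → 0 < b → a ≤ b → b ≤ 32*Y → (b-a)/(32*Y) ≤ Real.log b-Real.log a := fun a b ha hb hab hbY => by
        have := Real.log_le_sub_one_of_pos (show 0 < a/b by positivity)
        rw [Real.log_div ha.ne' hb.ne'] at this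
        have h3 : (b-a)/(32*Y) ≤ (b-a)/b := by apply div_le_div_of_nonneg_left (by linarith only [hab]) hb hbY
        have : (b-a)/b = 1-a/b := by field_simp
        linarith
      have c3 : (((c:ℝ)-c0)/(32*Y))^2 ≤ (Real.log c0-Real.log c)^2 := by
        rcases le_total c0 c with h | h
        · have := key c0 c hc0 (by linarith only [h1, hY0, h]) h c2.le
          have : 0 ≤ ((c:ℝ)-c0)/(32*Y) := div_nonneg (by linarith only [h]) (by positivity)
          rw [← neg_sq (Real.log c0-Real.log c), neg_sub]; gcongr
        · have := key c c0 (by linarith only [hY0, c1]) hc0 h (by linarith only [h2, hY0])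
          have : 0 ≤ (c0-(c:ℝ))/(32*Y) := div_nonneg (by linarith only [h]) (by positivity)
          rw [← neg_sq (((c:ℝ)-c0)/(32*Y)), ← neg_div, neg_sub]; gcongr
      simp only [he]; rw [Real.exp_le_exp, neg_div, neg_div, neg_le_neg_iff, show (((c:ℝ)-c0)/(32*Y*η))^2/2 = (((c:ℝ)-c0)/(32*Y))^2/(2*η^2) by field_simp]; gcongr
    calc _ ≤ ∑ c ∈ Finset.Ico Y (32*Y), (sd Y c:ℝ)*Real.exp (-(((c:ℝ)-c0)/(32*Y*η))^2/2) := Finset.sum_le_sum fun c hc => mul_le_mul_of_nonneg_left (b1 c hc) (Nat.cast_nonneg _)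
      _ = ∑ d ∈ Finset.Icc 1 (Nat.sqrt (32*Y)), ∑ k ∈ Finset.Ico (Y ⌈/⌉ d) ((32*Y) ⌈/⌉ d), Real.exp (-((((d*k:ℕ):ℝ)-c0)/(32*Y*η))^2/2) :=
          dsum' Y hY (fun c => Real.exp (-(((c:ℝ)-c0)/(32*Y*η))^2/2))
      _ ≤ ∑ d ∈ Finset.Icc 1 (Nat.sqrt (32*Y)), (4+128*(Y*η)*(1/d)) := by
          refine Finset.sum_le_sum fun d hd => ?_
          have hd0 : (0:ℝ) < d := by exact_mod_cast (Finset.mem_Icc.1 hd).1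
          have := gsum (Finset.Ico (Y ⌈/⌉ d) ((32*Y) ⌈/⌉ d)) (c0/d) (d/(32*Y*η)) (by positivity)
          refine (le_of_eq (Finset.sum_congr rfl fun k _ => ?_)).trans (this.trans_eq ?_)
          · congr 4; push_cast; field_simp
          · field_simp; ring
      _ ≤ 4*√(32*Y) + 128*(Y*η)*(1+Real.log (32*Y)) := by
          rw [Finset.sum_add_distrib, ← Finset.mul_sum]
          gcongr
          · rw [Finset.sum_const, Nat.card_Icc, nsmul_eq_mul, mul_comm]; gcongr
            have := Real.nat_sqrt_le_real_sqrt (a := 32*Y); push_cast at this; simpa using this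
          · refine (harm _).trans ?_
            gcongr
            exact_mod_cast Nat.sqrt_le_self _
      _ ≤ _ := by linarith only [hYη]
  have h3 : 2/D*(128*(Y*η)*(2+Real.log (32*Y))) ≤ Y*η/8 := by
    rw [div_mul_eq_mul_div, div_le_iff₀ hD0]
    nlinarith only [hη, hη1, hYη', hD, mul_pos hY0 hη]
  have h4 := mul_le_mul_of_nonneg_left neg (show 0 ≤ 2/D by positivity)
  have : 0 < Y*η := by positivity
  change _ ≤ ∑ c ∈ Finset.Icc 1 M, ga D Y c*e c
  rw [e1]; linarith only [hη, hη1, hYη', pos, h3, h4]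

structure PR (n r : ℕ) (K V θ : ℝ) : Prop where
  hr : 10^4 ≤ Real.log r
  hK : (r:ℝ)^5 ≤ K
  hV1 : 0.99*K ≤ V
  hV2 : V ≤ K
  hn : n*Real.log 2 = V*r+K/4
  h1 : 11.5*(r*Real.log r) ≤ θ
  h2 : θ ≤ 13*(r*Real.log r)

noncomputable def Yb (n b : ℕ) : ℕ := 2^(n-Nat.log 2 b)
noncomputable def bet (V : ℝ) (r : ℕ) : ℝ := ∑ b ∈ BB V r, (1:ℝ)/b

lemma expb (w : ℝ) (h : 10^3 ≤ w) : 10^30*w^3 ≤ Real.exp w := by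
  have h1 := Real.pow_div_factorial_le_exp w (by linarith) 21
  have h2 : (10^3)^18 ≤ w^18 := by gcongr
  have : (Nat.factorial 21:ℝ) = 51090942171709440000 := by norm_num [Nat.factorial]
  rw [this, div_le_iff₀ (by norm_num)] at h1
  have h3 : 0 < w^3 := by positivity
  nlinarith only [h1, h2, h3, show w^21 = w^18*w^3 by ring]

section
variable {n r : ℕ} {K V θ : ℝ} (h : PR n r K V θ)
include h
lemma PR.r0 : (10:ℝ)^30*(Real.log r)^3 ≤ r := by
  have hr0 : (0:ℝ) < r := by by_contra h0; have := h.hr; rw [show (r:ℝ) = 0 by linarith [show (0:ℝ) ≤ r from Nat.cast_nonneg r]] at this; simp at this; linarith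
  have := expb (Real.log r) (by linarith [h.hr]); rwa [Real.exp_log hr0] at this
lemma PR.r1 : (10:ℝ)^40 ≤ r := by
  have := h.r0; have h2 : (10^4:ℝ)^3 ≤ (Real.log r)^3 := by gcongr; exact h.hr
  linarith
lemma PR.r2 : 1 ≤ r := by have := h.r1; have : (1:ℝ) ≤ r := by linarith
                          exact_mod_cast this
lemma PR.K1 : (10:ℝ)^200 ≤ K := le_trans (by have := h.r1; calc (10:ℝ)^200 = (10^40)^5 := by norm_num
                                              _ ≤ (r:ℝ)^5 := by gcongr) h.hK
lemma PR.F : (10:ℝ)^20*(r^3*(Real.log r)^2*(r*Real.log r+Real.log K)) ≤ K := by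
  have hK := h.hK; have r1 := h.r1; have r0 := h.r0; have g := h.hr
  have K1 := h.K1
  have hK0 : 0 < K := by linarith
  have hk5 : 5*Real.log r ≤ Real.log K := by
    have := Real.log_le_log (by positivity) hK; rwa [Real.log_pow] at this
  set G := Real.log r
  set κ := Real.log K
  have a1 : (10:ℝ)^20*(r^4*G^3) ≤ K/2 := by
    have : r^5 = r*(r:ℝ)^4 := by ring
    have : (10^30*G^3)*(r:ℝ)^4 ≤ r*r^4 := by gcongr
    nlinarith only [hK, K1, this, show 0 ≤ (r:ℝ)^4*G^3 by positivity]
  have a2 : (10:ℝ)^20*(r^3*G^2*κ) ≤ K/2 := by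
    have e1 := expb (κ/5) (by linarith)
    have e2 : Real.exp (κ/5)^5 = K := by rw [← Real.exp_nat_mul, ← Real.exp_log hK0]; congr 1; push_cast; ring
    have e3 : (r:ℝ) ≤ Real.exp (κ/5) := by rw [← Real.exp_log (by linarith : (0:ℝ) < r)]; exact Real.exp_le_exp.2 (by linarith)
    have e4 : 4*10^20*κ ≤ Real.exp (κ/5) := by nlinarith only [r1, g, hk5, e1, e3, mul_nonneg (by linarith : 0 ≤ κ) (sq_nonneg κ), sq_nonneg (κ-5)]
    have e5 : G^2 ≤ r := by nlinarith only [r1, r0, g, mul_nonneg (sq_nonneg G) (by linarith : 0 ≤ G-1)]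
    calc (10:ℝ)^20*(r^3*G^2*κ) = r^3*G^2*(10^20*κ) := by ring
      _ ≤ Real.exp (κ/5)^3*Real.exp (κ/5)*(Real.exp (κ/5)/4) := by gcongr; exacts [by linarith only [g, hk5], e5.trans e3, by linarith only [e4]]
      _ = Real.exp (κ/5)^5/4 := by ring
      _ ≤ _ := by rw [e2]; linarith only [K1]
  linarith only [a1, a2, show (10:ℝ)^20*(r^3*G^2*(r*G+κ)) = 10^20*(r^4*G^3)+10^20*(r^3*G^2*κ) by ring]
lemma PR.F1 : (10:ℝ)^20*(r*Real.log r+Real.log K) ≤ K := by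
  have := h.F; have g := h.hr; have r1 := h.r1
  have hk : 0 ≤ Real.log K := Real.log_nonneg (by linarith [h.K1])
  have h1 : 1 ≤ (r:ℝ)^3*(Real.log r)^2 := one_le_mul_of_one_le_of_one_le (one_le_pow₀ (by linarith)) (one_le_pow₀ (by linarith))
  nlinarith only [this, g, r1, hk, h1, show 0 ≤ r*Real.log r+Real.log K by positivity]
lemma PR.N : ((2^n:ℕ):ℝ) = Real.exp (V*r+K/4) := by
  rw [← h.hn, Real.exp_nat_mul, Real.exp_log (by norm_num)]; norm_num
lemma PR.V0 : 0 ≤ V := by linarith [h.hV1, h.K1]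
lemma PR.lK : Real.log K ≤ K/10^20 := by
  have := h.F1; have : 0 ≤ r*Real.log r := by have := h.hr; positivity
  linarith
lemma PR.bN {b : ℕ} (hb : b ∈ BB V r) : 0 < (b:ℝ) ∧ Real.exp (K/4) ≤ ((2^n:ℕ):ℝ)/b ∧ ((2^n:ℕ):ℝ)/b ≤ Real.exp (3*K/4) ∧
    ((2^n:ℕ):ℝ)/b ≤ Yb n b ∧ (Yb n b:ℝ) ≤ 2*(((2^n:ℕ):ℝ)/b) ∧ Nat.log 2 b ≤ n := by
  obtain ⟨-, -, -, b1, b2⟩ := BB_mem h.V0 h.r2 hb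
  have hb0 : 0 < (b:ℝ) := (Real.exp_pos _).trans_le b1
  have hbN : 0 < b := by exact_mod_cast hb0
  have c1 : Real.exp (K/4) ≤ ((2^n:ℕ):ℝ)/b := by
    rw [le_div_iff₀ hb0, h.N, add_comm, Real.exp_add]; gcongr
  have c3 : Nat.log 2 b ≤ n := by
    have : (b:ℝ) ≤ ((2^n:ℕ):ℝ) := by rw [h.N]; exact b2.trans (Real.exp_le_exp.2 (by linarith [h.K1]))
    calc _ ≤ Nat.log 2 (2^n) := Nat.log_mono_right (by exact_mod_cast this)
      _ = n := Nat.log_pow (by norm_num) n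
  have d1 := Nat.pow_log_le_self 2 hbN.ne'
  have d2 := Nat.lt_pow_succ_log_self (b := 2) (by norm_num) b
  have d3 : Yb n b*2^(Nat.log 2 b) = 2^n := by rw [Yb, ← pow_add]; congr 1; omega
  refine ⟨hb0, c1, ?_, ?_, ?_, c3⟩
  · rw [div_le_iff₀ hb0, h.N]
    calc _ ≤ Real.exp (3*K/4)*Real.exp (V*(r-1/2)) := by rw [← Real.exp_add]; exact Real.exp_le_exp.2 (by nlinarith only [h, h.hV2])
      _ ≤ _ := by gcongr
  · rw [div_le_iff₀ hb0, ← d3]; exact_mod_cast Nat.mul_le_mul_left _ d1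
  · rw [← mul_div_assoc, le_div_iff₀ hb0, ← d3]; push_cast
    have : (b:ℝ) ≤ 2*2^(Nat.log 2 b) := by rw [← pow_succ']; exact_mod_cast d2.le
    nlinarith only [this, show (0:ℝ) ≤ Yb n b from Nat.cast_nonneg _]
lemma PR.Y1 {b : ℕ} (hb : b ∈ BB V r) : 1 ≤ Yb n b ∧ 1+Real.log (32*Yb n b) ≤ K ∧ Real.exp (K/4) ≤ Yb n b ∧ (32*Yb n b:ℝ) ≤ Real.exp (0.9*K) := by
  obtain ⟨b0, b1, b2, b3, b4, -⟩ := h.bN hb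
  have K1 := h.K1
  have h4 : (32*Yb n b:ℝ) ≤ Real.exp (0.9*K) := by
    have : (64:ℝ) ≤ Real.exp (0.15*K) := le_trans (by linarith only [K1]) (Real.add_one_le_exp _)
    calc (32*Yb n b:ℝ) ≤ 64*Real.exp (3*K/4) := by linarith
      _ ≤ Real.exp (0.15*K)*Real.exp (3*K/4) := by gcongr
      _ = _ := by rw [← Real.exp_add]; congr 1; ring
  have h1 : 1 ≤ Yb n b := Nat.one_le_two_pow
  have hY : (1:ℝ) ≤ Yb n b := by exact_mod_cast h1
  refine ⟨h1, ?_, b1.trans b3, h4⟩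
  have := (Real.log_le_iff_le_exp (by positivity)).2 h4
  linarith only [K1, this]
lemma PR.z : Real.exp (0.9*K) ≤ Real.exp (V*(1-1/(2*r))) := by
  have r1 := h.r1
  have : 1/(2*(r:ℝ)) ≤ 1/100 := by gcongr; linarith
  exact Real.exp_le_exp.2 (by nlinarith only [h, this, h.hV1, h.K1])
lemma PR.be : Real.exp (-(2.1*(r*Real.log r))) ≤ bet V r := by
  have r1 := h.r1; have g := h.hr; have F := h.F; have hK := h.hK; have hV := h.hV1
  refine le_trans ?_ (BB_sum V r h.r2 (by linarith [h.K1]) ?_)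
  · rw [one_div, inv_pow, ← Real.exp_log (show (0:ℝ) < (13*(r:ℝ)^2)^r by positivity), ← Real.exp_neg]
    refine Real.exp_le_exp.2 (neg_le_neg ?_)
    rw [Real.log_pow, Real.log_mul (by norm_num) (by positivity), Real.log_pow]
    have : Real.log 13 ≤ 12 := (Real.log_le_sub_one_of_pos (by norm_num)).trans (by norm_num)
    push_cast; nlinarith only [r1, g, this]
  · have : (r:ℝ)^5 = r^2*r^3 := by ring
    have : (100:ℝ) ≤ r^3 := le_trans (by linarith) (le_self_pow₀ (by linarith) (by norm_num) : (r:ℝ) ≤ r^3)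
    nlinarith only [hK, hV, this, sq_nonneg (r:ℝ)]
lemma PR.sumY : ((2^n:ℕ):ℝ)*bet V r ≤ ∑ b ∈ BB V r, (Yb n b:ℝ) ∧ ∑ b ∈ BB V r, (Yb n b:ℝ) ≤ 2*((2^n:ℕ):ℝ)*bet V r := by
  rw [bet, Finset.mul_sum, Finset.mul_sum]
  exact ⟨Finset.sum_le_sum fun b hb => by rw [mul_one_div]; exact (h.bN hb).2.2.2.1, Finset.sum_le_sum fun b hb => by
    rw [mul_one_div, mul_div_assoc]; exact (h.bN hb).2.2.2.2.1⟩
lemma PR.prz {c : ℕ} (hc : (c:ℝ) ≤ Real.exp (0.9*K)) : ∀ p ∈ c.primeFactors, (p:ℝ) ≤ Real.exp (V*(1-1/(2*r))) := fun p hp =>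
  le_trans (by exact_mod_cast Nat.le_of_mem_primeFactors hp) (hc.trans h.z)
lemma PR.cor {D : ℝ} {Pm : ℕ} {P0 : Finset ℕ} (hP : ∀ p ∈ P0, 1 ≤ p ∧ p ≤ Pm) : Cor (2^n) Pm (BB V r) P0 (fun b => ga D (Yb n b)) := by
  refine ⟨Nat.one_le_two_pow, fun b hb => ⟨?_, fun c hc => ?_⟩, fun b hb b' hb' c c' hc hc' e => ?_, hP⟩
  · exact_mod_cast (h.bN hb).1
  · obtain ⟨c1, c2⟩ := ga_supp hc
    obtain ⟨b0, -, -, -, b4, -⟩ := h.bN hb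
    have := (h.Y1 hb).1
    have b1 : 1 ≤ b := by exact_mod_cast b0
    have : b*c ≤ 64*2^n := by
      have c3 : (c:ℝ) ≤ 32*Yb n b := by exact_mod_cast c2.le
      have : (b:ℝ)*c ≤ 64*((2^n:ℕ):ℝ) := by
        calc (b:ℝ)*c ≤ b*(32*(2*(((2^n:ℕ):ℝ)/b))) := by gcongr; linarith
          _ = _ := by field_simp; ring
      exact_mod_cast this
    exact ⟨by omega, (Nat.le_mul_of_pos_left c b1).trans this, this⟩
  · have key : ∀ b ∈ BB V r, ∀ c, ga D (Yb n b) c ≠ 0 → 0 < c ∧ ∀ p ∈ c.primeFactors, (p:ℝ) ≤ Real.exp (V*(1-1/(2*r))) := fun b hb c hc => by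
      obtain ⟨c1, c2⟩ := ga_supp hc
      have := h.Y1 hb
      refine ⟨by omega, h.prz (le_trans ?_ this.2.2.2)⟩
      exact_mod_cast c2.le
    have hB := fun b hb => fun p hp => ((BB_mem h.V0 h.r2 (b := b) hb).2.2.1 p hp).1
    have b0 := (h.bN hb).1
    exact (rough_uniq (hB b hb) (key b hb c hc).2 (hB b' hb') (key b' hb' c' hc').2
      (mul_ne_zero (by rintro rfl; simp at b0) (key b hb c hc).1.ne') e).1
end

section
variable {n r : ℕ} {K V θ : ℝ} (h : PR n r K V θ)
include h
lemma PR.k5 : 5*10^4 ≤ Real.log K := by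
  have := Real.log_le_log (by have := h.r1; positivity) h.hK; rw [Real.log_pow] at this
  push_cast at this; linarith [h.hr]
lemma PR.lN : Real.log (2^n:ℕ) = V*r+K/4 := by rw [h.N, Real.log_exp]
lemma PR.E0 : 10^44 ≤ r*Real.log r := by nlinarith [h.r1, h.hr]
lemma PR.s2 : √θ^2 = θ := Real.sq_sqrt (by linarith [h.h1, h.E0])
lemma PR.s1 : 10^20 ≤ √θ := Real.le_sqrt_of_sq_le (by linarith [h.h1, h.E0])
lemma PR.rK : (r:ℝ) ≤ K/10^20 := by
  have := h.F1; have := h.hr; have := h.k5; have := h.r1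
  nlinarith
lemma PR.J : ∃ J : ℕ, 4*Real.log (2^n:ℕ) ≤ Real.exp ((√θ^(3^J))^2/500) ∧ (√θ^(3^J))^4 ≤ K/10^4 := by
  have s1 := h.s1; have s2 := h.s2; have K1 := h.K1; have r1 := h.r1; have g := h.hr; have k5 := h.k5
  set s := √θ
  have ex : ∃ j : ℕ, 4*Real.log (2^n:ℕ) ≤ Real.exp ((s^(3^j))^2/500) := by
    obtain ⟨j, hj⟩ := exists_nat_ge (4*Real.log (2^n:ℕ))
    refine ⟨j, hj.trans (le_trans ?_ (Real.add_one_le_exp _))⟩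
    have a1 : s ≤ s^(3^j) := le_self_pow₀ (by linarith) (by positivity)
    have a2 : (j:ℝ) ≤ s^(3^j) := by
      have : j < 2^j := Nat.lt_two_pow_self
      calc (j:ℝ) ≤ 2^j := by exact_mod_cast this.le
        _ ≤ s^j := by gcongr; linarith
        _ ≤ _ := pow_le_pow_right₀ (by linarith) (Nat.lt_pow_self (by norm_num)).le
    nlinarith only [s1, a1, a2]
  refine ⟨Nat.find ex, Nat.find_spec ex, ?_⟩
  rcases hj : Nat.find ex with _ | j
  · have F := h.F; have h2 := h.h2
    have e : (s^3^0)^4 = θ^2 := by rw [← s2]; ring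
    rw [e]
    have h3 : θ^2 ≤ (13*(r*Real.log r))^2 := by gcongr; linarith only [h, h2, h.h1, h.E0]
    have h4 : 1 ≤ (r:ℝ)^2*Real.log r := one_le_mul_of_one_le_of_one_le (one_le_pow₀ (by linarith)) (by linarith)
    have h5 : (r*Real.log r)^2 ≤ r^3*Real.log r^2*(r*Real.log r) := by
      nlinarith only [h4, mul_le_mul_of_nonneg_left h4 (sq_nonneg (r*Real.log r))]
    have h6 : 0 ≤ r^3*Real.log r^2*Real.log K := by positivity
    nlinarith only [K1, F, h3, h5, h6]
  · have hm := Nat.find_min ex (m := j) (by omega)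
    rw [not_le, ← Real.lt_log_iff_exp_lt (by rw [h.lN]; have := h.V0; positivity), h.lN] at hm
    have e : (s^3^(j+1))^4 = ((s^3^j)^2)^6 := by rw [← pow_mul, ← pow_mul, ← pow_mul, pow_succ]; congr 1; ring
    have l1 : Real.log (4*(V*r+K/4)) ≤ 2*Real.log K := by
      rw [← Real.log_rpow (by linarith only [K1])]; have := h.V0
      refine Real.log_le_log (by positivity) ?_
      rw [Real.rpow_two]; nlinarith only [h, K1, h.rK, h.hV2]
    have l2 := Real.pow_div_factorial_le_exp (Real.log K) (by linarith) 14
    rw [Real.exp_log (by linarith), show (Nat.factorial 14:ℝ) = 87178291200 by norm_num [Nat.factorial], div_le_iff₀ (by norm_num)] at l2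
    have l3 : (5*10^4:ℝ)^8 ≤ Real.log K^8 := by gcongr
    rw [e]
    calc ((s^3^j)^2)^6 ≤ (1000*Real.log K)^6 := by gcongr; linarith only [hm, l1]
      _ ≤ _ := by
        have := mul_le_mul_of_nonneg_right l3 (show 0 ≤ Real.log K^6 by positivity)
        have e : Real.log K^8*Real.log K^6 = Real.log K^14 := by ring
        rw [e] at this; rw [mul_pow]; linarith only [K1, l2, this]
end

noncomputable def Dj (θ : ℝ) (j : ℕ) : Finset ℕ := Dv (√θ^(3^(j+1)))
section
variable {n r : ℕ} {K V θ : ℝ} (h : PR n r K V θ) {J : ℕ} (hJ : (√θ^(3^J))^4 ≤ K/10^4)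
include h hJ
lemma PR.Dj1 {j : ℕ} (hj : j < J) : (∀ p ∈ Dj θ j, p.Prime ∧ (p:ℝ) ≤ Real.exp (V*(1-1/(2*r)))) ∧ ((Dj θ j).card:ℝ) ≤ Real.exp (K/10^4)+1 ∧ 12*3^j ≤ ∑ p ∈ Dj θ j, (1:ℝ)/p := by
  have s1 := h.s1
  have h4 : (√θ^(3^(j+1)))^4 ≤ K/10^4 := le_trans (by gcongr <;> linarith only [s1, hj]) hJ
  refine ⟨fun p hp => ?_, ?_, le_trans ?_ (Dv_sum _ ?_)⟩
  · obtain ⟨a, -, b⟩ := Dv_mem.1 hp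
    exact ⟨a, b.trans (le_trans (Real.exp_le_exp.2 (by linarith [h.K1])) h.z)⟩
  · refine le_trans (Nat.cast_le.2 ((Finset.card_filter_le _ _).trans (Finset.card_range _).le)) ?_
    push_cast
    linarith [Nat.floor_le (Real.exp_pos ((√θ^(3^(j+1)))^4)).le, Real.exp_le_exp.2 h4]
  · have l1 : Real.log r ≤ 2*Real.log √θ := by
      have := Real.log_le_log (by linarith [h.r1] : (0:ℝ) < r) (show (r:ℝ) ≤ √θ^2 by rw [h.s2]; nlinarith only [h, h.h1, h.hr, h.r1])
      rwa [Real.log_pow] at this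
    rw [Real.log_pow, pow_succ]; push_cast
    have : (0:ℝ) < 3^j := by positivity
    nlinarith only [h, l1, this, h.hr]
  · exact le_trans (by linarith) (le_self_pow₀ (by linarith : 1 ≤ √θ) (by positivity : 3^(j+1) ≠ 0))
omit hJ in
lemma PR.Djd (i j p : ℕ) (hi : p ∈ Dj θ i) (hj : p ∈ Dj θ j) : i = j := by
  have s1 := h.s1
  have key : ∀ i j, i < j → p ∈ Dj θ i → p ∈ Dj θ j → False := fun i j hij hi hj => by
    obtain ⟨-, -, a⟩ := Dv_mem.1 hi
    obtain ⟨-, b, -⟩ := Dv_mem.1 hj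
    have := Real.exp_le_exp.1 (b.trans a)
    have h1 : (√θ^(3^(i+1)))^3 ≤ √θ^(3^(j+1)) := by rw [← pow_mul, ← pow_succ]; gcongr <;> linarith
    set S := √θ^(3^(i+1))
    have hS : 1 < S := one_lt_pow₀ (by linarith) (by positivity)
    have h2 : (S^3)^2 ≤ S^4 := le_trans (by gcongr) this
    rw [← pow_mul] at h2
    exact absurd h2 (not_le.2 (pow_lt_pow_right₀ hS (by norm_num)))
  rcases lt_trichotomy i j with h | h | h
  · exact (key i j h hi hj).elim
  · exact h
  · exact (key j i h hj hi).elim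
omit hJ in
lemma PR.Bz {b : ℕ} (hb : b ∈ BB V r) : b ≠ 0 ∧ ∀ p ∈ b.primeFactors, Real.exp (V*(1-1/(2*r))) < (p:ℝ) :=
  ⟨by have := (h.bN hb).1; rintro rfl; simp at this, fun p hp => ((BB_mem h.V0 h.r2 hb).2.2.1 p hp).1⟩
lemma PR.hyp (D' : ℝ) {j : ℕ} (hj : j < J) : Hyp (GG (BB V r) (Dj θ) J D') (Dj θ j) :=
  GG_hyp _ _ _ _ _ (fun _ => h.Bz) (fun _ hj => (h.Dj1 hJ hj).1) (fun i _ j _ => h.Djd i j) j hj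
lemma PR.SF : ((2^n:ℕ):ℝ)*bet V r/4 ≤ ∑ k ∈ Finset.Icc 1 (2*2^n), fG (2^n) (GG (BB V r) (Dj θ) J (12*K)) k ∧
    ∑ k ∈ Finset.Icc 1 (2*2^n), fG (2^n) (GG (BB V r) (Dj θ) J (12*K)) k ≤ 2*((2^n:ℕ):ℝ)*bet V r := by
  have K1 := h.K1
  set N := 2^n with hN
  have hN1 : 1 ≤ N := Nat.one_le_two_pow
  set G := GG (BB V r) (Dj θ) J (12*K) with hG
  have e1 : ∑ k ∈ Finset.Icc 1 (2*N), fG N G k = ∑ k ∈ Finset.Ico N (2*N), if G k then (1:ℝ) else 0 := by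
    rw [← Finset.sum_subset (s₁ := Finset.Ico N (2*N))]
    · exact Finset.sum_congr rfl fun k hk => by rw [Finset.mem_Ico] at hk; unfold fG; simp only [hk, true_and]
    · intro k; simp only [Finset.mem_Ico, Finset.mem_Icc]; omega
    · intro k _ hk; rw [Finset.mem_Ico] at hk; exact if_neg fun h => hk ⟨h.1, h.2.1⟩
  have big : ∀ b ∈ BB V r, 1000 ≤ (N:ℝ)/b ∧ (2*(N:ℝ))/b+1 ≤ Real.exp (0.9*K) ∧ 50*Real.exp (K/10^4)^2 ≤ (N:ℝ)/b := fun b hb => by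
    obtain ⟨b0, b1, b2, -⟩ := h.bN hb
    have a1 : 1000 ≤ Real.exp (K/8) := le_trans (by linarith) (Real.add_one_le_exp _)
    have a2 : Real.exp (K/10^4)^2*Real.exp (K/8) ≤ Real.exp (K/4) := by
      rw [← Real.exp_nat_mul, ← Real.exp_add]; exact Real.exp_le_exp.2 (by push_cast; linarith)
    have a3 : Real.exp (3*K/4)*Real.exp (K/8) ≤ Real.exp (0.9*K) := by rw [← Real.exp_add]; exact Real.exp_le_exp.2 (by linarith)
    have a4 : 1 ≤ Real.exp (K/10^4)^2 := one_le_pow₀ (Real.one_le_exp (by positivity))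
    have a5 : 1 ≤ Real.exp (3*K/4) := Real.one_le_exp (by positivity)
    refine ⟨by nlinarith only [b1, a1, a2, a4], ?_, by nlinarith only [b1, a1, a2, a4]⟩
    rw [mul_div_assoc]; nlinarith only [b1, b2, a1, a2, a3, a4, a5]
  rw [e1, bet]
  constructor
  · have l1 : ∀ k ∈ Finset.Ico N (2*N), ∑ b ∈ BB V r, (if b ∣ k ∧ good (Dj θ) J (12*K) (k/b) then (1:ℝ) else 0) ≤ if G k then (1:ℝ) else 0 := fun k hk => by
      by_cases hG : G k
      · rw [if_pos hG, Finset.sum_boole]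
        have : ((BB V r).filter (fun b => b ∣ k ∧ good (Dj θ) J (12*K) (k/b))).card ≤ 1 := by
          rw [Finset.card_le_one]
          have key : ∀ b ∈ BB V r, b ∣ k → ∀ p ∈ (k/b).primeFactors, (p:ℝ) ≤ Real.exp (V*(1-1/(2*r))) := fun b hb hbk => h.prz (by
            rw [Nat.cast_div hbk (by exact_mod_cast (h.Bz hb).1)]
            rw [Finset.mem_Ico] at hk
            have : (k:ℝ) ≤ 2*N := by exact_mod_cast hk.2.le
            have := (big b hb).2.1
            have : (k:ℝ)/b ≤ 2*N/b := by gcongr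
            linarith)
          intro b hb b' hb'
          simp only [Finset.mem_filter] at hb hb'
          exact (rough_uniq (h.Bz hb.1).2 (key b hb.1 hb.2.1) (h.Bz hb'.1).2 (key b' hb'.1 hb'.2.1)
            (by rw [Nat.mul_div_cancel' hb.2.1]; rw [Finset.mem_Ico] at hk; omega) (by rw [Nat.mul_div_cancel' hb.2.1, Nat.mul_div_cancel' hb'.2.1])).1
        exact_mod_cast this
      · rw [if_neg hG]
        exact (Finset.sum_eq_zero fun b hb => if_neg fun ⟨h1, h2⟩ => hG ⟨b, hb, k/b, (Nat.mul_div_cancel' h1).symm, h2⟩).le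
    refine le_trans ?_ (Finset.sum_le_sum l1)
    rw [Finset.sum_comm, Finset.mul_sum, Finset.sum_div]
    refine Finset.sum_le_sum fun b hb => ?_
    have hb0 := (h.Bz hb).1
    have hb1 : 1 ≤ b := Nat.one_le_iff_ne_zero.2 hb0
    have e2 : ∑ k ∈ Finset.Ico N (2*N), (if b ∣ k ∧ good (Dj θ) J (12*K) (k/b) then (1:ℝ) else 0) = ∑ m ∈ Finset.Ico (N ⌈/⌉ b) ((2*N) ⌈/⌉ b), if good (Dj θ) J (12*K) m then (1:ℝ) else 0 := by
      rw [← Finset.sum_congr rfl (fun k _ => by rw [ite_and]), ← Finset.sum_filter, mults b hb1 _ _ (fun k => if good (Dj θ) J (12*K) (k/b) then (1:ℝ) else 0)]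
      exact Finset.sum_congr rfl fun m _ => by simp only [Nat.mul_div_cancel_left m hb1]
    have c1 := cdiv b hb1 N; have c2 := cdiv b hb1 (2*N)
    obtain ⟨b1, b2, b3⟩ := big b hb
    rw [Nat.cast_mul, Nat.cast_ofNat] at c2
    have e4 : 2*(N:ℝ)/b = 2*((N:ℝ)/b) := by ring
    rw [e4] at c2 b2
    rw [e2]
    have a4 : 1 ≤ Real.exp (K/10^4) := Real.one_le_exp (by positivity)
    refine le_trans ?_ (good_cnt (Dj θ) J (12*K) (Real.exp (K/10^4)+1) _ _ ?_ (fun j hj => ?_) ?_ ?_ ?_)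
    · rw [mul_one_div]; linarith only [c1, c2, b1]
    · have : ((N ⌈/⌉ b : ℕ):ℝ) ≤ ((2*N) ⌈/⌉ b : ℕ) := by linarith only [c1, c2, b1]
      exact_mod_cast this
    · have := h.Dj1 hJ hj
      exact ⟨fun p hp => (this.1 p hp).1, this.2⟩
    · nlinarith only [c1, c2, b1, b3]
    · linarith only [c1, c2, b1]
    · have : Real.log ((2*N) ⌈/⌉ b : ℕ) ≤ 0.9*K := (Real.log_le_iff_le_exp (by linarith only [c2, b1])).2 (by linarith only [c2, b2])
      linarith only [K1, this]
  · have l1 : ∀ k ∈ Finset.Ico N (2*N), (if G k then (1:ℝ) else 0) ≤ ∑ b ∈ BB V r, (if b ∣ k then (1:ℝ) else 0) := fun k hk => by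
      have h0 : ∀ b ∈ BB V r, (0:ℝ) ≤ (if b ∣ k then (1:ℝ) else 0) := fun b _ => by split_ifs <;> norm_num
      split_ifs with hG
      · obtain ⟨b, hb, m, e, -⟩ := hG
        refine le_trans ?_ (Finset.single_le_sum h0 hb)
        rw [if_pos (e ▸ dvd_mul_right b m)]
      · exact Finset.sum_nonneg h0
    refine (Finset.sum_le_sum l1).trans ?_
    rw [Finset.sum_comm, Finset.mul_sum]
    refine Finset.sum_le_sum fun b hb => ?_
    have := (abs_le.1 (cnt b (Nat.one_le_iff_ne_zero.2 (h.Bz hb).1) N (2*N) (by omega))).2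
    have b1 := (big b hb).1
    have e : ((2*N:ℕ):ℝ)-N = N := by push_cast; ring
    rw [e] at this
    rw [mul_one_div, mul_div_assoc]; linarith
end

noncomputable def DD (K : ℝ) : ℝ := 4*(K*√K)
noncomputable def aa (n : ℕ) (K : ℝ) : ℕ → ℕ → ℝ := fun b => ga (DD K) (Yb n b)
noncomputable def GK (r : ℕ) (V K θ : ℝ) (J : ℕ) : ℕ → Prop := GG (BB V r) (Dj θ) J (12*K)
section
variable {n r : ℕ} {K V θ : ℝ} (h : PR n r K V θ)
include h
lemma PR.DD0 : 0 < DD K ∧ DD K^2 = 16*K^3 ∧ 10^4*K ≤ DD K := by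
  have K1 := h.K1
  have h1 : 10^4 ≤ √K := Real.le_sqrt_of_sq_le (by linarith)
  refine ⟨by unfold DD; positivity, ?_, ?_⟩
  · rw [DD, mul_pow, mul_pow, Real.sq_sqrt (by linarith)]; ring
  · unfold DD; nlinarith
lemma PR.sq1 {b : ℕ} (hb : b ∈ BB V r) (M : ℕ) : ∑ c ∈ Finset.Icc 1 M, aa n K b c^2 ≤ 64*Yb n b := by
  obtain ⟨d0, d1, -⟩ := h.DD0
  obtain ⟨y1, y2, -⟩ := h.Y1 hb
  have : 0 ≤ 1+Real.log (32*Yb n b) := by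
    have : (1:ℝ) ≤ Yb n b := by exact_mod_cast y1
    have := Real.log_nonneg (by linarith : (1:ℝ) ≤ 32*Yb n b); linarith
  have K1 := h.K1
  refine ga_sq d0 _ ?_ M
  rw [d1]
  have := pow_le_pow_left₀ this y2 3
  nlinarith only [d1, this, show 0 ≤ K^3 by positivity]
lemma PR.SA : ∑ b ∈ BB V r, ∑ c ∈ Finset.Icc 1 (64*2^n), aa n K b c^2 ≤ 128*(((2^n:ℕ):ℝ)*bet V r) := by
  refine (Finset.sum_le_sum fun b hb => h.sq1 hb _).trans ?_
  rw [← Finset.mul_sum]; linarith [h.sumY.2]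
lemma PR.B0 : ∑ b ∈ BB V r, ∑ c ∈ Finset.Icc 1 (64*2^n), |aa n K b c| ≤ 128*(((2^n:ℕ):ℝ)*bet V r) := by
  have : ∀ b ∈ BB V r, ∑ c ∈ Finset.Icc 1 (64*2^n), |aa n K b c| ≤ 64*(Yb n b:ℝ) := fun b hb => by
    have h1 : ∀ c ∈ Finset.Icc 1 (64*2^n), |aa n K b c| ≤ (aa n K b c^2+if c ∈ Finset.Ico (Yb n b) (32*Yb n b) then 1 else 0)/2 := fun c _ => by
      by_cases h0 : aa n K b c = 0
      · rw [h0]; split_ifs <;> norm_num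
      · rw [if_pos (Finset.mem_Ico.2 (ga_supp h0)), ← sq_abs]; nlinarith [sq_nonneg (|aa n K b c| - 1)]
    refine (Finset.sum_le_sum h1).trans ?_
    rw [← Finset.sum_div, Finset.sum_add_distrib, ← Finset.sum_filter, Finset.sum_const, nsmul_eq_mul, mul_one]
    have h2 : (((Finset.Icc 1 (64*2^n)).filter (fun c => c ∈ Finset.Ico (Yb n b) (32*Yb n b))).card:ℝ) ≤ 31*Yb n b := by
      have : ((Finset.Icc 1 (64*2^n)).filter (fun c => c ∈ Finset.Ico (Yb n b) (32*Yb n b))).card ≤ 31*Yb n b := by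
        refine (Finset.card_le_card (t := Finset.Ico (Yb n b) (32*Yb n b)) fun c hc => (Finset.mem_filter.1 hc).2).trans ?_
        rw [Nat.card_Ico]; omega
      exact_mod_cast this
    linarith [h.sq1 hb (64*2^n), (Nat.cast_nonneg (Yb n b) : (0:ℝ) ≤ _)]
  refine (Finset.sum_le_sum this).trans ?_
  rw [← Finset.mul_sum]; linarith [h.sumY.2]
lemma PR.TSl {J : ℕ} (hJ : (√θ^(3^J))^4 ≤ K/10^4) (P0 : Finset ℕ) (hP : ∀ p ∈ P0, Real.exp θ ≤ p ∧ (p:ℝ) ≤ 2*Real.exp θ) (ℓ : ℝ)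
    (h15 : 15*((2^n:ℕ):ℝ)^2*Real.exp θ ≤ Real.exp ℓ) (h30 : Real.exp ℓ ≤ 30*((2^n:ℕ):ℝ)^2*Real.exp θ) (η : ℝ) (h1 : Real.exp (-(K/20)) ≤ η) (h2 : η ≤ 1/16) :
    P0.card*(((2^n:ℕ):ℝ)*bet V r)^2*η/16 ≤ TS (2^n) (BB V r) P0 (GK r V K θ J) ℓ (aa n K) η := by
  have hη : 0 < η := (Real.exp_pos _).trans_le h1
  have K1 := h.K1
  set N := 2^n with hN
  have hN1 : 1 ≤ N := Nat.one_le_two_pow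
  have hNr : (1:ℝ) ≤ N := by exact_mod_cast hN1
  set G := GK r V K θ J with hG
  have key : ∀ b ∈ BB V r, ∀ p ∈ P0, ∀ k ∈ Finset.Icc 1 (2*N), fG N G k*(Yb n b*η/4) ≤ fG N G k*∑ c ∈ Finset.Icc 1 (64*N), aa n K b c*Real.exp (-(ℓ-Real.log (b*c*p*k))^2/(2*η^2)) := fun b hb p hp k hk => by
    by_cases h0 : fG N G k = 0
    · rw [h0, zero_mul, zero_mul]
    refine mul_le_mul_of_nonneg_left ?_ (fG_nn N G k)
    have hk : N ≤ k ∧ k < 2*N := by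
      unfold fG at h0; simp only [ne_eq, ite_eq_right_iff, not_forall] at h0; obtain ⟨h0, -⟩ := h0; exact ⟨h0.1, h0.2.1⟩
    have k1 : (N:ℝ) ≤ k := by exact_mod_cast hk.1
    have k2 : (k:ℝ) ≤ 2*N := by exact_mod_cast hk.2.le
    obtain ⟨b0, b1, b2, b3, b4, -⟩ := h.bN hb
    obtain ⟨y1, y2, y3, -⟩ := h.Y1 hb
    obtain ⟨p1, p2⟩ := hP p hp
    have hY : (1:ℝ) ≤ Yb n b := by exact_mod_cast y1
    have hp0 : (0:ℝ) < p := (Real.exp_pos _).trans_le p1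
    have hk0 : (0:ℝ) < k := by linarith
    set Q := Real.exp θ with hQ
    have hQ0 : 0 < Q := Real.exp_pos _
    have hc0 : 0 < Real.exp ℓ/(b*p*k) := by positivity
    rw [← hN, ← mul_div_assoc, le_div_iff₀ b0] at b4
    rw [← hN, div_le_iff₀ b0] at b3
    have x1 : Real.exp (K/5) ≤ Yb n b*η := by
      calc _ = Real.exp (K/4)*Real.exp (-(K/20)) := by rw [← Real.exp_add]; congr 1; ring
        _ ≤ _ := by gcongr
    have x0 := Real.add_one_le_exp (K/20)
    have x2 : Real.exp (K/20) ≤ Real.exp (K/5) := Real.exp_le_exp.2 (by linarith only [h2, hη, K1])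
    have := mainc (D := DD K) (Yb n b) (64*N) (by exact y1) (by
      obtain ⟨-, -, -, -, -, b5⟩ := h.bN hb
      have : Yb n b ≤ N := Nat.pow_le_pow_right (by norm_num) (Nat.sub_le _ _)
      omega) (Real.exp ℓ/(b*p*k)) η hη h2 ?_ ?_ ?_ ?_ ?_
    · refine this.trans (le_of_eq (Finset.sum_congr rfl fun c hc => ?_))
      have c1 : (0:ℝ) < c := by exact_mod_cast (Finset.mem_Icc.1 hc).1
      rw [Real.log_div (Real.exp_pos _).ne' (by positivity), Real.log_exp, show (b:ℝ)*c*p*k = b*p*k*c by ring, Real.log_mul (x := (b:ℝ)*p*k) (by positivity) c1.ne', sub_sub]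
      rfl
    · rw [le_div_iff₀ (by positivity)]
      calc 15/8*(Yb n b:ℝ)*(b*p*k) ≤ 15/8*(Yb n b:ℝ)*(b*(2*Q)*(2*N)) := by gcongr
        _ = 15/2*((Yb n b*b)*(Q*N)) := by ring
        _ ≤ 15/2*((2*N)*(Q*N)) := by gcongr
        _ ≤ _ := by linarith only [h15]
    · rw [div_le_iff₀ (by positivity)]
      calc _ ≤ 30*((N:ℝ)*(Q*N)) := by linarith only [h30]
        _ ≤ 30*((Yb n b*b)*(p*k)) := by gcongr
        _ = _ := by ring
    · rw [Real.sqrt_le_left (by positivity)]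
      have : 1 ≤ Yb n b*η^2 := by
        calc (1:ℝ) ≤ Real.exp (K/5)*Real.exp (-(K/20)) := by rw [← Real.exp_add]; exact Real.one_le_exp (by linarith only [h2, hη, K1])
          _ ≤ (Yb n b*η)*η := by gcongr
          _ = _ := by ring
      nlinarith only [h2, hη, K1, x1, x0, x2, this]
    · linarith only [h2, hη, K1, x1, x0, x2]
    · linarith only [h, h2, hη, K1, y2, h.DD0.2.2]
  have e : TS N (BB V r) P0 G ℓ (aa n K) η = ∑ b ∈ BB V r, ∑ p ∈ P0, ∑ k ∈ Finset.Icc 1 (2*N), fG N G k*∑ c ∈ Finset.Icc 1 (64*N), aa n K b c*Real.exp (-(ℓ-Real.log (b*c*p*k))^2/(2*η^2)) := by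
    unfold TS; refine Finset.sum_congr rfl fun b _ => ?_
    rw [Finset.sum_comm]; refine Finset.sum_congr rfl fun p _ => ?_
    rw [Finset.sum_comm]; refine Finset.sum_congr rfl fun k _ => ?_
    rw [Finset.mul_sum]; exact Finset.sum_congr rfl fun c _ => by ring
  rw [e]
  refine le_trans ?_ (Finset.sum_le_sum fun b hb => Finset.sum_le_sum fun p hp => Finset.sum_le_sum fun k hk => key b hb p hp k hk)
  simp_rw [← Finset.sum_mul, Finset.sum_const, nsmul_eq_mul]
  have f1 := (h.SF hJ).1; have f2 := h.sumY.1
  rw [← Finset.mul_sum, ← Finset.sum_div, ← Finset.sum_mul]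
  have : 0 ≤ (N:ℝ)*bet V r := by have := (Real.exp_pos _).trans_le h.be; positivity
  calc P0.card*((N:ℝ)*bet V r)^2*η/16 = P0.card*((N:ℝ)*bet V r/4)*(((N:ℝ)*bet V r)*η/4) := by ring
    _ ≤ _ := by gcongr; exacts [mul_nonneg (Nat.cast_nonneg _) (Finset.sum_nonneg fun k _ => fG_nn _ _ k), f1]
end

noncomputable def La (r : ℕ) (K : ℝ) : ℝ := r*Real.log r+Real.log K
section
variable {n r : ℕ} {K V θ : ℝ} (h : PR n r K V θ)
include h
lemma PR.L1 : 10^44 ≤ La r K ∧ 10^20*La r K ≤ K := ⟨by unfold La; linarith [h.E0, h.k5], h.F1⟩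
lemma PR.lT : Real.log (2^n*K) ≤ K*(r+1) := by
  have K1 := h.K1
  rw [Real.log_mul (by positivity) (by positivity)]
  have := h.lN; push_cast at this; rw [this]
  have r1 := h.r1
  nlinarith only [h.lK, h.hV2, r1, K1]
lemma PR.zt {b : ℕ} (hb : b ∈ BB V r) {t : ℝ} (t1 : Real.exp (8*La r K) ≤ |t|) (t2 : |t| ≤ 2^n*K) :
    ‖dp (64*2^n) (aa n K b) t‖ ≤ 2*(Real.exp (-(4*La r K))*Yb n b) := by
  have K1 := h.K1; have r1 := h.r1; have g := h.hr
  obtain ⟨L1, L2⟩ := h.L1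
  obtain ⟨d0, d1, d2⟩ := h.DD0
  obtain ⟨y1, y2, y3, y4⟩ := h.Y1 hb
  have hY : (1:ℝ) ≤ Yb n b := by exact_mod_cast y1
  set Y := Yb n b with hYd
  refine Cw_bound d0 Y (64*2^n) y1 ?_ t _ (Real.exp_pos _).le (by linarith) (fun d hd => ?_)
  · have : Y ≤ 2^n := Nat.pow_le_pow_right (by norm_num) (Nat.sub_le _ _)
    omega
  rw [Finset.mem_Icc, Nat.le_sqrt, ← sq] at hd
  have hd0 : (0:ℝ) < d := by exact_mod_cast hd.1
  have hd2 : (d:ℝ)^2 ≤ 32*Y := by exact_mod_cast hd.2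
  have M1 : Real.exp (K/9) ≤ (Y:ℝ)/d := by
    rw [le_div_iff₀ hd0]
    refine (pow_le_pow_iff_left₀ (by positivity) (by positivity) two_ne_zero).1 ?_
    have x : 32 ≤ Real.exp (K/36) := le_trans (by linarith only [K1]) (Real.add_one_le_exp _)
    calc (Real.exp (K/9)*d)^2 ≤ Real.exp (K/9)^2*(32*Y) := by rw [mul_pow]; gcongr
      _ ≤ Real.exp (K/9)^2*(Real.exp (K/36)*Y) := by gcongr
      _ = Real.exp (K/4)*Y := by rw [← Real.exp_nat_mul, ← mul_assoc, ← Real.exp_add]; congr 2; push_cast; ring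
      _ ≤ _ := by rw [sq]; gcongr
  have c1 := cdiv d hd.1 Y
  have Yd1 : 1 ≤ (Y:ℝ)/d := le_trans (Real.one_le_exp (by positivity)) M1
  have m1 : (4*Real.log r) ≤ (⌈4*Real.log r⌉₊:ℝ) := Nat.le_ceil _
  have m2 : (⌈4*Real.log r⌉₊:ℝ) ≤ 5*Real.log r := by have := Nat.ceil_lt_add_one (show 0 ≤ 4*Real.log r by linarith only [g]); linarith only [g, this]
  have lr : Real.log r ≤ r := by have := Real.log_le_sub_one_of_pos (show (0:ℝ) < r by linarith only [r1]); linarith only [this]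
  have key := zs (7*(r+1)) ⌈4*Real.log r⌉₊ (12*(7*(r+1))) (by omega) rfl (by
      have : (1:ℝ) ≤ (⌈4*Real.log r⌉₊:ℝ) := by linarith only [g, m1]
      exact_mod_cast this) (by
      have : (⌈4*Real.log r⌉₊:ℝ) ≤ 12*(7*(r+1)) := by linarith only [r1, m2, lr]
      exact_mod_cast this) (by
      have : (100*(12*(7*(r+1))+1):ℝ) ≤ 2^⌈4*Real.log r⌉₊ := by
        calc (100*(12*(7*(r+1))+1):ℝ) ≤ (r:ℝ)^2 := by nlinarith only [r1]
          _ = Real.exp (2*Real.log r) := by rw [← Real.exp_log (show (0:ℝ) < r by linarith), ← Real.exp_nat_mul, Real.log_exp]; norm_num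
          _ ≤ Real.exp (⌈4*Real.log r⌉₊*Real.log 2) := Real.exp_le_exp.2 (by nlinarith only [Real.log_two_gt_d9, m1, g])
          _ = _ := by rw [Real.exp_nat_mul, Real.exp_log (by norm_num)]
      exact_mod_cast this) (Y ⌈/⌉ d) ((32*Y) ⌈/⌉ d) (K/9) (Real.exp (8*La r K)) (2^n*K) (Real.exp (-(4*La r K))/2) t (M1.trans c1.1) ?_ ?_ ?_ (Real.exp_pos _) t1 t2 ?_ ?_
  · refine key.trans ?_
    have := mul_le_mul_of_nonneg_left (show ((Y ⌈/⌉ d : ℕ):ℝ) ≤ 2*(Y/d) by linarith only [c1, Yd1]) (Real.exp_pos (-(4*La r K))).le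
    linarith only [this]
  · push_cast
    have := h.hK; have : (r:ℝ)*10^40 ≤ r*r^4 := by
      gcongr; exact r1.trans (le_self_pow₀ (by linarith) (by norm_num))
    linarith [show (r:ℝ)*r^4 = r^5 by ring]
  · have := h.lT; push_cast; linarith only [K1, r1, this, show K/9*(12*(7*(r+1))) = 28/3*(K*(r+1)) by ring, show 0 ≤ K*((r:ℝ)+1) by positivity]
  · rw [ceilDiv_le_iff_le_smul (by have := hd.1; omega), smul_eq_mul]
    have : Y ≤ d • (Y ⌈/⌉ d) := le_smul_ceilDiv (by have := hd.1; omega)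
    rw [smul_eq_mul] at this
    linarith only [this, Nat.mul_le_mul_left 32 this, mul_left_comm d 32 (Y ⌈/⌉ d)]
  · rw [le_div_iff₀ (by norm_num), div_mul_eq_mul_div, div_le_iff₀ (Real.exp_pos _), ← Real.exp_add]
    exact le_trans (by linarith) (Real.add_one_le_exp _)
  · rw [le_div_iff₀ (by norm_num)]
    have x : 4000 ≤ Real.exp (La r K) := le_trans (by linarith) (Real.add_one_le_exp _)
    calc _ = 4000*Real.exp (-(K/9/(3200*((12*(7*(r+1)):ℕ):ℝ)^3*(⌈4*Real.log r⌉₊:ℝ)^2))) := by push_cast; ring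
      _ ≤ Real.exp (La r K)*Real.exp (-(5*La r K)) := by
          gcongr
          rw [le_div_iff₀ (by have : (0:ℝ) < ⌈4*Real.log r⌉₊ := by linarith
                              positivity)]
          have F : 10^20*((r:ℝ)^3*(Real.log r)^2*La r K) ≤ K := h.F
          have k3 : ((12*(7*(r+1)):ℕ):ℝ) ≤ 100*r := by push_cast; linarith
          calc _ ≤ 5*La r K*(3200*(100*(r:ℝ))^3*(5*Real.log r)^2) := by gcongr
            _ = 4*10^11*((r:ℝ)^3*(Real.log r)^2*La r K) := by ring
            _ ≤ _ := by linarith [show 0 ≤ (r:ℝ)^3*(Real.log r)^2*La r K by positivity]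
      _ = _ := by rw [← Real.exp_add]; congr 1; ring
end

noncomputable def Bw (V : ℝ) (r w : ℕ) : Finset ℕ := (BB V r).filter (fun b => Nat.log 2 b = w)
section
variable {n r : ℕ} {K V θ : ℝ} (h : PR n r K V θ)
include h
lemma PR.n2 : (n:ℝ)+1 ≤ 2*(r*K) := by
  have := h.hn; have K1 := h.K1; have r1 := h.r1; have := h.hV2
  have : (0:ℝ) ≤ n := Nat.cast_nonneg n
  have : V*r ≤ K*r := by gcongr
  nlinarith only [this, h.hn, Real.log_two_gt_d9, mul_le_mul r1 K1 (by norm_num) (by positivity), ‹(0:ℝ) ≤ n›, mul_le_mul_of_nonneg_right r1 (by linarith : 0 ≤ K)]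
lemma PR.N10 : Real.exp (10*K) ≤ ((2^n:ℕ):ℝ) ∧ 10^38*K ≤ Real.log (2^n:ℕ) := by
  have K1 := h.K1; have r1 := h.r1
  have : (0.99*K)*10^40 ≤ V*r := mul_le_mul h.hV1 r1 (by norm_num) h.V0
  rw [h.lN, h.N]; exact ⟨Real.exp_le_exp.2 (by linarith), by linarith⟩
lemma PR.EL1 (η : ℝ) (hη : 0 < η) (hηN : η*(2^n:ℕ) ≤ 1) (U : Set ℝ) (hU : MeasurableSet U) (hUT : ∀ t ∈ U, |t| ≤ 2^n*K)
    (hm : (gm η).real U ≤ Real.exp (-0.54*Real.log (2^n:ℕ))) {b : ℕ} (hb : b ∈ BB V r) :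
    ∫ t in U, ‖ds (Bw V r (Nat.log 2 b)) t‖^2 ∂(gm η) ≤ K^2*(((2^n:ℕ):ℝ)*bet V r)/(Yb n b:ℝ)^2 := by
  have K1 := h.K1; have r1 := h.r1
  obtain ⟨y1, y2, y3, y4⟩ := h.Y1 hb
  obtain ⟨b0, b1, b2, b3, b4, b5⟩ := h.bN hb
  obtain ⟨N1, N2⟩ := h.N10
  have hY : (1:ℝ) ≤ Yb n b := by exact_mod_cast y1
  have d3 : (Yb n b:ℝ)*2^(Nat.log 2 b) = (2^n:ℕ) := by rw [Yb]; push_cast; rw [← pow_add]; congr 1; omega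
  have hn2 := h.n2
  have hb0 : 0 < bet V r := (Real.exp_pos _).trans_le h.be
  have eK := expb K (by linarith only [K1])
  have hw : (Nat.log 2 b:ℝ) ≤ n := by exact_mod_cast b5
  set w := Nat.log 2 b with hwd
  set Y : ℝ := ((Yb n b : ℕ) : ℝ) with hYd
  set N : ℝ := ((2^n:ℕ):ℝ) with hN
  have hN0 : 0 < N := (Real.exp_pos _).trans_le N1
  have hA : (2:ℝ)^w = N/Y := by rw [eq_div_iff (by positivity)]; linarith only [d3]
  have K3 : 1 ≤ K^2 := one_le_pow₀ (by linarith only [K1])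
  have hbw : ∀ x ∈ Bw V r w, x ∈ Finset.Ico (2^w) (2*2^w) := fun x hx => by
    simp only [Bw, Finset.mem_filter] at hx
    have := (h.bN hx.1).1
    have x1 := Nat.pow_log_le_self 2 (show x ≠ 0 by rintro rfl; simp at this)
    have x2 := Nat.lt_pow_succ_log_self (b := 2) (by norm_num) x
    rw [hx.2] at x1 x2; rw [pow_succ'] at x2
    exact Finset.mem_Ico.2 ⟨x1, x2⟩
  have key := HM_B η hη (2^w) Nat.one_le_two_pow w (by push_cast; rfl) (2^n*K) ?_ U hU hUT (Bw V r w) hbw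
  swap
  · push_cast; rw [hA, div_pow, le_div_iff₀ (by positivity), show (2:ℝ)^n = N by rw [hN]; push_cast; rfl]
    have e1 : Y^2 ≤ Real.exp (2*K) := by
      calc Y^2 ≤ Real.exp (0.9*K)^2 := by gcongr; linarith only [y4, hY]
        _ ≤ _ := by rw [← Real.exp_nat_mul]; exact Real.exp_le_exp.2 (by push_cast; linarith only [K1])
    calc 2*(N*K)*Y^2 ≤ N*(Real.exp K*Real.exp (2*K)) := by
          rw [show 2*(N*K)*Y^2 = N*((2*K)*Y^2) by ring]; gcongr; nlinarith only [eK, K3, K1]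
      _ ≤ N*N := by gcongr; refine le_trans ?_ N1; rw [← Real.exp_add]; exact Real.exp_le_exp.2 (by linarith only [K1])
      _ = _ := by ring
  refine key.trans ?_
  have c1 : ((Bw V r w).card:ℝ) ≤ 2*(N/Y)*bet V r := by
    calc ((Bw V r w).card:ℝ) = ∑ x ∈ Bw V r w, (1:ℝ) := by simp
      _ ≤ ∑ x ∈ Bw V r w, 2*(N/Y)*(1/x) := Finset.sum_le_sum fun x hx => by
          have x2 := Finset.mem_Ico.1 (hbw x hx)
          have x0 : (0:ℝ) < x := by exact_mod_cast lt_of_lt_of_le (by positivity) x2.1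
          rw [mul_one_div, le_div_iff₀ x0, one_mul, ← hA]; exact_mod_cast x2.2.le
      _ ≤ _ := by rw [← Finset.mul_sum, bet]; gcongr; exact Finset.filter_subset _ _
  have hl : Real.log ((2^w:ℕ):ℝ) ≤ n := by
    push_cast; rw [Real.log_pow]; nlinarith only [hw, Real.log_two_lt_d9, (Nat.cast_nonneg w : (0:ℝ) ≤ w)]
  have rK := h.rK
  have hl0 : 0 ≤ Real.log ((2^w:ℕ):ℝ) := Real.log_natCast_nonneg _
  have c2 : √(800*(2^n*K)*(1+Real.log ((2^w:ℕ):ℝ)))*(gm η).real U ≤ 1/Y := by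
    have s1 : √(800*(2^n*K)*(1+Real.log ((2^w:ℕ):ℝ))) ≤ Real.exp (0.5*Real.log (2^n:ℕ)+K) := by
      rw [Real.sqrt_le_left (Real.exp_pos _).le, ← Real.exp_nat_mul, show (2:ℕ)*(0.5*Real.log (2^n:ℕ)+K) = Real.log (2^n:ℕ)+(K+K) by push_cast; ring, Real.exp_add, Real.exp_add, Real.exp_log hN0]
      rw [show (2:ℝ)^n = N by rw [hN]; push_cast; rfl]
      calc _ ≤ 800*(N*K)*(2*(K/10^20*K)) := by gcongr; nlinarith only [hl, hn2, rK, K1]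
        _ ≤ N*(K^3*1) := by nlinarith only [show 0 ≤ N*K^3 by positivity]
        _ ≤ _ := by gcongr
                    · nlinarith only [eK, show 0 ≤ K^3 by positivity]
                    · exact Real.one_le_exp (by linarith only [K1])
    calc _ ≤ Real.exp (0.5*Real.log (2^n:ℕ)+K)*Real.exp (-0.54*Real.log (2^n:ℕ)) := by gcongr
      _ ≤ Real.exp (-(0.9*K)) := by rw [← Real.exp_add]; exact Real.exp_le_exp.2 (by linarith only [K1, N2])
      _ ≤ _ := by rw [Real.exp_neg, one_div]; gcongr; linarith only [y4, hY]
  have c3 : 48*((2^w:ℕ):ℝ)*η*(w+1) ≤ 96*(r*K)/Y := by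
    have : η*2^w ≤ 1/Y := by rw [hA, ← mul_div_assoc]; gcongr
    push_cast
    calc 48*(2:ℝ)^w*η*(w+1) = 48*(η*2^w)*(w+1) := by ring
      _ ≤ 48*(1/Y)*(2*(r*K)) := by gcongr; linarith only [hn2, hw]
      _ = _ := by ring
  calc _ ≤ 2*(N/Y)*bet V r*(96*(r*K)/Y+1/Y) := by gcongr
    _ = (192*(r*K)+2)*(N*bet V r)/Y^2 := by ring
    _ ≤ _ := by gcongr; nlinarith only [rK, K1]
lemma PR.EL {J : ℕ} (hJ : (√θ^(3^J))^4 ≤ K/10^4) (P0 : Finset ℕ) (η : ℝ) (hη : 0 < η) (hηN : η*(2^n:ℕ) ≤ 1) (U : Set ℝ) (hU : MeasurableSet U)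
    (hUT : U ⊆ {t | Real.exp (8*La r K) ≤ |t| ∧ |t| ≤ 2^n*K}) (hm : (gm η).real U ≤ Real.exp (-0.54*Real.log (2^n:ℕ))) :
    ∫ t in U, ‖dp (64*2^n) (cv (BB V r) (aa n K)) t‖*(‖ds P0 t‖*‖dp (2*2^n) (fG (2^n) (GK r V K θ J)) t‖) ∂(gm η) ≤ P0.card*(14*Real.exp (-(4*La r K))*K^3*((2^n:ℕ)*bet V r)) := by
  have K1 := h.K1; have r1 := h.r1
  set ws := (BB V r).image (Nat.log 2) with hws
  set σ := Real.exp (-(4*La r K)) with hσ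
  have hσ0 : 0 < σ := Real.exp_pos _
  have hb0 : 0 < bet V r := (Real.exp_pos _).trans_le h.be
  set F := fun t => ‖dp (2*2^n) (fG (2^n) (GK r V K θ J)) t‖ with hF
  have bF : bc F := bc_dp _ _
  have hA : ∀ t ∈ U, ‖dp (64*2^n) (cv (BB V r) (aa n K)) t‖ ≤ ∑ w ∈ ws, 2*(σ*2^(n-w))*‖ds (Bw V r w) t‖ := fun t ht => by
    have e := (h.cor (D := DD K) (Pm := 0) (P0 := ∅) (by simp)).A_eq t
    rw [← Finset.sum_fiberwise_of_maps_to (t := ws) (g := Nat.log 2) fun b hb => Finset.mem_image_of_mem _ hb] at e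
    change dp (64*2^n) (cv (BB V r) (aa n K)) t = _ at e
    rw [e]
    refine (norm_sum_le _ _).trans (Finset.sum_le_sum fun w hw => ?_)
    obtain ⟨b, hb, rfl⟩ := Finset.mem_image.1 hw
    have e2 : ∑ x ∈ (BB V r).filter (fun x => Nat.log 2 x = Nat.log 2 b), dz t x*dp (64*2^n) (ga (DD K) (Yb n x)) t = ds (Bw V r (Nat.log 2 b)) t*dp (64*2^n) (aa n K b) t := by
      rw [ds, Finset.sum_mul, Bw]
      exact Finset.sum_congr rfl fun x hx => by rw [aa, Yb, Yb, (Finset.mem_filter.1 hx).2]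
    rw [e2, norm_mul, mul_comm]
    have := h.zt hb (hUT ht).1 (hUT ht).2
    rw [Yb] at this; push_cast at this
    gcongr
  have hI : ∀ w, Integrable (fun t => ‖ds (Bw V r w) t‖*F t) ((gm η).restrict U) := fun w => ((bc_ds _).mul bF).int _
  have h1 : ∫ t in U, ‖dp (64*2^n) (cv (BB V r) (aa n K)) t‖*(‖ds P0 t‖*F t) ∂(gm η) ≤ ∫ t in U, ∑ w ∈ ws, P0.card*(2*(σ*2^(n-w)))*(‖ds (Bw V r w) t‖*F t) ∂(gm η) := by
    refine setIntegral_mono_on (((bc_dp _ _).mul ((bc_ds P0).mul bF)).int _) (integrable_finsetSum _ fun w _ => (hI w).const_mul _) hU fun t ht => ?_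
    calc _ ≤ (∑ w ∈ ws, 2*(σ*2^(n-w))*‖ds (Bw V r w) t‖)*(P0.card*F t) := by
          have := bF.2.1 t
          gcongr
          · exact hA t ht
          · exact ds_bound P0 t
      _ = _ := by rw [Finset.sum_mul]; exact Finset.sum_congr rfl fun w _ => by ring
  refine h1.trans ?_
  rw [integral_finsetSum _ fun w _ => (hI w).const_mul _]
  set N : ℝ := ((2^n:ℕ):ℝ) with hN
  have hN0 : 0 < N := by positivity
  have h2 : ∀ w ∈ ws, ∫ t in U, P0.card*(2*(σ*2^(n-w)))*(‖ds (Bw V r w) t‖*F t) ∂(gm η) ≤ P0.card*(14*σ*K*(N*bet V r)) := fun w hw => by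
    obtain ⟨b, hb, rfl⟩ := Finset.mem_image.1 hw
    have e1 := h.EL1 η hη hηN U hU (fun t ht => (hUT ht).2) hm hb
    have e2 : ∫ t in U, F t^2 ∂(gm η) ≤ 20*(2*N*bet V r) := (setIntegral_le_integral (by simpa only [sq] using (bF.mul bF).int (gm η)) (Filter.Eventually.of_forall fun t => sq_nonneg _)).trans
      (MVF Nat.one_le_two_pow _ η hη (by linarith) _ (h.SF hJ).2)
    have e3 := CS _ _ _ (bc_ds _) bF _ _ e1 e2
    have Y0 : 0 < (Yb n b:ℝ) := by exact_mod_cast (h.Y1 hb).1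
    rw [integral_const_mul, show (2:ℝ)^(n-Nat.log 2 b) = Yb n b by rw [Yb]; push_cast; rfl]
    have e4 : √(K^2*(N*bet V r)/(Yb n b:ℝ)^2*(20*(2*N*bet V r))) ≤ 7*K*(N*bet V r)/Yb n b := by
      rw [Real.sqrt_le_left (by positivity), div_pow, div_mul_eq_mul_div]
      gcongr
      nlinarith only [show 0 ≤ K^2*(N*bet V r)^2 by positivity]
    calc _ ≤ P0.card*(2*(σ*Yb n b))*(7*K*(N*bet V r)/Yb n b) := by gcongr; exact e3.trans e4
      _ = _ := by field_simp; ring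
  refine (Finset.sum_le_card_nsmul _ _ _ h2).trans ?_
  rw [nsmul_eq_mul]
  have hc : (ws.card:ℝ) ≤ K^2 := by
    have : ws ⊆ Finset.range (n+1) := fun w hw => by
      obtain ⟨b, hb, rfl⟩ := Finset.mem_image.1 hw
      exact Finset.mem_range.2 (Nat.lt_succ_of_le (h.bN hb).2.2.2.2.2)
    have := Finset.card_le_card this; rw [Finset.card_range] at this
    have : (ws.card:ℝ) ≤ n+1 := by exact_mod_cast this
    nlinarith only [this, h.n2, h.rK, K1]
  calc _ ≤ K^2*(P0.card*(14*σ*K*(N*bet V r))) := by gcongr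
    _ = _ := by ring
end

section
variable {n r : ℕ} {K V θ : ℝ} (h : PR n r K V θ) {J : ℕ} (hJ : (√θ^(3^J))^4 ≤ K/10^4) (hJ1 : 4*Real.log (2^n:ℕ) ≤ Real.exp ((√θ^(3^J))^2/500))
  {P0 : Finset ℕ} (hP : ∀ p ∈ P0, p.Prime ∧ Real.exp θ ≤ p ∧ (p:ℝ) ≤ 2*Real.exp θ) (hc : Real.exp θ/(4*(θ+2)) ≤ P0.card) (hc2 : (P0.card:ℝ) ≤ Real.exp θ+1)
  {η : ℝ} (hη : 0 < η) (hηN : η*(2^n:ℕ) ≤ 1) (hηN' : 1/2 ≤ η*(2^n:ℕ))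
include h hJ hJ1 hP hc hc2 hη hηN hηN'
lemma PR.Er : ∫ t in {t | Real.exp (8*La r K) ≤ |t|}, ‖dp (64*2^n) (cv (BB V r) (aa n K)) t‖*(‖ds P0 t‖*‖dp (2*2^n) (fG (2^n) (GK r V K θ J)) t‖) ∂(gm η) ≤
    P0.card*(((2^n:ℕ):ℝ)*bet V r^2)/256 := by
  have K1 := h.K1; have r1 := h.r1; have E0 := h.E0; have s1 := h.s1; have s2 := h.s2
  have h1 := h.h1; have h2 := h.h2; have hbe := h.be
  obtain ⟨N1, N2⟩ := h.N10
  obtain ⟨L1, L2⟩ := h.L1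
  have hLE : La r K = r*Real.log r+Real.log K := rfl
  have k5 := h.k5
  have hB0 := h.B0; have hSF := (h.SF hJ).2
  set E := r*Real.log r with hE
  set β := bet V r with hβ
  have hb0 : 0 < β := (Real.exp_pos _).trans_le hbe
  have big : ∀ x C : ℝ, C ≤ x → C ≤ Real.exp x := fun x C hx => le_trans (by linarith only [hx]) (Real.add_one_le_exp _)
  have hcor := h.cor (D := DD K) (Pm := 0) (P0 := ∅) (by simp)
  set N : ℝ := ((2^n:ℕ):ℝ) with hN
  have hN0 : 0 < N := (Real.exp_pos _).trans_le N1
  set A := fun t => ‖dp (64*2^n) (cv (BB V r) (aa n K)) t‖ with hA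
  set F := fun t => ‖dp (2*2^n) (fG (2^n) (GK r V K θ J)) t‖ with hF
  have bA : bc A := bc_dp _ _
  have bF : bc F := bc_dp _ _
  have bD := bc_ds P0
  have hI := (bA.mul (bD.mul bF)).int (gm η)
  have A2 : ∫ t, A t^2 ∂(gm η) ≤ 516*(128*(N*β)) := hcor.MVA η hη (by linarith only [hηN]) _ h.SA
  have F2 : ∫ t, F t^2 ∂(gm η) ≤ 20*(2*N*β) := MVF Nat.one_le_two_pow _ η hη (by linarith only [hηN]) _ hSF
  have A0 : ∀ t, A t ≤ 128*(N*β) := fun t => by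
    have : A t = ‖∑ b ∈ BB V r, dz t b*dp (64*2^n) (aa n K b) t‖ := congrArg norm (hcor.A_eq t)
    rw [this]; refine (norm_sum_le _ _).trans (le_trans (Finset.sum_le_sum fun b _ => ?_) hB0)
    rw [norm_mul, dz_norm, one_mul]; exact dp_bound _ _ _
  have F0 : ∀ t, F t ≤ 2*N*β := fun t => (dp_bound _ _ _).trans (by simp_rw [abs_of_nonneg (fG_nn _ _ _)]; exact hSF)
  have hθ0 : 0 < θ := by linarith only [E0, h1]
  set c : ℝ := (P0.card:ℝ) with hcd
  have hc0 : 0 < c := lt_of_lt_of_le (by positivity) hc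
  set S0 : Set ℝ := {t | Real.exp (8*La r K) ≤ |t|} with hS0
  set W1 : Set ℝ := {t | |t| ≤ 2^n*K} with hW1
  set Bd : Set ℝ := {t | Real.exp (0.8*θ) ≤ ‖ds P0 t‖} with hBd
  have mS : MeasurableSet S0 := (isClosed_le continuous_const continuous_abs).measurableSet
  have mW : MeasurableSet W1 := (isClosed_le continuous_abs continuous_const).measurableSet
  have mB : MeasurableSet Bd := (isClosed_le continuous_const (ds_cont P0).norm).measurableSet
  -- tail
  have p1 : ∫ t in S0 \ W1, A t*(‖ds P0 t‖*F t) ∂(gm η) ≤ c*(N*β^2)/1024 := by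
    have sub : S0 \ W1 ⊆ {t | N*K ≤ |t|} := fun t ht => by
      have := ht.2; simp only [hW1, Set.mem_ofPred_eq, not_le] at this ⊢; rw [hN]; push_cast; exact this.le
    have g1 : (gm η).real (S0 \ W1) ≤ 2*Real.exp (-(K^2/8)) := by
      refine (measureReal_mono sub).trans ((gm_tail η (N*K) hη (by positivity)).trans ?_)
      gcongr
      have : K/2 ≤ η*(N*K) := by nlinarith only [hηN', K1]
      have := pow_le_pow_left₀ (by positivity) this 2
      linarith only [this]
    have x1 : ∀ t ∈ S0 \ W1, A t*(‖ds P0 t‖*F t) ≤ 128*(N*β)*(c*(2*N*β)) := fun t _ => by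
      have := bF.2.1 t; have := A0 t; have := F0 t; have := ds_bound P0 t
      gcongr
    have x2 := setIntegral_mono_on (μ := gm η) (g := fun _ => 128*(N*β)*(c*(2*N*β))) hI.integrableOn (integrableOn_const (measure_ne_top _ _)) (mS.diff mW) x1
    rw [setIntegral_const, smul_eq_mul] at x2
    refine x2.trans ?_
    have x3 : N*Real.exp (-(K^2/8)) ≤ Real.exp (-K) := by
      rw [← Real.exp_log hN0, ← Real.exp_add]
      refine Real.exp_le_exp.2 ?_
      rw [hN, h.lN]
      have := mul_le_mul h.hV2 h.rK (by linarith only [r1]) (by linarith only [K1])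
      nlinarith only [this, K1]
    have x4 : Real.exp (-K)*10^9 ≤ 1 := by
      rw [Real.exp_neg, inv_mul_le_iff₀ (Real.exp_pos _), mul_one]; exact big K _ (by linarith only [K1])
    calc _ ≤ 2*Real.exp (-(K^2/8))*(128*(N*β)*(c*(2*N*β))) := by gcongr
      _ = 512*(N*Real.exp (-(K^2/8)))*(c*(N*β^2)) := by ring
      _ ≤ 512*Real.exp (-K)*(c*(N*β^2)) := by gcongr
      _ ≤ _ := by nlinarith only [mul_le_mul_of_nonneg_right x4 (show 0 ≤ c*(N*β^2) by positivity), show 0 ≤ c*(N*β^2) by positivity]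
  -- small
  have p2 : ∫ t in (S0 ∩ W1) \ Bd, A t*(‖ds P0 t‖*F t) ∂(gm η) ≤ c*(N*β^2)/1024 := by
    have x1 : ∀ t ∈ (S0 ∩ W1) \ Bd, A t*(‖ds P0 t‖*F t) ≤ Real.exp (0.8*θ)*(A t*F t) := fun t ht => by
      have := ht.2; simp only [hBd, Set.mem_ofPred_eq, not_le] at this
      have := bF.2.1 t; have := bA.2.1 t
      rw [mul_left_comm]; gcongr
    have hAF := (bA.mul bF).int (gm η)
    have x2 := setIntegral_mono_on (μ := gm η) hI.integrableOn (hAF.const_mul (Real.exp (0.8*θ))).integrableOn ((mS.inter mW).diff mB) x1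
    rw [integral_const_mul] at x2
    have x3 : ∫ t in (S0 ∩ W1) \ Bd, A t*F t ∂(gm η) ≤ √(516*(128*(N*β))*(20*(2*N*β))) := (setIntegral_le_integral hAF (Filter.Eventually.of_forall fun t => (bA.mul bF).2.1 t)).trans (CS _ _ _ bA bF _ _ A2 F2)
    have x4 : √(516*(128*(N*β))*(20*(2*N*β))) ≤ 1650*(N*β) := by
      rw [Real.sqrt_le_left (by positivity)]; nlinarith only [show 0 ≤ (N*β)^2 by positivity]
    have x5 : 1650*1024*Real.exp (0.8*θ) ≤ c*β := by
      refine le_trans ?_ (mul_le_mul hc hbe (Real.exp_pos _).le hc0.le)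
      rw [div_mul_eq_mul_div, le_div_iff₀ (by positivity), ← Real.exp_add]
      have q := Real.quadratic_le_exp_of_nonneg (show 0 ≤ 0.2*E by positivity)
      calc _ = 1650*1024*4*(θ+2)*Real.exp (0.8*θ) := by ring
        _ ≤ Real.exp (0.2*E)*Real.exp (0.8*θ) := by gcongr; nlinarith only [q, h2, E0]
        _ ≤ _ := by rw [← Real.exp_add]; exact Real.exp_le_exp.2 (by linarith only [h1])
    calc _ ≤ Real.exp (0.8*θ)*(1650*(N*β)) := x2.trans (by gcongr; exact x3.trans x4)
      _ ≤ _ := by nlinarith only [mul_le_mul_of_nonneg_right x5 (show 0 ≤ N*β by positivity)]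
  -- large
  have p3 : ∫ t in (S0 ∩ W1) ∩ Bd, A t*(‖ds P0 t‖*F t) ∂(gm η) ≤ 2*(c*(N*β^2/4096))+c*(N*β^2)/1024 := by
    have e1 : c*(14*Real.exp (-(4*La r K))*K^3*(N*β)) ≤ c*(N*β^2)/1024 := by
      have : 14*1024*(Real.exp (-(4*La r K))*K^3) ≤ β := by
        refine le_trans ?_ hbe
        have e : K^3 = Real.exp (3*Real.log K) := by conv_lhs => rw [← Real.exp_log (show 0 < K by linarith), ← Real.exp_nat_mul]
                                                     norm_num
        rw [e, ← Real.exp_add]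
        calc _ ≤ Real.exp (0.9*E)*Real.exp (-(4*La r K)+3*Real.log K) := by gcongr; exact big _ _ (by linarith)
          _ ≤ _ := by rw [← Real.exp_add, hLE]; exact Real.exp_le_exp.2 (by linarith)
      nlinarith only [mul_le_mul_of_nonneg_right this (show 0 ≤ c*(N*β) by positivity)]
    have key := chain η hη (2^n) (by linarith) (GK r V K θ J) A (fun t => ‖ds P0 t‖) bA bD _ c _ A2 (ds_bound P0) hc0.le (S0 ∩ W1)
      (fun U hU mU hm => h.EL hJ P0 η hη hηN U mU hU hm) J √θ 0.2 {0} (fun _ => P0) (fun _ => θ) (fun _ => Real.exp (0.8*θ)) (by linarith) ?_ (by norm_num) ?_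
      (fun i hi => h.hyp hJ (12*K) hi) hJ1 (by linarith) _ Set.inter_subset_left ((mS.inter mW).inter mB) (fun t ht => ⟨0, by simp, ht.2⟩)
    · refine key.trans ?_
      refine add_le_add ?_ e1
      gcongr
      rw [Real.sqrt_le_left (by positivity), div_pow, le_div_iff₀ (by norm_num)]
      have x1 : 516*128*4096^2*Real.exp (-√θ^3/2) ≤ Real.exp (-(2.1*E))^3 := by
        have : √θ^3 = √θ*θ := by rw [show √θ^3 = √θ*√θ^2 by ring, s2]
        calc _ ≤ Real.exp E*Real.exp (-√θ^3/2) := by gcongr; exact big _ _ (by linarith)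
          _ ≤ _ := by rw [← Real.exp_add, ← Real.exp_nat_mul]; exact Real.exp_le_exp.2 (by push_cast; nlinarith only [this, s1, h1, E0])
      have x2 : Real.exp (-(2.1*E))^3 ≤ β^3 := by gcongr
      nlinarith only [mul_le_mul_of_nonneg_right (x1.trans x2) (show 0 ≤ N^2*β by positivity)]
    · refine ⟨?_, fun i _ => hP, fun i _ => ⟨by linarith, ?_⟩, fun i _ => Real.exp_pos _, fun i _ => ?_⟩
      · simp only [Finset.card_singleton, Nat.cast_one]; exact Real.one_le_exp (by positivity)
      · rw [show √θ^4 = (√θ^2)^2 by ring, s2]; nlinarith only [h1, E0]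
      · rw [← Real.exp_nat_mul, ← Real.exp_add]
        have : 1 ≤ Real.exp θ := Real.one_le_exp hθ0.le
        calc 2*(P0.card:ℝ) ≤ 4*Real.exp θ := by linarith
          _ ≤ Real.exp √θ*Real.exp θ := by gcongr; exact big _ _ (by linarith)
          _ ≤ _ := by rw [← Real.exp_add]; exact Real.exp_le_exp.2 (by push_cast; linarith)
    · have : 24/√θ ≤ 0.02 := by rw [div_le_iff₀ (by linarith)]; linarith
      linarith
  have f1 := integral_inter_add_sdiff (s := S0) mW hI.integrableOn
  have f2 := integral_inter_add_sdiff (s := S0 ∩ W1) mB hI.integrableOn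
  rw [← f1, ← f2]
  have : 0 ≤ c*(N*β^2) := by positivity
  linarith
end

section
variable {n r : ℕ} {K V θ : ℝ} (h : PR n r K V θ)
  {P0 : Finset ℕ} (hP : ∀ p ∈ P0, p.Prime ∧ Real.exp θ ≤ p ∧ (p:ℝ) ≤ 2*Real.exp θ) (hc : Real.exp θ/(4*(θ+2)) ≤ P0.card) (hc2 : (P0.card:ℝ) ≤ Real.exp θ+1)
  {η : ℝ} (hη : 0 < η) (hηN : η*(2^n:ℕ) ≤ 1) (hηN' : 1/2 ≤ η*(2^n:ℕ)) {ℓ : ℝ}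
  (h15 : 15*((2^n:ℕ):ℝ)^2*Real.exp θ ≤ Real.exp ℓ) (h30 : Real.exp ℓ ≤ 30*((2^n:ℕ):ℝ)^2*Real.exp θ)
include h hP hc hc2 hη hηN hηN' h15 h30
lemma PR.cnt {J : ℕ} (hJ : (√θ^(3^J))^4 ≤ K/10^4) (hJ1 : 4*Real.log (2^n:ℕ) ≤ Real.exp ((√θ^(3^J))^2/500)) :
    P0.card*(((2^n:ℕ):ℝ)*bet V r^2)/64 ≤ (TT (2^n) (BB V r) P0 (GK r V K θ J) ℓ (aa n K) (r*η)).card := by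
  have K1 := h.K1; have r1 := h.r1; have E0 := h.E0; have hbe := h.be; have r0 := h.r0; have g := h.hr
  obtain ⟨N1, N2⟩ := h.N10
  obtain ⟨L1, L2⟩ := h.L1
  have hLE : La r K = r*Real.log r+Real.log K := rfl
  have k5 := h.k5
  have big : ∀ x C : ℝ, C ≤ x → C ≤ Real.exp x := fun x C hx => le_trans (by linarith only [hx]) (Real.add_one_le_exp _)
  have small : ∀ x C : ℝ, 0 < C → C ≤ x → C*Real.exp (-x) ≤ 1 := fun x C hC hx => by
    rw [Real.exp_neg, ← div_eq_mul_inv, div_le_one (Real.exp_pos _)]; exact big x C hx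
  have hcor := h.cor (D := DD K) (Pm := ⌊2*Real.exp θ⌋₊) (P0 := P0) (fun p hp => ⟨(hP p hp).1.one_le, Nat.le_floor (hP p hp).2.2⟩)
  have eT : Real.exp (-(16*La r K)) ≤ 1/16 := by linarith only [E0, k5, small, small (16*La r K) 16 (by norm_num) (by linarith only [E0, hLE, k5])]
  have hηη : η ≤ Real.exp (-(16*La r K)) := by
    have : η ≤ Real.exp (-(10*K)) := by
      rw [Real.exp_neg, ← one_div, le_div_iff₀ (Real.exp_pos _)]
      exact (mul_le_mul_of_nonneg_left N1 hη.le).trans hηN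
    exact this.trans (Real.exp_le_exp.2 (by linarith))
  have key := core hcor (fun b c => ga_le h.DD0.1 _ _) (GK r V K θ J) ℓ η (Real.exp (-(16*La r K))) (Real.exp (8*La r K)) r _ _ _ _ hη hηη hηN (Real.exp_pos _).le (by positivity)
    h.SA (h.SF hJ).2 h.B0 (h.Er hJ hJ1 hP hc hc2 hη hηN hηN')
  have tsl := h.TSl hJ P0 (fun p hp => (hP p hp).2) ℓ h15 h30 (Real.exp (-(16*La r K))) (Real.exp_le_exp.2 (by linarith only [hη, K1, L2, eT, hηη])) eT
  set N : ℝ := ((2^n:ℕ):ℝ) with hN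
  set β := bet V r with hβ
  set c : ℝ := (P0.card:ℝ) with hcd
  have hb0 : 0 < β := (Real.exp_pos _).trans_le hbe
  have hN0 : 0 < N := (Real.exp_pos _).trans_le N1
  have hX : 0 ≤ c*(N*β^2) := by positivity
  have t1 : c*(N*β^2)/32 ≤ η*(TS (2^n) (BB V r) P0 (GK r V K θ J) ℓ (aa n K) (Real.exp (-(16*La r K)))/Real.exp (-(16*La r K))) := by
    calc c*(N*β^2)/32 ≤ η*N*(c*(N*β^2)/16) := by nlinarith only [mul_le_mul_of_nonneg_right hηN' hX]
      _ = η*(c*(N*β)^2*Real.exp (-(16*La r K))/16/Real.exp (-(16*La r K))) := by field_simp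
      _ ≤ _ := by gcongr
  have t2 : Real.exp (-(r:ℝ)^2/4)*(c*√(516*(128*(N*β))*(20*(2*N*β)))) ≤ c*(N*β^2)/256 := by
    have x4 : √(516*(128*(N*β))*(20*(2*N*β))) ≤ 1650*(N*β) := by
      rw [Real.sqrt_le_left (by positivity)]; nlinarith only [show 0 ≤ (N*β)^2 by positivity]
    have x5 : 1650*256*Real.exp (-(r:ℝ)^2/4) ≤ β := by
      refine le_trans ?_ hbe
      calc _ ≤ Real.exp (r*Real.log r)*Real.exp (-(r:ℝ)^2/4) := by gcongr; exact big _ _ (by linarith only [hη, E0, eT, hηη])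
        _ ≤ _ := by
          rw [← Real.exp_add]; refine Real.exp_le_exp.2 ?_
          have : 100*Real.log r ≤ r := by nlinarith only [r0, g, mul_nonneg (show 0 ≤ Real.log r-1 by linarith only [hη, g, eT, hηη]) (show 0 ≤ Real.log r*(Real.log r+1) by nlinarith only [g])]
          nlinarith only [mul_le_mul_of_nonneg_left this (show (0:ℝ) ≤ r by positivity), r1]
    calc _ ≤ Real.exp (-(r:ℝ)^2/4)*(c*(1650*(N*β))) := by gcongr
      _ ≤ _ := by nlinarith only [mul_le_mul_of_nonneg_right x5 (show 0 ≤ c*(N*β) by positivity)]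
  have t3 : η*(Real.exp (8*La r K)^3*Real.exp (-(16*La r K))^2*(128*(N*β)*(c*(2*N*β)))) ≤ c*(N*β^2)/256 := by
    have e : Real.exp (8*La r K)^3*Real.exp (-(16*La r K))^2 = Real.exp (-(8*La r K)) := by
      rw [← Real.exp_nat_mul, ← Real.exp_nat_mul, ← Real.exp_add]; congr 1; push_cast; ring
    rw [e]
    have s := small (8*La r K) (256*256) (by norm_num) (by linarith only [hη, E0, hLE, k5, eT, hηη])
    calc _ = η*N*(256*Real.exp (-(8*La r K)))*(c*(N*β^2)) := by ring
      _ ≤ 1*(1/256)*(c*(N*β^2)) := by gcongr; linarith only [s]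
      _ = _ := by ring
  have key' : η*(TS (2^n) (BB V r) P0 (GK r V K θ J) ℓ (aa n K) (Real.exp (-(16*La r K)))/Real.exp (-(16*La r K))) ≤
    (TT (2^n) (BB V r) P0 (GK r V K θ J) ℓ (aa n K) (r*η)).card + Real.exp (-(r:ℝ)^2/4)*(c*√(516*(128*(N*β))*(20*(2*N*β)))) + c*(N*β^2)/256 +
      η*(Real.exp (8*La r K)^3*Real.exp (-(16*La r K))^2*(128*(N*β)*(c*(2*N*β)))) := key
  linarith only [t1, t2, t3, key']

lemma PR.fin (S : Finset ℕ) (hS : ∀ s : ℕ, 0 < s → (∀ p ∈ s.primeFactors, (p:ℝ) ≤ Real.exp V) → |ℓ-Real.log s| < r*η → s ∈ S) :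
    P0.card*(((2^n:ℕ):ℝ)*bet V r^2)/64 ≤ 4^r*K^3*S.card := by
  obtain ⟨J, hJ1, hJ⟩ := h.J
  refine (h.cnt hP hc hc2 hη hηN hηN' h15 h30 hJ hJ1).trans ?_
  have K1 := h.K1; have r1 := h.r1; have V0 := h.V0; have r2 := h.r2; have lK := h.lK; have k5 := h.k5
  set z := Real.exp (V*(1-1/(2*r))) with hz
  have zV : z ≤ Real.exp V := Real.exp_le_exp.2 (by
    have : 0 ≤ V*(1/(2*r)) := by positivity
    linarith only [this])
  have hθz : 2*Real.exp θ ≤ z := by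
    refine le_trans ?_ h.z
    have h2 := h.h2
    have F1 := h.F1
    calc 2*Real.exp θ ≤ Real.exp 1*Real.exp θ := by gcongr; linarith only [Real.add_one_le_exp 1]
      _ ≤ _ := by rw [← Real.exp_add]; exact Real.exp_le_exp.2 (by linarith only [K1, k5, h2, F1])
  set M := ⌊2*DD K*(12*K)⌋₊ with hM
  have T1 : ∀ x ∈ TT (2^n) (BB V r) P0 (GK r V K θ J) ℓ (aa n K) (r*η), (|ℓ-Real.log (x.1*x.2.1*x.2.2.1*x.2.2.2)| < r*η) ∧ x.1 ∈ BB V r ∧ 0 < x.2.1 ∧ (∀ p ∈ x.2.1.primeFactors, (p:ℝ) ≤ z) ∧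
      x.2.2.1.Prime ∧ (x.2.2.1:ℝ) ≤ z ∧ ∃ b' ∈ BB V r, ∃ m, x.2.2.2 = b'*m ∧ 0 < m ∧ (∀ p ∈ m.primeFactors, (p:ℝ) ≤ z) ∧ 2*tau x.2.1*tau m ≤ M := by
    rintro ⟨b, c, p, k⟩ hx
    simp only [TT, Finset.mem_filter, Finset.mem_product, Finset.mem_Icc] at hx
    obtain ⟨⟨hb, ⟨c1, -⟩, hp, k1, -⟩, ha, hf, hl⟩ := hx
    have hcs := ga_supp ha.ne'
    have hct := ga_pos h.DD0.1 ha
    simp only [fG] at hf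
    split_ifs at hf with hk
    · obtain ⟨k2, k3, b', hb', m, rfl, -, hm⟩ := hk
      have b'0 := h.bN hb'
      have hm0 : 0 < m := Nat.pos_of_ne_zero (by rintro rfl; simp at k1)
      refine ⟨hl, hb, c1, h.prz (le_trans ?_ (h.Y1 hb).2.2.2), (hP p hp).1, (hP p hp).2.2.trans hθz, b', hb', m, rfl, hm0, h.prz ?_, Nat.le_floor ?_⟩
      · exact_mod_cast hcs.2.le
      · have : (m:ℝ) ≤ 2*(((2^n:ℕ):ℝ)/b') := by
          rw [← mul_div_assoc, le_div_iff₀ b'0.1]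
          have : ((b'*m:ℕ):ℝ) ≤ ((2*2^n:ℕ):ℝ) := by exact_mod_cast k3.le
          push_cast at this ⊢; linarith only [this]
        linarith only [h, hb', b'0, this, (h.Y1 hb').2.2.2, b'0.2.2.2.1, show (0:ℝ) ≤ Yb n b' by positivity]
      · push_cast
        have := h.DD0.1
        gcongr
    · norm_num at hf
  have T2 : (TT (2^n) (BB V r) P0 (GK r V K θ J) ℓ (aa n K) (r*η)).card ≤ (4^r*(Nat.log 2 M*M))*S.card := by
    refine Finset.card_le_mul_card_image_of_maps_to (f := fun x => x.1*x.2.1*x.2.2.1*x.2.2.2) (fun x hx => ?_) _ (fun s _ => ?_)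
    · obtain ⟨t1, t2, t3, t4, t5, t6, b', t7, m, t8, t9, t10, -⟩ := T1 x hx
      obtain ⟨-, -, u1, -⟩ := BB_mem V0 r2 t2
      obtain ⟨-, -, u2, -⟩ := BB_mem V0 r2 t7
      have a1 : x.1 ≠ 0 := by have := (h.bN t2).1; exact_mod_cast this.ne'
      have a2 : b' ≠ 0 := by have := (h.bN t7).1; exact_mod_cast this.ne'
      have a3 := t5.ne_zero
      refine hS _ (Nat.pos_of_ne_zero (by rw [t8]; simp; omega)) (fun p hp => ?_) (by push_cast; exact t1)
      rw [t8, Nat.primeFactors_mul (by simp; omega) (by simp; omega), Nat.primeFactors_mul (by simp; omega) a3, Nat.primeFactors_mul a1 (by omega), Nat.primeFactors_mul a2 (by omega), t5.primeFactors] at hp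
      simp only [Finset.mem_union, Finset.mem_singleton] at hp
      rcases hp with ((hp|hp)|rfl)|(hp|hp)
      · exact (u1 p hp).2
      · exact (t4 p hp).trans zV
      · exact t6.trans zV
      · exact (u2 p hp).2
      · exact (t10 p hp).trans zV
    · refine mult (BB V r) z r M (fun b hb => ?_) s _ (fun x hx => ?_)
      · obtain ⟨v1, v2, v3, -⟩ := BB_mem V0 r2 hb
        exact ⟨v1, v2, fun p hp => (v3 p hp).1⟩
      · rw [Finset.mem_filter] at hx
        exact ⟨hx.2, (T1 x hx.1).2⟩
  have T3 : ((Nat.log 2 M*M:ℕ):ℝ) ≤ K^3 := by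
    obtain ⟨d0, d1, d2⟩ := h.DD0
    have sK : √K^2 = K := Real.sq_sqrt (by linarith only [K1])
    have s1 : 10^100 ≤ √K := Real.le_sqrt_of_sq_le (by linarith)
    have m1 : (M:ℝ) ≤ 96*(K^2*√K) := (Nat.floor_le (by positivity)).trans (by rw [DD]; ring_nf; rfl)
    have m2 : (96:ℝ)*(K^2*√K) ≤ K^3 := by nlinarith only [mul_le_mul_of_nonneg_left s1 (show 0 ≤ K^2*√K by positivity), sK, show 0 ≤ K^2*√K by positivity]
    have m3 : (Nat.log 2 M:ℝ) ≤ 6*Real.log K := by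
      have : 1 ≤ M := Nat.le_floor (by push_cast; nlinarith only [d2, K1])
      have e : ((2^Nat.log 2 M:ℕ):ℝ) ≤ K^3 := le_trans (by exact_mod_cast Nat.pow_log_le_self 2 (by omega)) (m1.trans m2)
      have := Real.log_le_log (by positivity) e
      push_cast at this
      rw [Real.log_pow, Real.log_pow] at this; push_cast at this
      nlinarith only [this, Real.log_two_gt_d9, show (0:ℝ) ≤ Nat.log 2 M by positivity]
    have m4 : 1000*Real.log K ≤ √K := by
      have : Real.log K = 4*Real.log √(√K) := by rw [Real.log_sqrt (by positivity), Real.log_sqrt (by positivity)]; ring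
      have a := Real.log_le_self (Real.sqrt_nonneg √K)
      have b : √√K^2 = √K := Real.sq_sqrt (by positivity)
      have : 10^5 ≤ √√K := Real.le_sqrt_of_sq_le (by linarith only [s1])
      nlinarith only [this, a, b, ‹Real.log K = _›]
    push_cast
    calc (Nat.log 2 M:ℝ)*M ≤ (6*Real.log K)*(96*(K^2*√K)) := by gcongr
      _ ≤ √K*(K^2*√K) := by nlinarith only [mul_le_mul_of_nonneg_right m4 (show 0 ≤ K^2*√K by positivity), show 0 ≤ Real.log K*(K^2*√K) by have := k5; positivity]
      _ = K^2*√K^2 := by ring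
      _ = K^3 := by rw [sK]; ring
  calc ((TT (2^n) (BB V r) P0 (GK r V K θ J) ℓ (aa n K) (r*η)).card:ℝ) ≤ (((4^r*(Nat.log 2 M*M))*S.card:ℕ):ℝ) := by exact_mod_cast T2
    _ = 4^r*((Nat.log 2 M*M:ℕ):ℝ)*S.card := by push_cast; ring
    _ ≤ _ := by gcongr
end

lemma dick_c {ρ : ℝ → ℝ} (hρ : IsDickman ρ) : Continuous (fun v => ρ (max 0 v)) := hρ.1.comp_continuous (by fun_prop) (fun v => Set.mem_Ici.2 (le_max_left _ _))
lemma dick_int {ρ : ℝ → ℝ} (hρ : IsDickman ρ) {u : ℝ} (hu : 1 ≤ u) : u*ρ u = ∫ v in (u-1)..u, ρ (max 0 v) := by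
  have hc := dick_c hρ
  obtain ⟨h1, h2, h3, h4⟩ := hρ
  set F : ℝ → ℝ := fun x => ∫ v in (0:ℝ)..x, ρ (max 0 v) with hF
  have dF : ∀ x, HasDerivAt F (ρ (max 0 x)) x := fun x => (hc.integral_hasStrictDerivAt 0 x).hasDerivAt
  have cF : Continuous F := continuous_iff_continuousAt.2 fun x => (dF x).continuousAt
  have e : ∫ v in (u-1)..u, ρ (max 0 v) = F u-F (u-1) := by
    rw [hF]; exact (intervalIntegral.integral_interval_sub_left (hc.intervalIntegrable _ _) (hc.intervalIntegrable _ _)).symm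
  have F0 : F 0 = 0 := intervalIntegral.integral_same
  have F1 : F 1 = 1 := by
    have : F 1 = ∫ v in (0:ℝ)..1, (1:ℝ) := intervalIntegral.integral_congr fun v hv => by
      rw [Set.uIcc_of_le zero_le_one] at hv; rw [max_eq_right hv.1]; exact h2 v hv.1 hv.2
    rw [this]; simp
  set g : ℝ → ℝ := fun x => x*ρ x-(F x-F (x-1)) with hg
  have key : g u = g 1 := by
    rcases hu.eq_or_lt with rfl | hu1
    · rfl
    obtain ⟨c, -, hs⟩ := exists_hasDerivAt_eq_slope g (fun _ => 0) hu1
      ((continuousOn_id.mul (h1.mono fun x hx => Set.mem_Ici.2 (le_trans zero_le_one hx.1))).sub (by fun_prop)) (fun x hx => by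
        have hx1 := hx.1
        have := ((hasDerivAt_id x).mul (h3 x hx1)).sub ((dF x).sub ((dF (x-1)).comp x ((hasDerivAt_id x).sub_const 1)))
        refine HasDerivAt.congr_deriv (f := g) this ?_
        simp only [id]; rw [max_eq_right (by linarith), max_eq_right (by linarith)]; field_simp; ring)
    rw [eq_comm, div_eq_zero_iff] at hs
    rcases hs with hs | hs <;> linarith
  simp only [hg, sub_self, F0, F1, h2 1 zero_le_one le_rfl] at key
  rw [e]; linarith

lemma dick_pos {ρ : ℝ → ℝ} (hρ : IsDickman ρ) {u : ℝ} (hu : 0 ≤ u) : 0 < ρ u := by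
  by_contra hn
  push Not at hn
  have hc := dick_c hρ
  have h2 := hρ.2.1
  have hu1 : 1 ≤ u := by by_contra h; rw [h2 u hu (by linarith)] at hn; linarith
  obtain ⟨w, ⟨⟨hw1, hw2⟩, hw3⟩, hw⟩ := (isCompact_Icc.inter_right (isClosed_le hc continuous_const) : IsCompact (Set.Icc 1 u ∩ {v | ρ (max 0 v) ≤ 0})).exists_isLeast
    ⟨u, ⟨hu1, le_rfl⟩, by simpa [max_eq_right hu] using hn⟩
  simp only [Set.mem_ofPred_eq] at hw3
  have pos : 0 < ∫ v in (w-1)..w, ρ (max 0 v) := by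
    refine intervalIntegral.intervalIntegral_pos_of_pos_on (hc.intervalIntegrable _ _) (fun v hv => ?_) (by linarith)
    have v0 : 0 < v := by linarith [hv.1]
    by_contra h'
    push Not at h'
    rcases le_total v 1 with hv1 | hv1
    · rw [max_eq_right v0.le, h2 v v0.le hv1] at h'; linarith
    · linarith [hw ⟨⟨hv1, by linarith [hv.2]⟩, h'⟩, hv.2]
  rw [← dick_int hρ hw1] at pos
  rw [max_eq_right (by linarith)] at hw3
  nlinarith

lemma dick_anti {ρ : ℝ → ℝ} (hρ : IsDickman ρ) : AntitoneOn ρ (Set.Ici 1) := by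
  refine antitoneOn_of_deriv_nonpos (convex_Ici 1) (hρ.1.mono fun x hx => Set.mem_Ici.2 (le_trans zero_le_one hx)) ?_ ?_ <;> rw [interior_Ici]
  · exact fun x hx => (hρ.2.2.1 x hx).differentiableAt.differentiableWithinAt
  · intro x hx
    rw [(hρ.2.2.1 x hx).deriv]
    have hx' : 1 < x := hx
    have := dick_pos hρ (show 0 ≤ x-1 by linarith)
    exact div_nonpos_of_nonpos_of_nonneg (by linarith) (by linarith)

lemma dick_rec {ρ : ℝ → ℝ} (hρ : IsDickman ρ) {u δ : ℝ} (hu : 2 ≤ u) (h0 : 0 ≤ δ) (h1 : δ ≤ 1) : u*ρ u ≤ δ*ρ (u-1)+ρ (u-1+δ) := by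
  have hc := dick_c hρ
  have ha := dick_anti hρ
  have key : ∀ a b : ℝ, 1 ≤ a → a ≤ b → ∫ v in a..b, ρ (max 0 v) ≤ (b-a)*ρ a := fun a b h1 h2 => by
    have := intervalIntegral.integral_mono_on h2 (hc.intervalIntegrable (μ := volume) _ _) (intervalIntegrable_const (c := ρ a)) (fun v hv => by
      rw [max_eq_right (by linarith [hv.1])]; exact ha h1 (h1.trans hv.1) hv.1)
    rwa [intervalIntegral.integral_const, smul_eq_mul] at this
  rw [dick_int hρ (by linarith), ← intervalIntegral.integral_add_adjacent_intervals (hc.intervalIntegrable (u-1) (u-1+δ)) (hc.intervalIntegrable (u-1+δ) u)]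
  have k1 := key (u-1) (u-1+δ) (by linarith) (by linarith)
  have k2 := key (u-1+δ) u (by linarith) (by linarith)
  have := dick_pos hρ (show 0 ≤ u-1+δ by linarith)
  nlinarith

lemma dick_bd {ρ : ℝ → ℝ} (hρ : IsDickman ρ) (C : ℝ) (hC : 1 ≤ C) : ∃ u₁ : ℝ, ∀ u ≥ u₁, ρ u ≤ Real.exp (-(u*Real.log (C*u))) := by
  suffices H : ∀ C : ℝ, 1 ≤ C → ∃ u₁ B : ℝ, 1 ≤ B ∧ 1 ≤ u₁ ∧ ∀ u ≥ u₁, ρ u ≤ B*Real.exp (-(u*Real.log (C*u))) by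
    obtain ⟨u₁, B, hB, h1, h⟩ := H (3*C) (by linarith)
    refine ⟨max u₁ B, fun u hu => (h u (le_trans (le_max_left _ _) hu)).trans ?_⟩
    have hu1 := le_trans (le_max_left _ _) hu
    have hu2 := le_trans (le_max_right _ _) hu
    have e : Real.log (3*C*u) = Real.log 3+Real.log (C*u) := by
      rw [mul_assoc, Real.log_mul (by norm_num) (by nlinarith)]
    have l3 : 1 ≤ Real.log 3 := by rw [Real.le_log_iff_exp_le (by norm_num)]; linarith [Real.exp_one_lt_d9]
    calc B*Real.exp (-(u*Real.log (3*C*u))) ≤ Real.exp u*Real.exp (-(u*Real.log (3*C*u))) := by gcongr; linarith [Real.add_one_le_exp u]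
      _ ≤ _ := by rw [← Real.exp_add, e]; exact Real.exp_le_exp.2 (by nlinarith only [l3, hu1, h1])
  intro C hC
  set φ : ℝ → ℝ := fun u => u*Real.log (C*u) with hφ
  have dφ : ∀ u s : ℝ, 0 ≤ s → s < u → φ u ≤ φ (u-s)+s*(Real.log (C*u)+1) := fun u s hs hsu => by
    have u0 : 0 < u := by linarith
    simp only [hφ]
    have a1 : Real.log (C*u) = Real.log (C*(u-s))+Real.log (u/(u-s)) := by
      rw [← Real.log_mul (by nlinarith) (by have := sub_pos.2 hsu; positivity)]; congr 1; have := sub_pos.2 hsu; field_simp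
    have a2 := Real.log_le_sub_one_of_pos (show 0 < u/(u-s) by have := sub_pos.2 hsu; positivity)
    have a3 : (u-s)*(u/(u-s)-1) = s := by have := sub_pos.2 hsu; field_simp; ring
    have := mul_le_mul_of_nonneg_left a2 (show 0 ≤ u-s by linarith)
    rw [a3] at this; rw [a1]; nlinarith only [this]
  set δ := 1/(6*C) with hδ
  have hδ0 : 0 < δ := by positivity
  have hδ1 : δ ≤ 1/2 := by rw [hδ, div_le_div_iff₀ (by positivity) (by norm_num)]; linarith
  have hδC : δ*C = 1/6 := by rw [hδ]; field_simp
  obtain ⟨u₁, hu2, hu1⟩ : ∃ u₁ : ℝ, 3 ≤ u₁ ∧ 6*C ≤ u₁^δ := by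
    obtain ⟨a, ha⟩ := ((tendsto_rpow_atTop hδ0).eventually_ge_atTop (6*C)).exists_forall_of_atTop
    exact ⟨max 3 a, le_max_left _ _, ha _ (le_max_right _ _)⟩
  have mφ : ∀ u v : ℝ, 1 ≤ u → u ≤ v → φ u ≤ φ v := fun u v h1 h2 => by
    simp only [hφ]
    have : 0 ≤ Real.log (C*u) := Real.log_nonneg (by nlinarith only [hC, h1])
    have : 0 ≤ v := by linarith
    gcongr
  refine ⟨u₁, Real.exp (φ u₁), Real.one_le_exp (mul_nonneg (by linarith) (Real.log_nonneg (by nlinarith only [hC, hu2]))), by linarith, ?_⟩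
  set B := Real.exp (φ u₁)
  have key : ∀ n : ℕ, ∀ u : ℝ, u₁-1 ≤ u → u ≤ u₁+n/2 → ρ u ≤ B*Real.exp (-φ u) := by
    intro n
    have base : ∀ u : ℝ, u₁-1 ≤ u → u ≤ u₁ → ρ u ≤ B*Real.exp (-φ u) := fun u h1 h2 => by
      have a := dick_anti hρ (Set.mem_Ici.2 le_rfl) (Set.mem_Ici.2 (by linarith)) (show 1 ≤ u by linarith)
      rw [hρ.2.1 1 zero_le_one le_rfl] at a
      rw [← Real.exp_add]
      exact a.trans (Real.one_le_exp (by linarith [mφ u u₁ (by linarith) h2]))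
    induction n with
    | zero => intro u h1 h2; exact base u h1 (by simpa using h2)
    | succ n ih =>
      intro u h1 h2
      rcases le_total u u₁ with hu | hu
      · exact base u h1 hu
      push_cast at h2
      have n0 : (0:ℝ) ≤ n := by positivity
      have u0 : 0 < u := by linarith
      have r1 := ih (u-1) (by linarith) (by linarith)
      have r2 := ih (u-1+δ) (by linarith) (by linarith)
      have hrec := dick_rec hρ (show 2 ≤ u by linarith) hδ0.le (by linarith)
      have ex : ∀ s : ℝ, 0 ≤ s → s < u → Real.exp (-φ (u-s)) ≤ Real.exp (-φ u)*(3*C*u)^s := fun s hs hsu => by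
        rw [Real.rpow_def_of_pos (by positivity), ← Real.exp_add]
        refine Real.exp_le_exp.2 ?_
        have l3 : Real.log (C*u)+1 ≤ Real.log (3*C*u) := by
          rw [mul_assoc, Real.log_mul (x := 3) (by norm_num) (by positivity)]
          have : 1 ≤ Real.log 3 := by rw [Real.le_log_iff_exp_le (by norm_num)]; linarith [Real.exp_one_lt_d9]
          linarith
        nlinarith only [dφ u s hs hsu, mul_le_mul_of_nonneg_left l3 hs]
      have e1 := ex 1 (by norm_num) (by linarith)
      have e2 := ex (1-δ) (by linarith) (by linarith)
      rw [Real.rpow_one] at e1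
      rw [show u-(1-δ) = u-1+δ by ring] at e2
      have e3 : (3*C*u)^(1-δ) ≤ u/2 := by
        have p1 : (3*C*u)^(1-δ) = (3*C)^(1-δ)*(u/u^δ) := by
          rw [Real.mul_rpow (by positivity) u0.le, Real.rpow_sub u0, Real.rpow_one]
        have p2 : (3*C)^(1-δ) ≤ 3*C := by
          conv_rhs => rw [← Real.rpow_one (3*C)]
          exact Real.rpow_le_rpow_of_exponent_le (by linarith) (by linarith)
        have p3 : 6*C ≤ u^δ := hu1.trans (Real.rpow_le_rpow (by linarith) hu hδ0.le)
        rw [p1]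
        calc _ ≤ 3*C*(u/(6*C)) := by gcongr
          _ = u/2 := by field_simp; norm_num
      have B0 : 0 < B := Real.exp_pos _
      have X0 := Real.exp_pos (-φ u)
      have f1 : δ*ρ (u-1) ≤ B*Real.exp (-φ u)*(u/2) := by
        calc δ*ρ (u-1) ≤ δ*(B*(Real.exp (-φ u)*(3*C*u))) := by gcongr; exact r1.trans (by gcongr)
          _ = B*Real.exp (-φ u)*(3*(δ*C)*u) := by ring
          _ = _ := by rw [hδC]; ring
      have f2 : ρ (u-1+δ) ≤ B*Real.exp (-φ u)*(u/2) := by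
        calc ρ (u-1+δ) ≤ B*(Real.exp (-φ u)*(u/2)) := r2.trans (by gcongr; exact e2.trans (by gcongr))
          _ = _ := by ring
      nlinarith only [hrec, f1, f2, u0]
  intro u hu
  obtain ⟨n, hn⟩ := exists_nat_ge (2*(u-u₁))
  exact key n u (by linarith) (by linarith)

lemma psi_split {a b y : ℝ} (hab : a ≤ b) :
    Psi a y+((Finset.Ioc ⌊a⌋₊ ⌊b⌋₊).filter (fun n => ∀ p : ℕ, p ∈ n.primeFactors → (p : ℝ) ≤ y)).card ≤ Psi b y := by
  have hf := Nat.floor_mono hab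
  rw [Psi, Psi, ← Finset.card_union_of_disjoint]
  · refine Finset.card_le_card fun s hs => ?_
    simp only [Finset.mem_union, Finset.mem_filter, Finset.mem_Icc, Finset.mem_Ioc] at hs ⊢
    rcases hs with ⟨⟨a1, a2⟩, a3⟩ | ⟨⟨a1, a2⟩, a3⟩
    · exact ⟨⟨a1, a2.trans hf⟩, a3⟩
    · exact ⟨⟨by omega, a2⟩, a3⟩
  · rw [Finset.disjoint_left]
    intro s h1 h2
    simp only [Finset.mem_filter, Finset.mem_Icc, Finset.mem_Ioc] at h1 h2
    omega

lemma half {P : ℝ} (hP : 1000 ≤ Real.log P) (h0 : 0 < P) : ∃ θ : ℝ, ∃ P0 : Finset ℕ, (Real.exp θ = P ∨ Real.exp θ = 2*P) ∧ Real.log P ≤ θ ∧ θ ≤ Real.log P+1 ∧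
    (∀ p ∈ P0, p.Prime ∧ Real.exp θ ≤ p ∧ (p:ℝ) ≤ 2*Real.exp θ) ∧ Real.exp θ/(4*(θ+2)) ≤ P0.card ∧ (P0.card:ℝ) ≤ Real.exp θ+1 := by
  have h4 := (pr4 _ hP).2
  rw [Real.exp_log h0] at h4
  have hs := pr_add (fun _ => (1:ℝ)) (show P ≤ 2*P by linarith) (show 2*P ≤ 4*P by linarith)
  simp only [Finset.sum_const, nsmul_eq_mul, mul_one] at hs
  have cd : ∀ Q : ℝ, 0 < Q → ((pr Q (2*Q)).card:ℝ) ≤ Q+1 := fun Q hQ => by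
    have h1 : (pr Q (2*Q)).card ≤ ⌊2*Q⌋₊-⌊Q⌋₊ := (Finset.card_filter_le _ _).trans (Nat.card_Ioc _ _).le
    have h2 : ((pr Q (2*Q)).card:ℝ)+⌊Q⌋₊ ≤ ⌊2*Q⌋₊ := by
      have := Nat.floor_mono (show Q ≤ 2*Q by linarith only [hQ])
      have : (pr Q (2*Q)).card+⌊Q⌋₊ ≤ ⌊2*Q⌋₊ := by omega
      exact_mod_cast this
    linarith only [hQ, h2, Nat.floor_le (show 0 ≤ 2*Q by linarith only [hQ]), Nat.lt_floor_add_one Q]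
  have mem : ∀ Q : ℝ, 0 < Q → ∀ p ∈ pr Q (2*Q), p.Prime ∧ Q ≤ p ∧ (p:ℝ) ≤ 2*Q := fun Q hQ p hp => by
    have := (pr_mem hQ.le (by linarith)).1 hp
    exact ⟨this.1, this.2.1.le, this.2.2⟩
  by_cases hc : P/(4*(Real.log P+2)) ≤ (pr P (2*P)).card
  · refine ⟨Real.log P, pr P (2*P), Or.inl (Real.exp_log h0), le_rfl, by linarith, ?_⟩
    rw [Real.exp_log h0]
    exact ⟨mem P h0, hc, cd P h0⟩
  · have e : Real.log (2*P) = Real.log 2+Real.log P := Real.log_mul (by norm_num) h0.ne'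
    have l2 := Real.log_two_gt_d9
    have l2' := Real.log_two_lt_d9
    have e4 : 4*P = 2*(2*P) := by ring
    rw [e4] at hs h4
    refine ⟨Real.log (2*P), pr (2*P) (2*(2*P)), Or.inr (Real.exp_log (by linarith)), by linarith, by linarith, ?_⟩
    rw [Real.exp_log (by linarith)]
    refine ⟨mem _ (by linarith), ?_, cd _ (by linarith)⟩
    push Not at hc
    have : P/(Real.log P+2) = 4*(P/(4*(Real.log P+2))) := by field_simp
    have : 2*P/(4*(Real.log (2*P)+2)) ≤ 2*(P/(4*(Real.log P+2))) := by
      rw [← mul_div_assoc]; gcongr; linarith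
    linarith [show 0 ≤ P/(4*(Real.log P+2)) by positivity]

lemma fin_arith {u l K L θ c N β D s : ℝ} {r : ℕ} (b1 : (1/(13*(r:ℝ)^2))^r ≤ β) (a2 : D ≤ 240*r*(Real.exp θ*N)) (hc : Real.exp θ/(4*(θ+2)) ≤ c) (hf : c*(N*β^2)/64 ≤ 4^r*K^3*s)
    (hθ0 : 0 ≤ θ) (hθ : θ ≤ 6*u*l+5) (r0 : 1 ≤ (r:ℝ)) (r2 : (r:ℝ) ≤ u/2+1) (hl : Real.log r ≤ l) (l1 : 1 ≤ l) (KL : K*u = L) (hK : 0 < K) (u2 : 10^3 ≤ u) (u1 : l ≤ u) (N0 : 0 < N) (hs : 0 ≤ s) (hD : 0 ≤ D) :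
    D*Real.exp (-(2*u*l+20*u))/L^3 ≤ s := by
  have u0 : 0 < u := by linarith only [u2]
  have β0 : 0 < β := lt_of_lt_of_le (by positivity) b1
  have l0 : 0 ≤ Real.log r := Real.log_nonneg r0
  have e1 : Real.exp (-(u*l+3*u+2*l)) ≤ β := by
    refine le_trans ?_ b1
    rw [one_div, inv_pow, ← Real.exp_log (show (0:ℝ) < (13*(r:ℝ)^2)^r by positivity), ← Real.exp_neg]
    refine Real.exp_le_exp.2 (neg_le_neg ?_)
    rw [Real.log_pow, Real.log_mul (by norm_num) (by positivity), Real.log_pow]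
    have : Real.log 13 ≤ 5 := by
      have h1 : Real.log 16 = 4*Real.log 2 := by rw [show (16:ℝ) = 2^4 by norm_num, Real.log_pow]; norm_num
      have h2 := Real.log_le_log (by norm_num) (show (13:ℝ) ≤ 16 by norm_num)
      linarith only [Real.log_two_lt_d9, h1, h2]
    push_cast
    calc (r:ℝ)*(Real.log 13+2*Real.log r) ≤ (u/2+1)*(5+2*l) := by gcongr
      _ ≤ _ := by nlinarith only [u2]
  have e2 : (4:ℝ)^r ≤ Real.exp (2*u) := by
    calc (4:ℝ)^r ≤ (Real.exp 2)^r := by gcongr; linarith only [Real.quadratic_le_exp_of_nonneg (show (0:ℝ) ≤ 2 by norm_num)]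
      _ ≤ _ := by rw [← Real.exp_nat_mul]; exact Real.exp_le_exp.2 (by linarith only [r2, u2])
  have e3 : 61440*r*(θ+2) ≤ Real.exp u := by
    refine le_trans ?_ (expb u u2)
    calc 61440*(r:ℝ)*(θ+2) ≤ 61440*u*(6*u*u+7) := by
          have : 6*u*l ≤ 6*u*u := by gcongr
          exact mul_le_mul (by linarith only [r2, u2]) (by linarith only [hθ, this]) (by linarith only [hθ0]) (by linarith only [u0])
      _ ≤ _ := by nlinarith only [u2, pow_le_pow_left₀ (by norm_num) u2 2, show 0 ≤ u^3 by positivity, mul_le_mul_of_nonneg_left (pow_le_pow_left₀ (by norm_num) u2 2) u0.le]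
  have e4 : D*β^2 ≤ 61440*r*(θ+2)*(4^r*K^3*s) := by
    rw [div_le_iff₀ (by positivity)] at hc
    calc D*β^2 ≤ 240*r*(Real.exp θ*N)*β^2 := by gcongr
      _ ≤ 240*r*(c*(4*(θ+2))*N)*β^2 := by gcongr
      _ = 61440*r*(θ+2)*(c*(N*β^2)/64) := by ring
      _ ≤ _ := by gcongr
  have L0 : 0 < L := by rw [← KL]; positivity
  rw [div_le_iff₀ (by positivity)]
  have e5 : Real.exp (-(2*u*l+20*u)) ≤ Real.exp (-(5*u))*β^2 := by
    calc Real.exp (-(2*u*l+20*u)) ≤ Real.exp (-(5*u))*Real.exp (-(u*l+3*u+2*l))^2 := by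
          rw [← Real.exp_nat_mul, ← Real.exp_add]; exact Real.exp_le_exp.2 (by push_cast; linarith only [u1, u0])
      _ ≤ _ := by gcongr
  calc D*Real.exp (-(2*u*l+20*u)) ≤ D*(Real.exp (-(5*u))*β^2) := by gcongr
    _ = Real.exp (-(5*u))*(D*β^2) := by ring
    _ ≤ Real.exp (-(5*u))*(Real.exp u*(Real.exp (2*u)*K^3*s)) := mul_le_mul_of_nonneg_left (e4.trans (by gcongr)) (Real.exp_pos _).le
    _ = Real.exp (-(5*u)+u+2*u)*(K^3*s) := by rw [Real.exp_add, Real.exp_add]; ring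
    _ ≤ 1*(L^3*s) := by
      gcongr
      · exact Real.exp_le_one_iff.2 (by linarith only [u0])
      · rw [← KL]; nlinarith only [hK, u2]
    _ = s*L^3 := by ring

set_option maxHeartbeats 1000000 in
lemma stepX {u x X : ℝ} (hu : 2*10^4 ≤ Real.log u) (hx : 1 ≤ x) (hL : u^6 ≤ Real.log x) (hu0 : 0 < u) (hX : x ≤ X) (hX2 : X ≤ 2*x) :
    Real.exp (3*u*Real.log u)*√x*Real.exp (-(2*u*Real.log u+20*u))/(Real.log x)^3 ≤
      (Psi (X+Real.exp (3*u*Real.log u)*√x) (x^(1/u)):ℝ)-Psi X (x^(1/u)) := by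
  set l := Real.log u with hl
  set L := Real.log x with hLd
  have hxL : x = Real.exp L := (Real.exp_log (by linarith)).symm
  have sx : √x = Real.exp (L/2) := by rw [hxL, Real.exp_half]
  have ul : 10^30*l^3 ≤ u := by have := expb l (by linarith); rwa [hl, Real.exp_log hu0] at this
  have l3 : (2*10^4)^2*l ≤ l^3 := by nlinarith only [hu, mul_le_mul_of_nonneg_right (pow_le_pow_left₀ (by norm_num) hu 2) (show 0 ≤ l by linarith)]
  have u1 : 10^38*l ≤ u := by linarith
  have u2 : (10:ℝ)^42 ≤ u := by linarith
  set r := ⌈u/2⌉₊ with hr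
  have r1 : u/2 ≤ r := Nat.le_ceil _
  have r2 : (r:ℝ) < u/2+1 := Nat.ceil_lt_add_one (by linarith only [hu, ul, l3])
  have r0 : (0:ℝ) < r := by linarith only [hu, ul, l3, r1]
  set lr := Real.log r with hlr
  have lr1 : l-1 ≤ lr := by
    have := Real.log_le_log (by linarith only [hu, ul, l3]) r1
    rw [Real.log_div hu0.ne' (by norm_num)] at this; linarith only [this, Real.log_two_lt_d9]
  have lr2 : lr ≤ l := Real.log_le_log r0 (by linarith only [hu, ul, l3, r2])
  set K := L/u with hK
  have KL : K*u = L := by rw [hK]; field_simp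
  have K5 : u^5 ≤ K := by rw [hK, le_div_iff₀ hu0]; linarith only [hL, show u^5*u = u^6 by ring]
  have K2 : 10^40*(u*l) ≤ K := by
    have a : 10^40*u^2 ≤ u^5 := by nlinarith only [mul_le_mul_of_nonneg_right (u2.trans (le_self_pow₀ (by linarith only [hu, ul, l3]) (by norm_num : 3 ≠ 0))) (show 0 ≤ u^2 by positivity), show 0 ≤ u^2 by positivity]
    have : u*l ≤ u^2 := by nlinarith only [u1, hu, hu0]
    linarith
  set H := Real.exp (3*u*l) with hH
  set η := H/(8*r*√x) with hη
  have H0 : 0 < H := Real.exp_pos _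
  have s0 : 0 < √x := by rw [sx]; exact Real.exp_pos _
  have η0 : 0 < η := by positivity
  have hlη : Real.log (1/η) = L/2-3*u*l+Real.log 8+lr := by
    rw [hη, one_div_div, Real.log_div (by positivity) H0.ne', Real.log_mul (by positivity) s0.ne', Real.log_mul (by norm_num) r0.ne', hH, Real.log_exp, sx, Real.log_exp]; ring
  have l8 : 0 ≤ Real.log 8 ∧ Real.log 8 ≤ 3 := by
    have : Real.log 8 = 3*Real.log 2 := by rw [show (8:ℝ) = 2^3 by norm_num, Real.log_pow]; norm_num
    constructor <;> linarith only [this, Real.log_two_lt_d9, Real.log_two_gt_d9]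
  have ul0 : 10^42*10^4 ≤ u*l := by nlinarith only [u2, hu]
  have ul1 : u ≤ u*l := by nlinarith only [u2, hu]
  have KuL : 10^42*K ≤ L := by rw [← KL]; nlinarith only [u2, K2, ul0]
  have hη1 : 10 ≤ Real.log (1/η) := by rw [hlη]; linarith only [hu, lr1, K2, l8, ul0, KuL]
  have η1 : 1 ≤ 1/η := (Real.one_le_exp (by linarith only [hu, lr1, K2, hlη, l8, ul0, KuL])).trans_eq (Real.exp_log (by positivity))
  obtain ⟨n, n1, n2⟩ := exists_nat_pow_near η1 (one_lt_two)
  set N : ℝ := ((2^n:ℕ):ℝ) with hN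
  have hN2 : N = 2^n := by rw [hN]; push_cast; rfl
  have N0 : 0 < N := by rw [hN2]; positivity
  rw [← hN2] at n1
  rw [pow_succ, ← hN2] at n2
  have ηN : η*N ≤ 1 := by rw [le_div_iff₀ η0] at n1; linarith only [n1]
  have ηN' : 1/2 ≤ η*N := by rw [div_lt_iff₀ η0] at n2; linarith only [n2]
  have lN : n*Real.log 2 = Real.log N := by rw [hN2, Real.log_pow]
  have lN1 : Real.log N ≤ L/2-3*u*l+3+l := by
    have := Real.log_le_log N0 n1; rw [hlη] at this; linarith only [lr2, l8, this]
  have lN2 : L/2-3*u*l ≤ Real.log N := by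
    have := Real.log_le_log (by positivity) n2.le
    rw [hlη, Real.log_mul N0.ne' (by norm_num)] at this; linarith only [hu, lr1, l8, this, Real.log_two_lt_d9]
  set V := (n*Real.log 2-K/4)/r with hV
  have Vr : V*r = n*Real.log 2-K/4 := by rw [hV]; field_simp
  -- ℓ and P
  have rη : r*η ≤ 1/16 := by
    have : η ≤ Real.exp (-(L/4)) := by
      rw [← Real.log_le_iff_le_exp η0]
      have := hlη; rw [one_div, Real.log_inv] at this
      linarith only [hu, lr1, K2, l8, ul0, KuL, this]
    have e := Real.quadratic_le_exp_of_nonneg (show 0 ≤ L/4 by linarith only [K2, ul0, KuL])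
    have : r*η ≤ u*Real.exp (-(L/4)) := by gcongr; linarith only [hu, ul, l3, r2]
    refine this.trans ?_
    rw [Real.exp_neg, ← div_eq_mul_inv, div_le_div_iff₀ (Real.exp_pos _) (by norm_num)]
    nlinarith only [e, KuL, K2, u1, ul0, hu, hu0]
  set ℓ := Real.log X+r*η with hℓ
  have X0 : 0 < X := by linarith only [hx, hX]
  have eℓ : Real.exp ℓ = X*Real.exp (r*η) := by rw [hℓ, Real.exp_add, Real.exp_log X0]
  have rη0 : 0 ≤ r*η := by positivity
  have ℓ1 : x ≤ Real.exp ℓ := by rw [eℓ]; nlinarith only [Real.one_le_exp rη0, hX, X0]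
  have ex1 : ∀ t : ℝ, 0 ≤ t → t ≤ 1/2 → Real.exp t ≤ 1+2*t := fun t h1 h2 => by
    have := Real.exp_bound_div_one_sub_of_interval h1 (by linarith only [h2])
    refine this.trans ?_
    rw [div_le_iff₀ (by linarith only [h2])]; nlinarith only [h1, h2]
  have ℓ2 : Real.exp ℓ ≤ 4*x := by rw [eℓ]; nlinarith only [ex1 _ rη0 (by linarith only [rη]), hX2, X0, rη]
  set P := Real.exp ℓ/(30*N^2) with hP
  have P0 : 0 < P := by positivity
  have lP : Real.log P = ℓ-Real.log 30-2*Real.log N := by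
    rw [hP, Real.log_div (Real.exp_pos _).ne' (by positivity), Real.log_exp, Real.log_mul (by norm_num) (by positivity), Real.log_pow]; push_cast; ring
  have ℓ3 : L ≤ ℓ := by rw [hLd, Real.log_le_iff_le_exp (by linarith only [hx])]; exact ℓ1
  have ℓ4 : ℓ ≤ L+3 := by
    rw [← Real.le_log_iff_exp_le (by linarith only [hx]), Real.log_mul (by norm_num) (by linarith only [hx])] at ℓ2
    have : Real.log 4 ≤ 3 := (Real.log_le_sub_one_of_pos (by norm_num)).trans (by norm_num)
    linarith only [ℓ2, this]
  have l30 : 0 ≤ Real.log 30 ∧ Real.log 30 ≤ 29 := ⟨Real.log_nonneg (by norm_num), (Real.log_le_sub_one_of_pos (by norm_num)).trans (by norm_num)⟩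
  have lP1 : 6*u*l-2*l-35 ≤ Real.log P := by rw [lP]; linarith only [lN1, ℓ3, l30]
  have lP2 : Real.log P ≤ 6*u*l+3 := by rw [lP]; linarith only [lN2, ℓ4, l30]
  obtain ⟨θ, Q, hθ, θ1, θ2, q1, q2, q3⟩ := half (show 1000 ≤ Real.log P by linarith only [ul, l3, ul0, ul1, lN1, lP, ℓ3, l30]) P0
  have eP : 30*N^2*P = Real.exp ℓ := by rw [hP]; field_simp
  have pr : PR n r K V θ := by
    refine ⟨by linarith only [hu, lr1], le_trans (pow_le_pow_left₀ r0.le (by linarith only [hu, ul, l3, r2]) 5) K5, ?_, ?_, by rw [Vr]; ring, ?_, ?_⟩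
    · refine le_of_mul_le_mul_right ?_ r0
      rw [Vr, lN]
      nlinarith only [lN2, KL, K2, ul0, mul_le_mul_of_nonneg_left r2.le (show 0 ≤ K by linarith only [K2, ul0]), mul_le_mul_of_nonneg_left u2 (show 0 ≤ K by linarith only [K2, ul0])]
    · refine le_of_mul_le_mul_right ?_ r0
      rw [Vr, lN]
      linarith only [lN1, KL, K2, ul0, u1, ul1, mul_le_mul_of_nonneg_left r1 (show 0 ≤ K by linarith only [K2, ul0])]
    · calc 11.5*(r*lr) ≤ 11.5*((u/2+1)*l) := by gcongr
        _ ≤ θ := by nlinarith only [θ1, lP1, u2, hu]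
    · calc θ ≤ 13*((u/2)*(l-1)) := by nlinarith only [θ2, lP2, u2, hu]
        _ ≤ _ := by gcongr; linarith only [hu]
  have eK : x^(1/u) = Real.exp K := by rw [hxL, ← Real.exp_mul, hK, mul_one_div]
  set S := ((Finset.Ioc ⌊X⌋₊ ⌊X+H*√x⌋₊).filter (fun n => ∀ p : ℕ, p ∈ n.primeFactors → (p : ℝ) ≤ x^(1/u))) with hS
  have hSp : (S.card:ℝ) ≤ (Psi (X+H*√x) (x^(1/u)):ℝ)-Psi X (x^(1/u)) := by
    have := psi_split (y := x^(1/u)) (show X ≤ X+H*√x by linarith only [hx, show 0 ≤ H*√x by positivity])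
    have : (Psi X (x^(1/u)):ℝ)+S.card ≤ Psi (X+H*√x) (x^(1/u)) := by exact_mod_cast this
    linarith only [this]
  refine le_trans ?_ hSp
  clear hSp
  have hfin := pr.fin q1 q2 q3 η0 ηN ηN' (ℓ := ℓ) (by rcases hθ with e | e <;> rw [e, ← eP] <;> nlinarith only [show 0 ≤ N^2*P by positivity])
    (by rcases hθ with e | e <;> rw [e, ← eP] <;> nlinarith only [show 0 ≤ N^2*P by positivity]) S (fun s s0' hs1 hs2 => by
      rw [abs_lt] at hs2
      have s0 : (0:ℝ) < s := by exact_mod_cast s0'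
      simp only [hS, Finset.mem_filter, Finset.mem_Ioc]
      refine ⟨⟨(Nat.floor_lt X0.le).2 ?_, Nat.le_floor ?_⟩, fun p hp => ?_⟩
      · rw [← Real.log_lt_log_iff X0 s0]; linarith only [hs2]
      · have a : (s:ℝ) ≤ X*Real.exp (2*(r*η)) := by
          rw [← Real.exp_log X0, ← Real.exp_add, ← Real.log_le_iff_le_exp s0]; linarith only [hs2]
        have b : r*η*(8*√x) = H := by rw [hη]; field_simp
        have c : x = √x*√x := (Real.mul_self_sqrt (by linarith only [hx, rη, hs2])).symm
        have d := ex1 (2*(r*η)) (by linarith only [hs2]) (by linarith only [rη, hs2])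
        calc (s:ℝ) ≤ X*(1+2*(2*(r*η))) := a.trans (by gcongr)
          _ ≤ X+8*(r*η)*x := by nlinarith only [hX2, rη0]
          _ = X+r*η*(8*√x)*√x := by nth_rewrite 1 [c]; ring
          _ = _ := by rw [b]
      · rw [eK]; exact (hs1 p hp).trans (Real.exp_le_exp.2 pr.hV2))
  clear_value S
  have b1 : (1/(13*(r:ℝ)^2))^r ≤ bet V r := BB_sum V r pr.r2 (by linarith only [pr.hV1, pr.K1]) (by
    have := pow_le_pow_left₀ (by norm_num) pr.r1 3
    nlinarith only [pr.hV1, pr.hK, mul_le_mul_of_nonneg_left this (sq_nonneg (r:ℝ)), sq_nonneg (r:ℝ)])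
  have a2 : H*√x ≤ 240*r*(Real.exp θ*N) := by
    have c : x = √x*√x := (Real.mul_self_sqrt (by linarith only [hx])).symm
    have d : 8*r*√x*η = H := by rw [hη]; field_simp
    have e : P ≤ Real.exp θ := by rcases hθ with e | e <;> linarith only [e, P0]
    calc H*√x = 8*r*η*(√x*√x) := by rw [← d]; ring
      _ ≤ 8*r*η*(30*N^2*P) := by rw [← c, eP]; gcongr
      _ = 240*r*(P*N)*(η*N) := by ring
      _ ≤ 240*r*(Real.exp θ*N)*1 := by gcongr
      _ = _ := by ring
  exact fin_arith b1 a2 q2 hfin (by linarith only [θ1, lP1, ul0, u1, ul1, hu]) (by linarith only [θ2, lP2]) (by linarith only [r1, u2]) r2.le lr2 (by linarith only [hu]) KL (by linarith only [K2, ul0])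
    (by linarith only [u2]) (by linarith only [u1, hu]) N0 (Nat.cast_nonneg _) (mul_nonneg H0.le s0.le)

theorem stmt4 (ε : ℝ) (hε0 : 0 < ε) (hε : ε < 1 / 6)
    (ρ : ℝ → ℝ) (hρ : IsDickman ρ) :
    ∃ u₀ : ℝ, ∀ x : ℝ, 1 ≤ x →
      ∀ u : ℝ, u₀ ≤ u → u ≤ (Real.log x) ^ ((1 : ℝ) / 6 - ε) →
      ∀ h : ℝ, (ρ u) ^ (-(3 : ℝ) - ε) ≤ h → h ≤ Real.sqrt x →
      ρ u ^ 2 * h * Real.sqrt x / (Real.log x) ^ 3 ≤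
        (Psi (x + h * Real.sqrt x) (x ^ (1 / u)) : ℝ) - (Psi x (x ^ (1 / u)) : ℝ) := by
  obtain ⟨u₁, hd⟩ := dick_bd hρ (Real.exp 11) (Real.one_le_exp (by norm_num))
  refine ⟨max u₁ (Real.exp (2*10^4)), fun x hx u hu0 huL h hh1 hh2 => ?_⟩
  have hu1 := (le_max_right _ _).trans hu0
  have ub := Real.add_one_le_exp (2*10^4:ℝ)
  have u0 : 0 < u := by linarith
  have hl : 2*10^4 ≤ Real.log u := by rwa [Real.le_log_iff_exp_le u0]
  have hb := hd u ((le_max_left _ _).trans hu0)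
  have hp := dick_pos hρ u0.le
  rw [Real.log_mul (Real.exp_pos _).ne' u0.ne', Real.log_exp] at hb
  have L0 : 0 ≤ Real.log x := Real.log_nonneg hx
  have L1 : 1 ≤ Real.log x := by
    by_contra hc
    linarith only [hε0, hε, huL, hu1, ub, L0, hc, Real.rpow_le_one L0 (by linarith) (show 0 ≤ (1:ℝ)/6-ε by linarith)]
  have hL : u^6 ≤ Real.log x := by
    calc u^6 ≤ ((Real.log x)^((1:ℝ)/6))^6 := by
          gcongr; exact huL.trans (Real.rpow_le_rpow_of_exponent_le L1 (by linarith))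
      _ = Real.log x := by rw [← Real.rpow_natCast, ← Real.rpow_mul L0]; norm_num
  set l := Real.log u with hld
  set L := Real.log x with hLd
  set H := Real.exp (3*u*l) with hH
  have H0 : 0 < H := Real.exp_pos _
  have hHh : H ≤ h := by
    refine le_trans ?_ hh1
    rw [Real.rpow_def_of_pos hp]
    refine Real.exp_le_exp.2 ?_
    have := (Real.log_le_iff_le_exp hp).2 hb
    have ul : 0 ≤ u*l := by positivity
    nlinarith only [mul_le_mul_of_nonneg_right (show Real.log (ρ u) ≤ -(u*l) by linarith) (show 0 ≤ 3+ε by linarith), mul_nonneg hε0.le ul]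
  set G := H*√x*Real.exp (-(2*u*l+20*u))/L^3 with hG
  have s0 : 0 < √x := Real.sqrt_pos.2 (by linarith)
  have sx : √x*√x = x := Real.mul_self_sqrt (by linarith)
  have h0 : 0 < h := H0.trans_le hHh
  set m := ⌊h/H⌋₊ with hm
  have m1 : (m:ℝ) ≤ h/H := Nat.floor_le (by positivity)
  have m2 : h/H < m+1 := Nat.lt_floor_add_one _
  have m0 : (1:ℝ) ≤ m := by
    have : 1 ≤ m := Nat.le_floor (by rw [Nat.cast_one, le_div_iff₀ H0]; linarith)
    exact_mod_cast this
  rw [le_div_iff₀ H0] at m1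
  rw [div_lt_iff₀ H0] at m2
  have key : ∀ k : ℕ, k ≤ m → (k:ℝ)*G ≤ (Psi (x+k*H*√x) (x^(1/u)):ℝ)-Psi x (x^(1/u)) := by
    intro k
    induction k with
    | zero => intro _; simp
    | succ k ih =>
      intro hk
      have ih := ih (by omega)
      have hk' : (k:ℝ)+1 ≤ m := by exact_mod_cast hk
      have := stepX (X := x+k*H*√x) hl hx hL u0 (by linarith only [hx, show 0 ≤ k*H*√x by positivity]) (by
        have : k*H*√x ≤ √x*√x := by gcongr; nlinarith only [hk', m1, hh2, H0]
        linarith only [sx, this])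
      rw [show x+k*H*√x+Real.exp (3*u*Real.log u)*√x = x+(k+1:ℕ)*H*√x by rw [hH, hld]; push_cast; ring] at this
      push_cast at this ⊢
      linarith only [ih, this]
  have kf := key m le_rfl
  have mono := psi_split (y := x^(1/u)) (show x+m*H*√x ≤ x+h*√x by gcongr)
  have mono' : (Psi (x+m*H*√x) (x^(1/u)):ℝ) ≤ Psi (x+h*√x) (x^(1/u)) := by exact_mod_cast (Nat.le_add_right _ _).trans mono
  refine le_trans ?_ (show m*G ≤ _ by linarith only [kf, mono'])
  have r2 : 2*ρ u^2 ≤ Real.exp (-(2*u*l+20*u)) := by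
    calc 2*ρ u^2 ≤ Real.exp (2*u)*Real.exp (-(u*(11+l)))^2 := by gcongr; linarith only [hε0, hε, hu1, ub, Real.add_one_le_exp (2*u)]
      _ = _ := by rw [← Real.exp_nat_mul, ← Real.exp_add]; congr 1; push_cast; ring
  calc ρ u^2*h*√x/L^3 ≤ ρ u^2*(2*m*H)*√x/L^3 := by gcongr; nlinarith only [m2, m0, H0]
    _ = m*(H*√x*(2*ρ u^2)/L^3) := by ring
    _ ≤ m*G := by rw [hG]; gcongr
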